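/- For every integer n ≥ 1755, the largest prime factor of g(n) satisfies P⁺(g(n)) ≥ √(n·log n). -/

import Mathlib

/-- Landau's function: the maximal order of a permutation of the symmetric group on `n` letters. -/
noncomputable def landau (n : ℕ) : ℕ :=
  Finset.univ.sup fun σ : Equiv.Perm (Fin n) => orderOf σ

/-- The largest prime factor of `m` (0 if `m` has no prime factor). -/
def maxPrimeFac (m : ℕ) : ℕ := m.primeFactors.sup id

set_option maxRecDepth 100000
set_option exponentiation.threshold 10000000

noncomputable section
namespace LP
open Complex Filter Topology Set
local notation "nnm" => by norm_num
local notation "lna" => by linarith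
local notation "psv" => by positivity
local notation "oma" => by omega
local notation "Lo" => Real.log
local notation "Ex" => Real.exp
local notation "Frg" => Finset.range
local notation "mulL" => mul_le_mul_of_nonneg_left
local notation "T48" => 281474976710656
local notation "vM" => ArithmeticFunction.vonMangoldt
local notation "sumC" => Finset.sum_congr rfl
theorem dck {p : Prop} (h : p := by decide +kernel) : p := h
open Finset (mul_sum sum_le_sum sum_range_succ sum_sub_distrib sum_add_distrib)
open Chebyshev (psi theta)

section
open Metric
lemma entire_div (f : ℂ → ℂ) (hf : Differentiable ℂ f) (a : ℂ) (ha : analyticOrderAt f a ≠ ⊤) :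
    ∃ g : ℂ → ℂ, Differentiable ℂ g ∧ g a ≠ 0 ∧ ∀ z, f z = (z - a) ^ analyticOrderNatAt f a * g z := by
  have han : AnalyticAt ℂ f a := hf.analyticAt a
  obtain ⟨g0, hg0, hg0a, hev⟩ := (han.analyticOrderNatAt_eq_iff ha (n := analyticOrderNatAt f a)).1 rfl
  set n := analyticOrderNatAt f a
  let g : ℂ → ℂ := Function.update (fun z => f z / (z - a) ^ n) a (g0 a)
  have hg_ne : ∀ z, z ≠ a → g z = f z / (z - a) ^ n := fun z hz => by simp [g, hz]
  have hga : g a = g0 a := by simp [g]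
  have hgev : g =ᶠ[𝓝 a] g0 := by
    filter_upwards [hev] with z hz
    rcases eq_or_ne z a with rfl | h
    · exact hga
    · rw [hg_ne z h, hz]
      have : (z - a) ^ n ≠ 0 := pow_ne_zero _ (sub_ne_zero.2 h)
      simp [this]
  refine ⟨g, ?_, by rw [hga]; exact hg0a, ?_⟩
  · intro z
    rcases eq_or_ne z a with rfl | h
    · exact hg0.differentiableAt.congr_of_eventuallyEq hgev
    · have : g =ᶠ[𝓝 z] fun z => f z / (z - a) ^ n := by
        filter_upwards [isOpen_ne.mem_nhds h] with w hw using hg_ne w hw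
      refine DifferentiableAt.congr_of_eventuallyEq ?_ this
      exact (hf z).div (by fun_prop) (pow_ne_zero _ (sub_ne_zero.2 h))
  · intro z
    rcases eq_or_ne z a with rfl | h
    · rw [hev.self_of_nhds, hga]; simp
    · rw [hg_ne z h, mul_div_cancel₀]
      exact pow_ne_zero _ (sub_ne_zero.2 h)

lemma entire_order_ne_top (f : ℂ → ℂ) (hf : Differentiable ℂ f) (h0 : f 0 ≠ 0) (a : ℂ) :
    analyticOrderAt f a ≠ ⊤ := by
  have hAn : AnalyticOnNhd ℂ f univ := fun z _ => hf.analyticAt z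
  intro h
  have := (analyticOrderAt_eq_top.1 h)
  exact h0 (by simpa using hAn.eqOn_zero_of_preconnected_of_eventuallyEq_zero isPreconnected_univ (mem_univ a) this (mem_univ 0))

lemma entire_zeros_finite (f : ℂ → ℂ) (hf : Differentiable ℂ f) (h0 : f 0 ≠ 0) (R : ℝ) :
    {z | ‖z‖ ≤ R ∧ f z = 0}.Finite := by
  by_contra hinf
  have hK : IsCompact (closedBall (0 : ℂ) R) := isCompact_closedBall _ _
  obtain ⟨z, hz, hacc⟩ := (show Set.Infinite {z | ‖z‖ ≤ R ∧ f z = 0} from hinf).exists_accPt_of_subset_isCompact hK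
    (fun z hz => by simpa using hz.1)
  have hAn : AnalyticOnNhd ℂ f univ := fun z _ => hf.analyticAt z
  have hfr : ∃ᶠ w in 𝓝[≠] z, f w = 0 := by
    rw [accPt_iff_frequently_nhdsNE] at hacc
    exact hacc.mono fun w hw => hw.2
  exact h0 (by simpa using hAn.eqOn_zero_of_preconnected_of_frequently_eq_zero isPreconnected_univ (mem_univ z) hfr (mem_univ 0))

lemma entire_factor (f : ℂ → ℂ) (hf : Differentiable ℂ f) (h0 : f 0 ≠ 0) (s : Finset ℂ) :
    ∃ h : ℂ → ℂ, Differentiable ℂ h ∧ (∀ a ∈ s, h a ≠ 0) ∧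
      ∀ z, f z = (∏ a ∈ s, (z - a) ^ analyticOrderNatAt f a) * h z := by
  classical
  induction s using Finset.induction_on with
  | empty => exact ⟨f, hf, by simp, by simp⟩
  | insert b s hb ih =>
    obtain ⟨h, hd, hne, heq⟩ := ih
    have hh0 : h 0 ≠ 0 := fun h1 => h0 (by rw [heq, h1, mul_zero])
    have htop := entire_order_ne_top h hd hh0 b
    obtain ⟨g, hgd, hgb, hgeq⟩ := entire_div h hd b htop
    have hord : analyticOrderNatAt h b = analyticOrderNatAt f b := by
      have hP : AnalyticAt ℂ (fun z => ∏ a ∈ s, (z - a) ^ analyticOrderNatAt f a) b := by fun_prop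
      have hPb : (∏ a ∈ s, (b - a) ^ analyticOrderNatAt f a) ≠ 0 := by
        refine Finset.prod_ne_zero_iff.2 fun a ha => pow_ne_zero _ (sub_ne_zero.2 ?_)
        rintro rfl; exact hb ha
      have e : f = (fun z => ∏ a ∈ s, (z - a) ^ analyticOrderNatAt f a) * h := by
        ext z; exact heq z
      have : analyticOrderAt f b = analyticOrderAt h b := by
        conv_lhs => rw [e]
        rw [analyticOrderAt_mul hP (hd.analyticAt b), hP.analyticOrderAt_eq_zero.2 hPb, zero_add]
      rw [analyticOrderNatAt, analyticOrderNatAt, this]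
    refine ⟨g, hgd, ?_, ?_⟩
    · intro a ha
      rcases Finset.mem_insert.1 ha with rfl | ha
      · exact hgb
      · intro hga; exact hne a ha (by rw [hgeq, hga, mul_zero])
    · intro z
      rw [Finset.prod_insert hb, heq z, hgeq z, hord]; ring

/-- zeros in closed ball -/
def zset (f : ℂ → ℂ) (hf : Differentiable ℂ f) (h0 : f 0 ≠ 0) (R : ℝ) : Finset ℂ :=
  (entire_zeros_finite f hf h0 R).toFinset

lemma mem_zset {f : ℂ → ℂ} {hf : Differentiable ℂ f} {h0 : f 0 ≠ 0} {R : ℝ} {z : ℂ} :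
    z ∈ zset f hf h0 R ↔ ‖z‖ ≤ R ∧ f z = 0 := by simp [zset]

lemma order_even {f : ℂ → ℂ} (hf : Differentiable ℂ f) (hev : ∀ z, f (-z) = f z) (a : ℂ) :
    analyticOrderNatAt f (-a) = analyticOrderNatAt f a := by
  have h1 : f = f ∘ (fun z => -z) := by ext z; simp [hev]
  have h2 : analyticOrderAt (f ∘ (fun z => -z)) a = analyticOrderAt f (-a) := by
    refine analyticOrderAt_comp_of_deriv_ne_zero (f := f) (g := fun z : ℂ => -z) (z₀ := a) (by fun_prop) ?_
    simp
  rw [analyticOrderNatAt, analyticOrderNatAt, ← h2, ← h1]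

/-- bound for the log-derivative of the zero-free part -/
lemma hadamard_aux (f : ℂ → ℂ) (hf : Differentiable ℂ f) (h0 : f 0 ≠ 0) (hev : ∀ z, f (-z) = f z)
    (R M : ℝ) (hR : 0 < R) (hM : 0 < M) (hb : ∀ z, ‖z‖ = 4 * R → ‖f z‖ ≤ ‖f 0‖ * Ex M)
    (w : ℂ) (hw : ‖w‖ < R / 4) (hfw : f w ≠ 0) :
    ‖logDeriv f w - ∑ a ∈ zset f hf h0 R, (analyticOrderNatAt f a : ℂ) / (w - a)‖ ≤ 64 * M * ‖w‖ / R ^ 2 := by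
  obtain ⟨h, hd, hne, heq⟩ := entire_factor f hf h0 (zset f hf h0 R)
  set Z := zset f hf h0 R with hZ
  set P : ℂ → ℂ := fun z => ∏ a ∈ Z, (z - a) ^ analyticOrderNatAt f a with hP
  set N : ℕ := ∑ a ∈ Z, analyticOrderNatAt f a with hN
  have hhne : ∀ z, ‖z‖ ≤ R → h z ≠ 0 := by
    intro z hz h1
    have : f z = 0 := by rw [heq, h1, mul_zero]
    exact hne z (mem_zset.2 ⟨hz, this⟩) h1
  have hP0 : P 0 ≠ 0 := fun h1 => h0 (by rw [heq]; simp only [hP] at h1; rw [h1, zero_mul])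
  have hPneg : ∀ z, P (-z) = (-1) ^ N * P z := by
    intro z
    have e1 : P (-z) = ∏ a ∈ Z, ((-1) ^ analyticOrderNatAt f (-a) * (z - -a) ^ analyticOrderNatAt f (-a)) := by
      refine Finset.prod_congr rfl fun a _ => ?_
      rw [order_even hf hev, ← mul_pow]; congr 1; ring
    have e2 : ∏ a ∈ Z, ((-1) ^ analyticOrderNatAt f (-a) * (z - -a) ^ analyticOrderNatAt f (-a))
        = ∏ a ∈ Z, ((-1) ^ analyticOrderNatAt f a * (z - a) ^ analyticOrderNatAt f a) := by
      refine Finset.prod_nbij' (fun a => -a) (fun a => -a) ?_ ?_ (by simp) (by simp) (by simp)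
      · intro a ha
        have := mem_zset.1 ha
        exact mem_zset.2 ⟨by simpa using this.1, by rw [hev]; exact this.2⟩
      · intro a ha
        have := mem_zset.1 ha
        exact mem_zset.2 ⟨by simpa using this.1, by rw [hev]; exact this.2⟩
    rw [e1, e2, Finset.prod_mul_distrib, Finset.prod_pow_eq_pow_sum]
  have hsgn : ((-1 : ℂ)) ^ N = 1 := by
    have := hPneg 0
    rw [neg_zero] at this
    exact mul_right_cancel₀ hP0 (by rw [one_mul]; exact this.symm)
  have hPne : ∃ᶠ z in 𝓝[≠] (0:ℂ), P z ≠ 0 := by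
    have hc : ContinuousAt P 0 := by
      have : Continuous P := by simp only [hP]; fun_prop
      exact this.continuousAt
    exact ((hc.eventually_ne hP0).filter_mono nhdsWithin_le_nhds).frequently
  have hheven : ∀ z, h (-z) = h z := by
    have hA1 : AnalyticOnNhd ℂ (fun z => h (-z)) univ := fun z _ => (show Differentiable ℂ (fun z => h (-z)) by fun_prop).analyticAt z
    have hA2 : AnalyticOnNhd ℂ h univ := fun z _ => hd.analyticAt z
    have : ∃ᶠ z in 𝓝[≠] (0:ℂ), h (-z) = h z := by
      refine hPne.mono fun z hz => ?_
      have h1 := hev z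
      rw [heq, heq z] at h1
      change P (-z) * h (-z) = P z * h z at h1
      rw [hPneg, hsgn, one_mul] at h1
      exact mul_left_cancel₀ hz h1
    intro z
    exact congrFun (hA1.eq_of_frequently_eq hA2 this) z
  -- bound on h
  have hPlow : ∀ z, ‖z‖ = 4 * R → (3 * R) ^ N ≤ ‖P z‖ := by
    intro z hz
    simp only [hP, norm_prod, norm_pow, hN, ← Finset.prod_pow_eq_pow_sum]
    refine Finset.prod_le_prod (fun a _ => by positivity) fun a ha => ?_
    have ha' := (mem_zset.1 ha).1
    have : ‖z‖ - ‖a‖ ≤ ‖z - a‖ := norm_sub_norm_le z a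
    gcongr; linarith
  have hPup : ‖P 0‖ ≤ R ^ N := by
    simp only [hP, norm_prod, norm_pow, hN, ← Finset.prod_pow_eq_pow_sum]
    refine Finset.prod_le_prod (fun a _ => by positivity) fun a ha => ?_
    have ha' := (mem_zset.1 ha).1
    gcongr; simpa using ha'
  have hh0 : h 0 ≠ 0 := hhne 0 (by simpa using hR.le)
  have hsph : ∀ z, ‖z‖ = 4 * R → ‖h z‖ ≤ ‖h 0‖ * Ex M := by
    intro z hz
    have h1 := hb z hz
    rw [heq, heq 0, norm_mul, norm_mul] at h1
    change ‖P z‖ * ‖h z‖ ≤ ‖P 0‖ * ‖h 0‖ * _ at h1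
    have hRN : 0 < R ^ N := by positivity
    have h3 : R ^ N ≤ ‖P z‖ := le_trans (by gcongr; linarith) (hPlow z hz)
    have h4 : R ^ N * ‖h z‖ ≤ R ^ N * (‖h 0‖ * Ex M) := by
      calc R ^ N * ‖h z‖ ≤ ‖P z‖ * ‖h z‖ := by gcongr
        _ ≤ _ := h1
        _ ≤ R ^ N * ‖h 0‖ * Ex M := by gcongr
        _ = _ := by ring
    exact le_of_mul_le_mul_left h4 hRN
  have hball : ∀ z, ‖z‖ ≤ 4 * R → ‖h z‖ ≤ ‖h 0‖ * Ex M := by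
    intro z hz
    refine Complex.norm_le_of_forall_mem_frontier_norm_le (U := ball 0 (4 * R)) isBounded_ball
      hd.diffContOnCl ?_ ?_
    · intro z hz
      rw [frontier_ball _ psv] at hz
      exact hsph z (by simpa using hz)
    · rw [closure_ball _ psv]; simpa using hz
  -- log
  have hlog : ∃ L : ℂ → ℂ, ∀ z ∈ ball (0:ℂ) R, HasDerivAt L (logDeriv h z) z := by
    have hdo : DifferentiableOn ℂ (logDeriv h) (ball 0 R) := by
      intro z hz
      have hz' : ‖z‖ < R := by simpa using hz
      have : DifferentiableAt ℂ (deriv h) z := (hd.analyticAt z).deriv.differentiableAt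
      exact (this.div (hd z) (hhne z hz'.le)).differentiableWithinAt
    exact (hdo.isExactOn_ball)
  obtain ⟨L0, hL0⟩ := hlog
  set L : ℂ → ℂ := fun z => L0 z - L0 0 with hL
  have hLd : ∀ z ∈ ball (0:ℂ) R, HasDerivAt L (logDeriv h z) z := fun z hz => (hL0 z hz).sub_const _
  have hexp : ∀ z ∈ ball (0:ℂ) R, h z = h 0 * exp (L z) := by
    have hconst : ∀ z ∈ ball (0:ℂ) R, h z * exp (-L z) = h 0 * exp (- L 0) := by
      intro z hz
      refine IsOpen.is_const_of_deriv_eq_zero (f := fun z => h z * exp (-L z)) (s := ball (0:ℂ) R) isOpen_ball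
        (convex_ball _ _).isPreconnected ?_ ?_ hz (by simpa using hR)
      · intro y hy
        exact ((hd y).mul (hLd y hy).neg.cexp.differentiableAt).differentiableWithinAt
      · intro y hy
        have hy' : ‖y‖ < R := by simpa using hy
        have := ((hd y).hasDerivAt.mul (hLd y hy).neg.cexp).deriv
        simp only [Pi.zero_apply]
        refine Eq.trans this ?_
        have := hhne y hy'.le
        simp only [logDeriv_apply]
        field_simp; ring
    intro z hz
    have := hconst z hz
    have hL00 : L 0 = 0 := by simp [hL]
    rw [hL00, neg_zero, exp_zero, mul_one] at this
    rw [← this, mul_assoc, ← exp_add]; simp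
  have hre : ∀ z ∈ ball (0:ℂ) R, (L z).re ≤ M := by
    intro z hz
    have hz' : ‖z‖ < R := by simpa using hz
    have h1 := hball z lna
    rw [hexp z hz, norm_mul, Complex.norm_exp] at h1
    exact Real.exp_le_exp.1 (le_of_mul_le_mul_left h1 (norm_pos_iff.2 hh0))
  have hLdo : DifferentiableOn ℂ L (ball 0 R) := fun z hz => (hLd z hz).differentiableAt.differentiableWithinAt
  have hLb : ∀ z, ‖z‖ ≤ R / 2 → ‖L z‖ ≤ 2 * M := by
    intro z hz
    have hz2 : z ∈ ball (0:ℂ) R := by simp; linarith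
    have := Complex.borelCaratheodory_zero hM hLdo (fun z hz => hre z hz) hR hz2 (by simp [hL])
    refine this.trans ?_
    rw [div_le_iff₀ lna]
    nlinarith
  have hL'b : ∀ z, ‖z‖ ≤ R / 4 → ‖logDeriv h z‖ ≤ 8 * M / R := by
    intro z hz
    have h1 : ‖deriv L z‖ ≤ 2 * M / (R / 4) := by
      refine Complex.norm_deriv_le_of_forall_mem_sphere_norm_le psv ?_ ?_
      · refine DifferentiableOn.diffContOnCl ?_
        refine hLdo.mono ?_
        rw [closure_ball _ psv]
        intro y hy
        have : ‖y - z‖ ≤ R/4 := by simpa [dist_eq_norm] using hy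
        have : ‖y‖ ≤ ‖y - z‖ + ‖z‖ := by simpa using norm_add_le (y - z) z
        simp; linarith
      · intro y hy
        apply hLb
        have : ‖y - z‖ = R/4 := by simpa [dist_eq_norm] using hy
        have : ‖y‖ ≤ ‖y - z‖ + ‖z‖ := by simpa using norm_add_le (y - z) z
        linarith
    rw [(hLd z (by simp; linarith)).deriv] at h1
    refine h1.trans (le_of_eq ?_); field_simp; ring
  have hodd : logDeriv h 0 = 0 := by
    have h1 : deriv h 0 = 0 := by
      have e : h = fun z => h (-z) := by ext z; exact (hheven z).symm
      have : deriv h 0 = - deriv h 0 := by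
        conv_lhs => rw [e, deriv_comp_neg, neg_zero]
      have h2 : 2 * deriv h 0 = 0 := by linear_combination this
      simpa using h2
    simp [logDeriv_apply, h1]
  have hmain : ‖logDeriv h w‖ ≤ 64 * M * ‖w‖ / R ^ 2 := by
    have hdo : DifferentiableOn ℂ (logDeriv h) (ball 0 (R/4)) := by
      intro z hz
      have hz' : ‖z‖ < R / 4 := by simpa using hz
      have : DifferentiableAt ℂ (deriv h) z := (hd.analyticAt z).deriv.differentiableAt
      exact (this.div (hd z) (hhne z lna)).differentiableWithinAt
    have := Complex.dist_le_div_mul_dist_of_mapsTo_ball (f := logDeriv h) (c := 0) (R₁ := R / 4) (R₂ := 16 * M / R) (z := w) hdo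
      (fun z hz => by
        have hz' : ‖z‖ < R / 4 := by simpa using hz
        have := hL'b z hz'.le
        rw [hodd, mem_closedBall, dist_zero_right]
        refine le_trans this ?_
        gcongr; linarith) (by simpa using hw)
    rw [hodd, dist_zero_right, dist_zero_right] at this
    refine this.trans (le_of_eq ?_); field_simp; ring
  have hfin : logDeriv f w = ∑ a ∈ Z, (analyticOrderNatAt f a : ℂ) / (w - a) + logDeriv h w := by
    have hfP : f = fun z => P z * h z := by ext z; exact heq z
    have hPw : P w ≠ 0 := fun h1 => hfw (by rw [hfP]; simp [h1])
    have hhw : h w ≠ 0 := fun h1 => hfw (by rw [hfP]; simp [h1])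
    have hwa : ∀ a ∈ Z, w - a ≠ 0 := by
      intro a ha h1
      rw [sub_eq_zero] at h1
      exact hfw (h1 ▸ (mem_zset.1 ha).2)
    rw [show logDeriv f w = logDeriv (fun z => P z * h z) w by rw [← hfP]]
    rw [logDeriv_mul w hPw hhw (by simp only [hP]; fun_prop) (hd w)]
    congr 1
    simp only [hP]
    rw [logDeriv_prod]
    · refine sumC fun a ha => ?_
      rw [logDeriv_fun_pow (by fun_prop)]
      simp [logDeriv_apply, div_eq_mul_inv]
    · intro a ha; exact pow_ne_zero _ (hwa a ha)
    · intro a ha; fun_prop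
  rw [hfin, add_sub_cancel_left]; exact hmain
end

section
open Metric HurwitzZeta MeasureTheory
lemma evenKernel_ge_one {x : ℝ} (hx : 0 < x) : 1 ≤ evenKernel 0 x := by
  have h := hasSum_int_evenKernel₀ 0 hx
  have h2 : 0 ≤ evenKernel ((0:ℝ) : UnitAddCircle) x - if ((0:ℝ) : UnitAddCircle) = 0 then 1 else 0 := by
    refine h.nonneg fun n => ?_
    split_ifs <;> positivity
  simp at h2
  linarith

def Phi : ℝ → ℝ := fun x => if 1 < x then evenKernel 0 x - 1 else
  if x < 1 then evenKernel 0 x - x ^ (-(1/2):ℝ) else 0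

lemma Phi_nonneg {x : ℝ} (hx : 0 < x) : 0 ≤ Phi x := by
  unfold Phi
  split_ifs with h1 h2
  · linarith [evenKernel_ge_one hx]
  · have := evenKernel_functional_equation 0 x
    rw [← evenKernel_eq_cosKernel_of_zero] at this
    rw [this, Real.rpow_neg hx.le, one_div]
    have h3 := evenKernel_ge_one (show 0 < 1 / x by positivity)
    have h4 : 0 < (x ^ (1/2 : ℝ))⁻¹ := by positivity
    have h5 : (x ^ (1/2 : ℝ))⁻¹ * 1 ≤ (x ^ (1/2 : ℝ))⁻¹ * evenKernel 0 (1/x) := by gcongr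
    norm_num at *
    linarith
  · exact le_rfl

lemma f_modif_eq {x : ℝ} (hx : 0 < x) : (hurwitzEvenFEPair 0).f_modif x = (Phi x : ℂ) := by
  unfold Phi WeakFEPair.f_modif
  simp only [Pi.add_apply, indicator, mem_Ioi, mem_Ioo, hx, true_and, hurwitzEvenFEPair]
  split_ifs with h1 h2 h3
  · linarith
  · simp
  · simp
  · simp

lemma mellin_conv (s : ℂ) : IntegrableOn (fun x : ℝ => (x : ℂ) ^ (s / 2 - 1) * (Phi x : ℂ)) (Ioi 0) := by
  have := ((hurwitzEvenFEPair 0).isStrongFEPair_toStrongFEPair.hasMellin (s / 2)).1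
  refine IntegrableOn.congr_fun this ?_ measurableSet_Ioi
  intro x hx
  change (x : ℂ) ^ (s / 2 - 1) • (hurwitzEvenFEPair 0).f_modif x = _
  rw [f_modif_eq hx, smul_eq_mul]

lemma crz0_eq (s : ℂ) : completedRiemannZeta₀ s = (∫ x in Ioi (0:ℝ), (x : ℂ) ^ (s / 2 - 1) * (Phi x : ℂ)) / 2 := by
  rw [completedRiemannZeta₀, completedHurwitzZetaEven₀, WeakFEPair.Λ₀, mellin]
  congr 1
  refine setIntegral_congr_fun measurableSet_Ioi fun x hx => ?_
  simp only [smul_eq_mul]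
  rw [f_modif_eq hx]

def Ir (σ : ℝ) : ℝ := (∫ x in Ioi (0:ℝ), x ^ (σ / 2 - 1) * Phi x) / 2

lemma kern_re {x : ℝ} (hx : 0 < x) (σ : ℝ) :
    ((x : ℂ) ^ ((σ : ℂ) / 2 - 1) * (Phi x : ℂ)) = ((x ^ (σ / 2 - 1) * Phi x : ℝ) : ℂ) := by
  rw [ofReal_mul, ofReal_cpow hx.le]; push_cast; rfl

lemma norm_kern {x : ℝ} (hx : 0 < x) (s : ℂ) :
    ‖(x : ℂ) ^ (s / 2 - 1) * (Phi x : ℂ)‖ = x ^ (s.re / 2 - 1) * Phi x := by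
  rw [norm_mul, norm_cpow_eq_rpow_re_of_pos hx, norm_real, Real.norm_of_nonneg (Phi_nonneg hx)]
  congr 2
  simp

lemma Ir_int (σ : ℝ) : IntegrableOn (fun x : ℝ => x ^ (σ / 2 - 1) * Phi x) (Ioi 0) := by
  refine IntegrableOn.congr_fun (mellin_conv σ).norm ?_ measurableSet_Ioi
  intro x hx
  simpa using norm_kern hx (σ : ℂ)

lemma crz0_real (σ : ℝ) : completedRiemannZeta₀ σ = (Ir σ : ℂ) := by
  rw [crz0_eq, Ir, ofReal_div, ← integral_complex_ofReal]
  congr 1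
  exact setIntegral_congr_fun measurableSet_Ioi fun x hx => kern_re hx σ

lemma crz0_norm (s : ℂ) : ‖completedRiemannZeta₀ s‖ ≤ Ir s.re := by
  rw [crz0_eq, Ir, norm_div]
  simp only [norm_ofNat]
  gcongr
  refine (norm_integral_le_integral_norm _).trans (le_of_eq ?_)
  exact setIntegral_congr_fun measurableSet_Ioi fun x hx => norm_kern hx s

lemma crz0_conj (s : ℂ) : completedRiemannZeta₀ (starRingEnd ℂ s) = starRingEnd ℂ (completedRiemannZeta₀ s) := by
  rw [crz0_eq, crz0_eq, map_div₀, ← integral_conj]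
  simp only [map_ofNat]
  congr 1
  refine setIntegral_congr_fun measurableSet_Ioi fun x hx => ?_
  have hx : (0:ℝ) < x := hx
  simp only [map_mul, conj_ofReal]
  congr 1
  have harg : (x : ℂ).arg ≠ Real.pi := by rw [arg_ofReal_of_nonneg hx.le]; exact Real.pi_ne_zero.symm
  have := cpow_conj (x : ℂ) (s / 2 - 1) harg
  rw [conj_ofReal] at this
  rw [← this]; simp [map_ofNat]

lemma Ir_nonneg (σ : ℝ) : 0 ≤ Ir σ := by
  unfold Ir
  refine div_nonneg (setIntegral_nonneg measurableSet_Ioi fun x hx => ?_) nnm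
  have hx : (0:ℝ) < x := hx
  have := Phi_nonneg hx
  positivity

lemma Ir_le {a σ b : ℝ} (h1 : a ≤ σ) (h2 : σ ≤ b) : Ir σ ≤ Ir a + Ir b := by
  unfold Ir
  rw [← add_div, ← integral_add (Ir_int a) (Ir_int b)]
  gcongr ?_ / 2
  refine setIntegral_mono_on (Ir_int σ) ((Ir_int a).add (Ir_int b)) measurableSet_Ioi fun x hx => ?_
  have hx : (0:ℝ) < x := hx
  have hp := Phi_nonneg hx
  rw [← add_mul]
  gcongr
  rcases le_total 1 x with h | h
  · have := Real.rpow_le_rpow_of_exponent_le h (show σ / 2 - 1 ≤ b / 2 - 1 by linarith)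
    have h3 : 0 ≤ x ^ (a / 2 - 1) := by positivity
    linarith
  · have := Real.rpow_le_rpow_of_exponent_ge hx h (show a / 2 - 1 ≤ σ / 2 - 1 by linarith)
    have h3 : 0 ≤ x ^ (b / 2 - 1) := by positivity
    linarith

lemma Ir_symm (σ : ℝ) : Ir (1 - σ) = Ir σ := by
  have := completedRiemannZeta₀_one_sub (σ : ℂ)
  rw [crz0_real, ← ofReal_one, ← ofReal_sub, crz0_real] at this
  exact_mod_cast this

lemma Ir_eq {σ : ℝ} (h : 1 < σ) : (Ir σ : ℂ) = riemannZeta σ * Gammaℝ σ + 1 / σ + 1 / (1 - σ) := by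
  have h0 : (σ : ℂ) ≠ 0 := by norm_cast; linarith
  have hG : Gammaℝ σ ≠ 0 := Gammaℝ_ne_zero_of_re_pos (by simp; linarith)
  have := riemannZeta_def_of_ne_zero h0
  rw [completedRiemannZeta_eq, crz0_real] at this
  rw [this, div_mul_cancel₀ _ hG]; ring

lemma Ir_two : Ir 2 = Real.pi / 6 - 1 / 2 := by
  have h := Ir_eq (σ := 2) nnm
  have h2 : Gammaℝ ((2:ℝ):ℂ) = 1 / Real.pi := by
    rw [Gammaℝ]; push_cast
    rw [div_self (by norm_num : (2:ℂ) ≠ 0), Complex.Gamma_one, mul_one, neg_div, div_self (by norm_num : (2:ℂ) ≠ 0), cpow_neg_one]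
    simp
  rw [h2] at h
  push_cast at h
  rw [riemannZeta_two] at h
  have hpi : (Real.pi : ℂ) ≠ 0 := by exact_mod_cast Real.pi_ne_zero
  have : (Ir 2 : ℂ) = ((Real.pi / 6 - 1 / 2 : ℝ) : ℂ) := by
    rw [h]; push_cast; field_simp; ring
  exact_mod_cast this

/-- Riemann xi -/
def xi (s : ℂ) : ℂ := s * (s - 1) * completedRiemannZeta₀ s + 1

lemma xi_diff : Differentiable ℂ xi := by
  have := differentiable_completedZeta₀
  unfold xi; fun_prop

lemma xi_symm (s : ℂ) : xi (1 - s) = xi s := by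
  unfold xi; rw [completedRiemannZeta₀_one_sub]; ring

lemma xi_conj (s : ℂ) : xi (starRingEnd ℂ s) = starRingEnd ℂ (xi s) := by
  unfold xi; rw [crz0_conj]; simp

lemma xi_eq {s : ℂ} (h0 : s ≠ 0) (h1 : s ≠ 1) : xi s = s * (s - 1) * Gammaℝ s * riemannZeta s ∨ Gammaℝ s = 0 := by
  by_cases hG : Gammaℝ s = 0
  · right; exact hG
  left
  rw [riemannZeta_def_of_ne_zero h0, completedRiemannZeta_eq, xi]
  have : s - 1 ≠ 0 := sub_ne_zero.2 h1
  have : 1 - s ≠ 0 := sub_ne_zero.2 h1.symm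
  field_simp
  ring

lemma xi_eq' {s : ℂ} (h0 : 0 < s.re) (h1 : s ≠ 1) : xi s = s * (s - 1) * Gammaℝ s * riemannZeta s := by
  rcases xi_eq (s := s) (by rintro rfl; simp at h0) h1 with h | h
  · exact h
  · exact absurd h (Gammaℝ_ne_zero_of_re_pos h0)

lemma xi_ne_zero_of_one_le {s : ℂ} (h : 1 ≤ s.re) : xi s ≠ 0 := by
  by_cases h1 : s = 1
  · subst h1; simp [xi]
  rw [xi_eq' lna h1]
  have a1 : s ≠ 0 := by rintro rfl; simp at h; linarith
  exact mul_ne_zero (mul_ne_zero (mul_ne_zero a1 (sub_ne_zero.2 h1)) (Gammaℝ_ne_zero_of_re_pos lna))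
    (riemannZeta_ne_zero_of_one_le_re h)

lemma xi_zero_re {s : ℂ} (h : xi s = 0) : 0 < s.re ∧ s.re < 1 := by
  constructor
  · by_contra h1
    refine xi_ne_zero_of_one_le (s := 1 - s) (by simp; linarith) ?_
    rw [xi_symm, h]
  · by_contra h1
    exact xi_ne_zero_of_one_le lna h

lemma xi_half_ne : xi (1 / 2) ≠ 0 := by
  have e : xi (1/2) = ((1 - Ir (1/2) / 4 : ℝ) : ℂ) := by
    have := crz0_real (1/2)
    push_cast at this
    rw [xi, this]; push_cast; ring
  rw [e]
  have h1 := Ir_le (a := -1) (σ := 1/2) (b := 2) nnm nnm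
  have h2 : Ir (-1) = Ir 2 := by rw [← Ir_symm 2]; norm_num
  rw [h2, Ir_two] at h1
  have := Real.pi_lt_four
  norm_cast
  intro h; linarith
end

section
open Metric HurwitzZeta MeasureTheory
lemma zeta_nat_norm {k : ℕ} (hk : 2 ≤ k) : ‖riemannZeta k‖ ≤ 2 := by
  rw [zeta_nat_eq_tsum_of_gt_one oma]
  have h2 := hasSum_zeta_two
  have hle : ∀ n : ℕ, ‖1 / (n : ℂ) ^ k‖ ≤ 1 / (n : ℝ) ^ 2 := by
    intro n
    rcases Nat.eq_zero_or_pos n with rfl | hn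
    · simp [show k ≠ 0 by omega]
    · rw [norm_div, norm_pow, norm_one, Complex.norm_natCast]
      have : (1 : ℝ) ≤ n := by exact_mod_cast hn
      gcongr
  refine (tsum_of_norm_bounded h2 hle).trans ?_
  nlinarith [Real.pi_lt_d2, Real.pi_pos]

lemma Ir_nat {n : ℕ} (hn : 1 ≤ n) : Ir (2 * n) ≤ 2 * (n : ℝ) ^ n := by
  have h1 : (1 : ℝ) ≤ n := by exact_mod_cast hn
  have h := Ir_eq (σ := 2 * n) lna
  have hG : ‖Gammaℝ ((2 * n : ℝ) : ℂ)‖ ≤ (n : ℝ) ^ n := by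
    rw [Gammaℝ]
    have e : ((2 * n : ℝ) : ℂ) / 2 = ((n - 1 : ℕ) : ℂ) + 1 := by push_cast [hn]; ring
    have e2 : -((2 * n : ℝ) : ℂ) / 2 = ((-n : ℝ) : ℂ) := by push_cast; ring
    rw [e, Complex.Gamma_nat_eq_factorial, e2, norm_mul, norm_cpow_eq_rpow_re_of_pos Real.pi_pos, ofReal_re, Complex.norm_natCast]
    have h3 : Real.pi ^ (-(n:ℝ)) ≤ 1 := Real.rpow_le_one_of_one_le_of_nonpos (by linarith [Real.pi_gt_three]) lna
    have h4 : ((n - 1).factorial : ℝ) ≤ (n : ℝ) ^ n := by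
      exact_mod_cast (Nat.factorial_le (Nat.sub_le n 1)).trans (Nat.factorial_le_pow n)
    have h5 : 0 ≤ Real.pi ^ (-(n:ℝ)) := by positivity
    nlinarith
  have hz : ‖riemannZeta ((2 * n : ℝ) : ℂ)‖ ≤ 2 := by
    have := zeta_nat_norm (k := 2 * n) oma
    push_cast at this ⊢; exact this
  have hr : (1 / ((2 * n : ℝ):ℂ) + 1 / (1 - ((2 * n : ℝ):ℂ))) = ((1 / (2 * n) + 1 / (1 - 2 * n) : ℝ) : ℂ) := by push_cast; rfl
  rw [add_assoc, hr] at h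
  have h5 : Ir (2*n) - (1 / (2 * n) + 1 / (1 - 2 * n)) ≤ ‖riemannZeta ((2 * n : ℝ) : ℂ) * Gammaℝ ((2 * n : ℝ) : ℂ)‖ := by
    have : riemannZeta ((2 * n : ℝ) : ℂ) * Gammaℝ ((2 * n : ℝ) : ℂ) = ((Ir (2*n) - (1 / (2 * n) + 1 / (1 - 2 * n)) : ℝ) : ℂ) := by
      rw [ofReal_sub, h]; ring
    rw [this, norm_real]; exact le_abs_self _
  rw [norm_mul] at h5
  have h6 : 1 / (2 * n : ℝ) + 1 / (1 - 2 * n) ≤ 0 := by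
    rw [show (1 - 2 * (n:ℝ)) = -(2*n - 1) by ring, one_div_neg_eq_neg_one_div, ← sub_eq_add_neg, sub_nonpos]
    apply one_div_le_one_div_of_le <;> linarith
  nlinarith [norm_nonneg (riemannZeta ((2 * n : ℝ) : ℂ)), norm_nonneg (Gammaℝ ((2 * n : ℝ) : ℂ))]

def xf (w : ℂ) : ℂ := xi (1 / 2 + w)
lemma xf_diff : Differentiable ℂ xf := xi_diff.comp (by fun_prop)
lemma xf_zero : xf 0 ≠ 0 := by simpa [xf] using xi_half_ne
lemma xf_even (w : ℂ) : xf (-w) = xf w := by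
  unfold xf; rw [← xi_symm]; congr 1; ring
lemma xf_conj (w : ℂ) : xf (starRingEnd ℂ w) = starRingEnd ℂ (xf w) := by
  unfold xf; rw [← xi_conj]; congr 1; simp [show (starRingEnd ℂ) 2 = 2 from map_ofNat _ 2]

lemma pow_self_le {x : ℝ} (n : ℕ) (hn : 1 ≤ n) (hx : (n:ℝ) ≤ x) : (n : ℝ) ^ n ≤ Ex (2 * (x * √x)) := by
  have h1 : (1:ℝ) ≤ n := by exact_mod_cast hn
  have hl : Lo n ≤ 2 * √x := by
    have : Lo n ≤ Lo x := Real.log_le_log lna hx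
    have h2 : Lo x = 2 * Lo (√x) := by rw [Real.log_sqrt lna]; ring
    have h3 := Real.log_le_sub_one_of_pos (show 0 < √x from Real.sqrt_pos.2 lna)
    linarith
  rw [← Real.exp_log (show (0:ℝ) < (n:ℝ)^n by positivity), Real.log_pow]
  apply Real.exp_le_exp.2
  have h5 := Real.sqrt_nonneg x
  have h6 : (n:ℝ) * Lo n ≤ x * (2 * √x) := mul_le_mul hx hl (Real.log_nonneg h1) lna
  linarith

lemma xi_growth {s : ℂ} {T : ℝ} (hT : 1 ≤ T) (hs : ‖s‖ + 1 ≤ T) (hre : 1 / 2 ≤ s.re) :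
    ‖xi s‖ ≤ Ex (6 * (T * √T)) := by
  set n := ⌈‖s‖⌉₊ with hn
  have hs0 : 0 < ‖s‖ := lt_of_lt_of_le lna (le_trans (le_abs_self s.re) (abs_re_le_norm s))
  have hn1 : 1 ≤ n := Nat.one_le_iff_ne_zero.2 (by rw [hn]; simpa using hs0.ne')
  have hnT : (n:ℝ) ≤ T := (Nat.ceil_lt_add_one hs0.le).le.trans hs
  have hsn : ‖s‖ ≤ n := Nat.le_ceil _
  have hI : Ir s.re ≤ 1 + 2 * (n:ℝ) ^ n := by
    have h1 := Ir_le (a := -1) (σ := s.re) (b := 2 * n) lna (by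
      have := (le_abs_self s.re).trans (abs_re_le_norm s)
      have : (1:ℝ) ≤ n := by exact_mod_cast hn1
      linarith)
    have h2 : Ir (-1) = Ir 2 := by rw [← Ir_symm 2]; norm_num
    rw [h2, Ir_two] at h1
    have := Ir_nat hn1
    have := Real.pi_lt_four
    linarith
  have hN := pow_self_le n hn1 hnT
  have hN1 : (1:ℝ) ≤ (n:ℝ)^n := one_le_pow₀ (by exact_mod_cast hn1)
  have h3 : ‖xi s‖ ≤ T * T * (1 + 2 * (n:ℝ)^n) + 1 := by
    unfold xi
    refine (norm_add_le _ _).trans ?_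
    rw [norm_one, norm_mul, norm_mul]
    have h4 : ‖s - 1‖ ≤ T := (norm_sub_le s 1).trans (by simpa using hs)
    have h5 := (crz0_norm s).trans hI
    gcongr
    linarith
  have h6 : T * T * (1 + 2 * (n:ℝ)^n) + 1 ≤ T * T * 4 * (n:ℝ)^n := by nlinarith [mul_le_mul hT hT nnm lna]
  have hsq : 1 ≤ √T := Real.one_le_sqrt.2 hT
  have hT4 : T * T * 4 ≤ Ex (4 * T) := by
    have := Real.add_one_le_exp T
    have e : Ex (4 * T) = (Ex T * Ex T) * (Ex T * Ex T) := by
      rw [← Real.exp_add, ← Real.exp_add]; ring_nf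
    rw [e]
    have h7 : (2:ℝ) ≤ Ex T := by linarith
    have h8 : T ≤ Ex T := by linarith
    have : T * T ≤ Ex T * Ex T := by gcongr
    have : 2 * 2 ≤ Ex T * Ex T := by gcongr
    nlinarith
  calc ‖xi s‖ ≤ T * T * 4 * (n:ℝ)^n := h3.trans h6
    _ ≤ Ex (4 * T) * Ex (2 * (T * √T)) := by gcongr
    _ = Ex (4 * T + 2 * (T * √T)) := (Real.exp_add _ _).symm
    _ ≤ _ := by gcongr; nlinarith

lemma xf_growth {R : ℝ} (hR : 1 ≤ R) {w : ℂ} (hw : ‖w‖ = 4 * R) : ‖xf w‖ ≤ Ex (144 * (R * √R)) := by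
  wlog hre : 0 ≤ w.re generalizing w
  · rw [← xf_even]
    exact this (by simpa using hw) (by simp at hre ⊢; linarith)
  unfold xf
  have h1 : ‖(1/2 + w : ℂ)‖ ≤ 1/2 + 4 * R := (norm_add_le _ _).trans (by rw [hw]; norm_num)
  refine (xi_growth (T := 6 * R) lna lna (by simp; linarith)).trans ?_
  apply Real.exp_le_exp.2
  have : √(6 * R) ≤ 4 * √R := by
    rw [show (4:ℝ) = √16 by rw [show (16:ℝ) = 4^2 by norm_num]; simp, ← Real.sqrt_mul nnm]
    apply Real.sqrt_le_sqrt; linarith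
  nlinarith [Real.sqrt_nonneg R]

def mz (a : ℂ) : ℕ := analyticOrderNatAt xf a
def ZR (R : ℝ) : Finset ℂ := zset xf xf_diff xf_zero R

lemma mem_ZR {R : ℝ} {a : ℂ} : a ∈ ZR R ↔ ‖a‖ ≤ R ∧ xf a = 0 := mem_zset
lemma mz_eq_zero {a : ℂ} (h : xf a ≠ 0) : mz a = 0 := by
  by_contra h1
  exact h (apply_eq_zero_of_analyticOrderNatAt_ne_zero h1)
lemma xf_eq_zero_of_mz {a : ℂ} (h : mz a ≠ 0) : xf a = 0 := apply_eq_zero_of_analyticOrderNatAt_ne_zero h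
lemma mz_pos {a : ℂ} (h : xf a = 0) : 1 ≤ mz a := by
  rw [Nat.one_le_iff_ne_zero]
  intro h1
  have ht := entire_order_ne_top xf xf_diff xf_zero a
  have h2 := Nat.cast_analyticOrderNatAt ht
  have h3 : analyticOrderNatAt xf a = 0 := h1
  rw [h3] at h2
  exact ((xf_diff.analyticAt a).analyticOrderAt_eq_zero.1 (by simpa using h2.symm)) h

lemma mz_neg (a : ℂ) : mz (-a) = mz a := order_even xf_diff xf_even a

lemma zero_re {a : ℂ} (h : xf a = 0) : |a.re| < 1 / 2 := by
  have := xi_zero_re (s := 1/2 + a) h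
  simp at this
  rw [abs_lt]; constructor <;> linarith

theorem xf_hadamard (w : ℂ) (hw : xf w ≠ 0) :
    Tendsto (fun R => ∑ a ∈ ZR R, (mz a : ℂ) / (w - a)) atTop (𝓝 (logDeriv xf w)) := by
  obtain ⟨K, hK1, hK⟩ : ∃ K : ℝ, 0 < K ∧ - Lo ‖xf 0‖ ≤ K :=
    ⟨max 1 (- Lo ‖xf 0‖), by simp, le_max_right _ _⟩
  have hx0 : 0 < ‖xf 0‖ := norm_pos_iff.2 xf_zero
  rw [tendsto_iff_norm_sub_tendsto_zero]
  have hlim : Tendsto (fun R : ℝ => 64 * (144 + K) * ‖w‖ / √R) atTop (𝓝 0) := by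
    exact Tendsto.div_atTop tendsto_const_nhds Real.tendsto_sqrt_atTop
  refine squeeze_zero' (Eventually.of_forall fun _ => norm_nonneg _) ?_ hlim
  filter_upwards [eventually_ge_atTop 1, eventually_gt_atTop (4 * ‖w‖)] with R hR1 hR2
  rw [norm_sub_rev]
  have hs1 : 1 ≤ √R := Real.one_le_sqrt.2 hR1
  have hRs : 1 ≤ R * √R := by nlinarith
  have hb := hadamard_aux xf xf_diff xf_zero xf_even R ((144 + K) * (R * √R)) lna psv (by
    intro z hz
    refine (xf_growth hR1 hz).trans ?_
    have : 1 ≤ ‖xf 0‖ * Ex (K * (R * √R)) := by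
      calc (1:ℝ) = ‖xf 0‖ * Ex (- Lo ‖xf 0‖) := by
            rw [Real.exp_neg, Real.exp_log hx0, mul_inv_cancel₀ hx0.ne']
        _ ≤ _ := by gcongr; nlinarith
    calc Ex (144 * (R * √R)) = 1 * Ex (144 * (R * √R)) := by ring
      _ ≤ ‖xf 0‖ * Ex (K * (R * √R)) * Ex (144 * (R * √R)) := by gcongr
      _ = _ := by rw [mul_assoc, ← Real.exp_add]; ring_nf) w lna hw
  refine hb.trans (le_of_eq ?_)
  have hsq : √R * √R = R := Real.mul_self_sqrt lna
  have h0 : √R ≠ 0 := by linarith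
  rw [div_eq_div_iff psv h0]
  calc 64 * ((144 + K) * (R * √R)) * ‖w‖ * √R = 64 * (144 + K) * ‖w‖ * (R * (√R * √R)) := by ring
    _ = _ := by rw [hsq]; ring

lemma ZR_mono {R R' : ℝ} (h : R ≤ R') : ZR R ⊆ ZR R' := fun a ha => by
  rw [mem_ZR] at *; exact ⟨ha.1.trans h, ha.2⟩

lemma hasSum_of_ZR {g : ℂ → ℝ} {l : ℝ} (hg : ∀ a, xf a = 0 → 0 ≤ g a) (hg0 : ∀ a, xf a ≠ 0 → g a = 0)
    (h : Tendsto (fun R => ∑ a ∈ ZR R, g a) atTop (𝓝 l)) : HasSum g l := by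
  have hg' : ∀ a, 0 ≤ g a := fun a => by
    by_cases h1 : xf a = 0
    · exact hg a h1
    · exact (hg0 a h1).ge
  have hmono : Monotone (fun R => ∑ a ∈ ZR R, g a) := fun R R' hR =>
    Finset.sum_le_sum_of_subset_of_nonneg (ZR_mono hR) fun a _ _ => hg' a
  refine hasSum_of_isLUB_of_nonneg l hg' ⟨?_, ?_⟩
  · rintro _ ⟨s, rfl⟩
    obtain ⟨B, hB⟩ : ∃ B : ℝ, ∀ a ∈ s, ‖a‖ ≤ B := by
      obtain ⟨B, hB⟩ := (s.finite_toSet.image (fun a => ‖a‖)).bddAbove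
      exact ⟨B, fun a ha => hB ⟨a, ha, rfl⟩⟩
    refine le_trans ?_ (hmono.ge_of_tendsto h B)
    classical
    calc ∑ a ∈ s, g a = ∑ a ∈ s.filter (fun a => xf a = 0), g a := by
          refine (Finset.sum_filter_of_ne fun a _ hne => ?_).symm
          by_contra h1; exact hne (hg0 a h1)
      _ ≤ ∑ a ∈ ZR B, g a := Finset.sum_le_sum_of_subset_of_nonneg (fun a ha => by
          rw [Finset.mem_filter] at ha
          exact mem_ZR.2 ⟨hB a ha.1, ha.2⟩) fun a _ _ => hg' a
  · intro u hu
    exact le_of_tendsto' h fun R => hu ⟨ZR R, rfl⟩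

/-- The main positivity formula. -/
theorem xf_re_hasSum (w : ℂ) (hw : 1 / 2 ≤ w.re) :
    HasSum (fun a => (mz a : ℝ) * (1 / (w - a)).re) (logDeriv xf w).re := by
  have hne : xf w ≠ 0 := fun h => by
    have := zero_re h; rw [abs_lt] at this; linarith
  refine hasSum_of_ZR ?_ ?_ ?_
  · intro a ha
    have := zero_re ha; rw [abs_lt] at this
    refine mul_nonneg psv ?_
    rw [one_div, inv_re]
    refine div_nonneg ?_ (normSq_nonneg _)
    simp; linarith
  · intro a ha; simp [mz_eq_zero ha]
  · have := (continuous_re.tendsto _).comp (xf_hadamard w hne)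
    refine this.congr fun R => ?_
    simp only [Function.comp, re_sum]
    refine sumC fun a _ => ?_
    rw [div_eq_mul_one_div, ← ofReal_natCast, re_ofReal_mul]
end

section
open Metric MeasureTheory
def gn (n : ℕ) (t : ℝ) : ℝ := (Ioc (0:ℝ) n).indicator (fun t => (1 - t / n) ^ n) t

lemma gn_meas (n : ℕ) : Measurable (gn n) := by
  unfold gn
  exact Measurable.indicator (by fun_prop) measurableSet_Ioc

lemma gn_bd (n : ℕ) (t : ℝ) : 0 ≤ gn n t ∧ gn n t ≤ Ex (-t) := by
  unfold gn indicator
  split_ifs with h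
  · refine ⟨pow_nonneg ?_ _, Real.one_sub_div_pow_le_exp_neg h.2⟩
    have h1 : 0 < (n:ℝ) := h.1.trans_le h.2
    rw [sub_nonneg, div_le_one h1]; exact h.2
  · exact ⟨le_rfl, (Real.exp_pos _).le⟩

lemma norm_tpow {t : ℝ} (ht : 0 < t) (s : ℂ) : ‖(t:ℂ) ^ (s - 1)‖ = t ^ (s.re - 1) := by
  rw [norm_cpow_eq_rpow_re_of_pos ht]; simp

lemma cpow_meas (s : ℂ) : AEStronglyMeasurable (fun t : ℝ => (t:ℂ) ^ (s - 1)) (volume.restrict (Ioi 0)) := by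
  refine ContinuousOn.aestronglyMeasurable (fun t ht => ?_) measurableSet_Ioi
  have ht : (0:ℝ) < t := ht
  exact (continuousAt_ofReal_cpow_const t (s-1) (Or.inr ht.ne')).continuousWithinAt

lemma gn_int {s : ℂ} (hs : 0 < s.re) (n : ℕ) : IntegrableOn (fun t : ℝ => (gn n t : ℂ) * (t:ℂ) ^ (s - 1)) (Ioi 0) := by
  refine Integrable.mono' (Real.GammaIntegral_convergent hs) ?_ ?_
  · exact (by have := gn_meas n; fun_prop : Measurable fun t => (gn n t : ℂ)).aestronglyMeasurable.mul (cpow_meas s)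
  · refine (ae_restrict_mem measurableSet_Ioi).mono fun t ht => ?_
    rw [norm_mul, norm_tpow ht, norm_real, Real.norm_of_nonneg (gn_bd n t).1]
    have := (gn_bd n t).2
    have ht : (0:ℝ) < t := ht
    gcongr

lemma gammaSeq_eq {s : ℂ} (hs : 0 < s.re) {n : ℕ} (hn : n ≠ 0) :
    GammaSeq s n = ∫ t in Ioi (0:ℝ), (gn n t : ℂ) * (t:ℂ) ^ (s - 1) := by
  rw [GammaSeq_eq_approx_Gamma_integral hs hn, intervalIntegral.integral_of_le psv]
  rw [← integral_indicator measurableSet_Ioc, ← integral_indicator measurableSet_Ioi]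
  congr 1; ext t
  by_cases h : t ∈ Ioc (0:ℝ) n
  · have h2 : t ∈ Ioi (0:ℝ) := h.1
    rw [indicator_of_mem h, indicator_of_mem h2, gn, indicator_of_mem h]
  · rw [indicator_of_notMem h]
    by_cases h2 : t ∈ Ioi (0:ℝ)
    · rw [indicator_of_mem h2, gn, indicator_of_notMem h]; simp
    · rw [indicator_of_notMem h2]

def om (n : ℕ) (t : ℝ) : ℝ := Ex (-t) - gn n t

lemma om_int {s : ℂ} (hs : 0 < s.re) (n : ℕ) : IntegrableOn (fun t : ℝ => (om n t : ℂ) * (t:ℂ) ^ (s - 1)) (Ioi 0) := by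
  have := (GammaIntegral_convergent hs).sub (gn_int hs n)
  refine this.congr (Eventually.of_forall fun t => ?_)
  simp only [om, Pi.sub_apply]; push_cast; ring

lemma gamma_sub {s : ℂ} (hs : 0 < s.re) {n : ℕ} (hn : n ≠ 0) :
    Gamma s - GammaSeq s n = ∫ t in Ioi (0:ℝ), (om n t : ℂ) * (t:ℂ) ^ (s - 1) := by
  rw [gammaSeq_eq hs hn, Gamma_eq_integral hs, GammaIntegral, ← integral_sub (GammaIntegral_convergent hs) (gn_int hs n)]
  congr 1; ext t; simp only [om]; push_cast; ring

def Om (n : ℕ) (x : ℝ) : ℝ := ∫ t in Ioi (0:ℝ), om n t * t ^ (x - 1)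

lemma om_nonneg (n : ℕ) (t : ℝ) : 0 ≤ om n t := sub_nonneg.2 (gn_bd n t).2

lemma norm_om {t : ℝ} (ht : 0 < t) (n : ℕ) (s : ℂ) : ‖(om n t : ℂ) * (t:ℂ) ^ (s - 1)‖ = om n t * t ^ (s.re - 1) := by
  rw [norm_mul, norm_tpow ht, norm_real, Real.norm_of_nonneg (om_nonneg n t)]

lemma Om_int {x : ℝ} (hx : 0 < x) (n : ℕ) : IntegrableOn (fun t : ℝ => om n t * t ^ (x - 1)) (Ioi 0) := by
  refine IntegrableOn.congr_fun (om_int (s := x) (by simpa using hx) n).norm ?_ measurableSet_Ioi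
  intro t ht
  simpa using norm_om ht n (x:ℂ)

lemma Om_eq {x : ℝ} (hx : 0 < x) {n : ℕ} (hn : n ≠ 0) : (Om n x : ℂ) = Gamma x - GammaSeq x n := by
  rw [gamma_sub (by simpa using hx) hn, Om, ← integral_complex_ofReal]
  refine setIntegral_congr_fun measurableSet_Ioi fun t ht => ?_
  have ht : (0:ℝ) < t := ht
  show ((om n t * t ^ (x - 1) : ℝ) : ℂ) = (om n t : ℂ) * (t:ℂ) ^ ((x:ℂ) - 1)
  rw [ofReal_mul, ofReal_cpow ht.le]; push_cast; rfl

lemma Om_tendsto {x : ℝ} (hx : 0 < x) : Tendsto (fun n => Om n x) atTop (𝓝 0) := by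
  have h := (GammaSeq_tendsto_Gamma (x:ℂ)).const_sub (Gamma x)
  rw [sub_self] at h
  have h2 : Tendsto (fun n => (Om n x : ℂ)) atTop (𝓝 0) := by
    refine h.congr' ?_
    filter_upwards [eventually_ne_atTop 0] with n hn using (Om_eq hx hn).symm
  have := (continuous_re.tendsto _).comp h2
  simpa [Function.comp_def] using this

lemma gamma_sub_le {s : ℂ} {a b : ℝ} (ha : 0 < a) (h1 : a ≤ s.re) (h2 : s.re ≤ b) {n : ℕ} (hn : n ≠ 0) :
    ‖Gamma s - GammaSeq s n‖ ≤ Om n a + Om n b := by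
  have hs : 0 < s.re := by linarith
  rw [gamma_sub hs hn]
  refine (norm_integral_le_integral_norm _).trans ?_
  unfold Om
  rw [← integral_add (Om_int ha n) (Om_int lna n)]
  refine setIntegral_mono_on (om_int hs n).norm ((Om_int ha n).add (Om_int lna n)) measurableSet_Ioi fun x hx => ?_
  have hx : (0:ℝ) < x := hx
  have hp := om_nonneg n x
  rw [norm_om hx, ← mul_add]
  gcongr
  rcases le_total 1 x with h | h
  · have := Real.rpow_le_rpow_of_exponent_le h (show s.re - 1 ≤ b - 1 by linarith)
    have h3 : 0 ≤ x ^ (a - 1) := by positivity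
    linarith
  · have := Real.rpow_le_rpow_of_exponent_ge hx h (show a - 1 ≤ s.re - 1 by linarith)
    have h3 : 0 ≤ x ^ (b - 1) := by positivity
    linarith

lemma add_nat_ne {z : ℂ} (hz : 0 < z.re) (k : ℕ) : z + k ≠ 0 := by
  intro h
  have := congrArg re h
  simp at this
  have : (0:ℝ) ≤ k := by positivity
  linarith

lemma digamma_lim {z : ℂ} (hz : 0 < z.re) :
    Tendsto (fun n : ℕ => Complex.log n - ∑ k ∈ Frg (n + 1), 1 / (z + k)) atTop (𝓝 (digamma z)) := by
  set s : Set ℂ := {w | z.re / 2 < w.re ∧ w.re < 2 * z.re} with hs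
  have hso : IsOpen s := (isOpen_lt continuous_const continuous_re).inter (isOpen_lt continuous_re continuous_const)
  have hzs : z ∈ s := ⟨by linarith, by linarith⟩
  have hdiff : ∀ n : ℕ, n ≠ 0 → ∀ w : ℂ, 0 < w.re → DifferentiableAt ℂ (fun w => GammaSeq w n) w := by
    intro n hn w hw
    have hn' : (n:ℂ) ≠ 0 := by exact_mod_cast hn
    unfold GammaSeq
    refine DifferentiableAt.div ?_ (by fun_prop) (Finset.prod_ne_zero_iff.2 fun k _ => add_nat_ne hw k)
    exact (DifferentiableAt.const_cpow differentiableAt_id (Or.inl hn')).mul_const _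
  have hunif : TendstoLocallyUniformlyOn (fun n w => GammaSeq w n) Gamma atTop s := by
    apply TendstoUniformlyOn.tendstoLocallyUniformlyOn
    rw [Metric.tendstoUniformlyOn_iff]
    intro ε hε
    have hlim := (Om_tendsto (x := z.re/2) lna).add (Om_tendsto (x := 2 * z.re) lna)
    rw [add_zero] at hlim
    filter_upwards [hlim.eventually (gt_mem_nhds hε), eventually_ne_atTop 0] with n hn hn0 w hw
    rw [dist_eq_norm]
    exact (gamma_sub_le lna hw.1.le hw.2.le hn0).trans_lt hn
  have := logDeriv_tendsto hso hzs hunif (by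
    filter_upwards [eventually_ne_atTop 0] with n hn w hw
    exact (hdiff n hn w (by linarith [hw.1])).differentiableWithinAt) (Gamma_ne_zero_of_re_pos hz)
  rw [digamma_def]
  refine this.congr' ?_
  filter_upwards [eventually_ne_atTop 0] with n hn
  have hn' : (n:ℂ) ≠ 0 := by exact_mod_cast hn
  have hfac : (n.factorial : ℂ) ≠ 0 := by exact_mod_cast n.factorial_ne_zero
  have hprod : ∏ j ∈ Frg (n + 1), (z + j) ≠ 0 := Finset.prod_ne_zero_iff.2 fun k _ => add_nat_ne hz k
  have hnz : (n:ℂ)^z * (n.factorial : ℂ) ≠ 0 := mul_ne_zero (by simp [cpow_eq_zero_iff, hn']) hfac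
  have hd1 : HasDerivAt (fun w => (n:ℂ)^w * (n.factorial : ℂ)) ((n:ℂ)^z * Complex.log n * 1 * (n.factorial : ℂ)) z :=
    ((hasDerivAt_id z).const_cpow (Or.inl hn')).mul_const _
  change logDeriv (fun w : ℂ => (n:ℂ)^w * (n.factorial : ℂ) / ∏ j ∈ Frg (n + 1), (w + (j:ℂ))) z = _
  rw [logDeriv_div z hnz hprod hd1.differentiableAt (by fun_prop), logDeriv_prod (fun k _ => add_nat_ne hz k) (fun k _ => by fun_prop)]
  congr 1
  · have hnzz : (n:ℂ)^z ≠ 0 := by simp [cpow_eq_zero_iff, hn']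
    rw [logDeriv_apply, hd1.deriv]; field_simp
  · refine sumC fun k _ => ?_
    rw [logDeriv_apply]; simp

/-- trapezoid -/
lemma trap {w : ℂ} (hw : 0 < w.re) :
    ‖Complex.log (w + 1) - Complex.log w - (1 / w + 1 / (w + 1)) / 2‖ ≤ 1 / (4 * ‖w‖ ^ 3) := by
  have hw0 : w ≠ 0 := by rintro rfl; simp at hw
  have hw1 : w + 1 ≠ 0 := by simpa using add_nat_ne hw 1
  let F : ℝ → ℂ := fun t => Complex.log (w + t) - ((t - t^2/2) / w + t^2/2 / (w+1))
  have hne : ∀ t : ℝ, 0 ≤ t → w + t ≠ 0 := fun t ht h => by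
    have := congrArg re h; simp at this; linarith
  have hF : ∀ t : ℝ, 0 ≤ t → HasDerivAt F (1 / (w + t) - ((1 - t) / w + t / (w+1))) t := by
    intro t ht
    have h1 : HasDerivAt (fun t : ℝ => (t:ℂ)) 1 t := ofRealCLM.hasDerivAt
    have h2 : HasDerivAt (fun t : ℝ => w + (t:ℂ)) 1 t := h1.const_add w
    have h3 := h2.clog_real (Or.inl (by simp; linarith))
    have h4 : HasDerivAt (fun t : ℝ => ((t:ℂ) - (t:ℂ)^2/2) / w) ((1 - t) / w) t := by
      refine ((h1.sub ((h1.pow 2).div_const 2)).div_const w).congr_deriv ?_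
      simp
    have h5 : HasDerivAt (fun t : ℝ => (t:ℂ)^2/2 / (w+1)) (t / (w+1)) t := by
      refine (((h1.pow 2).div_const 2).div_const (w+1)).congr_deriv ?_
      simp
    exact h3.sub (h4.add h5)
  have hbd : ∀ t ∈ Ico (0:ℝ) 1, ‖1 / (w + t) - ((1 - t) / w + t / (w+1))‖ ≤ 1 / (4 * ‖w‖^3) := by
    rintro t ⟨ht0, ht1⟩
    have e : 1 / (w + t) - ((1 - t) / w + t / (w+1)) = - ((t * (1 - t) : ℝ) : ℂ) / (w * (w+1) * (w+t)) := by
      have := hne t ht0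
      push_cast; field_simp; ring
    have n1 : ‖w‖ ≤ ‖w + 1‖ := by
      rw [← sq_le_sq₀ (norm_nonneg _) (norm_nonneg _), Complex.sq_norm, Complex.sq_norm, normSq_apply, normSq_apply]
      simp; nlinarith
    have n2 : ‖w‖ ≤ ‖w + t‖ := by
      rw [← sq_le_sq₀ (norm_nonneg _) (norm_nonneg _), Complex.sq_norm, Complex.sq_norm, normSq_apply, normSq_apply]
      simp; nlinarith
    have hwp : 0 < ‖w‖ := norm_pos_iff.2 hw0
    rw [e, norm_div, norm_neg, norm_real, Real.norm_of_nonneg (by nlinarith), norm_mul, norm_mul]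
    have h1 : t * (1 - t) ≤ 1 / 4 := by nlinarith [sq_nonneg (t - 1/2)]
    calc t * (1 - t) / (‖w‖ * ‖w+1‖ * ‖w + t‖) ≤ (1/4) / (‖w‖ * ‖w‖ * ‖w‖) := by gcongr
      _ = _ := by rw [div_div]; congr 1; ring
  have := norm_image_sub_le_of_norm_deriv_le_segment_01' (f := F) (f' := fun t => 1 / (w + t) - ((1 - t) / w + t / (w+1)))
    (C := 1 / (4 * ‖w‖^3)) (fun t ht => (hF t ht.1).hasDerivWithinAt) hbd
  have e : F 1 - F 0 = Complex.log (w + 1) - Complex.log w - (1 / w + 1 / (w + 1)) / 2 := by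
    simp [F]; ring
  rwa [e] at this
end

lemma sum_cube_le {r : ℝ} (hr : 1 < r) (n : ℕ) :
    ∑ k ∈ Frg n, 2 / (r + k) ^ 2 ≤ 2 / (r - 1) - 2 / (r - 1 + n) := by
  induction n with
  | zero => simp
  | succ n ih =>
    rw [sum_range_succ]
    have hn : (0:ℝ) ≤ n := by positivity
    have h1 : 0 < r - 1 + n := by linarith
    have h2 : 0 < r + n := by linarith
    have : 2 / (r + n) ^ 2 ≤ 2 / (r - 1 + n) - 2 / (r - 1 + (n + 1 : ℕ)) := by
      have e : 2 / (r - 1 + n) - 2 / (r - 1 + (n + 1 : ℕ)) = 2 / ((r - 1 + n) * (r + n)) := by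
        push_cast
        rw [show r - 1 + (n + 1) = r + n by ring]
        field_simp; ring
      rw [e]
      gcongr
      nlinarith
    linarith

lemma norm_add_nat_sq {z : ℂ} (hz : 0 < z.re) (k : ℕ) : (‖z‖ + k) ^ 2 ≤ 2 * ‖z + k‖ ^ 2 := by
  have h1 : ‖z + k‖ ^ 2 = (z.re + k) ^ 2 + z.im ^ 2 := by
    rw [Complex.sq_norm, normSq_apply]; simp; ring
  have h2 : ‖z‖ ^ 2 = z.re ^ 2 + z.im ^ 2 := by
    rw [Complex.sq_norm, normSq_apply]; ring
  have hk : (0:ℝ) ≤ k := by positivity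
  nlinarith [sq_nonneg (‖z‖ - k), mul_nonneg hz.le hk]

lemma norm_le_add_nat {z : ℂ} (hz : 0 < z.re) (k : ℕ) : ‖z‖ ≤ ‖z + k‖ := by
  have h1 : ‖z + k‖ ^ 2 = (z.re + k) ^ 2 + z.im ^ 2 := by
    rw [Complex.sq_norm, normSq_apply]; simp; ring
  have h2 : ‖z‖ ^ 2 = z.re ^ 2 + z.im ^ 2 := by
    rw [Complex.sq_norm, normSq_apply]; ring
  have hk : (0:ℝ) ≤ k := by positivity
  refine abs_le_of_sq_le_sq' ?_ (norm_nonneg _) |>.2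
  nlinarith [mul_nonneg hz.le hk]

lemma tendsto_log_ratio (z : ℂ) : Tendsto (fun n : ℕ => Lo n - Lo ‖z + n‖) atTop (𝓝 0) := by
  have h1 : Tendsto (fun n : ℕ => z / (n:ℂ)) atTop (𝓝 0) := tendsto_const_div_atTop_nhds_zero_nat z
  have h2 : Tendsto (fun n : ℕ => Lo ‖z / (n:ℂ) + 1‖) atTop (𝓝 0) := by
    have := ((h1.add_const 1).norm).log (by simp)
    simpa using this
  have h3 := h2.neg
  rw [neg_zero] at h3
  have h4 : ∀ᶠ n : ℕ in atTop, ‖z / (n:ℂ) + 1‖ ≠ 0 := by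
    have := ((h1.add_const 1).norm)
    exact this.eventually_ne (by simp)
  refine h3.congr' ?_
  filter_upwards [eventually_ne_atTop 0, h4] with n hn h
  have hn' : (n:ℂ) ≠ 0 := by exact_mod_cast hn
  have e : z + n = (z / n + 1) * n := by field_simp
  have hn2 : (n:ℝ) ≠ 0 := by exact_mod_cast hn
  rw [e, norm_mul, Complex.norm_natCast, Real.log_mul h hn2]
  ring

lemma digamma_re_bd {z : ℂ} (hz : 0 < z.re) (hr : 1 < ‖z‖) :
    |(digamma z).re - (Lo ‖z‖ - (1 / (2 * z)).re)| ≤ 1 / (2 * ‖z‖ * (‖z‖ - 1)) := by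
  have hre : Tendsto (fun n : ℕ => (Complex.log n - ∑ k ∈ Frg (n + 1), 1 / (z + k)).re) atTop (𝓝 (digamma z).re) :=
    (continuous_re.tendsto _).comp (digamma_lim hz)
  have hinv : Tendsto (fun n : ℕ => (1 / (2 * (z + n))).re) atTop (𝓝 0) := by
    have h : Tendsto (fun n : ℕ => 1 / (2 * (z + n))) atTop (𝓝 0) := by
      rw [tendsto_zero_iff_norm_tendsto_zero]
      have h0 : Tendsto (fun n : ℕ => 1 / (n:ℝ)) atTop (𝓝 0) := tendsto_const_div_atTop_nhds_zero_nat 1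
      refine squeeze_zero' (Eventually.of_forall fun n => norm_nonneg _) ?_ h0
      filter_upwards [eventually_gt_atTop 0] with n hn
      have hn' : (0:ℝ) < n := by exact_mod_cast hn
      rw [norm_div, norm_mul]
      have : (n:ℝ) ≤ ‖z + n‖ := by
        have := abs_re_le_norm (z + n)
        simp at this
        rw [abs_of_pos lna] at this; linarith
      simp only [norm_one, Complex.norm_ofNat]
      gcongr
      linarith
    have h9 := (continuous_re.tendsto _).comp h
    rw [Complex.zero_re] at h9
    exact h9
  have hl := (hre.sub (tendsto_log_ratio z)).add hinv
  rw [sub_zero, add_zero] at hl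
  refine le_of_tendsto ((hl.sub_const _).abs) (Eventually.of_forall fun n => ?_)
  have hT : (Complex.log n - ∑ k ∈ Frg (n + 1), 1 / (z + k)).re - (Lo n - Lo ‖z + n‖) + (1 / (2 * (z + n))).re
      - (Lo ‖z‖ - (1 / (2 * z)).re) = (∑ k ∈ Frg n, (Complex.log (z + k + 1) - Complex.log (z + k) - (1 / (z + k) + 1 / (z + k + 1)) / 2)).re := by
    have e : ∀ n : ℕ, ∑ k ∈ Frg n, (Complex.log (z + k + 1) - Complex.log (z + k) - (1 / (z + k) + 1 / (z + k + 1)) / 2)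
        = Complex.log (z + n) - Complex.log z - ∑ k ∈ Frg (n + 1), 1 / (z + k) + 1 / (2 * z) + 1 / (2 * (z + n)) := by
      intro n
      induction n with
      | zero => simp; ring
      | succ n ih =>
        rw [sum_range_succ, ih, sum_range_succ _ (n+1)]
        push_cast
        rw [← add_assoc]
        have e3 : ∀ w : ℂ, 1 / (2 * w) = 1 / w / 2 := fun w => by rw [mul_comm, div_div]
        rw [e3 (z + n), e3 (z + n + 1)]
        ring
    rw [e]
    simp only [sub_re, add_re, log_re, Complex.norm_natCast]
    ring
  rw [hT]
  refine (abs_re_le_norm _).trans ((norm_sum_le _ _).trans ?_)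
  have hr0 : 0 < ‖z‖ - 1 := by linarith
  have hr1 : 0 < ‖z‖ := by linarith
  calc ∑ k ∈ Frg n, ‖Complex.log (z + k + 1) - Complex.log (z + k) - (1 / (z + k) + 1 / (z + k + 1)) / 2‖
      ≤ ∑ k ∈ Frg n, 1 / (4 * ‖z‖) * (2 / (‖z‖ + k) ^ 2) := by
        refine sum_le_sum fun k _ => ?_
        have hzk : 0 < (z + k).re := by simp; positivity
        refine (trap hzk).trans ?_
        have h1 := norm_add_nat_sq hz k
        have h2 := norm_le_add_nat hz k
        have h3 : 0 < ‖z + k‖ := by linarith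
        rw [div_mul_div_comm, div_le_div_iff₀ psv psv]
        have : ‖z‖ * (‖z‖ + k) ^ 2 ≤ ‖z + k‖ * (2 * ‖z + k‖ ^ 2) := by gcongr
        nlinarith
    _ ≤ 1 / (4 * ‖z‖) * (2 / (‖z‖ - 1)) := by
        rw [← mul_sum]
        gcongr
        have := sum_cube_le hr n
        have h5 : 0 ≤ 2 / (‖z‖ - 1 + n) := by positivity
        linarith
    _ = _ := by field_simp; ring

lemma digamma_real_le {x : ℝ} (hx : 0 < x) : (digamma x).re ≤ Lo x := by
  have hre : Tendsto (fun n : ℕ => (Complex.log n - ∑ k ∈ Frg (n + 1), 1 / ((x:ℂ) + k)).re) atTop (𝓝 (digamma x).re) :=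
    (continuous_re.tendsto _).comp (digamma_lim (by simpa using hx))
  have hl := (hre.sub (tendsto_log_ratio (x+1)))
  rw [sub_zero] at hl
  refine le_of_tendsto hl (Eventually.of_forall fun n => ?_)
  have key : ∀ n : ℕ, Lo (x + n) - Lo x ≤ ∑ k ∈ Frg n, 1 / (x + k) := by
    intro n
    induction n with
    | zero => simp
    | succ n ih =>
      rw [sum_range_succ]
      have h0 : 0 < x + n := by positivity
      have := Real.log_le_sub_one_of_pos (show 0 < (x + (n+1:ℕ)) / (x + n) by positivity)
      rw [Real.log_div psv psv] at this
      have e : (x + (n+1:ℕ)) / (x + n) - 1 = 1 / (x + n) := by push_cast; field_simp; ring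
      linarith
  have := key (n+1)
  have e1 : (∑ k ∈ Frg (n + 1), 1 / ((x:ℂ) + k)).re = ∑ k ∈ Frg (n + 1), 1 / (x + k) := by
    rw [re_sum]
    refine sumC fun k _ => ?_
    rw [show 1 / ((x:ℂ) + k) = ((1 / (x + k) : ℝ) : ℂ) by push_cast; rfl, ofReal_re]
  have e2 : ‖(x:ℂ) + 1 + n‖ = x + (n+1:ℕ) := by
    rw [show (x:ℂ) + 1 + n = ((x + (n+1:ℕ) : ℝ) : ℂ) by push_cast; ring, norm_real, Real.norm_of_nonneg psv]
  rw [sub_re, e1, e2, log_re, Complex.norm_natCast]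
  linarith

lemma digamma_real_ge {x : ℝ} (hx : 0 < x) : Lo x - 1 / x ≤ (digamma x).re := by
  have hre : Tendsto (fun n : ℕ => (Complex.log n - ∑ k ∈ Frg (n + 1), 1 / ((x:ℂ) + k)).re) atTop (𝓝 (digamma x).re) :=
    (continuous_re.tendsto _).comp (digamma_lim (by simpa using hx))
  have hl := (hre.sub (tendsto_log_ratio x))
  rw [sub_zero] at hl
  refine ge_of_tendsto hl (Eventually.of_forall fun n => ?_)
  have key : ∀ n : ℕ, ∑ k ∈ Frg (n+1), 1 / (x + k) ≤ 1 / x + Lo (x + n) - Lo x := by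
    intro n
    induction n with
    | zero => simp
    | succ n ih =>
      rw [sum_range_succ]
      have h0 : 0 < x + n := by positivity
      have := Real.log_le_sub_one_of_pos (show 0 < (x + n) / (x + (n+1:ℕ)) by positivity)
      rw [Real.log_div psv psv] at this
      have e : (x + n) / (x + (n+1:ℕ)) - 1 = - (1 / (x + (n+1:ℕ))) := by
        have : x + (n+1:ℕ) ≠ 0 := by positivity
        field_simp; push_cast; ring
      linarith
  have := key n
  have e1 : (∑ k ∈ Frg (n + 1), 1 / ((x:ℂ) + k)).re = ∑ k ∈ Frg (n + 1), 1 / (x + k) := by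
    rw [re_sum]
    refine sumC fun k _ => ?_
    rw [show 1 / ((x:ℂ) + k) = ((1 / (x + k) : ℝ) : ℂ) by push_cast; rfl, ofReal_re]
  have e2 : ‖(x:ℂ) + n‖ = x + n := by
    rw [show (x:ℂ) + n = ((x + n : ℝ) : ℂ) by push_cast; ring, norm_real, Real.norm_of_nonneg psv]
  rw [sub_re, e1, e2, log_re, Complex.norm_natCast]
  linarith

lemma mz_conj_le (a : ℂ) : mz (starRingEnd ℂ a) = mz a := by
  have hne : analyticOrderAt xf a ≠ ⊤ := entire_order_ne_top xf xf_diff xf_zero a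
  have ha : AnalyticAt ℂ xf a := xf_diff.analyticAt a
  have ha' : AnalyticAt ℂ xf (starRingEnd ℂ a) := xf_diff.analyticAt _
  have h1 : analyticOrderAt xf a = (mz a : ℕ∞) := (Nat.cast_analyticOrderNatAt hne).symm
  obtain ⟨g, hg, hg0, hgf⟩ := (ha.analyticOrderAt_eq_natCast).1 h1
  have h2 : analyticOrderAt xf (starRingEnd ℂ a) = (mz a : ℕ∞) := by
    refine (ha'.analyticOrderAt_eq_natCast).2 ⟨fun z => starRingEnd ℂ (g (starRingEnd ℂ z)), ?_, ?_, ?_⟩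
    · rw [Complex.analyticAt_iff_eventually_differentiableAt] at hg ⊢
      have hc : Tendsto (starRingEnd ℂ) (𝓝 (starRingEnd ℂ a)) (𝓝 a) := by
        have := (Complex.continuous_conj.tendsto (starRingEnd ℂ a)); simpa using this
      filter_upwards [hc.eventually hg] with z hz
      have := hz.conj_conj
      simpa [Function.comp_def] using this
    · simpa using hg0
    · have hc : Tendsto (starRingEnd ℂ) (𝓝 (starRingEnd ℂ a)) (𝓝 a) := by
        have := (Complex.continuous_conj.tendsto (starRingEnd ℂ a)); simpa using this
      filter_upwards [hc.eventually hgf] with z hz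
      rw [xf_conj] at hz
      have := congrArg (starRingEnd ℂ) hz
      simpa using this
  rw [mz, analyticOrderNatAt, h2]; rfl

lemma mz_refl (a : ℂ) : mz (-(starRingEnd ℂ a)) = mz a := by rw [mz_neg, mz_conj_le]

/-- the reflection `a ↦ -conj a` -/
def reflE : ℂ ≃ ℂ := (starRingAut (R := ℂ)).toEquiv.trans (Equiv.neg ℂ)

lemma reflE_apply (a : ℂ) : reflE a = -(starRingEnd ℂ a) := rfl

lemma re_inv (w : ℂ) : (1 / w).re = w.re / (w.re ^ 2 + w.im ^ 2) := by
  rw [one_div, inv_re, normSq_apply]; ring_nf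

/-- contribution of a zero with abscissa `b` at distance `p`, `d` -/
def pr (p b d : ℝ) : ℝ := ((p - b) / ((p - b)^2 + d^2) + (p + b) / ((p + b)^2 + d^2)) / 2

lemma xf_pr_hasSum (w : ℂ) (hw : 1 / 2 ≤ w.re) :
    HasSum (fun a : ℂ => (mz a : ℝ) * pr w.re a.re (w.im - a.im)) (logDeriv xf w).re := by
  have h1 := xf_re_hasSum w hw
  have h2 : HasSum (fun a : ℂ => (mz a : ℝ) * (1 / (w - reflE a)).re) (logDeriv xf w).re := by
    have := (Equiv.hasSum_iff reflE).2 h1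
    refine this.congr_fun ?_ |> id
    intro a
    simp only [Function.comp, reflE_apply, mz_refl]
  have h3 := (h1.add h2).div_const 2
  rw [add_self_div_two] at h3
  refine h3.congr_fun ?_ |> id
  intro a
  rw [re_inv, re_inv, pr, reflE_apply]
  simp
  ring

lemma xf_logDeriv {s : ℂ} (hs : 1 < s.re) : logDeriv xf (s - 1/2) =
    - LSeries (fun n => (vM n : ℂ)) s + 1 / s + 1 / (s - 1) - Complex.log Real.pi / 2 + digamma (s / 2) / 2 := by
  have h0 : s ≠ 0 := by rintro rfl; simp at hs; linarith
  have h1 : s - 1 ≠ 0 := by intro h; rw [sub_eq_zero] at h; subst h; simp at hs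
  have hz : riemannZeta s ≠ 0 := riemannZeta_ne_zero_of_one_lt_re hs
  have hG : Gammaℝ s ≠ 0 := Gammaℝ_ne_zero_of_re_pos lna
  have hGa : Gamma (s/2) ≠ 0 := Gamma_ne_zero_of_re_pos (by simp; linarith)
  have hpi : (Real.pi : ℂ) ≠ 0 := by exact_mod_cast Real.pi_ne_zero
  have e1 : logDeriv xf (s - 1/2) = logDeriv xi s := by
    have : xf = xi ∘ (fun w => 1/2 + w) := rfl
    rw [this, logDeriv_comp (xi_diff _) (by fun_prop)]
    simp
  have hopen : IsOpen {z : ℂ | 1 < z.re} := isOpen_lt continuous_const continuous_re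
  have e2 : xi =ᶠ[𝓝 s] fun z => ((z * (z - 1)) * ((Real.pi:ℂ) ^ (-z / 2) * Gamma (z / 2))) * riemannZeta z := by
    filter_upwards [hopen.mem_nhds hs] with z hz
    have hz : 1 < z.re := hz
    rw [xi_eq' lna (by rintro rfl; simp at hz), Gammaℝ_def]
  have d1 : DifferentiableAt ℂ (fun z : ℂ => (Real.pi:ℂ) ^ (-z / 2)) s := by
    refine DifferentiableAt.const_cpow (by fun_prop) (Or.inl hpi)
  have d2 : DifferentiableAt ℂ (fun z : ℂ => Gamma (z / 2)) s := by
    refine DifferentiableAt.comp s (g := Gamma) (differentiableAt_Gamma _ fun m h => ?_) (by fun_prop)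
    have := congrArg re h
    simp at this
    have : (0:ℝ) ≤ m := by positivity
    linarith
  have hp : (Real.pi:ℂ) ^ (-s / 2) ≠ 0 := by simp [cpow_eq_zero_iff, hpi]
  have d3 : DifferentiableAt ℂ riemannZeta s := differentiableAt_riemannZeta (by rintro rfl; simp at hs)
  have e3 : logDeriv xi s = logDeriv (fun z => ((z * (z - 1)) * ((Real.pi:ℂ) ^ (-z / 2) * Gamma (z / 2))) * riemannZeta z) s := by
    rw [logDeriv_apply, logDeriv_apply, e2.deriv_eq, e2.eq_of_nhds]
  rw [e1, e3, logDeriv_mul s (by simp [h0, h1, hp, hGa]) hz (by fun_prop) d3,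
    logDeriv_mul s (by simp [h0, h1]) (by simp [hp, hGa]) (by fun_prop) (by fun_prop),
    logDeriv_mul s h0 h1 (by fun_prop) (by fun_prop), logDeriv_mul s hp hGa d1 d2]
  have f1 : logDeriv riemannZeta s = - LSeries (fun n => (vM n : ℂ)) s := by
    rw [ArithmeticFunction.LSeries_vonMangoldt_eq_deriv_riemannZeta_div hs, logDeriv_apply]; ring
  have f2 : logDeriv (fun z : ℂ => Gamma (z/2)) s = digamma (s/2) / 2 := by
    have : (fun z : ℂ => Gamma (z/2)) = Gamma ∘ (fun z => z / 2) := rfl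
    rw [this, logDeriv_comp (differentiableAt_Gamma _ fun m h => ?_) (by fun_prop), digamma_def]
    · simp; ring
    · have := congrArg re h
      simp at this
      have : (0:ℝ) ≤ m := by positivity
      linarith
  have f3 : logDeriv (fun z : ℂ => (Real.pi:ℂ) ^ (-z / 2)) s = - Complex.log Real.pi / 2 := by
    have hd : HasDerivAt (fun z : ℂ => -z / 2) (-1/2) s := ((hasDerivAt_id s).neg).div_const 2
    have := hd.const_cpow (c := (Real.pi:ℂ)) (Or.inl hpi)
    rw [logDeriv_apply, this.deriv]
    field_simp
  have f4 : logDeriv (fun z : ℂ => z - 1) s = 1 / (s - 1) := by rw [logDeriv_apply]; simp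
  have f5 : logDeriv (fun z : ℂ => z) s = 1 / s := by rw [logDeriv_apply]; simp
  rw [f1, f2, f3, f4, f5]; ring

lemma pr_ge {p b d : ℝ} (hp : 1 ≤ p) (hb : |b| < 1/2) (hd : 1 ≤ p^2 + d^2 - 1): p / (p^2 + d^2 + 1) ≤ pr p b d := by
  have hb2 : b^2 < 1/4 := by nlinarith [abs_lt.1 hb |>.1, abs_lt.1 hb |>.2, sq_abs b, abs_nonneg b]
  obtain ⟨hb3, hb4⟩ := abs_lt.1 hb
  have h1 : 0 < (p - b)^2 + d^2 := by nlinarith [sq_nonneg d]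
  have h2 : 0 < (p + b)^2 + d^2 := by nlinarith [sq_nonneg d]
  have e : pr p b d = p * (p^2 - b^2 + d^2) / (((p - b)^2 + d^2) * ((p + b)^2 + d^2)) := by
    rw [pr]; field_simp; ring
  rw [e, div_le_div_iff₀ psv psv]
  have : ((p - b)^2 + d^2) * ((p + b)^2 + d^2) ≤ (p^2 - b^2 + d^2) * (p^2 + d^2 + 1) := by
    have h5 : 0 ≤ b^2 * p^2 := by positivity
    nlinarith [mul_nonneg (show 0 ≤ 1/4 - b^2 by linarith) (show 0 ≤ p^2 + d^2 by positivity), mul_nonneg (show 0 ≤ 1/4 - b^2 by linarith) (sq_nonneg b)]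
  nlinarith

lemma pr_nonneg {p b d : ℝ} (hp : 1/2 ≤ p) (hb : |b| < 1/2) : 0 ≤ pr p b d := by
  obtain ⟨hb3, hb4⟩ := abs_lt.1 hb
  rw [pr]
  have h1 : 0 ≤ p - b := by linarith
  have h2 : 0 ≤ p + b := by linarith
  positivity

lemma mz_pr_nonneg {p d : ℝ} (hp : 1/2 ≤ p) (a : ℂ) : 0 ≤ (mz a : ℝ) * pr p a.re d := by
  by_cases h : xf a = 0
  · exact mul_nonneg psv (pr_nonneg hp (zero_re h))
  · simp [mz_eq_zero h]

/-- real part of the log derivative at real points -/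
def Lr (s : ℝ) : ℝ := (logDeriv xf ((s - 1/2 : ℝ) : ℂ)).re

lemma Lr_hasSum {s : ℝ} (hs : 1 ≤ s) : HasSum (fun a : ℂ => (mz a : ℝ) * pr (s - 1/2) a.re a.im) (Lr s) := by
  have := xf_pr_hasSum ((s - 1/2 : ℝ) : ℂ) (by rw [ofReal_re]; linarith)
  refine this.congr_fun ?_ |> id
  intro a
  rw [ofReal_re, ofReal_im, pr, pr]
  ring

lemma LS_re {σ t : ℝ} (hσ : 1 < σ) : HasSum (fun n : ℕ => vM n * (n:ℝ)^(-σ) * Real.cos (t * Lo n))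
    (LSeries (fun n => (vM n : ℂ)) (σ + t * I)).re := by
  have h := (ArithmeticFunction.LSeriesSummable_vonMangoldt (s := σ + t * I) (by simpa using hσ)).hasSum
  have h2 := Complex.reCLM.hasSum h
  refine h2.congr_fun ?_ |> id
  intro n
  rcases Nat.eq_zero_or_pos n with rfl | hn
  · simp
  have hn' : (0:ℝ) < n := by exact_mod_cast hn
  have hn0 : (n:ℂ) ≠ 0 := by exact_mod_cast hn.ne'
  simp only [Complex.reCLM_apply]
  rw [LSeries.term_of_ne_zero hn.ne', div_eq_mul_inv, ← Complex.cpow_neg]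
  have e : (n:ℂ) ^ (-((σ:ℂ) + t * I)) = ((n:ℝ)^(-σ) : ℝ) * Complex.exp (((-(t * Lo n)) : ℝ) * I) := by
    rw [Complex.cpow_def_of_ne_zero hn0, Real.rpow_def_of_pos hn', ofReal_exp, ← Complex.exp_add]
    congr 1
    rw [← Complex.natCast_log]; push_cast; ring
  rw [e, ← mul_assoc, ← ofReal_mul, re_ofReal_mul, exp_ofReal_mul_I_re, Real.cos_neg]

lemma Lr_eq {s : ℝ} (hs : 1 < s) : Lr s = - (LSeries (fun n => (vM n : ℂ)) s).re + 1 / s + 1 / (s - 1)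
    - Lo Real.pi / 2 + (digamma ((s / 2 : ℝ) : ℂ)).re / 2 := by
  have := xf_logDeriv (s := s) (by simpa using hs)
  rw [Lr, show (((s - 1/2 : ℝ)) : ℂ) = s - 1/2 by push_cast; ring, this]
  rw [show Complex.log Real.pi = (Lo Real.pi : ℂ) from (ofReal_log Real.pi_pos.le).symm]
  rw [show (1:ℂ) / s = ((1 / s : ℝ) : ℂ) by push_cast; ring, show (1:ℂ) / (s - 1) = ((1 / (s - 1) : ℝ) : ℂ) by push_cast; ring,
    show (s:ℂ) / 2 = ((s / 2 : ℝ) : ℂ) by push_cast; ring]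
  have e2 : ∀ z : ℂ, (z / 2).re = z.re / 2 := fun z => by simp
  simp only [add_re, sub_re, neg_re, e2, ofReal_re]

lemma LSr_ge {s : ℝ} (hs : 1 < s) (F : Finset ℕ) :
    ∑ n ∈ F, vM n * (n:ℝ)^(-s) ≤ (LSeries (fun n => (vM n : ℂ)) s).re := by
  have h := LS_re (σ := s) (t := 0) hs
  simp only [ofReal_zero, zero_mul, add_zero, Real.cos_zero, mul_one] at h
  exact sum_le_hasSum F (fun n _ => mul_nonneg ArithmeticFunction.vonMangoldt_nonneg psv) h

lemma log_pi_gt : 1.65 * Lo 2 ≤ Lo Real.pi := by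
  have h1 : Lo ((2:ℝ)^33) ≤ Lo (Real.pi^20) := by
    apply Real.log_le_log psv
    have : (3.1415:ℝ)^20 ≤ Real.pi^20 := by gcongr; exact Real.pi_gt_d4.le
    exact le_trans nnm this
  rw [Real.log_pow, Real.log_pow] at h1
  push_cast at h1; linarith

lemma log_three_lt : Lo 3 ≤ 27/17 * Lo 2 := by
  have h1 : Lo ((3:ℝ)^17) ≤ Lo (2^27) := by
    apply Real.log_le_log (by positivity); norm_num
  rw [Real.log_pow, Real.log_pow] at h1
  push_cast at h1; linarith
lemma log_three_gt : 19/12 * Lo 2 ≤ Lo 3 := by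
  have h1 : Lo ((2:ℝ)^19) ≤ Lo (3^12) := by
    apply Real.log_le_log (by positivity); norm_num
  rw [Real.log_pow, Real.log_pow] at h1
  push_cast at h1; linarith

lemma digamma_step {x : ℝ} (hx : 0 < x) : (digamma ((x + 1 : ℝ) : ℂ)).re = (digamma (x:ℂ)).re + 1 / x := by
  have h : ∀ m : ℕ, (x:ℂ) ≠ -m := by
    intro m h
    have := congrArg re h
    simp at this
    have : (0:ℝ) ≤ m := by positivity
    linarith
  have := digamma_apply_add_one (x:ℂ) h
  rw [ofReal_add, ofReal_one, this, show ((x:ℂ))⁻¹ = ((1/x:ℝ):ℂ) by push_cast; rw [one_div], add_re, ofReal_re]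

lemma digamma_two : (digamma ((2:ℝ):ℂ)).re ≤ 0.4445 := by
  have h6 := digamma_re_bd (z := ((6:ℝ):ℂ)) (by simp) (by simp)
  have s2 := digamma_step (x := 2) nnm
  have s3 := digamma_step (x := 3) nnm
  have s4 := digamma_step (x := 4) nnm
  have s5 := digamma_step (x := 5) nnm
  norm_num at s2 s3 s4 s5 h6
  have hl : Lo 6 = Lo 2 + Lo 3 := by
    rw [← Real.log_mul nnm nnm]; norm_num
  have := (abs_le.1 h6).2
  have l2 := Real.log_two_lt_d9
  have l3 := log_three_lt
  norm_num at this l2 ⊢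
  linarith

lemma Lr_four0 : (1:ℝ) / 4 + 1 / 3 - Lo Real.pi / 2 + (digamma ((2:ℝ):ℂ)).re / 2 ≤ 0.2339 := by
  have := digamma_two
  have := log_pi_gt
  have := Real.log_two_gt_d9
  norm_num at *
  linarith

lemma Lr_four : Lr 4 ≤ 0.1772 := by
  have h := Lr_eq (s := 4) nnm
  have hL := LSr_ge (s := 4) nnm {2, 3}
  rw [Finset.sum_pair nnm] at hL
  rw [ArithmeticFunction.vonMangoldt_apply_prime Nat.prime_two, ArithmeticFunction.vonMangoldt_apply_prime Nat.prime_three] at hL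
  have e1 : ((2:ℕ):ℝ)^(-(4:ℝ)) = 1/16 := by
    rw [Real.rpow_neg psv]; norm_num
  have e2 : ((3:ℕ):ℝ)^(-(4:ℝ)) = 1/81 := by
    rw [Real.rpow_neg psv]; norm_num
  rw [e1, e2] at hL
  have := Lr_four0
  have := Real.log_two_gt_d9
  have := log_three_gt
  rw [show ((4:ℝ)/2 : ℝ) = 2 by norm_num] at h
  norm_num at *
  linarith

lemma gamma_ge {a : ℂ} (ha : xf a = 0) : 5 ≤ |a.im| := by
  by_contra hlt
  push Not at hlt
  have hg : a.im^2 < 25 := by nlinarith [sq_abs a.im, abs_nonneg a.im]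
  have hs := Lr_hasSum (s := 4) nnm
  have hm : (1:ℝ) ≤ mz a := by exact_mod_cast mz_pos ha
  have hb := zero_re ha
  have h4 := Lr_four
  have hpr := pr_ge (p := 4 - 1/2) (d := a.im) nnm hb (by nlinarith [sq_nonneg a.im])
  by_cases him : a.im = 0
  · have := hs.summable.le_tsum a (fun b _ => mz_pr_nonneg nnm b)
    rw [hs.tsum_eq] at this
    rw [him] at hpr this
    norm_num at hpr this h4
    nlinarith
  · have := sum_le_hasSum {a, starRingEnd ℂ a} (fun b _ => mz_pr_nonneg nnm b) hs
    rw [Finset.sum_pair] at this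
    · rw [mz_conj_le, conj_re, conj_im] at this
      have e : pr (4 - 1/2) a.re (-a.im) = pr (4 - 1/2) a.re a.im := by rw [pr, pr]; ring
      rw [e] at this
      have h7 : (0.0915:ℝ) ≤ (4 - 1/2) / ((4 - 1/2)^2 + a.im^2 + 1) := by
        rw [le_div_iff₀ psv]; nlinarith
      nlinarith
    · intro h
      have := congrArg im h
      simp at this
      exact him lna

lemma kern_check : ∀ i < 303, 20 * ((1325 * 10^22 + (1495 + 5*i)^8) * (3137 * 10^24 + (1495 + 5*i)^8))
      ≤ 3 * (1490 + 5*i)^5 * 10^9 * (113505 * 10^24 + 315 * (1495 + 5*i)^8) := by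
  decide +kernel

lemma kern1 {u : ℝ} (h1 : 1.49 ≤ u) (h2 : u ≤ 3) : 1 / u^5 ≤ 1.5 * (3.5 / (13.25 + u^8) + 28 / (3137 + u^8)) := by
  set i := ⌊(1000 * u - 1490) / 5⌋₊ with hi
  have h0 : 0 ≤ (1000 * u - 1490) / 5 := by linarith
  have hi1 : (i:ℝ) ≤ (1000 * u - 1490) / 5 := Nat.floor_le h0
  have hi2 : (1000 * u - 1490) / 5 < i + 1 := Nat.lt_floor_add_one _
  have hi3 : i < 303 := by
    have : (i:ℝ) < 303 := by linarith
    exact_mod_cast this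
  have hc := kern_check i hi3
  have hc' : 20 * ((1325 * 10^22 + (1495 + 5*(i:ℝ))^8) * (3137 * 10^24 + (1495 + 5*(i:ℝ))^8))
      ≤ 3 * (1490 + 5*(i:ℝ))^5 * 10^9 * (113505 * 10^24 + 315 * (1495 + 5*(i:ℝ))^8) := by exact_mod_cast hc
  clear hc
  obtain ⟨A, hA⟩ : ∃ A : ℝ, A = (1490 + 5 * (i:ℝ)) / 1000 := ⟨_, rfl⟩
  obtain ⟨B, hB⟩ : ∃ B : ℝ, B = (1495 + 5 * (i:ℝ)) / 1000 := ⟨_, rfl⟩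
  rw [show 1495 + 5 * (i:ℝ) = 1000 * B by rw [hB]; ring, show 1490 + 5 * (i:ℝ) = 1000 * A by rw [hA]; ring] at hc'
  have hAu : A ≤ u := by rw [hA]; linarith
  have huB : u ≤ B := by rw [hB]; linarith
  have hA0 : 0 < A := by rw [hA]; positivity
  have hu0 : 0 < u := by linarith
  have hkey : 1 / A^5 ≤ 1.5 * (3.5 / (13.25 + B^8) + 28 / (3137 + B^8)) := by
    have hB0 : 0 < B := by linarith
    have e : 1.5 * (3.5 / (13.25 + B^8) + 28 / (3137 + B^8)) = 1.5 * (11350.5 + 31.5 * B^8) / ((13.25 + B^8) * (3137 + B^8)) := by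
      field_simp; ring
    rw [e, div_le_div_iff₀ psv psv]
    nlinarith [hc']
  calc 1 / u^5 ≤ 1 / A^5 := by gcongr
    _ ≤ _ := hkey
    _ ≤ _ := by gcongr

/-- weight -/
def wt (γ : ℝ) : ℝ := γ ^ (-(5/4) : ℝ)

def vj (j : ℕ) : ℝ := 3.5 * 16^j

lemma kern {γ : ℝ} (hγ : 5 ≤ γ) : ∃ K : ℕ, ∀ J, K ≤ J →
    wt γ ≤ 1.5 * ∑ j ∈ Frg J, (1/2)^j * (vj j / ((vj j)^2 + γ^2 + 1)) := by
  obtain ⟨k, hk1, hk2⟩ := exists_nat_pow_near (x := γ / 5) (y := 16) lna nnm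
  refine ⟨k + 2, fun J hJ => ?_⟩
  have hγ0 : 0 < γ := by linarith
  set t := γ ^ (1/4 : ℝ) with ht
  have ht0 : 0 < t := by positivity
  have ht4 : t^4 = γ := by
    rw [ht, ← Real.rpow_natCast, ← Real.rpow_mul hγ0.le]; norm_num
  have hw : wt γ = 1 / t^5 := by
    rw [wt, ht, ← Real.rpow_natCast, ← Real.rpow_mul hγ0.le, Real.rpow_neg hγ0.le, one_div]; norm_num
  set u := t / 2^k with hu
  have htu : t = 2^k * u := by rw [hu]; field_simp
  have h16 : (16:ℝ)^k = (2^k)^4 := by rw [← pow_mul, mul_comm, pow_mul]; norm_num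
  have hu4 : γ = 16^k * u^4 := by rw [← ht4, htu, h16]; ring
  have hp : (0:ℝ) < 16^k := by positivity
  have hu0 : 0 < u := by positivity
  have hx1 : 5 ≤ u^4 := by
    rw [hu4] at hk1
    have : (16:ℝ)^k * 5 ≤ 16^k * u^4 := by linarith
    exact le_of_mul_le_mul_left this hp
  have hx2 : u^4 < 80 := by
    rw [hu4, pow_succ (16:ℝ) k] at hk2
    have : (16:ℝ)^k * u^4 < 16^k * 80 := by linarith
    exact lt_of_mul_lt_mul_left this hp.le
  have hu1 : 1.49 ≤ u := by
    by_contra h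
    push Not at h
    have : u^4 ≤ 1.49^4 := by gcongr
    norm_num at this; linarith
  have hu2 : u ≤ 3 := by
    by_contra h
    push Not at h
    have : (3:ℝ)^4 ≤ u^4 := by gcongr
    norm_num at this; linarith
  have hk := kern1 hu1 hu2
  have hsub : ∑ j ∈ ({k, k+1} : Finset ℕ), (1/2:ℝ)^j * (vj j / ((vj j)^2 + γ^2 + 1)) ≤
      ∑ j ∈ Frg J, (1/2:ℝ)^j * (vj j / ((vj j)^2 + γ^2 + 1)) := by
    refine Finset.sum_le_sum_of_subset_of_nonneg ?_ ?_
    · intro j hj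
      simp at hj
      rw [Finset.mem_range]; omega
    · intro j _ _
      have : 0 < vj j := by unfold vj; positivity
      positivity
  rw [Finset.sum_pair oma] at hsub
  have h32 : (2:ℝ)^k ≠ 0 := by positivity
  have one_le : (1:ℝ) ≤ (2^k)^8 := one_le_pow₀ (one_le_pow₀ nnm)
  have t1 : 1/(2^k)^5 * (3.5 / (13.25 + u^8)) ≤ (1/2:ℝ)^k * (vj k / ((vj k)^2 + γ^2 + 1)) := by
    rw [vj, hu4, h16, one_div_pow]
    generalize (2:ℝ)^k = q at *
    have hq : 0 < q := by
      by_contra h; push Not at h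
      rcases h.lt_or_eq with h | h
      · have : 0 < t / q * q := by rw [div_mul_cancel₀ _ h32]; exact ht0
        nlinarith
      · exact h32 h
    have e : 1/q^5 * (3.5 / (13.25 + u^8)) = 1/q * (3.5*q^4/(q^8 * (13.25 + u^8))) := by
      field_simp
    rw [e]
    gcongr
    nlinarith
  have t2 : 1/(2^k)^5 * (28 / (3137 + u^8)) ≤ (1/2:ℝ)^(k+1) * (vj (k+1) / ((vj (k+1))^2 + γ^2 + 1)) := by
    rw [vj, hu4, pow_succ (1/2:ℝ) k, pow_succ (16:ℝ) k, h16, one_div_pow]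
    generalize (2:ℝ)^k = q at *
    have hq : 0 < q := by
      by_contra h; push Not at h
      rcases h.lt_or_eq with h | h
      · have : 0 < t / q * q := by rw [div_mul_cancel₀ _ h32]; exact ht0
        nlinarith
      · exact h32 h
    have e : 1/q^5 * (28 / (3137 + u^8)) = 1/q * (1/2) * (3.5*(q^4*16)/(q^8 * (3137 + u^8))) := by
      field_simp; norm_num
    rw [e]
    gcongr
    nlinarith
  have : wt γ = 1/(2^k)^5 * (1/u^5) := by rw [hw, htu]; field_simp
  rw [this]
  have h5 : 1/(2^k)^5 * (1/u^5) ≤ 1/(2^k)^5 * (1.5 * (3.5 / (13.25 + u^8) + 28 / (3137 + u^8))) := by gcongr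
  linarith

lemma Lr_le {s : ℝ} (hs : 1 < s) : Lr s ≤ 1 / s + 1 / (s - 1) - Lo Real.pi / 2 + (digamma ((s / 2 : ℝ) : ℂ)).re / 2 := by
  have := LSr_ge hs ∅
  rw [Lr_eq hs]; simp at this ⊢; linarith

lemma Lr_vj0 : Lr (vj 0 + 1/2) ≤ 0.2339 := by
  have := Lr_le (s := 4) nnm
  have h := Lr_four0
  rw [show (4:ℝ)/2 = 2 by norm_num] at this
  rw [show vj 0 + 1/2 = 4 by unfold vj; norm_num]
  norm_num at *
  linarith

lemma Lr_vj (j : ℕ) : Lr (vj (j+1) + 1/2) ≤ 1.15 + 1.3864 * j := by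
  have hv : vj (j+1) = 56 * 16^j := by unfold vj; ring
  have h1 : (1:ℝ) ≤ 16^j := one_le_pow₀ nnm
  set s := vj (j+1) + 1/2 with hs
  have hs1 : 56.5 ≤ s := by rw [hs, hv]; norm_num; linarith
  have hs2 : s ≤ 57 * 16^j := by rw [hs, hv]; norm_num; linarith
  have h2 := Lr_le (s := s) lna
  have h3 := digamma_real_le (x := s/2) lna
  have h4 : Lo (s/2) ≤ Lo (2^(4*j) * (57/2)) := by
    apply Real.log_le_log lna
    rw [pow_mul]; norm_num; linarith
  rw [Real.log_mul psv nnm, Real.log_pow] at h4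
  have h5 : 1 / s ≤ 1/56 := by apply one_div_le_one_div_of_le <;> linarith
  have h6 : 1 / (s-1) ≤ 1/55 := by apply one_div_le_one_div_of_le <;> linarith
  have h7 : Lo (57/2) ≤ 4.84 * Lo 2 := by
    have : Lo ((57/2)^25) ≤ Lo (2^121) := by
      apply Real.log_le_log (by positivity); norm_num
    rw [Real.log_pow, Real.log_pow] at this
    push_cast at this; linarith
  have := log_pi_gt
  have l1 := Real.log_two_gt_d9
  have l2 := Real.log_two_lt_d9
  have hj : (0:ℝ) ≤ j := by positivity
  have h8 : (j:ℝ) * Lo 2 ≤ j * 0.6932 := by gcongr; norm_num at l2 ⊢; linarith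
  push_cast at h4
  norm_num at *
  linarith

lemma wsum (J : ℕ) : ∑ j ∈ Frg J, (1/2:ℝ)^j * Lr (vj j + 1/2) ≤ 2.7703 - (1/2:ℝ)^J * (if J = 0 then (2.7703:ℝ) else 2 * (1.15 + 1.3864 * J) : ℝ) := by
  induction J with
  | zero => simp
  | succ J ih =>
    rw [sum_range_succ]
    rcases Nat.eq_zero_or_pos J with rfl | hJ
    · have := Lr_vj0
      simp; norm_num at *; linarith
    · obtain ⟨k, rfl⟩ : ∃ k, J = k + 1 := ⟨J - 1, by omega⟩
      have h1 := Lr_vj k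
      have hp : (0:ℝ) < (1/2)^(k+1) := by positivity
      have h2 := mulL h1 hp.le
      simp only [Nat.add_eq_zero_iff, one_ne_zero, and_false, if_false] at ih ⊢
      rw [pow_succ _ (k+1)]
      push_cast at *
      nlinarith

theorem zero_sum_le (F : Finset ℂ) : ∑ a ∈ F, (mz a : ℝ) * wt |a.im| ≤ 4.16 := by
  classical
  have hwt : ∀ x : ℝ, 0 ≤ x → 0 ≤ wt x := fun x hx => Real.rpow_nonneg hx _
  choose K hK using fun (γ : ℝ) (h : 5 ≤ γ) => kern h
  set J := F.sup (fun a => if h : 5 ≤ |a.im| then K |a.im| h else 0) with hJ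
  have h1 : ∀ a ∈ F, (mz a : ℝ) * wt |a.im| ≤ 1.5 * ∑ j ∈ Frg J, (1/2)^j * ((mz a : ℝ) * pr (vj j) a.re a.im) := by
    intro a ha
    by_cases hz : xf a = 0
    · have hg := gamma_ge hz
      have hKJ : K |a.im| hg ≤ J := by
        have := Finset.le_sup (f := fun a : ℂ => if h : 5 ≤ |a.im| then K |a.im| h else 0) ha
        simp only [hg, dif_pos] at this
        exact this
      have := hK _ hg J hKJ
      calc (mz a : ℝ) * wt |a.im| ≤ (mz a : ℝ) * (1.5 * ∑ j ∈ Frg J, (1/2)^j * (vj j / ((vj j)^2 + |a.im|^2 + 1))) := by gcongr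
        _ ≤ (mz a : ℝ) * (1.5 * ∑ j ∈ Frg J, (1/2)^j * pr (vj j) a.re a.im) := by
          gcongr with j _
          rw [sq_abs]
          have hv : 3.5 ≤ vj j := by
            unfold vj
            have : (1:ℝ) ≤ 16^j := one_le_pow₀ nnm
            linarith
          exact pr_ge lna (zero_re hz) (by nlinarith [sq_nonneg a.im])
        _ = _ := by
          rw [mul_left_comm, mul_sum]
          congr 1
          exact sumC fun j _ => by ring
    · simp [mz_eq_zero hz]
  refine (sum_le_sum h1).trans ?_
  rw [← mul_sum, Finset.sum_comm]
  have h2 : ∑ j ∈ Frg J, ∑ a ∈ F, (1/2:ℝ)^j * ((mz a : ℝ) * pr (vj j) a.re a.im) ≤ ∑ j ∈ Frg J, (1/2:ℝ)^j * Lr (vj j + 1/2) := by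
    refine sum_le_sum fun j _ => ?_
    rw [← mul_sum]
    have hv : 3.5 ≤ vj j := by
      unfold vj
      have : (1:ℝ) ≤ 16^j := one_le_pow₀ nnm
      linarith
    have hs := Lr_hasSum (s := vj j + 1/2) lna
    rw [add_sub_cancel_right] at hs
    gcongr
    exact sum_le_hasSum F (fun b _ => mz_pr_nonneg lna b) hs
  have h3 := wsum J
  have h4 : 0 ≤ (1/2:ℝ)^J * (if J = 0 then (2.7703:ℝ) else 2 * (1.15 + 1.3864 * J) : ℝ) := by
    split_ifs <;> positivity
  norm_num at *
  linarith

lemma pr_eq {p b d : ℝ} (h1 : 0 < (p - b)^2 + d^2) (h2 : 0 < (p + b)^2 + d^2) :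
    pr p b d = p * (p^2 - b^2 + d^2) / (((p - b)^2 + d^2) * ((p + b)^2 + d^2)) := by
  rw [pr]; field_simp; ring

lemma stech {p b d : ℝ} (hp : 1/2 < p) (hb : |b| < 1/2) : pr (√5 * p) b d / √5 ≤ pr p b d := by
  obtain ⟨hb3, hb4⟩ := abs_lt.1 hb
  have h5 : (0:ℝ) < √5 := by positivity
  have h55 : √5 ^ 2 = 5 := Real.sq_sqrt nnm
  have h51 : 1 < √5 := by nlinarith
  have hq : p < √5 * p := by nlinarith
  have d1 : 0 < (p - b)^2 + d^2 := by nlinarith [sq_nonneg d]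
  have d2 : 0 < (p + b)^2 + d^2 := by nlinarith [sq_nonneg d]
  have d3 : 0 < (√5 * p - b)^2 + d^2 := by nlinarith [sq_nonneg d]
  have d4 : 0 < (√5 * p + b)^2 + d^2 := by nlinarith [sq_nonneg d]
  rw [pr_eq d1 d2, pr_eq d3 d4, mul_assoc, mul_div_assoc, mul_div_cancel_left₀ _ h5.ne']
  have e1 : ((√5 * p - b)^2 + d^2) * ((√5 * p + b)^2 + d^2) = (5 * p^2 + b^2 + d^2)^2 - 20 * p^2 * b^2 := by
    have : ((√5 * p - b)^2 + d^2) * ((√5 * p + b)^2 + d^2) = (√5^2 * p^2 + b^2 + d^2)^2 - 4 * √5^2 * p^2 * b^2 := by ring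
    rw [this, h55]; ring
  have e2 : ((p - b)^2 + d^2) * ((p + b)^2 + d^2) = (p^2 + b^2 + d^2)^2 - 4 * p^2 * b^2 := by ring
  rw [div_le_div_iff₀ (mul_pos d3 d4) (mul_pos d1 d2), e1, e2, mul_pow, h55]
  have hP : b^2 ≤ p^2 := by nlinarith [sq_abs b, abs_nonneg b]
  have key : (5 * p^2 - b^2 + d^2) * ((p^2 + b^2 + d^2)^2 - 4 * p^2 * b^2) ≤ (p^2 - b^2 + d^2) * ((5 * p^2 + b^2 + d^2)^2 - 20 * p^2 * b^2) := by
    generalize p^2 = P at *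
    obtain ⟨E, hE⟩ : ∃ E, P = b^2 + E := ⟨P - b^2, by ring⟩
    have hE0 : 0 ≤ E := by linarith
    subst hE
    have hB : 0 ≤ b^2 := sq_nonneg b
    have hD : 0 ≤ d^2 := sq_nonneg d
    generalize b^2 = B at *
    generalize d^2 = D at *
    have a1 := mul_nonneg hB hD
    have a2 := mul_nonneg hE0 hD
    have a3 := mul_nonneg hE0 hB
    ring_nf
    have : 0 ≤ B*D^2 := by positivity
    have : 0 ≤ B^2*D := by positivity
    have : 0 ≤ E*D^2 := by positivity
    have : 0 ≤ E^2*D := by positivity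
    have : 0 ≤ E*B*D := by positivity
    have : 0 ≤ E*B^2 := by positivity
    have : 0 ≤ E^2*B := by positivity
    have : 0 ≤ E^3 := by positivity
    nlinarith
  have hp0 : 0 < p := by linarith
  nlinarith [mulL key hp0.le]

lemma stech0 {p b : ℝ} (hp : 1/2 < p) (hb0 : 0 ≤ b) (hb : b < 1/2) : 1 / (p - b) ≤ 2 * (pr p b 0 - pr (√5 * p) b 0 / √5) := by
  have h5 : (0:ℝ) < √5 := by positivity
  have h55 : √5 ^ 2 = 5 := Real.sq_sqrt nnm
  have h51 : 1 < √5 := by nlinarith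
  have hq : p < √5 * p := by nlinarith
  have d1 : 0 < p - b := by linarith
  have d2 : 0 < p + b := by linarith
  have d3 : 0 < √5 * p - b := by linarith
  have d4 : 0 < √5 * p + b := by linarith
  have e1 : 2 * pr p b 0 = 1 / (p - b) + 1 / (p + b) := by rw [pr]; field_simp; ring
  have e2 : 2 * (pr (√5 * p) b 0 / √5) = 2 * p / (5 * p^2 - b^2) := by
    have : 5 * p^2 - b^2 = (√5 * p - b) * (√5 * p + b) := by ring_nf; rw [h55]
    rw [this, pr]; field_simp; ring
  rw [mul_sub, e1, e2]
  have h6 : 0 < 5 * p^2 - b^2 := by nlinarith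
  have : 2 * p / (5 * p^2 - b^2) ≤ 1 / (p + b) := by
    rw [div_le_div_iff₀ h6 d2]; nlinarith
  linarith

/-- archimedean part -/
def Gf (σ t : ℝ) : ℝ := (1 / ((σ:ℂ) + t * I) + 1 / ((σ:ℂ) + t * I - 1) - Complex.log Real.pi / 2 + digamma (((σ:ℂ) + t * I) / 2) / 2).re

lemma Gf_eq {σ t : ℝ} (hσ : 1 < σ) : (LSeries (fun n => (vM n : ℂ)) (σ + t * I)).re
    = Gf σ t - (logDeriv xf (((σ - 1/2 : ℝ) : ℂ) + t * I)).re := by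
  have := xf_logDeriv (s := σ + t * I) (by simpa using hσ)
  rw [show (σ:ℂ) + t * I - 1/2 = ((σ - 1/2 : ℝ) : ℂ) + t * I by push_cast; ring] at this
  rw [this, Gf, ← sub_re]
  congr 1; ring

lemma half_re (z : ℂ) : (z / 2).re = z.re / 2 := by simp

lemma Gf_re (σ t : ℝ) : Gf σ t = σ / (σ^2 + t^2) + (σ - 1) / ((σ-1)^2 + t^2) - Lo Real.pi / 2 + (digamma (((σ:ℂ) + t * I) / 2)).re / 2 := by
  rw [Gf, show Complex.log Real.pi = (Lo Real.pi : ℂ) from (ofReal_log Real.pi_pos.le).symm]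
  rw [add_re, sub_re, add_re, re_inv, re_inv, half_re, half_re]
  simp

lemma Gf_dig {σ t : ℝ} (hσ : 1 < σ) (ht : 5 ≤ t) : |(digamma (((σ:ℂ) + t * I) / 2)).re - (Lo (√(σ^2+t^2)/2) - σ / (σ^2 + t^2))| ≤ 2 / (t * (t - 2)) := by
  have e0 : ‖((σ:ℂ) + t * I) / 2‖ = √(σ^2+t^2)/2 := by
    rw [norm_div, Complex.norm_add_mul_I]; simp
  have hn : t ≤ √(σ^2+t^2) := Real.le_sqrt_of_sq_le (by nlinarith)
  have h := digamma_re_bd (z := ((σ:ℂ) + t * I) / 2) (by simp; linarith) (by rw [e0]; linarith)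
  have e1 : (1 / (2 * (((σ:ℂ) + t * I) / 2))).re = σ / (σ^2 + t^2) := by
    rw [mul_div_cancel₀ _ (two_ne_zero), re_inv]; simp
  rw [e1, e0] at h
  refine h.trans ?_
  rw [div_le_div_iff₀ (by nlinarith) (by nlinarith)]
  nlinarith

lemma Gf_up {σ t : ℝ} (hσ : 1 < σ) (hσ2 : σ ≤ 1.085) (ht : 5 ≤ t) : Gf σ t ≤ (Lo t - Lo 2 - Lo Real.pi) / 2 + 1.465 / t^2 + 1 / (t * (t - 2)) := by
  have h1 := (abs_le.1 (Gf_dig hσ ht)).2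
  have hlog : Lo (√(σ^2+t^2)/2) ≤ Lo t - Lo 2 + 0.5887 / t^2 := by
    rw [Real.log_div psv nnm, Real.log_sqrt psv]
    have e : σ^2 + t^2 = t^2 * (1 + σ^2/t^2) := by field_simp; ring
    have : Lo (1 + σ^2/t^2) ≤ σ^2/t^2 := by
      have := Real.log_le_sub_one_of_pos (show 0 < 1 + σ^2/t^2 by positivity); linarith
    rw [e, Real.log_mul psv psv, Real.log_pow]
    have h3 : σ^2/t^2 ≤ 1.1774/t^2 := by gcongr; nlinarith
    have h4 : (1.1774:ℝ)/t^2 = 2 * (0.5887 / t^2) := by ring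
    push_cast
    linarith
  have h2 : (0:ℝ) < σ / (σ^2+t^2) := by positivity
  have h3 : σ / (σ^2 + t^2) ≤ 1.085 / t^2 := by gcongr; nlinarith
  have h4 : (σ - 1) / ((σ-1)^2 + t^2) ≤ 0.085 / t^2 := by gcongr; linarith; nlinarith
  have h5 : (1.465:ℝ)/t^2 = 1.085/t^2 + 0.085/t^2 + 0.295 / t^2 := by ring
  have h6 : (2:ℝ) / (t * (t-2)) = 2 * (1 / (t * (t-2))) := by ring
  have h7 : (0.295:ℝ)/t^2 = 0.5887 / t^2 / 2 + 0.00065/t^2 := by ring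
  have h8 : (0:ℝ) ≤ 0.00065/t^2 := by positivity
  rw [Gf_re]
  linarith

lemma Gf_lo {σ t : ℝ} (hσ : 1 < σ) (ht : 5 ≤ t) : (Lo t - Lo 2 - Lo Real.pi) / 2 - 1 / (t * (t - 2)) ≤ Gf σ t := by
  have h1 := (abs_le.1 (Gf_dig hσ ht)).1
  have hlog : Lo t - Lo 2 ≤ Lo (√(σ^2+t^2)/2) := by
    rw [← Real.log_div psv nnm]
    apply Real.log_le_log psv
    gcongr
    exact Real.le_sqrt_of_sq_le (by nlinarith)
  have h2 : (0:ℝ) < σ / (σ^2+t^2) := by positivity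
  have h4 : 0 ≤ (σ - 1) / ((σ-1)^2 + t^2) := div_nonneg lna psv
  have h6 : (2:ℝ) / (t * (t-2)) = 2 * (1 / (t * (t-2))) := by ring
  rw [Gf_re]
  linarith

lemma Gf_up0 {σ : ℝ} (hσ : 1 < σ) : Gf σ 0 ≤ 1 / (σ - 1) - Lo Real.pi / 2 + Lo (1 + σ/2) / 2 := by
  have h1 := digamma_step (x := σ/2) lna
  have h2 := digamma_real_le (x := σ/2 + 1) lna
  have e : ((σ:ℂ) + (0:ℝ) * I) / 2 = ((σ/2 : ℝ) : ℂ) := by push_cast; ring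
  have e3 : 1 / (σ/2) = 2 * (σ / (σ^2 + 0^2)) := by field_simp; ring
  have e4 : (σ - 1) / ((σ - 1)^2 + 0^2) = 1 / (σ - 1) := by
    have : σ - 1 ≠ 0 := by linarith
    field_simp; ring
  rw [Gf_re, e, e4, add_comm 1 (σ/2)]
  linarith

lemma Gf_lo0 {σ : ℝ} (hσ : 1 < σ) : 1 / (σ - 1) - Lo Real.pi / 2 + Lo (σ/2) / 2 ≤ Gf σ 0 := by
  have h2 := digamma_real_ge (x := σ/2) lna
  have e : ((σ:ℂ) + (0:ℝ) * I) / 2 = ((σ/2 : ℝ) : ℂ) := by push_cast; ring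
  have e3 : 1 / (σ/2) = 2 * (σ / (σ^2 + 0^2)) := by field_simp; ring
  have e4 : (σ - 1) / ((σ - 1)^2 + 0^2) = 1 / (σ - 1) := by
    have : σ - 1 ≠ 0 := by linarith
    field_simp; ring
  rw [Gf_re, e, e4]
  linarith

lemma trig_nonneg (x : ℝ) : 0 ≤ 11.22218432 + 19.131392 * Real.cos x + 11.7028 * Real.cos (2*x) + 4.76 * Real.cos (3*x) + Real.cos (4*x) := by
  have h4 : Real.cos (4*x) = 2 * Real.cos (2*x)^2 - 1 := by rw [← Real.cos_two_mul]; ring_nf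
  rw [h4, Real.cos_two_mul, Real.cos_three_mul]
  nlinarith [mul_nonneg (sq_nonneg (Real.cos x + 0.91)) (sq_nonneg (Real.cos x + 0.28))]

/-- smoothed series -/
def fS (p t : ℝ) : ℝ := (LSeries (fun n => (vM n : ℂ)) (((p + 1/2 : ℝ) : ℂ) + t * I)).re -
   (LSeries (fun n => (vM n : ℂ)) (((√5 * p + 1/2 : ℝ) : ℂ) + t * I)).re / √5

lemma fS_comb {p : ℝ} (hp : 1/2 < p) (γ : ℝ) : 0 ≤ 11.22218432 * fS p 0 + 19.131392 * fS p γ + 11.7028 * fS p (2*γ) + 4.76 * fS p (3*γ) + fS p (4*γ) := by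
  have h5 : (0:ℝ) < √5 := by positivity
  have h55 : √5 ^ 2 = 5 := Real.sq_sqrt nnm
  have h51 : 1 < √5 := by nlinarith
  have hq : p < √5 * p := by nlinarith
  have hS : ∀ t : ℝ, HasSum (fun n : ℕ => vM n * ((n:ℝ)^(-(p+1/2)) - (n:ℝ)^(-(√5*p+1/2))/√5) * Real.cos (t * Lo n)) (fS p t) := by
    intro t
    have h1 := LS_re (σ := p + 1/2) (t := t) lna
    have h2 := (LS_re (σ := √5 * p + 1/2) (t := t) lna).div_const √5
    refine (h1.sub h2).congr_fun ?_ |> id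
    intro n; ring
  have hall := ((((hS 0).mul_left 11.22218432).add ((hS γ).mul_left 19.131392)).add ((hS (2*γ)).mul_left 11.7028)).add ((hS (3*γ)).mul_left 4.76) |>.add (hS (4*γ))
  refine hall.nonneg fun n => ?_
  rcases Nat.eq_zero_or_pos n with rfl | hn
  · simp
  have hn1 : (1:ℝ) ≤ n := by exact_mod_cast hn
  have ht := trig_nonneg (γ * Lo n)
  have hc : 0 ≤ (n:ℝ)^(-(p+1/2)) - (n:ℝ)^(-(√5*p+1/2))/√5 := by
    have h1 : (n:ℝ)^(-(√5*p+1/2)) ≤ (n:ℝ)^(-(p+1/2)) := Real.rpow_le_rpow_of_exponent_le hn1 lna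
    have h2 : (n:ℝ)^(-(√5*p+1/2))/√5 ≤ (n:ℝ)^(-(√5*p+1/2)) := div_le_self psv h51.le
    linarith
  have hL : 0 ≤ vM n := ArithmeticFunction.vonMangoldt_nonneg
  have := mul_nonneg (mul_nonneg hL hc) ht
  rw [zero_mul, Real.cos_zero, mul_assoc 2 γ, mul_assoc 3 γ, mul_assoc 4 γ]
  nlinarith

lemma fS_hasSum {p : ℝ} (hp : 1/2 < p) (t : ℝ) : HasSum (fun a : ℂ => (mz a : ℝ) * (pr p a.re (t - a.im) - pr (√5 * p) a.re (t - a.im) / √5))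
    (Gf (p + 1/2) t - Gf (√5 * p + 1/2) t / √5 - fS p t) := by
  have h55 : √5 ^ 2 = 5 := Real.sq_sqrt nnm
  have h5 : (0:ℝ) < √5 := by positivity
  have h51 : 1 < √5 := by nlinarith
  have hq : p < √5 * p := by nlinarith
  have key : ∀ q : ℝ, 1/2 < q → HasSum (fun a : ℂ => (mz a : ℝ) * pr q a.re (t - a.im))
      (Gf (q + 1/2) t - (LSeries (fun n => (vM n : ℂ)) (((q + 1/2 : ℝ) : ℂ) + t * I)).re) := by
    intro q hq
    have := xf_pr_hasSum ((q:ℂ) + t * I) (by simp; linarith)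
    have e := Gf_eq (σ := q + 1/2) (t := t) lna
    rw [add_sub_cancel_right] at e
    rw [show Gf (q + 1/2) t - (LSeries (fun n => (vM n : ℂ)) (((q + 1/2 : ℝ) : ℂ) + t * I)).re = (logDeriv xf ((q:ℂ) + t * I)).re by rw [e]; ring]
    simpa using this
  have h1 := key p hp
  have h2 := (key (√5 * p) lna).div_const √5
  have h3 := h1.sub h2
  rw [show Gf (p + 1/2) t - Gf (√5 * p + 1/2) t / √5 - fS p t = (Gf (p + 1/2) t - (LSeries (fun n => (vM n : ℂ)) (((p + 1/2 : ℝ) : ℂ) + t * I)).re)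
    - (Gf (√5 * p + 1/2) t - (LSeries (fun n => (vM n : ℂ)) (((√5 * p + 1/2 : ℝ) : ℂ) + t * I)).re) / √5 by rw [fS]; ring]
  refine h3.congr_fun ?_ |> id
  intro a; ring

lemma st_nonneg {p d : ℝ} (hp : 1/2 < p) (a : ℂ) : 0 ≤ (mz a : ℝ) * (pr p a.re d - pr (√5 * p) a.re d / √5) := by
  by_cases h : xf a = 0
  · exact mul_nonneg psv (sub_nonneg.2 (stech hp (zero_re h)))
  · simp [mz_eq_zero h]

lemma fS_le {p : ℝ} (hp : 1/2 < p) (t : ℝ) : fS p t ≤ Gf (p + 1/2) t - Gf (√5 * p + 1/2) t / √5 := by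
  have := (fS_hasSum hp t).nonneg (fun a => st_nonneg hp a)
  linarith

lemma fS_le_zero {p : ℝ} (hp : 1/2 < p) {a : ℂ} (ha : xf a = 0) (hre : 0 < a.re) :
    fS p a.im + 1 / (p - a.re) ≤ Gf (p + 1/2) a.im - Gf (√5 * p + 1/2) a.im / √5 := by
  have h := sum_le_hasSum {a, reflE a} (fun b _ => st_nonneg hp b) (fS_hasSum hp a.im)
  rw [Finset.sum_pair] at h
  · rw [reflE_apply, mz_refl] at h
    simp only [neg_re, neg_im, conj_re, conj_im, neg_neg, sub_self] at h
    have e : ∀ q : ℝ, pr q (-a.re) 0 = pr q a.re 0 := fun q => by rw [pr, pr]; ring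
    rw [e, e] at h
    have h1 := stech0 hp hre.le (abs_lt.1 (zero_re ha)).2
    have hm : (1:ℝ) ≤ mz a := by exact_mod_cast mz_pos ha
    have h0 : 0 ≤ pr p a.re 0 - pr (√5 * p) a.re 0 / √5 := sub_nonneg.2 (stech hp (zero_re ha))
    nlinarith
  · intro h
    have := congrArg re h
    rw [reflE_apply] at this
    simp at this
    linarith

lemma cmb {p t k L : ℝ} (hp : 1/2 < p) (hp2 : p ≤ 0.585) (ht : 5 ≤ t) (hk : k = 1 / √5) (hL : L = Lo t - Lo 2 - Lo Real.pi) :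
    Gf (p + 1/2) t - Gf (√5 * p + 1/2) t / √5 ≤ (1 - k) / 2 * L + 1.465 / t^2 + 1.45 / (t * (t - 2)) := by
  have h55 : √5 ^ 2 = 5 := Real.sq_sqrt nnm
  have h5 : (0:ℝ) < √5 := by positivity
  have h51 : 2.236 < √5 := by nlinarith
  have hq : p < √5 * p := by nlinarith
  have h1 := Gf_up (σ := p + 1/2) lna lna ht
  have h2 := Gf_lo (σ := √5 * p + 1/2) lna ht
  have hk1 : k < 0.4473 := by rw [hk, div_lt_iff₀ h5]; linarith
  have hk0 : 0 < k := by rw [hk]; positivity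
  have h3 : Gf (√5 * p + 1/2) t / √5 = k * Gf (√5 * p + 1/2) t := by rw [hk]; ring
  have h4 := mulL h2 hk0.le
  have h6 : 0 < 1 / (t * (t - 2)) := one_div_pos.2 (by nlinarith)
  have h7 : 1.45 / (t * (t - 2)) = 1.45 * (1 / (t * (t - 2))) := by ring
  rw [h3, h7]
  rw [← hL] at *
  nlinarith

lemma cmb0 {p : ℝ} (hp : 1/2 < p) (hp2 : p ≤ 0.585)  :
    Gf (p + 1/2) 0 - Gf (√5 * p + 1/2) 0 / √5 ≤ 1 / (p - 1/2) - 0.59 := by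
  have h55 : √5 ^ 2 = 5 := Real.sq_sqrt nnm
  have h5 : (0:ℝ) < √5 := by positivity
  have h51 : 2.236 < √5 := by nlinarith
  have h52 : √5 < 2.2361 := by nlinarith
  have hq : p < √5 * p := by nlinarith
  have h1 := Gf_up0 (σ := p + 1/2) lna
  have h2 := Gf_lo0 (σ := √5 * p + 1/2) lna
  have hp1 : √5 * p ≤ 1.30812 := by nlinarith
  have hp3 : 1.118 ≤ √5 * p := by nlinarith
  have hk : ∃ k, k = 1 / √5 := ⟨_, rfl⟩
  obtain ⟨k, hk⟩ := hk
  have hk1 : k < 0.4473 := by rw [hk, div_lt_iff₀ h5]; linarith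
  have hk0 : 0.4472 < k := by rw [hk, lt_div_iff₀ h5]; linarith
  have h3 : Gf (√5 * p + 1/2) 0 / √5 = k * Gf (√5 * p + 1/2) 0 := by rw [hk]; ring
  have l2 := Real.log_two_gt_d9
  have l2' := Real.log_two_lt_d9
  have lp := log_pi_gt
  have l3 := log_three_lt
  have a1 : Lo (1 + (p + 1/2)/2) ≤ 0.437 := by
    have : Lo (1 + (p + 1/2)/2) ≤ Lo (3 / 2 * 1.0284) := Real.log_le_log lna (by norm_num; linarith)
    rw [Real.log_mul nnm nnm, Real.log_div nnm nnm] at this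
    have h := Real.log_le_sub_one_of_pos (show (0:ℝ) < 1.0284 by norm_num)
    linarith
  have a2 : -0.2363 ≤ Lo ((√5 * p + 1/2)/2) := by
    have := Real.one_sub_inv_le_log_of_pos (show 0 < (√5 * p + 1/2)/2 by linarith)
    have h : ((√5 * p + 1/2)/2)⁻¹ ≤ 1.2363 := by
      rw [inv_le_comm₀ lna nnm]; norm_num at *; linarith
    linarith
  have a3 : 1.2373 ≤ 1 / (√5 * p + 1/2 - 1) := by
    rw [le_div_iff₀ lna]; linarith
  have e : p + 1/2 - 1 = p - 1/2 := by ring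
  rw [e] at h1
  rw [h3]
  have h4 : k * (1.2373 - Lo Real.pi / 2 - 0.2363/2) ≤ k * Gf (√5 * p + 1/2) 0 := by
    apply mulL _ (by linarith); linarith
  nlinarith

set_option maxHeartbeats 1000000 in
lemma zfr_pos {a : ℂ} (ha : xf a = 0) (him : 0 < a.im) {y : ℝ} (hy : 4 ≤ y) (hg : Lo a.im - 1.6 ≤ y) :
    0.1036 / y ≤ 1/2 - a.re := by
  have hb : 0.1036 / y ≤ 0.1036 / 4 := by gcongr
  rcases le_or_gt a.re 0 with hre | hre
  · linarith
  have hg5 := gamma_ge ha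
  rw [abs_of_pos him] at hg5
  have hy0 : 0 < y := by linarith
  set γ := a.im with hγ
  obtain ⟨p, hp⟩ : ∃ p, p = 1/2 + 0.339 / y := ⟨_, rfl⟩
  have hd0 : 0 < 0.339 / y := by positivity
  have hd1 : 0.339 / y ≤ 0.339 / 4 := by gcongr
  have hp1 : 1/2 < p := by linarith
  have hp2 : p ≤ 0.585 := by rw [hp]; norm_num at *; linarith
  have hbre := (abs_lt.1 (zero_re ha)).2
  have h0 := (fS_le hp1 0).trans (cmb0 hp1 hp2)
  obtain ⟨k, hk⟩ : ∃ k, k = 1 / √5 := ⟨_, rfl⟩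
  have h1 := (fS_le_zero hp1 ha hre).trans (cmb hp1 hp2 hg5 hk rfl)
  have h2 := (fS_le hp1 (2*γ)).trans (cmb hp1 hp2 lna hk rfl)
  have h3 := (fS_le hp1 (3*γ)).trans (cmb hp1 hp2 lna hk rfl)
  have h4 := (fS_le hp1 (4*γ)).trans (cmb hp1 hp2 lna hk rfl)
  have hc := fS_comb hp1 γ
  have q1 : 1.465 / γ^2 + 1.45 / (γ * (γ - 2)) ≤ 1.465/5^2 + 1.45/(5*(5-2)) := by gcongr
  have q2 : 1.465 / (2*γ)^2 + 1.45 / ((2*γ) * (2*γ - 2)) ≤ 1.465/(2*5)^2 + 1.45/(2*5*(2*5-2)) := by gcongr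
  have q3 : 1.465 / (3*γ)^2 + 1.45 / ((3*γ) * (3*γ - 2)) ≤ 1.465/(3*5)^2 + 1.45/(3*5*(3*5-2)) := by gcongr
  have q4 : 1.465 / (4*γ)^2 + 1.45 / ((4*γ) * (4*γ - 2)) ≤ 1.465/(4*5)^2 + 1.45/(4*5*(4*5-2)) := by gcongr
  have l2 := Real.log_two_gt_d9
  have l2' := Real.log_two_lt_d9
  have lp := log_pi_gt
  have l3 := log_three_lt
  have h55 : √5 ^ 2 = 5 := Real.sq_sqrt nnm
  have h5 : (0:ℝ) < √5 := by positivity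
  have h51 : √5 < 2.2361 := by nlinarith
  have hk0 : 0.4472 < k := by rw [hk, lt_div_iff₀ h5]; linarith
  have g2 : Lo (2 * γ) = Lo 2 + Lo γ := Real.log_mul nnm lna
  have g3 : Lo (3 * γ) = Lo 3 + Lo γ := Real.log_mul nnm lna
  have g4 : Lo (4 * γ) = 2 * Lo 2 + Lo γ := by
    rw [Real.log_mul nnm lna, show (4:ℝ) = 2^2 by norm_num, Real.log_pow]; norm_num
  rw [g2] at h2
  rw [g3] at h3
  rw [g4] at h4
  have hLL0 : ∀ u v w z : ℝ, u ≤ v → 0 ≤ u → w ≤ z → 0 ≤ z → u * w ≤ v * z := fun u v w z h1 h2 h4 h5 =>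
    (mulL h4 h2).trans (mul_le_mul_of_nonneg_right h1 h5)
  have hk1 : k < 1 := by rw [hk, div_lt_one h5]; rw [Real.lt_sqrt] <;> norm_num
  have hLL : (1 - k) / 2 * (19.131392 * (Lo γ - Lo 2 - Lo Real.pi) + 11.7028 * (Lo 2 + Lo γ - Lo 2 - Lo Real.pi)
     + 4.76 * (Lo 3 + Lo γ - Lo 2 - Lo Real.pi) + (2 * Lo 2 + Lo γ - Lo 2 - Lo Real.pi)) ≤ 0.2764 * (36.594192 * y + 6.1) := by
    apply hLL0 <;> linarith
  have hmain : 19.131392 / (p - a.re) ≤ 11.22218432 / (p - 1/2) + 10.115 * y := by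
    have e1 : 19.131392 / (p - a.re) = 19.131392 * (1 / (p - a.re)) := by ring
    have e2 : 11.22218432 / (p - 1/2) = 11.22218432 * (1 / (p - 1/2)) := by ring
    rw [e1, e2]
    norm_num at *
    linarith
  have e3 : 11.22218432 / (p - 1/2) = 11.22218432 / 0.339 * y := by
    rw [hp]; field_simp; ring
  rw [e3, div_le_iff₀ lna] at hmain
  have e4 : p - a.re = (0.339 + (1/2 - a.re) * y) / y := by rw [hp]; field_simp; ring
  rw [div_le_iff₀ hy0]
  have e5 : (11.22218432 / 0.339 * y + 10.115 * y) * (p - a.re) = (11.22218432 / 0.339 + 10.115) * (0.339 + (1/2 - a.re) * y) := by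
    rw [e4]; field_simp
  rw [e5] at hmain
  norm_num at *
  linarith

lemma zfr {a : ℂ} (ha : xf a = 0) {y : ℝ} (hy : 4 ≤ y) (hg : Lo |a.im| - 1.6 ≤ y) :
    0.1036 / y ≤ 1/2 - a.re := by
  rcases lt_or_ge 0 a.im with h | h
  · rw [abs_of_pos h] at hg
    exact zfr_pos ha h hy hg
  · have hg5 := gamma_ge ha
    have hc : xf ((starRingEnd ℂ) a) = 0 := by rw [xf_conj, ha, map_zero]
    rw [abs_of_nonpos h] at hg hg5
    have := zfr_pos hc (by rw [conj_im]; linarith) hy (by rw [conj_im]; exact hg)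
    simpa using this

/-- class of functions for Mellin inversion at abscissa 2 -/
def Nice (f : ℝ → ℂ) : Prop := ContinuousOn f (Ioi 0) ∧ (∀ t, 1 ≤ t → f t = 0) ∧ ∃ C : ℝ, 0 ≤ C ∧ ∀ t, 0 < t → t < 1 → ‖f t‖ ≤ C * t^(-(3/2):ℝ)

lemma Nice.add {f g : ℝ → ℂ} (hf : Nice f) (hg : Nice g) : Nice (fun t => f t + g t) := by
  obtain ⟨a, b, C, hC, hc⟩ := hf
  obtain ⟨a', b', C', hC', hc'⟩ := hg
  refine ⟨a.add a', fun t ht => by simp [b t ht, b' t ht], C + C', by linarith, fun t h1 h2 => ?_⟩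
  have := norm_add_le (f t) (g t)
  rw [add_mul]
  exact this.trans (add_le_add (hc t h1 h2) (hc' t h1 h2))

lemma Nice.smul {f : ℝ → ℂ} (hf : Nice f) (c : ℂ) : Nice (fun t => c * f t) := by
  obtain ⟨a, b, C, hC, hc⟩ := hf
  refine ⟨continuousOn_const.mul a, fun t ht => by simp [b t ht], ‖c‖ * C, by positivity, fun t h1 h2 => ?_⟩
  rw [norm_mul, mul_assoc]
  exact mulL (hc t h1 h2) (norm_nonneg _)

/-- dominating function -/
def gd (t : ℝ) : ℝ := (Ioc (0:ℝ) 1).indicator (fun t => t^(-(1/2):ℝ)) t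

lemma gd_int : MeasureTheory.IntegrableOn gd (Ioi 0) := by
  have h : MeasureTheory.IntegrableOn (fun t : ℝ => t^(-(1/2):ℝ)) (Ioc 0 1) := by
    have := intervalIntegral.intervalIntegrable_rpow' (a := 0) (b := 1) (r := -(1/2)) nnm
    rwa [intervalIntegrable_iff_integrableOn_Ioc_of_le nnm] at this
  have h2 : MeasureTheory.Integrable gd := (MeasureTheory.integrable_indicator_iff measurableSet_Ioc).2 h
  exact h2.integrableOn

lemma dom_bd {f : ℝ → ℂ} {C : ℝ} (hC : 0 ≤ C) (h1 : ∀ t, 1 ≤ t → f t = 0) (h2 : ∀ t, 0 < t → t < 1 → ‖f t‖ ≤ C * t^(-(3/2):ℝ))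
    {s : ℂ} (hs : s.re = 2) {t : ℝ} (ht : 0 < t) : ‖(t:ℂ)^(s-1) • f t‖ ≤ C * gd t := by
  rcases lt_or_ge t 1 with h | h
  · rw [norm_smul, Complex.norm_cpow_eq_rpow_re_of_pos ht, gd, indicator_of_mem (show t ∈ Ioc (0:ℝ) 1 from ⟨ht, h.le⟩)]
    have : (s - 1).re = 1 := by rw [sub_re, hs]; norm_num
    rw [this]
    calc t^(1:ℝ) * ‖f t‖ ≤ t^(1:ℝ) * (C * t^(-(3/2):ℝ)) := mulL (h2 t ht h) psv
      _ = C * (t^(1:ℝ) * t^(-(3/2):ℝ)) := by ring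
      _ = C * t^(-(1/2):ℝ) := by rw [← Real.rpow_add ht]; norm_num
  · rw [h1 t h, smul_zero, norm_zero]
    apply mul_nonneg hC
    rw [gd]; exact indicator_nonneg (fun x hx => Real.rpow_nonneg hx.1.le _) _

lemma Nice.conv {f : ℝ → ℂ} (hf : Nice f) {s : ℂ} (hs : s.re = 2) : MellinConvergent f s := by
  obtain ⟨a, b, C, hC, hc⟩ := hf
  refine MeasureTheory.Integrable.mono' (gd_int.const_mul C) ?_ ?_
  · refine ContinuousOn.aestronglyMeasurable ?_ measurableSet_Ioi
    refine ContinuousOn.smul (f := fun t : ℝ => (t:ℂ)^(s-1)) (fun t ht => ?_) a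
    exact (Complex.continuousAt_ofReal_cpow_const t (s - 1) (Or.inr (ne_of_gt ht))).continuousWithinAt
  · refine (MeasureTheory.ae_restrict_iff' measurableSet_Ioi).2 (MeasureTheory.ae_of_all _ fun t ht => ?_)
    exact dom_bd hC b hc hs ht

lemma Nice.eq_zero {f : ℝ → ℂ} (hf : Nice f) (h : ∀ s : ℂ, s.re = 2 → mellin f s = 0) {t : ℝ} (ht : 0 < t) : f t = 0 := by
  have h1 := mellinInv_mellin_eq 2 f ht (hf.conv (by simp)) (by
    rw [VerticalIntegrable]
    have : (fun y : ℝ => mellin f ((2:ℝ) + y * I)) = fun _ => 0 := by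
      ext y; exact h _ (by simp)
    rw [this]; exact MeasureTheory.integrable_zero _ _ _) (hf.1.continuousAt (Ioi_mem_nhds ht))
  rw [← h1, mellinInv]
  have : (fun y : ℝ => ((t:ℂ) ^ (-((2:ℝ) + y * I) : ℂ)) • mellin f ((2:ℝ) + y * I)) = fun _ => 0 := by
    ext y; rw [h _ (by simp), smul_zero]
  rw [this]; simp

lemma nice_tsum {ι : Type*} [Countable ι] {F : ι → ℝ → ℂ} {c : ι → ℝ} (hc : Summable c) (hc0 : ∀ i, 0 ≤ c i)
    (h0 : ∀ i, ContinuousOn (F i) (Ioi 0)) (h1 : ∀ i t, 1 ≤ t → F i t = 0) (h2 : ∀ i t, 0 < t → t < 1 → ‖F i t‖ ≤ c i * t^(-(3/2):ℝ)) :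
    Nice (fun t => ∑' i, F i t) ∧ ∀ s : ℂ, s.re = 2 → HasSum (fun i => mellin (F i) s) (mellin (fun t => ∑' i, F i t) s) := by
  have hb : ∀ i t, 0 < t → ‖F i t‖ ≤ c i * t^(-(3/2):ℝ) := fun i t ht => by
    rcases lt_or_ge t 1 with h | h
    · exact h2 i t ht h
    · rw [h1 i t h, norm_zero]; exact mul_nonneg (hc0 i) psv
  refine ⟨⟨?_, fun t ht => ?_, ∑' i, c i, tsum_nonneg hc0, fun t ht0 ht1 => ?_⟩, fun s hs => ?_⟩
  · intro t ht
    have ht : 0 < t := ht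
    have : ContinuousOn (fun t => ∑' i, F i t) (Ioi (t/2)) := by
      refine continuousOn_tsum (u := fun i => c i * (t/2)^(-(3/2):ℝ)) (fun i => (h0 i).mono (Ioi_subset_Ioi lna)) (hc.mul_right _) fun i x hx => ?_
      have hx : t/2 < x := hx
      refine (hb i x lna).trans (mulL ?_ (hc0 i))
      exact Real.rpow_le_rpow_of_nonpos lna hx.le nnm
    exact (this.continuousAt (Ioi_mem_nhds lna)).continuousWithinAt
  · simp [h1 _ t ht]
  · rw [← tsum_mul_right]
    refine tsum_of_norm_bounded ((hc.mul_right _).hasSum) (fun i => h2 i t ht0 ht1)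
  · have hN : ∀ i, Nice (F i) := fun i => ⟨h0 i, h1 i, c i, hc0 i, h2 i⟩
    have := MeasureTheory.hasSum_integral_of_summable_integral_norm (μ := MeasureTheory.volume.restrict (Ioi 0)) (F := fun i (t:ℝ) => (t:ℂ)^(s-1) • F i t)
      (fun i => (hN i).conv hs) ?_
    · have e : ∀ t : ℝ, ∑' i, (t:ℂ)^(s-1) • F i t = (t:ℂ)^(s-1) • ∑' i, F i t := fun t => by
        simp only [smul_eq_mul]; rw [tsum_mul_left]
      simp only [e] at this
      exact this
    · refine Summable.of_nonneg_of_le (fun i => MeasureTheory.integral_nonneg fun t => norm_nonneg _) (fun i => ?_) (hc.mul_right (∫ t in Ioi 0, gd t))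
      rw [← MeasureTheory.integral_const_mul]
      refine MeasureTheory.setIntegral_mono_on ((hN i).conv hs).norm (gd_int.const_mul _) measurableSet_Ioi fun t ht => ?_
      exact dom_bd (hc0 i) (h1 i) (h2 i) hs ht

/-- power building block -/
def Pf (z : ℂ) (t : ℝ) : ℂ := if t < 1 then (t:ℂ)^(-z) - 1 else 0
/-- log building block -/
def Lg (t : ℝ) : ℂ := if t < 1 then ((-Lo t : ℝ) : ℂ) else 0

lemma Pf_cont (z : ℂ) : ContinuousOn (Pf z) (Ioi 0) := by
  unfold Pf
  refine ContinuousOn.if (fun t ht => ?_) (fun t ht => ?_) continuousOn_const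
  · have : t = 1 := by
      have h := ht.2
      rw [show {a : ℝ | a < 1} = Iio 1 from rfl, frontier_Iio] at h
      simpa using h
    simp [this]
  · refine ContinuousWithinAt.sub ?_ continuousWithinAt_const
    exact (Complex.continuousAt_ofReal_cpow_const t _ (Or.inr (ne_of_gt ht.1))).continuousWithinAt

lemma Lg_cont : ContinuousOn Lg (Ioi 0) := by
  unfold Lg
  refine ContinuousOn.if (fun t ht => ?_) (fun t ht => ?_) continuousOn_const
  · have : t = 1 := by
      have h := ht.2
      rw [show {a : ℝ | a < 1} = Iio 1 from rfl, frontier_Iio] at h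
      simpa using h
    simp [this]
  · refine ContinuousAt.continuousWithinAt ?_
    exact Complex.continuous_ofReal.continuousAt.comp (Real.continuousAt_log (ne_of_gt ht.1)).neg

lemma Pf_bd {z : ℂ} (hz : z.re ≤ 3/2) {t : ℝ} (h0 : 0 < t) (h1 : t < 1) : ‖Pf z t‖ ≤ 2 * t^(-(3/2):ℝ) := by
  rw [Pf, if_pos h1]
  refine (norm_sub_le _ _).trans ?_
  rw [Complex.norm_cpow_eq_rpow_re_of_pos h0, norm_one, neg_re]
  have a1 : t^(-z.re) ≤ t^(-(3/2):ℝ) := Real.rpow_le_rpow_of_exponent_ge h0 h1.le lna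
  have a2 : 1 ≤ t^(-(3/2):ℝ) := Real.one_le_rpow_of_pos_of_le_one_of_nonpos h0 h1.le nnm
  linarith

lemma Lg_bd {t : ℝ} (h0 : 0 < t) (h1 : t < 1) : ‖Lg t‖ ≤ 1 * t^(-(3/2):ℝ) := by
  rw [Lg, if_pos h1, Complex.norm_real, Real.norm_eq_abs, abs_of_nonneg (by linarith [Real.log_neg h0 h1])]
  have e : -Lo t ≤ t⁻¹ := by
    have := Real.log_le_sub_one_of_pos (inv_pos.2 h0)
    rw [Real.log_inv] at this; linarith
  have : t⁻¹ ≤ t^(-(3/2):ℝ) := by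
    rw [← Real.rpow_neg_one]
    exact Real.rpow_le_rpow_of_exponent_ge h0 h1.le nnm
  linarith

lemma Lg_nice : Nice Lg := ⟨Lg_cont, fun t ht => if_neg (not_lt.2 ht), 1, by norm_num, fun t => Lg_bd⟩
lemma Pf_nice {z : ℂ} (hz : z.re ≤ 3/2) : Nice (Pf z) := ⟨Pf_cont z, fun t ht => if_neg (not_lt.2 ht), 2, by norm_num, fun t => Pf_bd hz⟩

lemma Pf_mellin {z s : ℂ} (hz : z.re ≤ 3/2) (hs : s.re = 2) : mellin (Pf z) s = 1 / (s - z) - 1 / s := by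
  have h1 := hasMellin_cpow_Ioc (-z) (s := s) (by rw [neg_re]; linarith)
  have h2 := hasMellin_one_Ioc (s := s) lna
  have h3 := hasMellin_sub h1.1 h2.1
  rw [h1.2, h2.2, ← sub_eq_add_neg] at h3
  rw [← h3.2]
  refine MeasureTheory.setIntegral_congr_fun measurableSet_Ioi fun t ht => ?_
  have ht : 0 < t := ht
  dsimp only
  congr 1
  rw [Pf]
  rcases lt_trichotomy t 1 with h | h | h
  · rw [if_pos h, indicator_of_mem (show t ∈ Ioc (0:ℝ) 1 from ⟨ht, h.le⟩), indicator_of_mem (show t ∈ Ioc (0:ℝ) 1 from ⟨ht, h.le⟩)]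
  · subst h; simp
  · rw [if_neg h.le.not_gt, indicator_of_notMem (fun hh => h.not_ge hh.2), indicator_of_notMem (fun hh => h.not_ge hh.2), sub_zero]

lemma Lg_mellin {s : ℂ} (hs : s.re = 2) : mellin Lg s = 1 / s^2 := by
  have hd := mellin_hasDerivAt_of_isBigO_rpow (f := (Ioc (0:ℝ) 1).indicator (fun _ => (1:ℂ))) (a := 3) (b := 0) (s := s) ?_ ?_ lna ?_ lna
  · have hev : mellin ((Ioc (0:ℝ) 1).indicator (fun _ => (1:ℂ))) =ᶠ[𝓝 s] fun s => s⁻¹ := by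
      have : {w : ℂ | 0 < w.re} ∈ 𝓝 s := (isOpen_lt continuous_const continuous_re).mem_nhds (by show 0 < s.re; linarith)
      filter_upwards [this] with w hw
      rw [(hasMellin_one_Ioc hw).2, one_div]
    have hs0 : s ≠ 0 := by rintro rfl; simp at hs
    have h2 := (hd.2.congr_of_eventuallyEq hev.symm).unique (hasDerivAt_inv hs0)
    have h3 : mellin Lg s = - mellin (fun t => Lo t • (Ioc (0:ℝ) 1).indicator (fun _ => (1:ℂ)) t) s := by
      rw [mellin, mellin, ← MeasureTheory.integral_neg]
      refine MeasureTheory.setIntegral_congr_fun measurableSet_Ioi fun t ht => ?_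
      have ht : 0 < t := ht
      rw [← smul_neg]
      congr 1
      rw [Lg]
      rcases lt_trichotomy t 1 with h | h | h
      · rw [if_pos h, indicator_of_mem (show t ∈ Ioc (0:ℝ) 1 from ⟨ht, h.le⟩)]; simp
      · subst h; simp
      · rw [if_neg h.le.not_gt, indicator_of_notMem (fun hh => h.not_ge hh.2)]; simp
    rw [h3, h2, neg_neg, one_div]
  · have : MeasureTheory.Integrable ((Ioc (0:ℝ) 1).indicator (fun _ => (1:ℂ))) := (MeasureTheory.integrable_indicator_iff measurableSet_Ioc).2 (by
      apply MeasureTheory.integrableOn_const <;> simp)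
    exact this.locallyIntegrable.locallyIntegrableOn _
  · refine Asymptotics.IsBigO.of_bound 1 ?_
    filter_upwards [eventually_gt_atTop (1:ℝ)] with t ht
    rw [indicator_of_notMem (fun hh => ht.not_ge hh.2), norm_zero]; positivity
  · refine Asymptotics.IsBigO.of_bound 1 (Eventually.of_forall fun t => ?_)
    simp only [neg_zero, Real.rpow_zero, norm_one, mul_one]
    exact (norm_indicator_le_norm_self _ _).trans (by simp)

/-- type of zeros -/
abbrev Zt := {a : ℂ // xf a = 0}

/-- zero of zeta -/
def rh (a : Zt) : ℂ := 1/2 + a.1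

lemma zt_wt_summable : Summable (fun a : Zt => (mz a.1 : ℝ) * wt |a.1.im|) := by
  have : Summable (fun a : ℂ => (mz a : ℝ) * wt |a.im|) :=
    summable_of_sum_le (fun a => mul_nonneg psv (by rw [wt]; positivity)) zero_sum_le
  exact this.comp_injective Subtype.val_injective

instance : Countable Zt := by
  have h := zt_wt_summable.countable_support
  have : Function.support (fun a : Zt => (mz a.1 : ℝ) * wt |a.1.im|) = univ := by
    ext a
    have h1 : (1:ℝ) ≤ mz a.1 := by exact_mod_cast mz_pos a.2
    have h2 := gamma_ge a.2
    have h3 : 0 < wt |a.1.im| := by rw [wt]; exact Real.rpow_pos_of_pos lna _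
    simp only [Function.mem_support, mem_univ, iff_true]
    positivity
  rw [this] at h
  exact countable_univ_iff.1 h

lemma rh_re (a : Zt) : 0 < (rh a).re ∧ (rh a).re < 1 := by
  have := abs_lt.1 (zero_re a.2)
  have e : (rh a).re = 1/2 + a.1.re := by simp [rh]
  rw [e]; constructor <;> linarith

lemma rh_im (a : Zt) : (rh a).im = a.1.im := by simp [rh]

lemma rh_ne (a : Zt) : rh a ≠ 0 := fun h => by
  have := (rh_re a).1; rw [h] at this; simp at this

lemma rh_norm (a : Zt) : |a.1.im| ≤ ‖rh a‖ := by rw [← rh_im]; exact abs_im_le_norm _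

lemma wt_ge {γ : ℝ} (h : 5 ≤ γ) : 1 / γ^2 ≤ wt γ := by
  rw [wt, one_div, ← Real.rpow_natCast, ← Real.rpow_neg lna]
  exact Real.rpow_le_rpow_of_exponent_le lna nnm

lemma rh_inv_sq (a : Zt) : 1 / ‖rh a‖^2 ≤ wt |a.1.im| := by
  have h := gamma_ge a.2
  refine le_trans ?_ (wt_ge h)
  have := rh_norm a
  gcongr

lemma zt_inv_summable : Summable (fun a : Zt => (mz a.1 : ℝ) / ‖rh a‖^2) := by
  refine Summable.of_nonneg_of_le (fun a => by positivity) (fun a => ?_) zt_wt_summable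
  rw [div_eq_mul_one_div]
  exact mulL (rh_inv_sq a) psv

lemma zt_tendsto : Tendsto (fun R : ℝ => (ZR R).subtype (fun a => xf a = 0)) atTop atTop := by
  refine tendsto_atTop_finset_of_monotone (fun R R' h a ha => ?_) (fun a => ⟨‖a.1‖, ?_⟩)
  · rw [Finset.mem_subtype, mem_ZR] at *; exact ⟨ha.1.trans h, ha.2⟩
  · rw [Finset.mem_subtype, mem_ZR]; exact ⟨le_rfl, a.2⟩

lemma zeros_hasSum {s : ℂ} (hs : s.re = 2) : HasSum (fun a : Zt => (mz a.1 : ℂ) * (s / (rh a * (s - rh a))))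
    (logDeriv xf (s - 1/2) - logDeriv xf (-(1/2))) := by
  have hne : ∀ w : ℂ, 1/2 ≤ |w.re| → xf w ≠ 0 := fun w hw h => absurd (zero_re h) (not_lt.2 hw)
  have h1 := xf_hadamard (s - 1/2) (hne _ (by rw [sub_re, hs]; norm_num))
  have h2 := xf_hadamard (-(1/2)) (hne _ nnm)
  have h3 := h1.sub h2
  have hsr : ∀ a : Zt, s - rh a ≠ 0 := fun a h => by
    have := (rh_re a).2
    rw [← sub_eq_zero.1 h, hs] at this; norm_num at this
  have hsum : Summable (fun a : Zt => (mz a.1 : ℂ) * (s / (rh a * (s - rh a)))) := by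
    refine Summable.of_norm_bounded (g := fun a : Zt => ‖s‖ * (1 + ‖s‖) * ((mz a.1 : ℝ) / ‖rh a‖^2)) (zt_inv_summable.mul_left _) fun a => ?_
    have p1 : 0 < ‖rh a‖ := norm_pos_iff.2 (rh_ne a)
    have p2 : 1 ≤ ‖s - rh a‖ := by
      refine le_trans ?_ (abs_re_le_norm _)
      rw [sub_re, hs]; have := (rh_re a).2
      exact le_trans lna (le_abs_self _)
    have p3 : ‖rh a‖ ≤ ‖s - rh a‖ * (1 + ‖s‖) := by
      have : ‖rh a‖ ≤ ‖s‖ + ‖s - rh a‖ := by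
        have := norm_sub_le s (s - rh a); rwa [sub_sub_cancel] at this
      nlinarith [norm_nonneg s]
    rw [norm_mul, norm_div, norm_mul, Complex.norm_natCast]
    have : ‖s‖ / (‖rh a‖ * ‖s - rh a‖) ≤ ‖s‖ * (1 + ‖s‖) * (1 / ‖rh a‖^2) := by
      rw [mul_one_div, div_le_div_iff₀ psv psv]
      have := mulL p3 (by positivity : 0 ≤ ‖s‖ * ‖rh a‖)
      nlinarith
    calc (mz a.1 : ℝ) * (‖s‖ / (‖rh a‖ * ‖s - rh a‖)) ≤ (mz a.1 : ℝ) * (‖s‖ * (1 + ‖s‖) * (1 / ‖rh a‖^2)) := by gcongr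
      _ = _ := by ring
  have h4 := hsum.hasSum.comp zt_tendsto
  have h5 : ∀ R : ℝ, ∑ a ∈ (ZR R).subtype (fun a => xf a = 0), (mz a.1 : ℂ) * (s / (rh a * (s - rh a)))
      = ∑ a ∈ ZR R, (mz a : ℂ) / (s - 1/2 - a) - ∑ a ∈ ZR R, (mz a : ℂ) / (-(1/2) - a) := by
    intro R
    rw [← sum_sub_distrib, ← Finset.sum_subtype_of_mem (p := fun a => xf a = 0) _ (fun a ha => (mem_ZR.1 ha).2)]
    refine sumC fun a _ => ?_
    have e1 : s - 1/2 - a.1 = s - rh a := by rw [rh]; ring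
    have e2 : -(1/2) - a.1 = - rh a := by rw [rh]; ring
    rw [e1, e2]
    have := hsr a
    have := rh_ne a
    field_simp
    ring
  have h6 : Tendsto (fun R : ℝ => ∑ a ∈ (ZR R).subtype (fun a => xf a = 0), (mz a.1 : ℂ) * (s / (rh a * (s - rh a)))) atTop (𝓝 (logDeriv xf (s - 1/2) - logDeriv xf (-(1/2)))) := by
    simp only [h5]; exact h3
  have := tendsto_nhds_unique h4 h6
  rw [← this]; exact hsum.hasSum

lemma dig_hasSum {s : ℂ} (hs : s.re = 2) : HasSum (fun k : ℕ => 1 / (2 * ((k:ℂ) + 1)) - 1 / (s + 2 * ((k:ℂ) + 1)))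
    (digamma (s/2) / 2 + 1 / s - digamma 1 / 2) := by
  have hs0 : s ≠ 0 := by rintro rfl; simp at hs
  have hsk : ∀ k : ℕ, s + 2 * ((k:ℂ) + 1) ≠ 0 := fun k h => by
    have := congrArg re h
    simp [hs] at this
    have : (0:ℝ) ≤ k := by positivity
    linarith
  have hk1 : ∀ k : ℕ, (k:ℂ) + 1 ≠ 0 := fun k => by exact_mod_cast Nat.succ_ne_zero k
  have hsum : Summable (fun k : ℕ => 1 / (2 * ((k:ℂ) + 1)) - 1 / (s + 2 * ((k:ℂ) + 1))) := by
    have hb : Summable (fun k : ℕ => ‖s‖ * (1 / ((k:ℝ) + 1)^2)) := by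
      have := (summable_nat_add_iff 1).2 (Real.summable_one_div_nat_pow (p := 2).2 nnm)
      push_cast at this
      exact this.mul_left _
    refine Summable.of_norm_bounded hb fun k => ?_
    have e : 1 / (2 * ((k:ℂ) + 1)) - 1 / (s + 2 * ((k:ℂ) + 1)) = s / ((2 * ((k:ℂ) + 1)) * (s + 2 * ((k:ℂ) + 1))) := by
      have := hsk k; have := hk1 k
      field_simp; ring
    have n1 : ‖2 * ((k:ℂ) + 1)‖ = 2 * ((k:ℝ) + 1) := by
      rw [norm_mul]; norm_cast
    have n2 : (k:ℝ) + 1 ≤ ‖s + 2 * ((k:ℂ) + 1)‖ := by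
      refine le_trans ?_ (re_le_norm _)
      simp [hs]; nlinarith [show (0:ℝ) ≤ k by positivity]
    rw [e, norm_div, norm_mul, n1, mul_one_div]
    gcongr
    nlinarith
  have h1 := digamma_lim (z := s/2) (by simp [hs])
  have h2 := digamma_lim (z := 1) (by simp)
  have h3 := ((h1.sub h2).div_const 2)
  have h4 := hsum.hasSum.tendsto_sum_nat
  have h0 : Tendsto (fun n : ℕ => 1 / (2 * ((n:ℂ) + 1))) atTop (𝓝 0) := by
    have : Tendsto (fun n : ℕ => (1/2) * (1 / ((n:ℂ) + 1))) atTop (𝓝 ((1/2) * 0)) := tendsto_one_div_add_atTop_nhds_zero_nat.const_mul _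
    rw [mul_zero] at this
    refine this.congr fun n => ?_
    have := hk1 n
    field_simp
  have h5 : ∀ n : ℕ, (∑ k ∈ Frg n, (1 / (2 * ((k:ℂ) + 1)) - 1 / (s + 2 * ((k:ℂ) + 1)))) + 1 / (2 * ((n:ℂ) + 1)) - 1 / s =
      ((Complex.log n - ∑ k ∈ Frg (n + 1), 1 / (s/2 + k)) - (Complex.log n - ∑ k ∈ Frg (n + 1), 1 / (1 + (k:ℂ)))) / 2 := by
    intro n
    rw [Finset.sum_range_succ' (fun k : ℕ => 1 / (s/2 + (k:ℂ))), sum_range_succ (fun k : ℕ => 1 / (1 + (k:ℂ))), sum_sub_distrib]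
    have e1 : ∑ k ∈ Frg n, 1 / (2 * ((k:ℂ) + 1)) = (∑ k ∈ Frg n, 1 / (1 + (k:ℂ))) / 2 := by
      rw [Finset.sum_div]
      refine sumC fun k _ => ?_
      rw [div_div, mul_comm, add_comm 1]
    have e2 : ∑ k ∈ Frg n, 1 / (s + 2 * ((k:ℂ) + 1)) = (∑ k ∈ Frg n, 1 / (s/2 + ((k + 1 : ℕ):ℂ))) / 2 := by
      rw [Finset.sum_div]
      refine sumC fun k _ => ?_
      rw [div_div]; push_cast; congr 1; ring
    rw [e1, e2]
    have e3 : 1 / (2 * ((n:ℂ) + 1)) = 1 / (1 + (n:ℂ)) / 2 := by rw [div_div, mul_comm, add_comm 1]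
    rw [e3]
    have e4 : 1 / (s/2 + ((0:ℕ):ℂ)) = 1/s*2 := by rw [Nat.cast_zero, add_zero]; field_simp
    rw [e4]
    ring
  have h6 := ((h4.add h0).sub_const (1/s))
  simp only [h5] at h6
  have := tendsto_nhds_unique h3 h6
  have e : digamma (s/2) / 2 + 1 / s - digamma 1 / 2 = ∑' k : ℕ, (1 / (2 * ((k:ℂ) + 1)) - 1 / (s + 2 * ((k:ℂ) + 1))) := by
    linear_combination this
  rw [e]; exact hsum.hasSum

/-- the constant -/
def Cc : ℂ := -Complex.log Real.pi / 2 + digamma 1 / 2 - logDeriv xf (-(1/2))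

lemma LS_formula {s : ℂ} (hs : s.re = 2) : LSeries (fun n => (vM n : ℂ)) s
    = 1 / (s - 1) + Cc - ∑' a : Zt, (mz a.1 : ℂ) * (s / (rh a * (s - rh a))) + ∑' k : ℕ, (1 / (2 * ((k:ℂ) + 1)) - 1 / (s + 2 * ((k:ℂ) + 1))) := by
  rw [(zeros_hasSum hs).tsum_eq, (dig_hasSum hs).tsum_eq, Cc, xf_logDeriv lna]
  ring

/-- the three sums -/
def Fp (n : ℕ) (t : ℝ) : ℂ := (vM n : ℂ) * Lg (n * t)
def Fz (a : Zt) (t : ℝ) : ℂ := (mz a.1 : ℂ) / (rh a)^2 * Pf (rh a) t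
def Ft (k : ℕ) (t : ℝ) : ℂ := 1 / (4 * ((k:ℂ) + 1)^2) * Pf (-(2 * ((k:ℂ) + 1))) t

lemma Fz_main : Nice (fun t => ∑' a, Fz a t) ∧ ∀ s : ℂ, s.re = 2 → HasSum (fun a => mellin (Fz a) s) (mellin (fun t => ∑' a, Fz a t) s) := by
  refine nice_tsum (c := fun a : Zt => (mz a.1 : ℝ) / ‖rh a‖^2 * 2) (zt_inv_summable.mul_right 2) (fun a => by positivity) (fun a => continuousOn_const.mul (Pf_cont _))
    (fun a t ht => by rw [Fz, Pf, if_neg (not_lt.2 ht), mul_zero]) (fun a t h0 h1 => ?_)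
  rw [Fz, norm_mul, norm_div, norm_pow, Complex.norm_natCast, mul_assoc]
  exact mulL (Pf_bd (by linarith [(rh_re a).2]) h0 h1) psv

lemma sum_k2 : Summable (fun k : ℕ => 1 / (4 * ((k:ℝ) + 1)^2)) := by
  have := (summable_nat_add_iff 1).2 (Real.summable_one_div_nat_pow (p := 2).2 nnm)
  push_cast at this
  refine (this.mul_left (1/4)).congr fun k => ?_
  field_simp

lemma Ft_main : Nice (fun t => ∑' k, Ft k t) ∧ ∀ s : ℂ, s.re = 2 → HasSum (fun k => mellin (Ft k) s) (mellin (fun t => ∑' k, Ft k t) s) := by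
  refine nice_tsum (c := fun k : ℕ => 1 / (4 * ((k:ℝ) + 1)^2) * 2) (sum_k2.mul_right 2) (fun a => by positivity) (fun a => continuousOn_const.mul (Pf_cont _))
    (fun a t ht => by rw [Ft, Pf, if_neg (not_lt.2 ht), mul_zero]) (fun k t h0 h1 => ?_)
  have e : ‖(1:ℂ) / (4 * ((k:ℂ) + 1)^2)‖ = 1 / (4 * ((k:ℝ) + 1)^2) := by
    rw [show (1:ℂ) / (4 * ((k:ℂ) + 1)^2) = ((1 / (4 * ((k:ℝ) + 1)^2) : ℝ) : ℂ) by push_cast; ring, Complex.norm_real, Real.norm_of_nonneg psv]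
  rw [Ft, norm_mul, e, mul_assoc]
  refine mulL (Pf_bd ?_ h0 h1) psv
  have : (-(2 * ((k:ℂ) + 1))).re = -(2 * ((k:ℝ) + 1)) := by simp
  rw [this]; nlinarith [show (0:ℝ) ≤ k by positivity]

lemma Fp_main : Nice (fun t => ∑' n, Fp n t) ∧ ∀ s : ℂ, s.re = 2 → HasSum (fun n => mellin (Fp n) s) (mellin (fun t => ∑' n, Fp n t) s) := by
  have hS := (LS_re (σ := 3/2) (t := 0) nnm).summable
  simp only [zero_mul, Real.cos_zero, mul_one] at hS
  have hv : ∀ n : ℕ, 0 ≤ vM n := fun n => ArithmeticFunction.vonMangoldt_nonneg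
  refine nice_tsum hS (fun n => mul_nonneg (hv n) psv) (fun n => ?_) (fun n t ht => ?_) (fun n t h0 h1 => ?_)
  · rcases Nat.eq_zero_or_pos n with rfl | hn
    · have : Fp 0 = fun _ => 0 := by ext t; simp [Fp]
      rw [this]; exact continuousOn_const
    · refine continuousOn_const.mul (Lg_cont.comp (by fun_prop) fun t ht => ?_)
      have ht : 0 < t := ht
      show 0 < (n:ℝ) * t
      positivity
  · rcases Nat.eq_zero_or_pos n with rfl | hn
    · simp [Fp]
    · have : (1:ℝ) ≤ n := by exact_mod_cast hn
      rw [Fp, Lg, if_neg (not_lt.2 (by nlinarith)), mul_zero]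
  · rcases Nat.eq_zero_or_pos n with rfl | hn
    · simp [Fp]
    · have hn0 : (0:ℝ) < n := by exact_mod_cast hn
      rw [Fp, norm_mul, Complex.norm_real, Real.norm_of_nonneg (hv n), mul_assoc]
      refine mulL ?_ (hv n)
      rw [← Real.mul_rpow hn0.le h0.le]
      rcases lt_or_ge ((n:ℝ) * t) 1 with h | h
      · have := Lg_bd psv h; linarith
      · rw [Lg, if_neg (not_lt.2 h), norm_zero]; positivity

lemma mellin_const_mul (c : ℂ) (f : ℝ → ℂ) (s : ℂ) : mellin (fun t => c * f t) s = c * mellin f s := by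
  simpa using mellin_const_smul f s c

lemma Fp_mellin {s : ℂ} (hs : s.re = 2) : mellin (fun t => ∑' n, Fp n t) s = LSeries (fun n => (vM n : ℂ)) s / s^2 := by
  refine (Fp_main.2 s hs).unique ?_
  have := (ArithmeticFunction.LSeriesSummable_vonMangoldt (s := s) lna).hasSum.div_const (s^2)
  refine this.congr_fun ?_ |> id
  intro n
  rcases Nat.eq_zero_or_pos n with rfl | hn
  · simp [Fp, mellin]
  · have hn0 : (0:ℝ) < n := by exact_mod_cast hn
    have : mellin (Fp n) s = (vM n : ℂ) * mellin (fun t => Lg (n * t)) s := mellin_const_mul _ _ _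
    rw [this, mellin_comp_mul_left _ _ hn0, Lg_mellin hs, LSeries.term_of_ne_zero hn.ne', cpow_neg, smul_eq_mul, ofReal_natCast]
    field_simp

lemma explicit {t : ℝ} (ht : 0 < t) : ∑' n, Fp n t = Pf 1 t + (Cc - 1) * Lg t - ∑' a, Fz a t - ∑' k, Ft k t := by
  have n1 := Fp_main.1
  have n2 := (Pf_nice (z := 1) nnm).smul (-1)
  have n3 := Lg_nice.smul (-(Cc - 1))
  have h := ((((n1.add n2).add n3).add Fz_main.1).add Ft_main.1)
  have := h.eq_zero ?_ ht
  · linear_combination this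
  intro s hs
  have cv : ∀ {f : ℝ → ℂ}, Nice f → MellinConvergent f s := fun hf => hf.conv hs
  rw [(hasMellin_add (cv (((n1.add n2).add n3).add Fz_main.1)) (cv Ft_main.1)).2, (hasMellin_add (cv ((n1.add n2).add n3)) (cv Fz_main.1)).2,
    (hasMellin_add (cv (n1.add n2)) (cv n3)).2, (hasMellin_add (cv n1) (cv n2)).2, mellin_const_mul, mellin_const_mul, Lg_mellin hs, Pf_mellin nnm hs,
    Fp_mellin hs, LS_formula hs]
  have hs0 : s ≠ 0 := by rintro rfl; simp at hs
  have hs1 : s - 1 ≠ 0 := fun h => by rw [sub_eq_zero.1 h] at hs; norm_num at hs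
  have e1 : mellin (fun t => ∑' a, Fz a t) s = (∑' a : Zt, (mz a.1 : ℂ) * (s / (rh a * (s - rh a)))) / s^2 := by
    refine (Fz_main.2 s hs).unique ?_
    refine ((zeros_hasSum hs).summable.hasSum.div_const (s^2)).congr_fun ?_ |> id
    intro a
    have : mellin (Fz a) s = (mz a.1 : ℂ) / (rh a)^2 * mellin (Pf (rh a)) s := mellin_const_mul _ _ _
    rw [this, Pf_mellin (by linarith [(rh_re a).2]) hs]
    have h1 := rh_ne a
    have h2 : s - rh a ≠ 0 := fun h => by
      have := (rh_re a).2
      rw [← sub_eq_zero.1 h, hs] at this; norm_num at this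
    field_simp
    ring
  have e2 : mellin (fun t => ∑' k, Ft k t) s = -(∑' k : ℕ, (1 / (2 * ((k:ℂ) + 1)) - 1 / (s + 2 * ((k:ℂ) + 1)))) / s^2 := by
    refine (Ft_main.2 s hs).unique ?_
    refine ((dig_hasSum hs).summable.hasSum.neg.div_const (s^2)).congr_fun ?_ |> id
    intro k
    have hk0 : (0:ℝ) ≤ k := by positivity
    have hre : (-(2 * ((k:ℂ) + 1))).re = -(2 * ((k:ℝ) + 1)) := by simp
    have : mellin (Ft k) s = 1 / (4 * ((k:ℂ) + 1)^2) * mellin (Pf (-(2 * ((k:ℂ) + 1)))) s := mellin_const_mul _ _ _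
    rw [this, Pf_mellin (by rw [hre]; linarith) hs]
    have h1 : (k:ℂ) + 1 ≠ 0 := by exact_mod_cast Nat.succ_ne_zero k
    have h2 : s + 2 * ((k:ℂ) + 1) ≠ 0 := fun h => by
      have := congrArg re h
      simp [hs] at this
      linarith
    rw [sub_neg_eq_add]
    generalize (k:ℂ) + 1 = K at *
    generalize hq : s + 2 * K = q at *
    have : K = (q - s) / 2 := by rw [← hq]; ring
    subst this
    have : q - s ≠ 0 := fun h => h1 (by rw [h]; ring)
    field_simp
    ring
  rw [e1, e2]
  field_simp
  ring

lemma decay {a : ℂ} (ha : xf a = 0) {u : ℝ} (hu : 600 ≤ u) :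
    Ex (-((1/2 - a.re) * u)) ≤ |a.im|^(3/4:ℝ) * Ex (-1.2 - 2 * √(0.0777 * u)) := by
  have hg := gamma_ge ha
  have hg0 : 0 < |a.im| := by linarith
  rw [Real.rpow_def_of_pos hg0, ← Real.exp_add]
  apply Real.exp_le_exp.2
  have hq2 : √(0.0777 * u)^2 = 0.0777 * u := Real.sq_sqrt lna
  have hq6 : 6 ≤ √(0.0777 * u) := Real.le_sqrt_of_sq_le lna
  generalize √(0.0777 * u) = q at *
  have hl : 1.6 ≤ Lo |a.im| := by
    have h1 : Lo 5 ≤ Lo |a.im| := Real.log_le_log nnm hg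
    have h2 : (1.6:ℝ) ≤ Lo 5 := by
      have h : Lo (2^16) ≤ Lo (5^7) := Real.log_le_log nnm nnm
      rw [Real.log_pow, Real.log_pow] at h
      have := Real.log_two_gt_d9
      push_cast at h
      have h3 : Lo (5/4) ≥ 1 - (5/4:ℝ)⁻¹ := Real.one_sub_inv_le_log_of_pos nnm
      have h4 : Lo (128/125) ≤ 128/125 - 1 := Real.log_le_sub_one_of_pos nnm
      rw [show (128/125:ℝ) = 2^7/5^3 by norm_num, Real.log_div nnm nnm, Real.log_pow, Real.log_pow] at h4
      push_cast at h4
      linarith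
    linarith
  rcases le_or_gt 5.6 (Lo |a.im|) with h | h
  · have hz := zfr ha (y := Lo |a.im| - 1.6) lna le_rfl
    generalize hy : Lo |a.im| - 1.6 = y at *
    have hy4 : 4 ≤ y := by linarith
    have e : Lo |a.im| = y + 1.6 := by linarith
    rw [e]
    have h1 : 0.1036 / y * u ≤ (1/2 - a.re) * u := mul_le_mul_of_nonneg_right hz lna
    have h2 : 2 * q - 0.75 * y ≤ 0.1036 / y * u := by
      rw [div_mul_eq_mul_div, le_div_iff₀ lna]
      nlinarith [sq_nonneg (q - 0.75 * y)]
    linarith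
  · have hz := zfr ha (y := 4) le_rfl lna
    have h1 : 0.1036 / 4 * u ≤ (1/2 - a.re) * u := mul_le_mul_of_nonneg_right hz lna
    nlinarith

lemma half_sum (F : Finset ℂ) (hF : ∀ a ∈ F, 0 < a.re) : ∑ a ∈ F, (mz a : ℝ) * wt |a.im| ≤ 2.08 := by
  classical
  have h := zero_sum_le (F ∪ F.map reflE.toEmbedding)
  rw [Finset.sum_union, Finset.sum_map] at h
  · have : ∀ a ∈ F, (mz (reflE.toEmbedding a) : ℝ) * wt |(reflE.toEmbedding a).im| = (mz a : ℝ) * wt |a.im| := fun a _ => by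
      rw [Equiv.coe_toEmbedding, reflE_apply, mz_refl]; simp
    rw [sumC this] at h
    linarith
  · rw [Finset.disjoint_left]
    intro a ha hb
    obtain ⟨b, hb', rfl⟩ := Finset.mem_map.1 hb
    have h1 := hF _ ha
    have h2 := hF _ hb'
    rw [Equiv.coe_toEmbedding, reflE_apply] at h1
    simp at h1
    linarith

/-- weighted zero sum -/
def Ez (u : ℝ) (a : Zt) : ℝ := (mz a.1 : ℝ) / ‖rh a‖^2 * Ex (((rh a).re - 1) * u)
/-- decay factor -/
def Kz (u : ℝ) : ℝ := Ex (-1.2 - 2 * √(0.0777 * u))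

lemma Ez_nonneg (u : ℝ) (a : Zt) : 0 ≤ Ez u a := by rw [Ez]; positivity

lemma Ez_term {u : ℝ} (hu : 600 ≤ u) (a : Zt) : Ez u a ≤ (mz a.1 : ℝ) * wt |a.1.im| * (if 0 < a.1.re then Kz u else Ex (-u/2)) := by
  have e : (rh a).re = 1/2 + a.1.re := by simp [rh]
  have hg := gamma_ge a.2
  have hg0 : 0 < |a.1.im| := by linarith
  rw [Ez, e]
  split_ifs with h
  · have h1 := decay a.2 hu
    have e1 : (1/2 + a.1.re - 1) * u = -((1/2 - a.1.re) * u) := by ring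
    rw [e1, div_eq_mul_one_div, mul_assoc, mul_assoc]
    refine mulL ?_ psv
    have h2 : 1 / ‖rh a‖^2 ≤ |a.1.im|^(-2:ℝ) := by
      rw [Real.rpow_neg hg0.le, ← one_div, show (2:ℝ) = ((2:ℕ):ℝ) by norm_num, Real.rpow_natCast]
      have := rh_norm a
      gcongr
    calc 1 / ‖rh a‖^2 * Ex (-((1/2 - a.1.re) * u)) ≤ |a.1.im|^(-2:ℝ) * (|a.1.im|^(3/4:ℝ) * Kz u) := by
          rw [Kz]; gcongr
      _ = wt |a.1.im| * Kz u := by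
          rw [← mul_assoc, ← Real.rpow_add hg0, wt]; norm_num
  · have h2 := rh_inv_sq a
    have h3 : Ex ((1/2 + a.1.re - 1) * u) ≤ Ex (-u/2) := by
      apply Real.exp_le_exp.2; nlinarith
    rw [div_eq_mul_one_div]
    have : 0 ≤ wt |a.1.im| := by rw [wt]; positivity
    gcongr

lemma Ez_sum {u : ℝ} (hu : 600 ≤ u) : Summable (Ez u) ∧ ∑' a, Ez u a ≤ 2.08 * Kz u + 4.16 * Ex (-u/2) := by
  have hb : ∀ F : Finset Zt, ∑ a ∈ F, Ez u a ≤ 2.08 * Kz u + 4.16 * Ex (-u/2) := by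
    intro F
    have hK : 0 < Kz u := Real.exp_pos _
    have hw : ∀ a : Zt, 0 ≤ (mz a.1 : ℝ) * wt |a.1.im| := fun a => mul_nonneg psv (by rw [wt]; positivity)
    have h1 : ∑ a ∈ F, Ez u a ≤ ∑ a ∈ F, ((if 0 < a.1.re then (mz a.1 : ℝ) * wt |a.1.im| else 0) * Kz u + (mz a.1 : ℝ) * wt |a.1.im| * Ex (-u/2)) := by
      refine sum_le_sum fun a _ => (Ez_term hu a).trans ?_
      split_ifs with h
      · have := mul_nonneg (hw a) (Real.exp_pos (-u/2)).le; linarith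
      · simp
    rw [sum_add_distrib, ← Finset.sum_mul, ← Finset.sum_mul] at h1
    have h2 : ∑ a ∈ F, (mz a.1 : ℝ) * wt |a.1.im| ≤ 4.16 := by
      have := zero_sum_le (F.map (Function.Embedding.subtype _))
      rwa [Finset.sum_map] at this
    have h3 : ∑ a ∈ F, (if 0 < a.1.re then (mz a.1 : ℝ) * wt |a.1.im| else 0) ≤ 2.08 := by
      rw [← Finset.sum_filter]
      have := half_sum ((F.filter (fun a => 0 < a.1.re)).map (Function.Embedding.subtype _)) (by
        intro a ha
        obtain ⟨b, hb, rfl⟩ := Finset.mem_map.1 ha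
        exact (Finset.mem_filter.1 hb).2)
      rwa [Finset.sum_map] at this
    have := mul_le_mul_of_nonneg_right h3 hK.le
    have := mul_le_mul_of_nonneg_right h2 (Real.exp_pos (-u/2)).le
    linarith
  exact ⟨summable_of_sum_le (Ez_nonneg u) hb, Real.tsum_le_of_sum_le (Ez_nonneg u) hb⟩

/-- weighted prime sum -/
def Wf (u : ℝ) : ℝ := (∑' n, Fp n (Ex (-u))).re

lemma Fp_exp (n : ℕ) (u : ℝ) : Fp n (Ex (-u)) = ((vM n * max 0 (u - Lo n) : ℝ) : ℂ) := by
  rcases Nat.eq_zero_or_pos n with rfl | hn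
  · simp [Fp]
  have hn0 : (0:ℝ) < n := by exact_mod_cast hn
  rw [Fp, Lg, ofReal_mul]
  congr 1
  have e : Lo (n * Ex (-u)) = Lo n - u := by
    rw [Real.log_mul hn0.ne' (Real.exp_pos _).ne', Real.log_exp]; ring
  have e2 : (n:ℝ) * Ex (-u) < 1 ↔ Lo n - u < 0 := by
    rw [← e, Real.log_neg_iff psv]
  split_ifs with h
  · rw [e2] at h
    rw [e, max_eq_right lna]; congr 1; ring
  · rw [e2] at h
    rw [max_eq_left lna, ofReal_zero]

lemma Wf_eq {u : ℝ} {N : ℕ} (hN : Ex u < N + 1) : Wf u = ∑ n ∈ Finset.Ioc 0 N, vM n * max 0 (u - Lo n) := by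
  rw [Wf, tsum_eq_sum (s := Finset.Ioc 0 N)]
  · rw [← ofReal_re (∑ n ∈ Finset.Ioc 0 N, _)]
    congr 1
    push_cast
    refine sumC fun n _ => ?_
    rw [Fp_exp]; push_cast; rfl
  · intro n hn
    rw [Fp_exp]
    rcases Nat.eq_zero_or_pos n with rfl | hn0
    · simp
    have hnN : N + 1 ≤ n := by
      by_contra hc; exact hn (Finset.mem_Ioc.2 ⟨hn0, by omega⟩)
    have : (N:ℝ) + 1 ≤ n := by exact_mod_cast hnN
    have h2 : u ≤ Lo n := by
      rw [Real.le_log_iff_exp_le (by exact_mod_cast hn0)]; linarith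
    rw [max_eq_left lna]; simp

lemma Wf_psi {u h : ℝ} (hh : 0 < h) : h * psi (Ex u) ≤ Wf (u + h) - Wf u ∧ Wf (u + h) - Wf u ≤ h * psi (Ex (u + h)) := by
  have hm : Ex u < Ex (u + h) := Real.exp_lt_exp.2 lna
  have hv : ∀ n : ℕ, 0 ≤ vM n := fun n => ArithmeticFunction.vonMangoldt_nonneg
  have h1 := Wf_eq (u := u + h) (Nat.lt_floor_add_one (Ex (u + h)))
  have h2 := Wf_eq (u := u) (N := ⌊Ex (u + h)⌋₊) (by linarith [Nat.lt_floor_add_one (Ex (u + h))])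
  rw [h1, h2, ← sum_sub_distrib, psi, psi, mul_sum, mul_sum]
  constructor
  · refine (sum_le_sum (g := fun n => vM n * max 0 (u + h - Lo n) - vM n * max 0 (u - Lo n)) fun n hn => ?_).trans
      (Finset.sum_le_sum_of_subset_of_nonneg (Finset.Ioc_subset_Ioc_right (Nat.floor_le_floor hm.le)) fun n _ _ => ?_)
    · obtain ⟨hn0, hn1⟩ := Finset.mem_Ioc.1 hn
      have : Lo n ≤ u := by
        rw [Real.log_le_iff_le_exp (by exact_mod_cast hn0)]
        exact (Nat.le_floor_iff (Real.exp_pos _).le).1 hn1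
      rw [max_eq_right lna, max_eq_right lna]
      linarith
    · rw [← mul_sub]
      refine mul_nonneg (hv n) (sub_nonneg.2 (max_le_max le_rfl lna))
  · refine sum_le_sum fun n _ => ?_
    rw [← mul_sub, mul_comm h]
    refine mulL ?_ (hv n)
    rcases max_cases 0 (u + h - Lo n) with h | h <;> rcases max_cases 0 (u - Lo n) with h' | h' <;> linarith

lemma Wf_explicit {u : ℝ} (hu : 0 < u) : Wf u = Ex u - 1 + (Cc.re - 1) * u - (∑' a, Fz a (Ex (-u))).re - (∑' k, Ft k (Ex (-u))).re := by
  have h1 : Ex (-u) < 1 := by rw [Real.exp_lt_one_iff]; linarith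
  rw [Wf, explicit (Real.exp_pos _), sub_re, sub_re, add_re, Pf, if_pos h1, Lg, if_pos h1, Real.log_exp, neg_neg]
  have : ((Ex (-u) : ℝ) : ℂ)^(-1:ℂ) = ((Ex u : ℝ) : ℂ) := by
    rw [cpow_neg, cpow_one, ← ofReal_inv, Real.exp_neg, inv_inv]
  rw [this]
  simp
  exact Complex.exp_ofReal_re u

lemma inv_sq_sum : ∑' k : ℕ, 1 / (4 * ((k:ℝ) + 1)^2) ≤ 1/2 := by
  have h := hasSum_zeta_two
  have h1 := (hasSum_nat_add_iff' 1).2 h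
  simp at h1
  have h2 := h1.mul_left (1/4)
  have : ∑' k : ℕ, 1 / (4 * ((k:ℝ) + 1)^2) = 1/4 * (Real.pi^2/6) := by
    rw [← h2.tsum_eq]
    refine tsum_congr fun k => ?_
    field_simp
  rw [this]
  nlinarith [Real.pi_lt_d2, Real.pi_pos]

lemma Ft_bd {u : ℝ} (hu : 0 < u) : ‖∑' k, Ft k (Ex (-u))‖ ≤ 1/2 := by
  refine (tsum_of_norm_bounded (sum_k2.hasSum) fun k => ?_).trans inv_sq_sum
  have h1 : Ex (-u) < 1 := by rw [Real.exp_lt_one_iff]; linarith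
  have h0 := Real.exp_pos (-u)
  have e : ‖(1:ℂ) / (4 * ((k:ℂ) + 1)^2)‖ = 1 / (4 * ((k:ℝ) + 1)^2) := by
    rw [show (1:ℂ) / (4 * ((k:ℂ) + 1)^2) = ((1 / (4 * ((k:ℝ) + 1)^2) : ℝ) : ℂ) by push_cast; ring, Complex.norm_real, Real.norm_of_nonneg psv]
  rw [Ft, norm_mul, e]
  refine mul_le_of_le_one_right psv ?_
  rw [Pf, if_pos h1, neg_neg, show (2 * ((k:ℂ) + 1)) = ((2 * (k + 1) : ℕ) : ℂ) by push_cast; ring, cpow_natCast, ← ofReal_pow, ← ofReal_one, ← ofReal_sub, Complex.norm_real,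
    Real.norm_eq_abs, abs_le]
  have := pow_le_one₀ (n := 2 * (k + 1)) h0.le h1.le
  have := pow_nonneg h0.le (2 * (k + 1))
  constructor <;> linarith

lemma Fz_summable (u : ℝ) : Summable (fun a => Fz a (Ex (-u))) := by
  rcases lt_or_ge (Ex (-u)) 1 with h1 | h1
  · refine Summable.of_norm_bounded (g := fun a : Zt => (mz a.1 : ℝ) / ‖rh a‖^2 * (2 * (Ex (-u))^(-(3/2):ℝ))) (zt_inv_summable.mul_right _) fun a => ?_
    rw [Fz, norm_mul, norm_div, norm_pow, Complex.norm_natCast]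
    exact mulL (Pf_bd (by linarith [(rh_re a).2]) (Real.exp_pos _) h1) psv
  · simp only [Fz, Pf, if_neg (not_lt.2 h1), mul_zero]; exact summable_zero

lemma exp_cpow (u : ℝ) (z : ℂ) : ((Ex (-u) : ℝ) : ℂ)^(-z) = Complex.exp (z * u) := by
  rw [cpow_def_of_ne_zero (by exact_mod_cast (Real.exp_pos _).ne'), ← ofReal_log (Real.exp_pos _).le, Real.log_exp]
  congr 1; push_cast; ring

lemma Fz_diff {u h : ℝ} (hu : 600 ≤ u) (hh : 0 < h) :
    ‖∑' a, Fz a (Ex (-(u + h))) - ∑' a, Fz a (Ex (-u))‖ ≤ Ex u * (Ex h + 1) * (2.08 * Kz u + 4.16 * Ex (-u/2)) := by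
  obtain ⟨hs, hb⟩ := Ez_sum hu
  rw [← (Fz_summable (u+h)).tsum_sub (Fz_summable u)]
  refine (tsum_of_norm_bounded ((hs.mul_left (Ex u * (Ex h + 1))).hasSum) fun a => ?_).trans ?_
  · have h1 : Ex (-u) < 1 := by rw [Real.exp_lt_one_iff]; linarith
    have h2 : Ex (-(u+h)) < 1 := by rw [Real.exp_lt_one_iff]; linarith
    rw [Fz, Fz, Pf, Pf, if_pos h1, if_pos h2, ← mul_sub, exp_cpow, exp_cpow, norm_mul, norm_div, norm_pow, Complex.norm_natCast, sub_sub_sub_cancel_right]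
    have e : Complex.exp (rh a * ((u + h : ℝ) : ℂ)) - Complex.exp (rh a * u) = Complex.exp (rh a * u) * (Complex.exp (rh a * h) - 1) := by
      rw [mul_sub, ← Complex.exp_add, mul_one]; congr 2; push_cast; ring
    rw [e, norm_mul, Complex.norm_exp, Ez]
    have e1 : (rh a * (u:ℂ)).re = u + ((rh a).re - 1) * u := by simp; ring
    rw [e1, Real.exp_add]
    have e2 : ‖Complex.exp (rh a * h) - 1‖ ≤ Ex h + 1 := by
      refine (norm_sub_le _ _).trans ?_
      rw [Complex.norm_exp, norm_one]
      have : (rh a * (h:ℂ)).re ≤ h := by simp; nlinarith [(rh_re a).2]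
      linarith [Real.exp_le_exp.2 this]
    calc (mz a.1 : ℝ) / ‖rh a‖^2 * (Ex u * Ex (((rh a).re - 1) * u) * ‖Complex.exp (rh a * h) - 1‖)
        ≤ (mz a.1 : ℝ) / ‖rh a‖^2 * (Ex u * Ex (((rh a).re - 1) * u) * (Ex h + 1)) := by gcongr
      _ = _ := by ring
  · rw [tsum_mul_left]
    exact mulL hb psv

lemma zt_inv_le : ∑' a : Zt, (mz a.1 : ℝ) / ‖rh a‖^2 ≤ 4.16 := by
  refine Real.tsum_le_of_sum_le (fun a => by positivity) fun F => ?_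
  have := zero_sum_le (F.map (Function.Embedding.subtype _))
  rw [Finset.sum_map] at this
  refine le_trans (sum_le_sum fun a _ => ?_) this
  rw [div_eq_mul_one_div]
  exact mulL (rh_inv_sq a) psv

lemma Cc_bd : |Cc.re| ≤ 100 := by
  have l2 := Real.log_two_gt_d9
  have l2' := Real.log_two_lt_d9
  have h := Wf_explicit (u := Lo 2) lna
  have h0 : Wf (Lo 2) = 0 := by
    rw [Wf_eq (N := 2) (by rw [Real.exp_log] <;> norm_num)]
    rw [show Finset.Ioc 0 2 = {1, 2} by rfl]
    simp
  have hT := (abs_re_le_norm _).trans (Ft_bd (u := Lo 2) lna)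
  have h1 : Ex (-Lo 2) = 1/2 := by rw [Real.exp_neg, Real.exp_log nnm]; norm_num
  have hZ : |(∑' a, Fz a (Ex (-Lo 2))).re| ≤ 40 := by
    refine (abs_re_le_norm _).trans ?_
    refine (tsum_of_norm_bounded ((zt_inv_summable.mul_right 8).hasSum) fun a => ?_).trans ?_
    · rw [Fz, norm_mul, norm_div, norm_pow, Complex.norm_natCast]
      refine mulL ?_ psv
      refine (Pf_bd (by linarith [(rh_re a).2]) (Real.exp_pos _) (by rw [h1]; norm_num)).trans ?_
      rw [h1]
      have : (1/2:ℝ)^(-(3/2):ℝ) ≤ (1/2:ℝ)^(-2:ℝ) := Real.rpow_le_rpow_of_exponent_ge nnm nnm nnm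
      have e : (1/2:ℝ)^(-2:ℝ) = 4 := by
        rw [show (-2:ℝ) = ((-2:ℤ):ℝ) by norm_num, Real.rpow_intCast]; norm_num
      linarith
    · rw [tsum_mul_right]; linarith [zt_inv_le]
  rw [h0, Real.exp_log nnm] at h
  rw [abs_le] at hT hZ ⊢
  constructor <;> nlinarith

lemma Wf_diff {u h : ℝ} (hu : 600 ≤ u) (hh : 0 < h) (hh1 : h ≤ 1) :
    |Wf (u + h) - Wf u - Ex u * (Ex h - 1)| ≤ Ex u * (Ex h + 1) * (2.08 * Kz u + 4.16 * Ex (-u/2)) + 102 := by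
  rw [Wf_explicit lna, Wf_explicit lna]
  have h1 := (abs_re_le_norm _).trans (Fz_diff hu hh)
  have h2 := (abs_re_le_norm _).trans (Ft_bd (u := u) lna)
  have h3 := (abs_re_le_norm _).trans (Ft_bd (u := u + h) lna)
  have h4 := Cc_bd
  rw [sub_re] at h1
  rw [Real.exp_add]
  rw [abs_le] at *
  constructor <;> nlinarith

lemma Kz_le {v : ℝ} (hv : 649.9 ≤ v) : Kz v ≤ 0.09 / v^2 := by
  set r := √v with hr
  have hr0 : 25.49 ≤ r := by
    rw [hr]; apply Real.le_sqrt_of_sq_le; linarith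
  have hv2 : r^2 = v := Real.sq_sqrt lna
  have hs : √(0.0777 * v) = √0.0777 * r := by rw [Real.sqrt_mul nnm]
  have hc : 0.27874 ≤ √(0.0777:ℝ) := by apply Real.le_sqrt_of_sq_le; norm_num
  have h1 : 1.2 + 2 * √(0.0777 * v) ≥ 15.4095 + 4 * (r / 25.49 - 1) := by
    rw [hs]
    have := mul_le_mul_of_nonneg_right hc (show 0 ≤ r by linarith)
    rw [div_eq_mul_inv]
    norm_num at *
    linarith
  have h2 : r / 25.49 ≤ Ex (r / 25.49 - 1) := by
    have := Real.add_one_le_exp (r / 25.49 - 1); linarith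
  have h3 : (r / 25.49)^4 ≤ Ex (4 * (r/25.49 - 1)) := by
    have := pow_le_pow_left₀ psv h2 4
    rw [← Real.exp_nat_mul] at this; push_cast at this; exact this
  have h4 : (4700000:ℝ) ≤ Ex 15.4095 := by
    have e1 := Real.exp_one_gt_d9
    have : Ex 15.4095 = Ex 1 ^ 15 * Ex 0.4095 := by
      rw [← Real.exp_nat_mul, ← Real.exp_add]; norm_num
    rw [this]
    have h5 : (1.5:ℝ) ≤ Ex 0.4095 := by
      have := Real.quadratic_le_exp_of_nonneg (x := 0.4095) nnm
      have h := Real.sum_le_exp_of_nonneg (x := 0.4095) nnm 5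
      norm_num [sum_range_succ, Nat.factorial] at h; linarith
    have h6 : (2.7182818:ℝ)^15 ≤ Ex 1 ^ 15 := pow_le_pow_left₀ nnm lna 15
    calc (4700000:ℝ) ≤ 2.7182818^15 * 1.5 := by norm_num
      _ ≤ _ := by gcongr
  have h7 : 4700000 * (r/25.49)^4 ≤ Ex (1.2 + 2 * √(0.0777 * v)) := by
    calc _ ≤ Ex 15.4095 * Ex (4 * (r/25.49 - 1)) := by gcongr
      _ = Ex (15.4095 + 4 * (r/25.49 - 1)) := by rw [← Real.exp_add]
      _ ≤ _ := Real.exp_le_exp.2 h1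
  have hK : Kz v = (Ex (1.2 + 2 * √(0.0777 * v)))⁻¹ := by
    rw [Kz, ← Real.exp_neg]; congr 1; ring
  rw [hK, inv_le_comm₀ (Real.exp_pos _) psv, inv_div]
  refine le_trans ?_ h7
  rw [← hv2, div_pow, div_le_iff₀ nnm]
  have h0 : 0 ≤ r^4 := by positivity
  have e : 4700000 * (r ^ 4 / 25.49 ^ 4) * 0.09 = r^4 * (4700000 * 0.09 / 25.49^4) := by ring
  have e2 : (1:ℝ) ≤ 4700000 * 0.09 / 25.49^4 := by norm_num
  rw [e]
  nlinarith

lemma exp_half_le {v : ℝ} (hv : 649.9 ≤ v) : Ex (-v/2) ≤ 0.00001 / v^2 := by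
  have h : (v/20)^10 ≤ Ex (v/2) := by
    have h2 : v/20 ≤ Ex (v/20) := by linarith [Real.add_one_le_exp (v/20)]
    have := pow_le_pow_left₀ psv h2 10
    rw [← Real.exp_nat_mul] at this; push_cast at this
    have e : 10 * (v/20) = v/2 := by ring
    rwa [e] at this
  rw [neg_div, Real.exp_neg, inv_le_comm₀ (Real.exp_pos _) psv, inv_div]
  refine le_trans ?_ h
  have h8 : (30:ℝ)^8 ≤ (v/20)^8 := pow_le_pow_left₀ nnm lna 8
  rw [div_le_iff₀ nnm]
  have : (v/20)^10 = (v/20)^8 * (v^2/400) := by ring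
  rw [this]
  have : (30:ℝ)^8 * (v^2/400) ≤ (v/20)^8 * (v^2/400) := by gcongr
  nlinarith [sq_nonneg v]

lemma Wf_diff' {u h : ℝ} (hu : 649.9 ≤ u) (hh : 0 < h) (hh1 : h ≤ 0.002) :
    |Wf (u + h) - Wf u - Ex u * (Ex h - 1)| ≤ Ex u * (0.377 / u^2) := by
  refine (Wf_diff lna hh lna).trans ?_
  have h1 := Kz_le hu
  have h2 := exp_half_le hu
  have h3 : Ex h ≤ 1.0021 := by
    have := Real.exp_bound_div_one_sub_of_interval hh.le lna
    refine this.trans ?_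
    rw [div_le_iff₀ lna]; linarith
  have h4 : 102 ≤ Ex u * (0.0002/u^2) := by
    have h5 : Ex u * Ex (-u/2) ≥ 102 := by
      rw [← Real.exp_add]
      linarith [Real.add_one_le_exp (u + -u/2)]
    have h6 : Ex u * Ex (-u/2) ≤ Ex u * (0.0002/u^2) := by
      refine mulL (h2.trans ?_) (Real.exp_pos _).le
      gcongr; norm_num
    linarith
  have h7 : (Ex h + 1) * (2.08 * Kz u + 4.16 * Ex (-u/2)) ≤ 2.0021 * (2.08 * (0.09/u^2) + 4.16 * (0.00001/u^2)) := by
    have : 0 ≤ Kz u := (Real.exp_pos _).le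
    gcongr
    linarith
  have h8 : 2.0021 * (2.08 * (0.09/u^2) + 4.16 * (0.00001/u^2)) + 0.0002/u^2 ≤ 0.377/u^2 := by
    rw [← sub_nonneg]
    have : 0.377/u^2 - (2.0021 * (2.08 * (0.09/u^2) + 4.16 * (0.00001/u^2)) + 0.0002/u^2) = (0.377 - (2.0021 * (2.08 * 0.09 + 4.16 * 0.00001) + 0.0002))/u^2 := by ring
    rw [this]; norm_num; positivity
  calc _ ≤ Ex u * ((Ex h + 1) * (2.08 * Kz u + 4.16 * Ex (-u/2))) + Ex u * (0.0002/u^2) := by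
        rw [mul_assoc]; gcongr
    _ = Ex u * ((Ex h + 1) * (2.08 * Kz u + 4.16 * Ex (-u/2)) + 0.0002/u^2) := by ring
    _ ≤ _ := by
        refine mulL ?_ (Real.exp_pos _).le
        linarith

lemma exp_le_quad {h : ℝ} (h0 : 0 ≤ h) (h1 : h ≤ 0.002) : Ex h ≤ 1 + h + 0.502 * h^2 := by
  have := Real.exp_bound' h0 lna (n := 3) nnm
  norm_num [sum_range_succ, Nat.factorial] at this
  nlinarith [mul_nonneg h0 h0, mul_nonneg (mul_nonneg h0 h0) (sub_nonneg.2 h1)]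

theorem psi_high {u : ℝ} (hu : 650 ≤ u) : |psi (Ex u) - Ex u| ≤ 0.9 / u * Ex u := by
  have hu0 : 0 < u := by linarith
  set h := 1/u with hh
  have hh0 : 0 < h := by positivity
  have hhu : h * u = 1 := by rw [hh]; field_simp
  have hh1 : h ≤ 0.0016 := by rw [hh, div_le_iff₀ hu0]; linarith
  have hE := Real.exp_pos u
  have e9 : 0.9 / u = 0.9 * h := by rw [hh]; ring
  have e3 : 0.377/u^2 = 0.377 * h^2 := by rw [hh]; ring
  rw [e9, abs_le]
  have q := exp_le_quad hh0.le lna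
  constructor
  · have h1 := (Wf_psi (u := u - h) hh0).2
    rw [sub_add_cancel] at h1
    have h2 := Wf_diff' (u := u - h) lna hh0 lna
    rw [sub_add_cancel, abs_le] at h2
    have h3 : Ex (u - h) * Ex h = Ex u := by rw [← Real.exp_add, sub_add_cancel]
    have h4 : 0.377 / (u-h)^2 ≤ 0.378 * h^2 := by
      rw [div_le_iff₀ (by have : 0 < u - h := by linarith
                          positivity)]
      have : h * (u - h) = 1 - h^2 := by linarith [hhu, mul_sub h u h, sq h]
      have e : h^2 * (u-h)^2 = (1 - h^2)^2 := by rw [← mul_pow, this]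
      nlinarith
    have h5 : Ex (u - h) * (0.377/(u-h)^2) ≤ Ex u * (0.378 * h^2) := by
      have : Ex (u - h) ≤ Ex u := Real.exp_le_exp.2 lna
      have h0 : 0 ≤ 0.377/(u-h)^2 := by positivity
      gcongr
    have h6 : Ex (u - h) ≤ Ex u * (1 - h + h^2/2) := by
      have : Ex (u - h) = Ex u * Ex (-h) := by rw [← Real.exp_add]; ring_nf
      rw [this]
      refine mulL ?_ hE.le
      have hb : Ex (-h) * Ex h = 1 := by rw [← Real.exp_add]; simp
      have hq := Real.quadratic_le_exp_of_nonneg hh0.le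
      have hp : 1 ≤ (1 - h + h^2/2) * (1 + h + h^2/2) := by nlinarith [sq_nonneg (h^2)]
      have hp1 : 0 < 1 - h + h^2/2 := by nlinarith
      have hp2 : 0 < Ex h := Real.exp_pos h
      by_contra hc
      push Not at hc
      have : (1 - h + h^2/2) * Ex h < Ex (-h) * Ex h := mul_lt_mul_of_pos_right hc hp2
      nlinarith
    have h7 : h * psi (Ex u) ≥ Ex u * (h - h^2/2 - 0.378*h^2) := by nlinarith
    have : h * (-(0.9 * h * Ex u)) ≤ h * (psi (Ex u) - Ex u) := by nlinarith [mul_pos hE (mul_pos hh0 hh0)]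
    exact le_of_mul_le_mul_left this hh0
  · have h1 := (Wf_psi (u := u) hh0).1
    have h2 := Wf_diff' (u := u) lna hh0 lna
    rw [abs_le, e3] at h2
    have : h * (psi (Ex u) - Ex u) ≤ h * (0.9 * h * Ex u) := by nlinarith [mul_pos hE (mul_pos hh0 hh0)]
    exact le_of_mul_le_mul_left this hh0

/-- `log ⌊y⌋!` -/
def TT (y : ℝ) : ℝ := Lo (⌊y⌋₊.factorial : ℝ)

lemma log_fact_bd (m : ℕ) (hm : 1 ≤ m) : m * Lo m - m + 1 ≤ Lo (m.factorial : ℝ) ∧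
    Lo (m.factorial : ℝ) ≤ m * Lo m - m + 1 + Lo m := by
  induction m, hm using Nat.le_induction with
  | base => simp
  | succ m hm ih =>
    have hm0 : (0:ℝ) < m := by exact_mod_cast hm
    rw [Nat.factorial_succ]
    push_cast
    rw [Real.log_mul psv psv]
    have h1 : Lo (m+1) - Lo m ≤ 1/m := by
      rw [← Real.log_div psv psv]
      have := Real.log_le_sub_one_of_pos (x := ((m:ℝ)+1)/m) psv
      refine this.trans (le_of_eq ?_); field_simp; ring
    have h2 : 1/((m:ℝ)+1) ≤ Lo (m+1) - Lo m := by
      rw [← Real.log_div psv psv]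
      have := Real.one_sub_inv_le_log_of_pos (x := ((m:ℝ)+1)/m) psv
      refine le_trans (le_of_eq ?_) this; field_simp; ring
    have h3 : m * (Lo (m+1) - Lo m) ≤ 1 := by
      have := mulL h1 hm0.le
      rwa [mul_one_div_cancel hm0.ne'] at this
    have h4 : 1 ≤ (m + 1) * (Lo (m+1) - Lo m) := by
      have := mulL h2 (show (0:ℝ) ≤ m + 1 by positivity)
      rwa [mul_one_div_cancel psv] at this
    constructor <;> nlinarith [ih.1, ih.2]

lemma TT_bd {y : ℝ} (hy : 1 ≤ y) : |TT y - (y * Lo y - y)| ≤ 1 + Lo y := by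
  have hm : 1 ≤ ⌊y⌋₊ := Nat.le_floor (by exact_mod_cast hy)
  obtain ⟨h1, h2⟩ := log_fact_bd _ hm
  have hm0 : (0:ℝ) < (⌊y⌋₊:ℝ) := by exact_mod_cast hm
  have ha : (⌊y⌋₊ : ℝ) ≤ y := Nat.floor_le lna
  have hb : y < ⌊y⌋₊ + 1 := Nat.lt_floor_add_one y
  set m : ℝ := (⌊y⌋₊ : ℝ) with hmd
  have hm1 : 1 ≤ m := by rw [hmd]; exact_mod_cast hm
  have hl : Lo m ≤ Lo y := Real.log_le_log hm0 ha
  have hl0 : 0 ≤ Lo m := Real.log_nonneg hm1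
  -- m (log y - log m) ≤ y - m ≤ y (log y - log m)
  have h3 : m * (Lo y - Lo m) ≤ y - m := by
    rw [← Real.log_div psv psv]
    have := mulL (Real.log_le_sub_one_of_pos (x := y/m) psv) hm0.le
    refine this.trans (le_of_eq ?_); field_simp
  have h4 : y - m ≤ y * (Lo y - Lo m) := by
    rw [← Real.log_div psv psv]
    have := mulL (Real.one_sub_inv_le_log_of_pos (x := y/m) psv) (show 0 ≤ y by linarith)
    refine le_trans (le_of_eq ?_) this; field_simp
  unfold TT
  rw [abs_le]
  constructor <;> nlinarith

lemma TT_eq {x : ℝ} (hx : 0 ≤ x) {d : ℕ} (hd : 0 < d) :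
    TT (x / d) = ∑ n ∈ Finset.Ioc 0 ⌊x⌋₊, vM n * ((⌊x⌋₊ / n / d : ℕ) : ℝ) := by
  rw [TT, Nat.floor_div_natCast]
  set X := ⌊x⌋₊
  have h1 : Lo ((X / d).factorial : ℝ) = ∑ n ∈ Finset.Ioc 0 (X/d), Lo n := by
    induction (X/d) with
    | zero => simp
    | succ k ih =>
      rw [Nat.factorial_succ, Nat.cast_mul, Real.log_mul psv psv, ih,
        Finset.sum_Ioc_succ_top oma, add_comm]
  have h2 := ArithmeticFunction.sum_Ioc_mul_zeta_eq_sum (R := ℝ) vM (X/d)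
  rw [ArithmeticFunction.vonMangoldt_mul_zeta] at h2
  rw [h1]
  have h3 : ∑ n ∈ Finset.Ioc 0 (X/d), Lo n = ∑ n ∈ Finset.Ioc 0 (X/d), ArithmeticFunction.log n := by
    refine sumC fun n _ => ?_
    rw [ArithmeticFunction.log_apply]
  rw [h3, h2]
  have hsub : Finset.Ioc 0 (X/d) ⊆ Finset.Ioc 0 X := Finset.Ioc_subset_Ioc_right (Nat.div_le_self _ _)
  rw [← Finset.sum_subset hsub]
  · refine sumC fun n _ => ?_
    rw [Nat.div_right_comm]
  · intro n hn hn'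
    have hn0 : 0 < n := (Finset.mem_Ioc.1 hn).1
    have : X / d < n := by
      by_contra hc
      exact hn' (Finset.mem_Ioc.2 ⟨hn0, by omega⟩)
    rw [Nat.div_right_comm, Nat.div_eq_of_lt this]; simp

/-- weighted list sums -/
def LS {R : Type*} [Semiring R] (L : List (ℕ × R)) (f : ℕ → R) : R := (L.map fun p => p.2 * f p.1).sum

lemma LS_nil {R : Type*} [Semiring R] (f : ℕ → R) : LS [] f = 0 := rfl
lemma LS_cons {R : Type*} [Semiring R] (p : ℕ × R) (L : List (ℕ × R)) (f : ℕ → R) : LS (p :: L) f = p.2 * f p.1 + LS L f := by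
  simp [LS]

lemma LS_sum (L : List (ℕ × ℝ)) (s : Finset ℕ) (F : ℕ → ℕ → ℝ) :
    LS L (fun d => ∑ n ∈ s, F n d) = ∑ n ∈ s, LS L (F n) := by
  induction L with
  | nil => simp [LS_nil]
  | cons p L ih => simp only [LS_cons, ih, sum_add_distrib, mul_sum]

lemma LS_mul (L : List (ℕ × ℝ)) (c : ℝ) (f : ℕ → ℝ) : LS L (fun d => c * f d) = c * LS L f := by
  induction L with
  | nil => simp [LS_nil]
  | cons p L ih => simp only [LS_cons, ih]; ring

/-- sum of absolute values of weights -/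
def LA (L : List (ℕ × ℝ)) : ℝ := (L.map fun p => |p.2|).sum

lemma stir (L : List (ℕ × ℝ)) {x : ℝ} (hL : ∀ p ∈ L, 0 < p.1 ∧ (p.1:ℝ) ≤ x) (hx : 1 ≤ x) :
    |LS L (fun d => TT (x / d)) - (x * (Lo x - 1) * LS L (fun d => 1/(d:ℝ)) - x * LS L (fun d => Lo d / d))| ≤ LA L * (1 + Lo x) := by
  induction L with
  | nil => simp [LS_nil, LA]
  | cons p L ih =>
    have ih' := ih (fun q hq => hL q (List.mem_cons_of_mem _ hq))
    obtain ⟨h1, h2⟩ := hL p List.mem_cons_self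
    have hp : (0:ℝ) < p.1 := by exact_mod_cast h1
    have hp1 : (1:ℝ) ≤ p.1 := by exact_mod_cast h1
    have hb := TT_bd (y := x / p.1) (by rw [le_div_iff₀ hp]; linarith)
    have hlog : Lo (x / p.1) = Lo x - Lo p.1 := Real.log_div lna hp.ne'
    have hlp : 0 ≤ Lo p.1 := Real.log_nonneg hp1
    have e : LS (p :: L) (fun d => TT (x / d)) - (x * (Lo x - 1) * LS (p :: L) (fun d => 1/(d:ℝ)) - x * LS (p :: L) (fun d => Lo d / d)) =
      p.2 * (TT (x / p.1) - (x / p.1 * Lo (x/p.1) - x / p.1)) + (LS L (fun d => TT (x / d)) - (x * (Lo x - 1) * LS L (fun d => 1/(d:ℝ)) - x * LS L (fun d => Lo d / d))) := by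
      simp only [LS_cons]
      rw [hlog]; ring
    have e2 : LA (p :: L) = |p.2| + LA L := by simp [LA]
    rw [e, e2, add_mul]
    refine (abs_add_le _ _).trans (add_le_add ?_ ih')
    rw [abs_mul]
    refine mulL (hb.trans ?_) (abs_nonneg _)
    linarith

/-- the remainder function -/
def ee (L : List (ℕ × ℝ)) (v : ℕ) : ℝ := 1 - LS L (fun d => ((v / d : ℕ) : ℝ))

lemma psi_id (L : List (ℕ × ℝ)) {x : ℝ} (hL : ∀ p ∈ L, 0 < p.1 ∧ (p.1:ℝ) ≤ x) (hx : 1 ≤ x)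
    (h0 : LS L (fun d => 1/(d:ℝ)) = 0) :
    |psi x + x * LS L (fun d => Lo d / d) - ∑ n ∈ Finset.Ioc 0 ⌊x⌋₊, vM n * ee L (⌊x⌋₊ / n)| ≤ LA L * (1 + Lo x) := by
  have h := stir L hL hx
  rw [h0] at h
  have e1 : LS L (fun d => TT (x / d)) = ∑ n ∈ Finset.Ioc 0 ⌊x⌋₊, vM n * LS L (fun d => ((⌊x⌋₊ / n / d : ℕ) : ℝ)) := by
    have : LS L (fun d => TT (x / d)) = LS L (fun d => ∑ n ∈ Finset.Ioc 0 ⌊x⌋₊, vM n * ((⌊x⌋₊ / n / d : ℕ) : ℝ)) := by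
      unfold LS
      congr 1
      refine List.map_congr_left fun p hp => ?_
      show p.2 * TT (x / p.1) = p.2 * _
      rw [TT_eq (x := x) lna (hL p hp).1]
    rw [this, LS_sum]
    refine sumC fun n _ => ?_
    rw [LS_mul]
  have e2 : ∑ n ∈ Finset.Ioc 0 ⌊x⌋₊, vM n * ee L (⌊x⌋₊ / n) = psi x - LS L (fun d => TT (x / d)) := by
    rw [e1, psi, ← sum_sub_distrib]
    refine sumC fun n _ => ?_
    rw [ee]; ring
  rw [e2]
  refine le_trans (le_of_eq ?_) h
  congr 1; ring

lemma psi_div {x : ℝ} (hx : 0 ≤ x) {v : ℕ} (hv : 0 < v) : psi (x / v) = ∑ n ∈ Finset.Ioc 0 ⌊x⌋₊, vM n * (if v ≤ ⌊x⌋₊ / n then 1 else 0) := by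
  rw [psi, Nat.floor_div_natCast]
  set X := ⌊x⌋₊
  have hsub : Finset.Ioc 0 (X/v) ⊆ Finset.Ioc 0 X := Finset.Ioc_subset_Ioc_right (Nat.div_le_self _ _)
  rw [← Finset.sum_subset hsub]
  · refine sumC fun n hn => ?_
    obtain ⟨h1, h2⟩ := Finset.mem_Ioc.1 hn
    rw [if_pos, mul_one]
    rw [Nat.le_div_iff_mul_le h1]; rw [Nat.le_div_iff_mul_le hv] at h2; linarith [mul_comm v n]
  · intro n hn hn'
    have h1 : 0 < n := (Finset.mem_Ioc.1 hn).1
    rw [if_neg, mul_zero]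
    intro h
    rw [Nat.le_div_iff_mul_le h1] at h
    exact hn' (Finset.mem_Ioc.2 ⟨h1, by rw [Nat.le_div_iff_mul_le hv]; linarith [mul_comm v n]⟩)

lemma tele (M : ℕ → ℝ) (h0 : M 1 = 0) (J : ℕ) (k : ℕ) (hk : 1 ≤ k) :
    ∑ v ∈ Finset.Ico 2 J, (M v - M (v-1)) * (if v ≤ k then 1 else 0) = M (min k (J-1)) ∨ J ≤ 1 := by
  by_cases hJ : J ≤ 1
  · right; exact hJ
  left
  induction J, (show 2 ≤ J by omega) using Nat.le_induction with
  | base => simp [Nat.min_eq_right hk, h0]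
  | succ J hJ2 ih =>
    rw [Finset.sum_Ico_succ_top hJ2, ih oma]
    by_cases h : J ≤ k
    · rw [if_pos h, Nat.min_eq_right oma, Nat.min_eq_right oma]; simp
    · rw [if_neg h, Nat.min_eq_left oma, Nat.min_eq_left oma]; simp

/-- one-sided Diamond–Erdős inequality; `τ = ±1` -/
theorem DE_side (L : List (ℕ × ℝ)) {x τ : ℝ} (hτ : |τ| = 1) (hL : ∀ p ∈ L, 0 < p.1 ∧ (p.1:ℝ) ≤ x) (hx : 1 ≤ x)
    (h0 : LS L (fun d => 1/(d:ℝ)) = 0) (M : ℕ → ℝ) (hM : M 1 = 0) {J : ℕ} (hJ : 2 ≤ J) {B : ℝ}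
    (he : ∀ v, 1 ≤ v → v < J → τ * ee L v ≤ M v) (hB : ∀ v, J ≤ v → τ * ee L v ≤ M (J-1) + B) :
    τ * (psi x + x * LS L (fun d => Lo d / d)) ≤
      ∑ v ∈ Finset.Ico 2 J, (M v - M (v-1)) * psi (x / v) + B * psi (x / J) + LA L * (1 + Lo x) := by
  have h := psi_id L hL hx h0
  set E := ∑ n ∈ Finset.Ioc 0 ⌊x⌋₊, vM n * ee L (⌊x⌋₊ / n)
  have h1 : τ * (psi x + x * LS L (fun d => Lo d / d)) ≤ τ * E + LA L * (1 + Lo x) := by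
    have : τ * (psi x + x * LS L (fun d => Lo d / d) - E) ≤ LA L * (1 + Lo x) := by
      refine (le_abs_self _).trans ?_
      rw [abs_mul, hτ, one_mul]; exact h
    linarith
  refine h1.trans ?_
  gcongr
  have e1 : ∑ v ∈ Finset.Ico 2 J, (M v - M (v-1)) * psi (x / v) + B * psi (x / J) =
      ∑ n ∈ Finset.Ioc 0 ⌊x⌋₊, vM n * (M (min (⌊x⌋₊/n) (J-1)) + B * (if J ≤ ⌊x⌋₊ / n then 1 else 0)) := by
    have : ∀ v ∈ Finset.Ico 2 J, (M v - M (v-1)) * psi (x / v) = ∑ n ∈ Finset.Ioc 0 ⌊x⌋₊, vM n * ((M v - M (v-1)) * (if v ≤ ⌊x⌋₊ / n then 1 else 0)) := by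
      intro v hv
      rw [psi_div lna (by have := (Finset.mem_Ico.1 hv).1; omega), mul_sum]
      refine sumC fun n _ => ?_
      ring
    rw [sumC this, Finset.sum_comm, psi_div lna oma, mul_sum, ← sum_add_distrib]
    refine sumC fun n hn => ?_
    obtain ⟨hn0, hn1⟩ := Finset.mem_Ioc.1 hn
    rw [← mul_sum]
    have hk : 1 ≤ ⌊x⌋₊ / n := by rw [Nat.le_div_iff_mul_le hn0]; omega
    rcases tele M hM J _ hk with h | h
    · rw [h]; ring
    · omega
  rw [e1, mul_sum]
  refine sum_le_sum fun n hn => ?_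
  obtain ⟨hn0, hn1⟩ := Finset.mem_Ioc.1 hn
  have hk : 1 ≤ ⌊x⌋₊ / n := by rw [Nat.le_div_iff_mul_le hn0]; omega
  rw [mul_left_comm]
  refine mulL ?_ ArithmeticFunction.vonMangoldt_nonneg
  by_cases h : J ≤ ⌊x⌋₊ / n
  · rw [if_pos h, Nat.min_eq_right oma, mul_one]; exact hB _ h
  · rw [if_neg h, Nat.min_eq_left oma, mul_zero, add_zero]; exact he _ hk (by omega)

/-! Fixed point logarithms, scale `2^48`. -/

/-- lower Horner scheme for `∑ Z^(2j)/(2j+1)`, `q ≈ Z²` -/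
def hL (q : ℕ) : ℕ → ℕ → ℕ
  | 0, _ => 0
  | n+1, i => T48 / (2*i+1) + q * hL q n (i+1) / T48

def hU (q : ℕ) : ℕ → ℕ → ℕ
  | 0, _ => T48 * 2
  | n+1, i => T48 / (2*i+1) + 1 + (q * hU q n (i+1) / T48 + 1)

def RR (Z : ℝ) (i : ℕ) : ℝ := ∑' j : ℕ, Z^(2*j) / (2*((j:ℝ)+i)+1)

lemma RR_summable {Z : ℝ} (h0 : 0 ≤ Z) (h1 : Z ≤ 1/3) (i : ℕ) : Summable fun j : ℕ => Z^(2*j) / (2*((j:ℝ)+i)+1) := by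
  refine Summable.of_nonneg_of_le (fun j => by positivity) (fun j => ?_) (summable_geometric_of_lt_one (r := 1/9) nnm nnm)
  rw [pow_mul]
  have : Z^2 ≤ 1/9 := by nlinarith
  refine (div_le_self psv ?_).trans (pow_le_pow_left₀ psv this j)
  have : (0:ℝ) ≤ j := by positivity
  have : (0:ℝ) ≤ i := by positivity
  linarith

lemma RR_nonneg {Z : ℝ} (h0 : 0 ≤ Z) (i : ℕ) : 0 ≤ RR Z i := tsum_nonneg fun j => by positivity

lemma RR_le {Z : ℝ} (h0 : 0 ≤ Z) (h1 : Z ≤ 1/3) (i : ℕ) : RR Z i ≤ 2 := by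
  have hs : Summable fun j : ℕ => (1/9:ℝ)^j := summable_geometric_of_lt_one nnm nnm
  have : RR Z i ≤ ∑' j : ℕ, (1/9:ℝ)^j := by
    refine (RR_summable h0 h1 i).tsum_le_tsum (fun j => ?_) hs
    rw [pow_mul]
    have : Z^2 ≤ 1/9 := by nlinarith
    refine (div_le_self psv ?_).trans (pow_le_pow_left₀ psv this j)
    have : (0:ℝ) ≤ j := by positivity
    have : (0:ℝ) ≤ i := by positivity
    linarith
  rw [tsum_geometric_of_lt_one nnm nnm] at this
  norm_num at this; linarith

lemma RR_succ {Z : ℝ} (h0 : 0 ≤ Z) (h1 : Z ≤ 1/3) (i : ℕ) : RR Z i = 1/(2*(i:ℝ)+1) + Z^2 * RR Z (i+1) := by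
  rw [RR, (RR_summable h0 h1 i).tsum_eq_zero_add, RR, ← tsum_mul_left]
  congr 1
  · simp
  · refine tsum_congr fun j => ?_
    push_cast
    rw [mul_add, pow_add, ← mul_div_assoc]
    ring_nf

lemma fdiv_le (a b : ℕ) : ((a / b : ℕ) : ℝ) ≤ (a:ℝ) / b := Nat.cast_div_le
lemma le_fdiv (a b : ℕ) : (a:ℝ) / b ≤ ((a / b : ℕ) : ℝ) + 1 := by
  rcases Nat.eq_zero_or_pos b with h | h
  · subst h; simp
  have hb : (0:ℝ) < b := by exact_mod_cast h
  rw [div_le_iff₀ hb]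
  have := Nat.lt_div_mul_add (a := a) h
  have h2 : a ≤ (a/b + 1) * b := by rw [add_mul, one_mul]; exact this.le
  exact_mod_cast h2

lemma hL_le {Z : ℝ} (h0 : 0 ≤ Z) (h1 : Z ≤ 1/3) {q : ℕ} (hq : (q:ℝ) ≤ 2^48 * Z^2) (n i : ℕ) :
    (hL q n i : ℝ) ≤ 2^48 * RR Z i := by
  induction n generalizing i with
  | zero => simp [hL]; exact RR_nonneg h0 i
  | succ n ih =>
    rw [hL, RR_succ h0 h1]
    push_cast
    have a1 := fdiv_le T48 (2*i+1)
    have a2 := fdiv_le (q * hL q n (i+1)) T48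
    push_cast at a1 a2
    have a3 : (q:ℝ) * hL q n (i+1) ≤ (2^48 * Z^2) * (2^48 * RR Z (i+1)) :=
      mul_le_mul hq (ih _) psv psv
    have a4 : (q:ℝ) * hL q n (i+1) / T48 ≤ 2^48 * (Z^2 * RR Z (i+1)) := by
      rw [div_le_iff₀ nnm]; refine a3.trans (le_of_eq ?_); ring
    have a5 : (T48:ℝ) / (2*i+1) = 2^48 * (1/(2*i+1)) := by ring
    rw [a5] at a1
    linarith

lemma le_hU {Z : ℝ} (h0 : 0 ≤ Z) (h1 : Z ≤ 1/3) {q : ℕ} (hq : 2^48 * Z^2 ≤ (q:ℝ)) (n i : ℕ) :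
    2^48 * RR Z i ≤ (hU q n i : ℝ) := by
  induction n generalizing i with
  | zero => simp [hU]; have := RR_le h0 h1 i; linarith
  | succ n ih =>
    rw [hU, RR_succ h0 h1]
    push_cast
    have a1 := le_fdiv T48 (2*i+1)
    have a2 := le_fdiv (q * hU q n (i+1)) T48
    push_cast at a1 a2
    have a3 : (2^48 * Z^2) * (2^48 * RR Z (i+1)) ≤ (q:ℝ) * hU q n (i+1) :=
      mul_le_mul hq (ih _) (mul_nonneg psv (RR_nonneg h0 _)) psv
    have a4 : 2^48 * (Z^2 * RR Z (i+1)) ≤ (q:ℝ) * hU q n (i+1) / T48 := by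
      rw [le_div_iff₀ nnm]; refine le_trans (le_of_eq ?_) a3; ring
    have a5 : (T48:ℝ) / (2*i+1) = 2^48 * (1/(2*i+1)) := by ring
    rw [a5] at a1
    linarith

lemma RR_log {Z : ℝ} (h0 : 0 ≤ Z) (h1 : Z ≤ 1/3) : Lo ((1+Z)/(1-Z)) = 2 * Z * RR Z 0 := by
  have h := Real.hasSum_log_sub_log_of_abs_lt_one (x := Z) (by rw [abs_of_nonneg h0]; linarith)
  rw [Real.log_div lna lna, ← h.tsum_eq, RR, ← tsum_mul_left]
  refine tsum_congr fun j => ?_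
  push_cast
  rw [pow_succ]; ring

def zz (m p : ℕ) : ℕ := T48 * (m - p) / (m + p)

/-- lower fixed-point log -/
def lgL (m : ℕ) : ℕ :=
  (fun k => (fun z => k * 195103586431999 + 2 * z * hL (z * z / T48) 12 0 / T48)
    (zz m (2^k))) (Nat.log2 m)
/-- upper fixed-point log -/
def lgU (m : ℕ) : ℕ :=
  (fun k => (fun z => k * 195103586572737 + (2 * z * hU (z * z / T48 + 1) 12 0 / T48 + 1))
    (zz m (2^k) + 1)) (Nat.log2 m)

lemma log_split {m : ℕ} (hm : 0 < m) : ∃ Z : ℝ, 0 ≤ Z ∧ Z ≤ 1/3 ∧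
    Lo m = (Nat.log2 m) * Lo 2 + 2 * Z * RR Z 0 ∧
    (zz m (2^(Nat.log2 m)) : ℝ) ≤ 2^48 * Z ∧ 2^48 * Z ≤ (zz m (2^(Nat.log2 m)) + 1 : ℝ) := by
  set k := Nat.log2 m with hk
  have hk1 : 2^k ≤ m := Nat.log2_self_le hm.ne'
  have hk2 : m < 2^(k+1) := Nat.lt_log2_self
  have hm0 : (0:ℝ) < m := by exact_mod_cast hm
  have hp0 : (0:ℝ) < 2^k := by positivity
  have r1 : (2:ℝ)^k ≤ m := by exact_mod_cast hk1
  have r2 : (m:ℝ) ≤ 2 * 2^k := by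
    have : m ≤ 2 * 2^k := by rw [← pow_succ']; exact hk2.le
    exact_mod_cast this
  have hZ0 : (0:ℝ) ≤ ((m:ℝ) - 2^k)/(m + 2^k) := div_nonneg lna psv
  have hZ1 : ((m:ℝ) - 2^k)/(m + 2^k) ≤ 1/3 := by rw [div_le_iff₀ psv]; linarith
  refine ⟨((m:ℝ) - 2^k)/(m + 2^k), hZ0, hZ1, ?_, ?_, ?_⟩
  · rw [← RR_log hZ0 hZ1, ← Real.log_pow, ← Real.log_mul psv ?_]
    · congr 1
      have : (1 + ((m:ℝ) - 2^k)/(m + 2^k))/(1 - ((m:ℝ) - 2^k)/(m + 2^k)) = m / 2^k := by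
        have h1 : (1 + ((m:ℝ) - 2^k)/(m + 2^k)) = 2*m/(m+2^k) := by field_simp; ring
        have h2 : (1 - ((m:ℝ) - 2^k)/(m + 2^k)) = 2*2^k/(m+2^k) := by field_simp; ring
        rw [h1, h2]; field_simp
      rw [this]; field_simp
    · apply (div_pos _ _).ne' <;> linarith
  · rw [zz]
    refine (fdiv_le _ _).trans (le_of_eq ?_)
    push_cast [Nat.cast_sub hk1]
    ring
  · rw [zz]
    refine le_trans (le_of_eq ?_) (le_fdiv _ _)
    push_cast [Nat.cast_sub hk1]
    ring

theorem lgL_le (m : ℕ) (hm : 0 < m) : (lgL m : ℝ) ≤ 2^48 * Lo m := by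
  obtain ⟨Z, h0, h1, h2, h3, h4⟩ := log_split hm
  simp only [lgL]
  set z := zz m (2^(Nat.log2 m))
  have hq : ((z * z / T48 : ℕ) : ℝ) ≤ 2^48 * Z^2 := by
    refine (fdiv_le _ _).trans ?_
    push_cast
    rw [div_le_iff₀ nnm]
    have := mul_le_mul h3 h3 psv psv
    refine this.trans (le_of_eq ?_); ring
  have a1 := hL_le h0 h1 hq 12 0
  have a2 := fdiv_le (2 * z * hL (z * z / T48) 12 0) T48
  rw [h2]
  push_cast at a2 ⊢
  have a3 : (z:ℝ) * hL (z * z / T48) 12 0 ≤ (2^48*Z) * (2^48 * RR Z 0) :=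
    mul_le_mul h3 a1 psv psv
  have a4 : 2 * (z:ℝ) * hL (z * z / T48) 12 0 / T48 ≤ 2^48 * (2 * Z * RR Z 0) := by
    rw [div_le_iff₀ nnm]; nlinarith
  have a5 : (195103586431999:ℝ) ≤ 2^48 * Lo 2 := by have := Real.log_two_gt_d9; linarith
  have a6 := mulL a5 (show (0:ℝ) ≤ (Nat.log2 m : ℝ) by positivity)
  linarith

theorem le_lgU (m : ℕ) (hm : 0 < m) : 2^48 * Lo m ≤ (lgU m : ℝ) := by
  obtain ⟨Z, h0, h1, h2, h3, h4⟩ := log_split hm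
  simp only [lgU]
  have h4' : 2^48 * Z ≤ ((zz m (2^(Nat.log2 m)) + 1 : ℕ) : ℝ) := by push_cast; exact h4
  set z := zz m (2^(Nat.log2 m)) + 1
  have hq : 2^48 * Z^2 ≤ ((z * z / T48 + 1 : ℕ) : ℝ) := by
    push_cast
    refine le_trans ?_ (le_fdiv _ _)
    push_cast
    rw [le_div_iff₀ nnm]
    have := mul_le_mul h4' h4' psv psv
    refine le_trans (le_of_eq ?_) this; ring
  have a1 := le_hU h0 h1 hq 12 0
  have a2 := le_fdiv (2 * z * hU (z * z / T48 + 1) 12 0) T48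
  rw [h2]
  push_cast at a2 ⊢
  have a3 : (2^48*Z) * (2^48 * RR Z 0) ≤ (z:ℝ) * hU (z * z / T48 + 1) 12 0 :=
    mul_le_mul h4' a1 (mul_nonneg psv (RR_nonneg h0 _)) psv
  have a4 : 2^48 * (2 * Z * RR Z 0) ≤ 2 * (z:ℝ) * hU (z * z / T48 + 1) 12 0 / T48 := by
    rw [le_div_iff₀ nnm]; nlinarith
  have a5 : 2^48 * Lo 2 ≤ (195103586572737:ℝ) := by have := Real.log_two_lt_d9; linarith
  have a6 := mulL a5 (show (0:ℝ) ≤ (Nat.log2 m : ℝ) by positivity)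
  linarith

/-! Packed-lane arithmetic for kernel computations. -/

def sm (f : ℕ → ℕ) (k : ℕ) : ℕ → ℕ :=
  Nat.rec (motive := fun _ => ℕ → ℕ) f (fun k ih a => Nat.add (ih a) (ih (Nat.add a (Nat.pow 2 k)))) k

lemma sm_succ (f : ℕ → ℕ) (k a : ℕ) : sm f (k+1) a = sm f k a + sm f k (a + 2^k) := rfl

lemma sm_eq (f : ℕ → ℕ) (k a : ℕ) : sm f k a = ∑ i ∈ Frg (2^k), f (a + i) := by
  induction k generalizing a with
  | zero => simp [sm]
  | succ k ih =>
    rw [sm_succ, ih, ih, pow_succ, mul_two, Finset.sum_range_add]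
    congr 1
    exact sumC fun i _ => by rw [add_assoc]

/-- exact packing -/
def pack (w n : ℕ) (f : ℕ → ℕ) : ℕ := ∑ i ∈ Frg n, f i * 2^(w*i)

lemma pack_succ (w n : ℕ) (f : ℕ → ℕ) : pack w (n+1) f = pack w n f + f n * 2^(w*n) := sum_range_succ _ _

lemma pack_congr {w n : ℕ} {f g : ℕ → ℕ} (h : ∀ i < n, f i = g i) : pack w n f = pack w n g :=
  sumC fun i hi => by rw [h i (Finset.mem_range.1 hi)]

lemma pack_lt {w n : ℕ} {f : ℕ → ℕ} (h : ∀ i < n, f i < 2^w) : pack w n f < 2^(w*n) := by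
  induction n with
  | zero => simp [pack]
  | succ n ih =>
    rw [pack_succ, mul_add, mul_one, pow_add]
    have h1 := ih fun i hi => h i oma
    have h2 : f n + 1 ≤ 2^w := h n oma
    have h3 := Nat.mul_le_mul_right (2^(w*n)) h2
    rw [add_mul, one_mul] at h3
    rw [mul_comm (2^(w*n))]
    omega

lemma pack_add (w n : ℕ) (f g : ℕ → ℕ) : pack w n f + pack w n g = pack w n (fun i => f i + g i) := by
  rw [pack, pack, pack, ← sum_add_distrib]
  exact sumC fun i _ => by ring

lemma pack_smul (w n c : ℕ) (f : ℕ → ℕ) : c * pack w n f = pack w n (fun i => c * f i) := by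
  rw [pack, pack, mul_sum]
  exact sumC fun i _ => by ring

lemma pack_sub (w n : ℕ) (f g : ℕ → ℕ) (h : ∀ i < n, g i ≤ f i) : pack w n f - pack w n g = pack w n (fun i => f i - g i) := by
  apply Nat.sub_eq_of_eq_add
  rw [pack_add]
  exact pack_congr fun i hi => by have := h i hi; omega

lemma pack_split (w r m : ℕ) (f : ℕ → ℕ) : pack w (r + m) f = pack w r f + 2^(w*r) * pack w m (fun i => f (r+i)) := by
  rw [pack, Finset.sum_range_add, pack, pack, mul_sum]
  congr 1
  exact sumC fun i _ => by rw [mul_add, pow_add]; ring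

lemma land_split {m a b x y : ℕ} (ha : a < 2^m) (hb : b < 2^m) : (2^m*x + a) &&& (2^m*y+b) = 2^m*(x &&& y) + (a &&& b) := by
  apply Nat.eq_of_testBit_eq
  intro i
  rw [Nat.testBit_and, Nat.testBit_two_pow_mul_add _ ha, Nat.testBit_two_pow_mul_add _ hb,
    Nat.testBit_two_pow_mul_add _ (lt_of_le_of_lt Nat.and_le_left ha)]
  split_ifs <;> rw [Nat.testBit_and]

lemma pack_land {w n : ℕ} {f g : ℕ → ℕ} (hf : ∀ i < n, f i < 2^w) (hg : ∀ i < n, g i < 2^w) :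
    pack w n f &&& pack w n g = pack w n (fun i => f i &&& g i) := by
  induction n with
  | zero => simp [pack]
  | succ n ih =>
    have a1 := pack_lt (w := w) (n := n) (f := f) fun i hi => hf i oma
    have a2 := pack_lt (w := w) (n := n) (f := g) fun i hi => hg i oma
    rw [pack_succ, pack_succ, pack_succ, ← ih (fun i hi => hf i oma) (fun i hi => hg i oma)]
    have := land_split (x := f n) (y := g n) a1 a2
    rw [add_comm (pack w n f), add_comm (pack w n g), mul_comm (f n), mul_comm (g n), this]
    ring

lemma pack_shr {w n : ℕ} {f : ℕ → ℕ} (hf : ∀ i < n, f i < 2^w) (r : ℕ) :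
    pack w n f >>> (w*r) = pack w n (fun i => if i + r < n then f (i+r) else 0) := by
  rw [Nat.shiftRight_eq_div_pow]
  rcases le_or_gt r n with h | h
  · obtain ⟨m, rfl⟩ := Nat.exists_eq_add_of_le h
    rw [pack_split, Nat.add_mul_div_left _ _ psv, Nat.div_eq_of_lt (pack_lt fun i hi => hf i oma), zero_add]
    rw [add_comm r m, pack_split]
    have : pack w r (fun i => (fun i => if i + r < m + r then f (i+r) else 0) (m+i)) = 0 := by
      rw [pack]; apply Finset.sum_eq_zero; intro i hi
      have : ¬ (m + i + r < m + r) := by omega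
      simp [this]
    rw [this, mul_zero, add_zero]
    exact pack_congr fun i hi => by rw [if_pos oma, add_comm]
  · rw [Nat.div_eq_of_lt]
    · rw [pack]; symm; apply Finset.sum_eq_zero; intro i hi
      have : ¬ (i + r < n) := by omega
      simp [this]
    · refine (pack_lt hf).trans_le (Nat.pow_le_pow_right nnm (Nat.mul_le_mul_left _ h.le))

def gt (w T i : ℕ) : ℕ := Nat.mod (Nat.shiftRight T (Nat.mul w i)) (Nat.pow 2 w)

lemma gt_pack {w n : ℕ} {f : ℕ → ℕ} (hf : ∀ i < n, f i < 2^w) {i : ℕ} (hi : i < n) : gt w (pack w n f) i = f i := by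
  show (pack w n f >>> (w*i)) % 2^w = f i
  rw [pack_shr hf]
  obtain ⟨m, rfl⟩ : ∃ m, n = 1 + m := ⟨n-1, by omega⟩
  rw [pack_split]
  simp only [mul_one, Nat.add_mul_mod_self_left]
  have : pack w 1 (fun j => if j + i < 1 + m then f (j+i) else 0) = f i := by
    simp [pack, hi]
  rw [this, Nat.mod_eq_of_lt (hf i hi)]

/-- lane-wise maximum; lanes `< 2^W`, lane width `W+1` -/
def mx (W ON X Y : ℕ) : ℕ :=
  (fun C => (fun H => Nat.add Y (Nat.land C (Nat.sub H (Nat.shiftRight H W)))) (Nat.land C (Nat.shiftLeft ON W)))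
    (Nat.sub (Nat.add X (Nat.shiftLeft ON W)) Y)

lemma mx_pack {W n : ℕ} {f g : ℕ → ℕ} (hf : ∀ i < n, f i < 2^W) (hg : ∀ i < n, g i < 2^W) :
    mx W (pack (W+1) n (fun _ => 1)) (pack (W+1) n f) (pack (W+1) n g) = pack (W+1) n (fun i => max (f i) (g i)) := by
  have hp : 2^(W+1) = 2 * 2^W := by rw [pow_succ]; ring
  show pack (W+1) n g + (((pack (W+1) n f + pack (W+1) n (fun _ => 1) <<< W) - pack (W+1) n g) &&&
    ((((pack (W+1) n f + pack (W+1) n (fun _ => 1) <<< W) - pack (W+1) n g) &&& (pack (W+1) n (fun _ => 1) <<< W)) -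
    (((pack (W+1) n f + pack (W+1) n (fun _ => 1) <<< W) - pack (W+1) n g) &&& (pack (W+1) n (fun _ => 1) <<< W)) >>> W)) = _
  have e0 : pack (W+1) n (fun _ => 1) <<< W = pack (W+1) n (fun _ => 2^W) := by
    rw [Nat.shiftLeft_eq, mul_comm, pack_smul]; simp
  rw [e0, pack_add, pack_sub _ _ _ _ (fun i hi => by have := hg i hi; omega)]
  have hc : ∀ i < n, f i + 2^W - g i < 2^(W+1) := fun i hi => by have := hf i hi; have := hg i hi; omega
  rw [pack_land hc (fun i _ => by rw [hp]; have : 0 < 2^W := by positivity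
                                  omega)]
  have e1 : pack (W+1) n (fun i => (f i + 2^W - g i) &&& 2^W) = 2^W * pack (W+1) n (fun i => if g i ≤ f i then 1 else 0) := by
    rw [pack_smul]
    refine pack_congr fun i hi => ?_
    rw [Nat.and_two_pow]
    have h1 := hf i hi
    have h2 := hg i hi
    by_cases h : g i ≤ f i
    · rw [if_pos h]
      have : f i + 2^W - g i = 2^W * 1 + (f i - g i) := by omega
      rw [this, Nat.testBit_two_pow_mul_add _ oma]
      simp
    · rw [if_neg h, Nat.testBit_lt_two_pow oma]; simp
  have e2 : (2^W * pack (W+1) n (fun i => if g i ≤ f i then 1 else 0)) >>> W = pack (W+1) n (fun i => if g i ≤ f i then 1 else 0) := by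
    rw [Nat.shiftRight_eq_div_pow, Nat.mul_div_cancel_left _ psv]
  rw [e1, e2, pack_smul, pack_sub _ _ _ _ (fun i _ => Nat.le_mul_of_pos_left _ psv), pack_land hc, pack_add]
  · refine pack_congr fun i hi => ?_
    have h1 := hf i hi
    have h2 := hg i hi
    by_cases h : g i ≤ f i
    · rw [if_pos h, mul_one, Nat.and_two_pow_sub_one_eq_mod, max_eq_left h]
      have : f i + 2^W - g i = (f i - g i) + 2^W := by omega
      rw [this, Nat.add_mod_right, Nat.mod_eq_of_lt oma]; omega
    · rw [if_neg h]; simp; omega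
  · intro i _
    have : 0 < 2^W := by positivity
    split_ifs <;> simp; omega

def wm (W ON j X : ℕ) : ℕ :=
  Nat.rec (motive := fun _ => ℕ) X (fun j x => mx W ON x (Nat.shiftRight x (Nat.mul (Nat.succ W) (Nat.pow 2 j)))) j

lemma wm_pack {W n : ℕ} {f : ℕ → ℕ} (hf : ∀ i < n, f i < 2^W) (j : ℕ) :
    ∃ g : ℕ → ℕ, (∀ i < n, g i < 2^W) ∧ wm W (pack (W+1) n (fun _ => 1)) j (pack (W+1) n f) = pack (W+1) n g ∧
      ∀ i < n, ∀ t, i ≤ t → t < i + 2^j → t < n → f t ≤ g i := by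
  have hp : 2^(W+1) = 2 * 2^W := by rw [pow_succ]; ring
  induction j with
  | zero => exact ⟨f, hf, rfl, fun i _ t h1 h2 _ => by rw [show t = i by simp at h2; omega]⟩
  | succ j ih =>
    obtain ⟨g, h1, h2, h3⟩ := ih
    have hg' : ∀ i < n, (if i + 2^j < n then g (i+2^j) else 0) < 2^W := fun i _ => by
      split_ifs with h
      · exact h1 _ h
      · positivity
    refine ⟨fun i => max (g i) (if i + 2^j < n then g (i+2^j) else 0), fun i hi => max_lt (h1 i hi) (hg' i hi), ?_, ?_⟩
    · show mx W _ (wm W _ j _) ((wm W _ j _) >>> ((W+1) * 2^j)) = _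
      rw [h2, pack_shr (fun i hi => by have := h1 i hi; omega), mx_pack h1 hg']
    · intro i hi t ht1 ht2 ht3
      by_cases h : t < i + 2^j
      · exact (h3 i hi t ht1 h ht3).trans (le_max_left _ _)
      · refine le_trans ?_ (le_max_right _ _)
        rw [if_pos oma]
        refine h3 _ oma t oma ?_ ht3
        rw [pow_succ] at ht2; omega

/-! Congruence packing -/
def CR (w n : ℕ) (f : ℕ → ℤ) (X : ℤ) : Prop := (2:ℤ)^(w*n) ∣ X - ∑ i ∈ Frg n, f i * 2^(w*i)

lemma CR.add {w n f g X Y} (h1 : CR w n f X) (h2 : CR w n g Y) : CR w n (fun i => f i + g i) (X+Y) := by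
  have := dvd_add h1 h2
  have e : X + Y - ∑ i ∈ Frg n, (f i + g i) * 2^(w*i) = (X - ∑ i ∈ Frg n, f i * 2^(w*i)) + (Y - ∑ i ∈ Frg n, g i * 2^(w*i)) := by
    simp only [add_mul, sum_add_distrib]; ring
  unfold CR
  rw [e]; exact this

lemma CR.sub {w n f g X Y} (h1 : CR w n f X) (h2 : CR w n g Y) : CR w n (fun i => f i - g i) (X-Y) := by
  have := dvd_sub h1 h2
  have e : X - Y - ∑ i ∈ Frg n, (f i - g i) * 2^(w*i) = (X - ∑ i ∈ Frg n, f i * 2^(w*i)) - (Y - ∑ i ∈ Frg n, g i * 2^(w*i)) := by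
    simp only [sub_mul, sum_sub_distrib]; ring
  unfold CR
  rw [e]; exact this

lemma CR.congr {w n f g X} (h1 : CR w n f X) (h : ∀ i < n, f i = g i) : CR w n g X := by
  have e : ∑ i ∈ Frg n, f i * 2^(w*i) = ∑ i ∈ Frg n, g i * 2^(w*i) :=
    sumC fun i hi => by rw [h i (Finset.mem_range.1 hi)]
  unfold CR at *
  rwa [← e]

lemma CR.md {w n f X Y} (h1 : CR w n f X) (h : (2:ℤ)^(w*n) ∣ Y - X) : CR w n f Y := by
  have := dvd_add h h1
  have e : Y - ∑ i ∈ Frg n, f i * 2^(w*i) = (Y - X) + (X - ∑ i ∈ Frg n, f i * 2^(w*i)) := by ring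
  unfold CR
  rw [e]; exact this

lemma CR.zero (w n) : CR w n (fun _ => 0) 0 := by simp [CR]

lemma CR.sum {w n : ℕ} {ι : Type*} (s : Finset ι) (f : ι → ℕ → ℤ) (X : ι → ℤ) (h : ∀ a ∈ s, CR w n (f a) (X a)) :
    CR w n (fun i => ∑ a ∈ s, f a i) (∑ a ∈ s, X a) := by
  classical
  induction s using Finset.induction_on with
  | empty => simpa using CR.zero w n
  | insert a s ha ih =>
    simp only [Finset.sum_insert ha]
    exact (h a (Finset.mem_insert_self _ _)).add (ih fun b hb => h b (Finset.mem_insert_of_mem hb))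

lemma CR.of_eq {w m n : ℕ} {f : ℕ → ℤ} {X : ℤ} (h : X = ∑ i ∈ Frg m, f i * 2^(w*i)) (hnm : n ≤ m) : CR w n f X := by
  obtain ⟨r, rfl⟩ := Nat.exists_eq_add_of_le hnm
  unfold CR
  rw [h, Finset.sum_range_add, add_sub_cancel_left]
  refine Finset.dvd_sum fun i _ => ?_
  rw [mul_add, pow_add]
  exact Dvd.intro_left (f (n+i) * 2^(w*i)) (by ring)

lemma CR.shift {w n f X} (h1 : CR w n f X) (r : ℕ) : CR w n (fun i => if r ≤ i then f (i-r) else 0) (X * 2^(w*r)) := by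
  have h2 : CR w n (fun i => if r ≤ i then f (i-r) else 0) ((∑ i ∈ Frg n, f i * 2^(w*i)) * 2^(w*r)) := by
    apply CR.of_eq (m := r + n) ?_ oma
    rw [Finset.sum_range_add]
    rw [Finset.sum_eq_zero (s := Frg r), zero_add, Finset.sum_mul]
    · refine sumC fun i _ => ?_
      rw [if_pos oma, Nat.add_sub_cancel_left, mul_add, pow_add]; ring
    · intro i hi
      rw [if_neg (by have := Finset.mem_range.1 hi; omega), zero_mul]
  refine h2.md ?_
  rw [← sub_mul]
  exact Dvd.dvd.mul_right h1 _

lemma CR.mul01 {w n f X} (h1 : CR w n f X) (b : ℤ) : CR w n (fun i => b * f i) (b * X) := by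
  have e : b * X - ∑ i ∈ Frg n, b * f i * 2^(w*i) = b * (X - ∑ i ∈ Frg n, f i * 2^(w*i)) := by
    rw [mul_sub, mul_sum]; congr 1
    exact sumC fun i _ => by ring
  unfold CR at *
  rw [e]; exact Dvd.dvd.mul_left h1 b

lemma CR.final {w n : ℕ} {f : ℕ → ℕ} {X : ℕ} (h : CR w n (fun i => (f i : ℤ)) X) (hf : ∀ i < n, f i < 2^w) :
    X % 2^(w*n) = pack w n f := by
  have h1 : X ≡ pack w n f [MOD 2^(w*n)] := by
    rw [Nat.ModEq.comm, Nat.modEq_iff_dvd]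
    unfold CR at h
    simpa [pack] using h
  rw [h1, Nat.mod_eq_of_lt (pack_lt hf)]

def pf (w j X : ℕ) : ℕ :=
  Nat.rec (motive := fun _ => ℕ) X (fun j x => Nat.add x (Nat.shiftLeft x (Nat.mul w (Nat.pow 2 j)))) j

lemma CR.pf {w n : ℕ} {f : ℕ → ℤ} {X : ℕ} (h : CR w n f X) (j : ℕ) :
    CR w n (fun i => ∑ t ∈ Frg (2^j), if t ≤ i then f (i-t) else 0) (pf w j X) := by
  induction j with
  | zero => simpa [LP.pf] using h
  | succ j ih =>
    have := ih.add (ih.shift (2^j))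
    have e : ((LP.pf w (j+1) X : ℕ) : ℤ) = (LP.pf w j X : ℤ) + (LP.pf w j X : ℤ) * 2^(w*2^j) := by
      have : LP.pf w (j+1) X = LP.pf w j X + LP.pf w j X <<< (w*2^j) := rfl
      rw [this, Nat.shiftLeft_eq]; push_cast; ring
    rw [e]
    refine this.congr fun i _ => ?_
    rw [pow_succ, mul_two, Finset.sum_range_add]
    congr 1
    split_ifs with h1
    · refine sumC fun t _ => ?_
      by_cases h2 : 2^j + t ≤ i
      · rw [if_pos h2, if_pos oma, Nat.sub_sub]
      · rw [if_neg h2, if_neg oma]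
    · symm; apply Finset.sum_eq_zero; intro t _; rw [if_neg oma]

lemma pf_full (f : ℕ → ℤ) {m i : ℕ} (hi : i < m) : (∑ t ∈ Frg m, if t ≤ i then f (i-t) else 0) = ∑ t ∈ Frg (i+1), f t := by
  rw [← Finset.sum_range_reflect f (i+1), ← Finset.sum_subset (Finset.range_subset_range.2 (show i+1 ≤ m by omega))]
  · refine sumC fun t ht => ?_
    have := Finset.mem_range.1 ht
    rw [if_pos oma]; congr 1
  · intro t _ ht
    rw [if_neg]; intro h; exact ht (Finset.mem_range.2 oma)

def Pt (wd : ℕ) (j : ℕ) : ℕ :=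
  Nat.rec (motive := fun _ => ℕ) 1 (fun j x => Nat.add x (Nat.shiftLeft x (Nat.mul wd (Nat.pow 2 j)))) j

lemma Pt_eq (w d j : ℕ) (hd : 0 < d) : (Pt (w*d) j : ℤ) = ∑ i ∈ Frg (d * 2^j), (if d ∣ i then 1 else 0) * 2^(w*i) := by
  induction j with
  | zero =>
    rw [Finset.sum_eq_single 0]
    · simp [Pt]
    · intro i hi h0
      rw [if_neg, zero_mul]
      intro h
      have := Nat.le_of_dvd oma h
      simp at hi; omega
    · intro h; simp at h; omega
  | succ j ih =>
    have : Pt (w*d) (j+1) = Pt (w*d) j + Pt (w*d) j <<< (w*d*2^j) := rfl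
    rw [this, Nat.shiftLeft_eq]
    push_cast
    rw [ih, pow_succ, ← mul_assoc, mul_two, Finset.sum_range_add]
    congr 1
    rw [Finset.sum_mul]
    refine sumC fun i _ => ?_
    have : (d ∣ d * 2^j + i) ↔ d ∣ i := Nat.dvd_add_right (Dvd.intro _ rfl)
    simp only [this, mul_add, pow_add, mul_assoc]
    ring

def hit (w N y0 d : ℕ) : ℕ :=
  Nat.shiftLeft (Pt (Nat.mul w d) (Nat.sub N (Nat.log2 d))) (Nat.mul w (Nat.sub d (Nat.mod y0 d)))

lemma CR_hit (w N y0 d : ℕ) (hd : 0 < d) : CR w (2^N) (fun i => if 1 ≤ i ∧ d ∣ y0 + i then 1 else 0) (hit w N y0 d) := by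
  have hb : 2^N ≤ d * 2^(N - Nat.log2 d) := by
    have h1 : 2^(Nat.log2 d) ≤ d := Nat.log2_self_le hd.ne'
    calc 2^N ≤ 2^(Nat.log2 d + (N - Nat.log2 d)) := Nat.pow_le_pow_right nnm oma
      _ = 2^(Nat.log2 d) * 2^(N - Nat.log2 d) := pow_add _ _ _
      _ ≤ _ := Nat.mul_le_mul_right _ h1
  have h1 := CR.of_eq (w := w) (f := fun i => if d ∣ i then 1 else 0) (Pt_eq w d (N - Nat.log2 d) hd) hb
  have h2 := h1.shift (d - y0 % d)
  have e : ((hit w N y0 d : ℕ) : ℤ) = Pt (w*d) (N - Nat.log2 d) * 2^(w*(d - y0 % d)) := by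
    have : hit w N y0 d = Pt (w*d) (N - Nat.log2 d) <<< (w*(d - y0 % d)) := rfl
    rw [this, Nat.shiftLeft_eq]; push_cast; ring
  rw [e]
  refine h2.congr fun i _ => ?_
  have hs := Nat.mod_lt y0 hd
  have hy := Nat.div_add_mod y0 d
  set s := y0 % d
  set q := y0 / d
  have key : ∀ t, (d ∣ y0 + t) ↔ d ∣ s + t := fun t => by
    rw [← hy, add_assoc]; exact Nat.dvd_add_right (Dvd.intro _ rfl)
  by_cases h : d - s ≤ i
  · rw [if_pos h]
    have : (1 ≤ i ∧ d ∣ y0 + i) ↔ d ∣ i - (d - s) := by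
      rw [key]
      have e : s + i = d + (i - (d-s)) := by omega
      rw [e, Nat.dvd_add_right (dvd_refl d)]
      exact ⟨fun h => h.2, fun h' => ⟨by omega, h'⟩⟩
    simp only [this]
  · rw [if_neg h, if_neg]
    rintro ⟨h1, h2⟩
    rw [key] at h2
    have := Nat.le_of_dvd oma h2
    omega

def bt (m d : ℕ) : ℕ := Nat.land (Nat.shiftRight m d) 1
def tb (mask d x : ℕ) : ℕ := Nat.rec (motive := fun _ => ℕ) 0 (fun _ _ => x) (bt mask d)

lemma bt_cases (m d : ℕ) : bt m d = 0 ∨ bt m d = 1 := by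
  have : bt m d = (m >>> d) % 2 := Nat.and_one_is_mod _
  rw [this]; omega

lemma tb_eq (m d x : ℕ) : tb m d x = bt m d * x := by
  unfold tb
  rcases bt_cases m d with h | h <;> rw [h] <;> simp

def hits (w N y0 mask k : ℕ) : ℕ := sm (fun d => tb mask d (hit w N y0 d)) k 0
def cnt (y0 mask k : ℕ) : ℕ := sm (fun d => tb mask d (Nat.div y0 d)) k 0

/-- `1 - ∑ c_d ⌊v/d⌋` -/
def ep (PM NM k v : ℕ) : ℤ := 1 - ∑ d ∈ Frg (2^k), ((bt PM d : ℤ) - bt NM d) * ((v / d : ℕ) : ℤ)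

lemma cnt_eq (y0 mask k : ℕ) : (cnt y0 mask k : ℤ) = ∑ d ∈ Frg (2^k), (bt mask d : ℤ) * ((y0 / d : ℕ) : ℤ) := by
  rw [cnt, sm_eq]; push_cast
  refine sumC fun d _ => ?_
  rw [zero_add, tb_eq]; push_cast; rfl

lemma ep_eq (PM NM k y : ℕ) : ep PM NM k y = 1 + cnt y NM k - cnt y PM k := by
  rw [ep, cnt_eq, cnt_eq]
  simp only [sub_mul, sum_sub_distrib]; ring

lemma CR_hits (w N y0 mask k : ℕ) (h0 : bt mask 0 = 0) :
    CR w (2^N) (fun i => ∑ d ∈ Frg (2^k), (bt mask d : ℤ) * (if 1 ≤ i ∧ d ∣ y0 + i then 1 else 0)) (hits w N y0 mask k) := by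
  have e : ((hits w N y0 mask k : ℕ) : ℤ) = ∑ d ∈ Frg (2^k), (bt mask d : ℤ) * (hit w N y0 d : ℤ) := by
    rw [hits, sm_eq]; push_cast
    refine sumC fun d _ => ?_
    rw [zero_add, tb_eq]; push_cast; rfl
  rw [e]
  refine CR.sum _ _ _ fun d _ => ?_
  rcases Nat.eq_zero_or_pos d with h | h
  · subst h; rw [h0]; simpa using CR.zero w (2^N)
  · exact (CR_hit w N y0 d h).mul01 _

lemma ep_succ (PM NM k v : ℕ) : ep PM NM k (v+1) = ep PM NM k v +
    (∑ d ∈ Frg (2^k), (bt NM d : ℤ) * (if d ∣ v+1 then 1 else 0) - ∑ d ∈ Frg (2^k), (bt PM d : ℤ) * (if d ∣ v+1 then 1 else 0)) := by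
  rw [ep, ep, ← sum_sub_distrib, sub_add, ← sum_sub_distrib]
  congr 1
  refine sumC fun d _ => ?_
  rw [Nat.succ_div]
  push_cast
  ring

def lanes (w N K y0 PM NM k : ℕ) : ℕ :=
  (fun M => Nat.mod (Nat.add
    (pf w N (Nat.add (Nat.sub (Nat.add (Nat.add K 1) (cnt y0 NM k)) (cnt y0 PM k)) (Nat.mod (hits w N y0 NM k) M)))
    (Nat.sub M (Nat.mod (pf w N (Nat.mod (hits w N y0 PM k) M)) M))) M) (Nat.pow 2 (Nat.mul w (Nat.pow 2 N)))

lemma CR.nmod {w n : ℕ} {f : ℕ → ℤ} {X : ℕ} (h : CR w n f X) : CR w n f ((X % 2^(w*n) : ℕ) : ℤ) := by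
  refine h.md ?_
  push_cast
  rw [Int.emod_def]
  exact ⟨-((X:ℤ) / 2^(w*n)), by ring⟩

lemma lanes_eq {w N K y0 PM NM k : ℕ} (hP : bt PM 0 = 0) (hN : bt NM 0 = 0)
    (hb : ∀ i < 2^N, 0 ≤ K + ep PM NM k (y0+i) ∧ K + ep PM NM k (y0 + i) < 2^w) :
    lanes w N K y0 PM NM k = pack w (2^N) (fun i => (K + ep PM NM k (y0+i)).toNat) := by
  set M := 2^(w*2^N) with hM
  set c := K + 1 + cnt y0 NM k - cnt y0 PM k with hc
  have h00 := hb 0 psv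
  have hcz : (c : ℤ) = K + ep PM NM k y0 := by
    rw [add_zero, ep_eq] at h00
    rw [ep_eq, hc, Nat.cast_sub oma]; push_cast; ring
  show (pf w N (c + hits w N y0 NM k % M) + (M - pf w N (hits w N y0 PM k % M) % M)) % M = _
  apply CR.final
  swap
  · intro i hi
    have := hb i hi
    rw [Int.toNat_lt this.1]; push_cast; exact this.2
  have a1 := (CR_hits w N y0 PM k hP).nmod.pf N
  have a2 := a1.nmod
  have hc0 : CR w (2^N) (fun i => if i = 0 then (c:ℤ) else 0) (c : ℤ) := by
    apply CR.of_eq (m := 2^N) _ le_rfl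
    rw [Finset.sum_eq_single 0]
    · simp
    · intro i _ h; rw [if_neg h, zero_mul]
    · intro h; simp at h
  have a3 := (hc0.add (CR_hits w N y0 NM k hN).nmod)
  rw [← Nat.cast_add] at a3
  have a4 := (a3.pf N).sub a2
  have a5 := a4.md (Y := ((pf w N (c + hits w N y0 NM k % M) + (M - pf w N (hits w N y0 PM k % M) % M) : ℕ) : ℤ)) (by
    have hlt : pf w N (hits w N y0 PM k % M) % M ≤ M := (Nat.mod_lt _ psv).le
    rw [Nat.cast_add, Nat.cast_sub hlt]
    refine ⟨1, ?_⟩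
    rw [← hM]
    have : (M:ℤ) = 2^(w*2^N) := by rw [hM]; push_cast; rfl
    rw [this]; ring)
  refine a5.congr fun i hi => ?_
  rw [Int.toNat_of_nonneg (hb i hi).1]
  have q1 := pf_full (fun t => (if t = 0 then (c:ℤ) else 0) + ∑ d ∈ Frg (2^k), (bt NM d : ℤ) * (if 1 ≤ t ∧ d ∣ y0 + t then 1 else 0)) hi
  have q2 := pf_full (fun t => ∑ d ∈ Frg (2^k), (bt PM d : ℤ) * (if 1 ≤ t ∧ d ∣ y0 + t then 1 else 0)) hi
  clear a1 a2 a3 a4 a5 hc0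
  have : ∀ j, (∑ t ∈ Frg (j+1), ((if t = 0 then (c:ℤ) else 0) + ∑ d ∈ Frg (2^k), (bt NM d : ℤ) * (if 1 ≤ t ∧ d ∣ y0 + t then 1 else 0))) -
      ∑ t ∈ Frg (j+1), (∑ d ∈ Frg (2^k), (bt PM d : ℤ) * (if 1 ≤ t ∧ d ∣ y0 + t then 1 else 0)) = K + ep PM NM k (y0+j) := by
    intro j
    induction j with
    | zero => simp [hcz]
    | succ j ih =>
      rw [sum_range_succ, sum_range_succ _ (j+1)]
      have e1 : ∀ m, ∑ d ∈ Frg (2^k), (bt m d : ℤ) * (if 1 ≤ j+1 ∧ d ∣ y0 + (j+1) then 1 else 0) =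
          ∑ d ∈ Frg (2^k), (bt m d : ℤ) * (if d ∣ y0 + j + 1 then 1 else 0) := by
        intro m
        refine sumC fun d _ => ?_
        simp [add_assoc]
      rw [e1, e1, ← add_assoc y0, ep_succ]
      simp only [Nat.add_eq_zero_iff, one_ne_zero, and_false, if_false]
      linarith
  refine Eq.trans ?_ (this i)
  exact congrArg₂ (· - ·) q1 q2

/-! Certificates -/

/-- step majorant certificate, fixed point scale `2^40` -/
def Cert (f : ℕ → ℕ) (K y m P Q : ℕ) : Prop := 2 ≤ y ∧ ∃ M : ℕ → ℕ, (∀ v, 1 ≤ v → v < y → f v ≤ M v) ∧ M 1 = K ∧ M (y-1) = m ∧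
  ∑ v ∈ Finset.Ico 2 y, ((M v - M (v-1) : ℕ) : ℝ) / v ≤ P / 2^40 ∧
  (Q:ℝ) / 2^40 ≤ ∑ v ∈ Finset.Ico 2 y, ((M (v-1) - M v : ℕ) : ℝ) / v

lemma Cert.start {f : ℕ → ℕ} {K : ℕ} (h : f 1 ≤ K) : Cert f K 2 K 0 0 :=
  ⟨le_rfl, fun _ => K, fun v h1 h2 => by rw [show v = 1 by omega]; exact h, rfl, rfl, by simp, by simp⟩

lemma Cert.block {f : ℕ → ℕ} {K y m P Q : ℕ} (h : Cert f K y m P Q) {l u : ℕ} (hl : 0 < l) (hu : ∀ t < l, f (y+t) ≤ u) :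
    Cert f K (y+l) u (P + ((u - m)*2^40/y + 1)) (Q + (m-u)*2^40/y) := by
  obtain ⟨hy, M, h1, h2, h3, h4, h5⟩ := h
  have hy0 : (0:ℝ) < y := by exact_mod_cast (show 0 < y by omega)
  have hM : ∀ v < y, (if v < y then M v else u) = M v := fun v hv => if_pos hv
  have hM' : ∀ v, y ≤ v → (if v < y then M v else u) = u := fun v hv => if_neg oma
  have e : ∀ g : ℕ → ℕ → ℕ, (∀ a, g a a = 0) → ∑ v ∈ Finset.Ico 2 (y+l), ((g (if v < y then M v else u) (if v-1 < y then M (v-1) else u) : ℕ) : ℝ)/v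
      = ∑ v ∈ Finset.Ico 2 y, ((g (M v) (M (v-1)) : ℕ) : ℝ)/v + (g u m : ℝ)/y := by
    intro g hg
    rw [← Finset.sum_Ico_consecutive _ hy (show y ≤ y+l by omega)]
    congr 1
    · refine sumC fun v hv => ?_
      have := Finset.mem_Ico.1 hv
      rw [hM v oma, hM (v-1) oma]
    · rw [Finset.sum_eq_sum_Ico_succ_bot oma, hM' y le_rfl, hM (y-1) oma, h3]
      rw [Finset.sum_eq_zero, add_zero]
      intro v hv
      have := Finset.mem_Ico.1 hv
      rw [hM' v oma, hM' (v-1) oma, hg]; simp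
  refine ⟨by omega, fun v => if v < y then M v else u, ?_, ?_, ?_, ?_, ?_⟩
  · intro v hv1 hv2
    by_cases h : v < y
    · simp only [if_pos h]; exact h1 v hv1 h
    · simp only [if_neg h]
      have := hu (v-y) oma
      rwa [Nat.add_sub_cancel' oma] at this
  · simp only [if_pos (show 1 < y by omega)]; exact h2
  · simp only [if_neg (show ¬ (y + l - 1 < y) by omega)]
  · rw [e (fun a b => a - b) (fun a => by simp)]
    have := le_fdiv ((u-m)*2^40) y
    push_cast at this ⊢
    rw [add_div]
    refine add_le_add h4 ?_
    rw [le_div_iff₀ nnm]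
    refine le_trans (le_of_eq ?_) this; ring
  · rw [e (fun a b => b - a) (fun a => by simp)]
    have := fdiv_le ((m-u)*2^40) y
    push_cast at this ⊢
    rw [add_div]
    refine add_le_add h5 ?_
    rw [div_le_iff₀ nnm]
    refine this.trans (le_of_eq ?_); ring

def prv (mp : ℕ) (val : ℕ → ℕ) (b : ℕ) : ℕ := Nat.rec (motive := fun _ => ℕ) mp (fun b' _ => val b') b

lemma Cert.blocks {f : ℕ → ℕ} {K y m P Q : ℕ} (h : Cert f K y m P Q) {l : ℕ} (hl : 0 < l) (val : ℕ → ℕ) (n : ℕ)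
    (hu : ∀ b < n, ∀ t < l, f (y+b*l+t) ≤ val b) :
    Cert f K (y+n*l) (prv m val n) (P + ∑ b ∈ Frg n, ((val b - prv m val b)*2^40/(y+b*l) + 1))
      (Q + ∑ b ∈ Frg n, (prv m val b - val b)*2^40/(y+b*l)) := by
  induction n with
  | zero => simpa [prv] using h
  | succ n ih =>
    have h1 := (ih fun b hb => hu b oma).block hl (hu n oma)
    rw [sum_range_succ, sum_range_succ, ← add_assoc P, ← add_assoc Q, add_mul n 1, one_mul, ← add_assoc y]
    exact h1

lemma Cert.weaken {f : ℕ → ℕ} {K y m P Q P' Q' : ℕ} (h : Cert f K y m P Q) (hP : P ≤ P') (hQ : Q' ≤ Q) : Cert f K y m P' Q' := by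
  obtain ⟨hy, M, h1, h2, h3, h4, h5⟩ := h
  have a : (P:ℝ) ≤ P' := by exact_mod_cast hP
  have b : (Q':ℝ) ≤ Q := by exact_mod_cast hQ
  exact ⟨hy, M, h1, h2, h3, h4.trans (by gcongr), le_trans (by gcongr) h5⟩

/-- run: `T` packed window maxima, starting lane `i0`, position `v0`, block length `2^j`, `2^c` blocks -/
def chk (w T v0 i0 j c m P Q m' P' Q' : ℕ) : Bool :=
  (fun val : ℕ → ℕ => and (Nat.ble (Nat.add P (sm (fun b => Nat.add (Nat.div (Nat.mul (Nat.sub (val b) (prv m val b)) 1099511627776) (Nat.add v0 (Nat.mul b (Nat.pow 2 j)))) 1) c 0)) P')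
    (and (Nat.ble Q' (Nat.add Q (sm (fun b => Nat.div (Nat.mul (Nat.sub (prv m val b) (val b)) 1099511627776) (Nat.add v0 (Nat.mul b (Nat.pow 2 j)))) c 0)))
      (Nat.beq (prv m val (Nat.pow 2 c)) m')))
  (fun b => gt w T (Nat.add i0 (Nat.mul b (Nat.pow 2 j))))

lemma Cert.chk {f : ℕ → ℕ} {K m P Q : ℕ} {W n v0 i0 j c m' P' Q' : ℕ} (h : Cert f K v0 m P Q)
    {F : ℕ → ℕ} (hF : ∀ i < n, F i < 2^W) (hfF : ∀ i, i0 + i < n → f (v0 + i) = F (i0+i))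
    (hn : i0 + 2^c * 2^j ≤ n)
    (hc : chk (W+1) (wm W (pack (W+1) n (fun _ => 1)) j (pack (W+1) n F)) v0 i0 j c m P Q m' P' Q' = true) :
    Cert f K (v0 + 2^c*2^j) m' P' Q' := by
  obtain ⟨g, g1, g2, g3⟩ := wm_pack hF j
  rw [g2] at hc
  unfold LP.chk at hc
  simp only [Bool.and_eq_true, Nat.ble_eq, Nat.beq_eq] at hc
  obtain ⟨c1, c2, c3⟩ := hc
  set val : ℕ → ℕ := fun b => gt (W+1) (pack (W+1) n g) (i0 + b * 2^j) with hval
  have hg : ∀ i < n, gt (W+1) (pack (W+1) n g) i = g i := fun i hi =>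
    gt_pack (fun i hi => (g1 i hi).trans_le (Nat.pow_le_pow_right nnm oma)) hi
  have hj : 0 < 2^j := by positivity
  have key := h.blocks hj val (2^c) (by
    intro b hb t ht
    have hb' : (b+1) * 2^j ≤ 2^c * 2^j := Nat.mul_le_mul_right _ hb
    rw [add_mul, one_mul] at hb'
    rw [hval]
    simp only
    rw [hg _ oma, add_assoc, hfF _ oma]
    refine g3 _ oma _ oma oma oma)
  have e3 : prv m val (2^c) = m' := c3
  rw [e3] at key
  refine key.weaken ?_ ?_
  · refine le_trans (le_of_eq ?_) c1
    show P + _ = P + sm (fun b => (val b - prv m val b) * 1099511627776 / (v0 + b * 2^j) + 1) c 0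
    rw [sm_eq]; simp
  · refine c2.trans (le_of_eq ?_)
    show Q + sm (fun b => (prv m val b - val b) * 1099511627776 / (v0 + b * 2^j)) c 0 = Q + _
    rw [sm_eq]; simp

def pcn (mask k : ℕ) : ℕ := sm (fun d => bt mask d) k 0

lemma pcn_eq (mask k : ℕ) : pcn mask k = ∑ d ∈ Frg (2^k), bt mask d := by
  rw [pcn, sm_eq]; simp

/-- `∑ c_d/d` -/
def sg (PM NM k : ℕ) : ℝ := ∑ d ∈ Frg (2^k), ((bt PM d : ℝ) - bt NM d) / d

lemma div_fract (v d : ℕ) (hd : 0 < d) : (v:ℝ)/d - 1 ≤ ((v/d:ℕ):ℝ) ∧ ((v/d:ℕ):ℝ) ≤ (v:ℝ)/d := by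
  refine ⟨?_, Nat.cast_div_le⟩
  have h : (v:ℝ)/d < ((v/d:ℕ):ℝ) + 1 := by
    rw [div_lt_iff₀ (by exact_mod_cast hd)]
    have := Nat.lt_div_mul_add hd (a := v)
    have h2 : v < (v/d+1)*d := by rw [add_mul, one_mul]; exact this
    exact_mod_cast h2
  linarith

lemma fr_bd {PM NM k : ℕ} (hP : bt PM 0 = 0) (hN : bt NM 0 = 0) (v : ℕ) :
    -(pcn NM k : ℝ) ≤ v * sg PM NM k - ∑ d ∈ Frg (2^k), ((bt PM d : ℝ) - bt NM d) * ((v/d:ℕ):ℝ) ∧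
    v * sg PM NM k - ∑ d ∈ Frg (2^k), ((bt PM d : ℝ) - bt NM d) * ((v/d:ℕ):ℝ) ≤ pcn PM k := by
  have e : v * sg PM NM k - ∑ d ∈ Frg (2^k), ((bt PM d : ℝ) - bt NM d) * ((v/d:ℕ):ℝ) =
      ∑ d ∈ Frg (2^k), ((bt PM d : ℝ) - bt NM d) * ((v:ℝ)/d - ((v/d:ℕ):ℝ)) := by
    rw [sg, mul_sum, ← sum_sub_distrib]
    refine sumC fun d _ => ?_
    ring
  rw [e, pcn_eq, pcn_eq]
  push_cast
  have key : ∀ d, -(bt NM d : ℝ) ≤ ((bt PM d : ℝ) - bt NM d) * ((v:ℝ)/d - ((v/d:ℕ):ℝ)) ∧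
      ((bt PM d : ℝ) - bt NM d) * ((v:ℝ)/d - ((v/d:ℕ):ℝ)) ≤ bt PM d := by
    intro d
    rcases Nat.eq_zero_or_pos d with h | h
    · subst h; simp [hP, hN]
    · obtain ⟨h1, h2⟩ := div_fract v d h
      have a : (0:ℝ) ≤ bt PM d := Nat.cast_nonneg _
      have b : (0:ℝ) ≤ bt NM d := Nat.cast_nonneg _
      constructor <;> nlinarith
  rw [← Finset.sum_neg_distrib]
  exact ⟨sum_le_sum fun d _ => (key d).1, sum_le_sum fun d _ => (key d).2⟩

lemma ep_cast (PM NM k v : ℕ) : (ep PM NM k v : ℝ) = 1 - ∑ d ∈ Frg (2^k), ((bt PM d : ℝ) - bt NM d) * ((v/d:ℕ):ℝ) := by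
  rw [ep]; push_cast; rfl

/-- smallness of sigma, kernel-checkable -/
def sgc (PM NM k : ℕ) : Bool :=
  (fun a b => and (Nat.ble (Nat.add a 0) (Nat.add b (Nat.pow 2 48))) (Nat.ble b (Nat.add a (Nat.pow 2 48))))
    (cnt (Nat.pow 2 80) PM k) (cnt (Nat.pow 2 80) NM k)

lemma sgc_bd {PM NM k : ℕ} (hP : bt PM 0 = 0) (hN : bt NM 0 = 0) (h : sgc PM NM k = true) (p1 : pcn PM k ≤ 1000) (p2 : pcn NM k ≤ 1000) :
    |sg PM NM k| ≤ 1/2^31 := by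
  unfold sgc at h
  simp only [Bool.and_eq_true, Nat.ble_eq] at h
  obtain ⟨h1, h2⟩ := h
  have h1' : cnt (2^80) PM k ≤ cnt (2^80) NM k + 2^48 := h1
  have h2' : cnt (2^80) NM k ≤ cnt (2^80) PM k + 2^48 := h2
  have hY : (((2:ℕ)^80 : ℕ):ℝ) = 2^80 := by norm_num
  generalize (2:ℕ)^80 = Y at *
  have := fr_bd (k := k) hP hN Y
  have e := ep_cast PM NM k Y
  have e2 := ep_eq PM NM k Y
  have e3 : (ep PM NM k Y : ℝ) = 1 + cnt Y NM k - cnt Y PM k := by rw [e2]; push_cast; ring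
  have c1 : (cnt Y PM k : ℝ) ≤ cnt Y NM k + 2^48 := by exact_mod_cast h1'
  have c2 : (cnt Y NM k : ℝ) ≤ cnt Y PM k + 2^48 := by exact_mod_cast h2'
  have p1' : (pcn PM k : ℝ) ≤ 1000 := by exact_mod_cast p1
  have p2' : (pcn NM k : ℝ) ≤ 1000 := by exact_mod_cast p2
  rw [abs_le]
  have hs : ∑ d ∈ Frg (2^k), ((bt PM d : ℝ) - bt NM d) * ((Y/d:ℕ):ℝ) = cnt Y PM k - cnt Y NM k := by linarith
  rw [hs, hY] at this
  constructor <;> norm_num at this c1 c2 ⊢ <;> linarith [this.1, this.2]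

structure Ok (PM NM k : ℕ) : Prop where
  hP : bt PM 0 = 0
  hN : bt NM 0 = 0
  p1 : pcn PM k ≤ 1000
  p2 : pcn NM k ≤ 1000
  hs : sgc PM NM k = true

lemma Ok.ep_bd {PM NM k : ℕ} (h : Ok PM NM k) {v : ℕ} (hv : v ≤ 2^22) : -1010 ≤ ep PM NM k v ∧ ep PM NM k v ≤ 1010 := by
  have h1 := fr_bd (k := k) h.hP h.hN v
  have h2 := sgc_bd h.hP h.hN h.hs h.p1 h.p2
  have e := ep_cast PM NM k v
  have p1' : (pcn PM k : ℝ) ≤ 1000 := by exact_mod_cast h.p1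
  have p2' : (pcn NM k : ℝ) ≤ 1000 := by exact_mod_cast h.p2
  have hv' : (v:ℝ) ≤ 2^22 := by exact_mod_cast hv
  have h3 : |(v:ℝ) * sg PM NM k| ≤ 1 := by
    rw [abs_mul, Nat.abs_cast]
    calc _ ≤ (2:ℝ)^22 * (1/2^31) := by gcongr
      _ ≤ 1 := by norm_num
  rw [abs_le] at h3
  have a : (-1010:ℝ) ≤ ep PM NM k v := by rw [e]; linarith [h1.1, h1.2, h3.1, h3.2]
  have b : (ep PM NM k v:ℝ) ≤ 1010 := by rw [e]; linarith [h1.1, h1.2, h3.1, h3.2]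
  exact ⟨by exact_mod_cast a, by exact_mod_cast b⟩

structure Ct (PM NM k y m P Q n p q : ℕ) : Prop where
  plus : Cert (fun v => ((1024:ℕ) + ep PM NM k v).toNat) 1024 y m P Q
  minus : Cert (fun v => ((1024:ℕ) - ep PM NM k v).toNat) 1024 y n p q

def ons (N : ℕ) : ℕ := Nat.div (Nat.sub (Nat.pow 2 (Nat.mul 12 (Nat.pow 2 N))) 1) 4095

lemma ons_eq (N : ℕ) : ons N = pack 12 (2^N) (fun _ => 1) := by
  have h := Nat.geomSum_eq (m := 2^12) nnm (2^N)
  have e : pack 12 (2^N) (fun _ => 1) = ∑ i ∈ Frg (2^N), (2^12)^i := by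
    rw [pack]
    refine sumC fun i _ => ?_
    rw [one_mul, pow_mul]
  rw [e, h, ← pow_mul]; rfl

def piece (PM NM k N y j c m P Q n p q m' P' Q' n' p' q' : ℕ) : Bool :=
  (fun ON => (fun E => and (chk 12 (wm 11 ON j E) y 0 j c m P Q m' P' Q')
    (chk 12 (wm 11 ON j (Nat.sub (Nat.shiftLeft ON 11) E)) y 0 j c n p q n' p' q')) (lanes 12 N 1024 y PM NM k)) (ons N)

theorem Ct.step {PM NM k y m P Q n p q : ℕ} (h : Ct PM NM k y m P Q n p q) (ok : Ok PM NM k) (N j c : ℕ) {y' m' P' Q' n' p' q' : ℕ}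
    (h1 : c + j = N) (h2 : y' = y + 2^N) (h3 : y' ≤ 2^22)
    (hk : piece PM NM k N y j c m P Q n p q m' P' Q' n' p' q' = true) : Ct PM NM k y' m' P' Q' n' p' q' := by
  unfold piece at hk
  simp only [Bool.and_eq_true] at hk
  obtain ⟨k1, k2⟩ := hk
  have hb : ∀ i < 2^N, -1010 ≤ ep PM NM k (y+i) ∧ ep PM NM k (y+i) ≤ 1010 := fun i hi => ok.ep_bd oma
  have hl := lanes_eq (w := 12) (N := N) (K := 1024) (y0 := y) ok.hP ok.hN (k := k) (by
    intro i hi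
    have := hb i hi
    constructor
    · push_cast; omega
    · push_cast; omega)
  rw [hl, ons_eq] at k1 k2
  have hF : ∀ i < 2^N, (((1024:ℕ):ℤ) + ep PM NM k (y+i)).toNat < 2^11 := by
    intro i hi; have := hb i hi; push_cast; omega
  have hF' : ∀ i < 2^N, (((1024:ℕ):ℤ) - ep PM NM k (y+i)).toNat < 2^11 := by
    intro i hi; have := hb i hi; push_cast; omega
  have e : Nat.sub (Nat.shiftLeft (pack 12 (2^N) (fun _ => 1)) 11) (pack 12 (2^N) (fun i => (((1024:ℕ):ℤ) + ep PM NM k (y+i)).toNat)) =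
      pack 12 (2^N) (fun i => (((1024:ℕ):ℤ) - ep PM NM k (y+i)).toNat) := by
    have : Nat.shiftLeft (pack 12 (2^N) (fun _ => 1)) 11 = pack 12 (2^N) (fun _ => 2048) := by
      show (pack 12 (2^N) (fun _ => 1)) <<< 11 = _
      rw [Nat.shiftLeft_eq, mul_comm, pack_smul]
    rw [this]
    show pack 12 (2^N) (fun _ => 2048) - _ = _
    rw [pack_sub]
    · refine pack_congr fun i hi => ?_
      have := hb i hi
      push_cast; omega
    · intro i hi
      have := hb i hi
      push_cast; omega
  rw [e] at k2
  have hcj : 2^c*2^j = 2^N := by rw [← pow_add, h1]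
  rw [h2, ← hcj]
  exact ⟨h.plus.chk hF (fun i hi => by simp) (by rw [hcj]; omega) k1,
    h.minus.chk hF' (fun i hi => by simp) (by rw [hcj]; omega) k2⟩

def scP : ℕ := 2907354897182427562197295231552018137414565442749272241125960796722669931398977646773343170441680478319422001226049435805501292655199298
def scN : ℕ := 150306725297525326584926758194517569780326412843812271911641350867951136058873949922881633914829565261922314412

lemma scok : Ok scP scN 9 := ⟨by decide +kernel, by decide +kernel, by decide +kernel, by decide +kernel, by decide +kernel⟩

lemma sc0 : Ct scP scN 9 2 1024 0 0 1024 0 0 :=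
  ⟨Cert.start dck, Cert.start dck⟩
theorem scJ : Ct scP scN 9 16384 1034 200444752455 192879268785 1031 206828714436 199112596799 := by
  have sc1 : Ct scP scN 9 4 1024 1 0 1024 1 0 :=
    sc0.step scok 1 1 0 rfl rfl nnm dck
  have sc2 : Ct scP scN 9 8 1024 2 0 1024 2 0 :=
    sc1.step scok 2 2 0 rfl rfl nnm dck
  have sc3 : Ct scP scN 9 16 1024 3 0 1024 3 0 :=
    sc2.step scok 3 3 0 rfl rfl nnm dck
  have sc4 : Ct scP scN 9 32 1024 4 0 1024 4 0 :=
    sc3.step scok 4 4 0 rfl rfl nnm dck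
  have sc5 : Ct scP scN 9 64 1024 5 0 1024 5 0 :=
    sc4.step scok 5 5 0 rfl rfl nnm dck
  have sc6 : Ct scP scN 9 128 1024 6 0 1024 6 0 :=
    sc5.step scok 6 6 0 rfl rfl nnm dck
  have sc7 : Ct scP scN 9 256 1026 18194877878 9162596898 1024 4581298487 4433514628 :=
    sc6.step scok 7 2 5 rfl rfl nnm dck
  have sc8 : Ct scP scN 9 512 1023 96619961195 97508569444 1026 96559182030 89584619476 :=
    sc7.step scok 8 2 6 rfl rfl nnm dck
  have sc9 : Ct scP scN 9 1024 1028 159876421005 152579156034 1022 156974066063 155774244756 :=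
    sc8.step scok 9 3 6 rfl rfl nnm dck
  have sc10 : Ct scP scN 9 2048 1023 189797827051 185879994629 1030 198109693400 189932304100 :=
    sc9.step scok 10 5 5 rfl rfl nnm dck
  have sc11 : Ct scP scN 9 4096 1029 198470163648 191347135701 1027 203635345777 196717234198 :=
    sc10.step scok 11 7 4 rfl rfl nnm dck
  have sc12 : Ct scP scN 9 8192 1029 199640922451 192467172854 1030 206145009969 198481328736 :=
    sc11.step scok 12 8 4 rfl rfl nnm dck
  have sc13 : Ct scP scN 9 16384 1034 200444752455 192879268785 1031 206828714436 199112596799 :=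
    sc12.step scok 13 9 4 rfl rfl nnm dck
  exact sc13

section
set_option maxHeartbeats 10000000
def bcP : ℕ := 145869951501798514428509038032006445775901629755352586241269466934119263258124637022188772415742678521066698359132504128367252683847029483137270370140492740273932582177459332110396035882440428448211668461409821532802507070343653741565872285541483974954068004712587866184355231535888717085582375397533814510874827012421283823169500431552184068078634854482227808891666676414147519004624648943677271364382665310697056472818379004500625806235735709859304834847515543412403327788921678920245756911618610840658291382915619169146282898448942449627457543592418278177910652772101360624388635656660020673010895089116093132801688613568666586928009814583526166802273991298064680522178019944978638040227269820361830149819800513916814687785594696728647537662433235638034058480971899333104663078793167366411151432915436223755883208485873310152347919514964236056670567512941320511146357798606940429592225728878234813583615361206620997058309646574798125644623856521433089919995614718798034553421218882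
def bcN : ℕ := 2821535210823327630951183120977619207921663626609344776074230925495518212888501367887627263017274238001797004754523994384243915454727974849956213162395281910751727522557878938903946294963179155555924540327255821337546049240107792105372653125745073740216472341140146352298087626008765362183781769010842337234201693750098170611903190097957587391707408456376757168432984056635411439041000265891792583751420850364510135033185172769163074602027422712502978229308919599146080814416220220475560029754135584306719615601553680098580899073649253009274644153128822369008948748802614778761652576506370519492536395946635279892859188244288323500644332758748303279717948247903173172353183049603231604235701996796610783386994705453154013745103560358389027951938426564133294868021893005186490469457136551467485457595361834790419684021171727006140118741134853732015919093181891244424627723332997382233339759112191669255071208658187615973396310224468399551579603482516867698970803260211102904849135099929934489321260767074986156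

lemma bcok : Ok bcP bcN 12 := ⟨by decide +kernel, by decide +kernel, by decide +kernel, by decide +kernel, by decide +kernel⟩

lemma bc0 : Ct bcP bcN 12 2 1024 0 0 1024 0 0 :=
  ⟨Cert.start dck, Cert.start dck⟩
theorem bcJ : Ct bcP bcN 12 4194304 1047 225080719305 224049354407 1049 223493411796 223181092682 := by
  have bc1 : Ct bcP bcN 12 4 1024 1 0 1024 1 0 :=
    bc0.step bcok 1 1 0 rfl rfl nnm dck
  have bc2 : Ct bcP bcN 12 8 1024 2 0 1024 2 0 :=
    bc1.step bcok 2 2 0 rfl rfl nnm dck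
  have bc3 : Ct bcP bcN 12 16 1024 3 0 1024 3 0 :=
    bc2.step bcok 3 3 0 rfl rfl nnm dck
  have bc4 : Ct bcP bcN 12 32 1024 4 0 1024 4 0 :=
    bc3.step bcok 4 4 0 rfl rfl nnm dck
  have bc5 : Ct bcP bcN 12 64 1024 5 0 1024 5 0 :=
    bc4.step bcok 5 5 0 rfl rfl nnm dck
  have bc6 : Ct bcP bcN 12 128 1024 6 0 1024 6 0 :=
    bc5.step bcok 6 6 0 rfl rfl nnm dck
  have bc7 : Ct bcP bcN 12 256 1024 7 0 1024 7 0 :=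
    bc6.step bcok 7 7 0 rfl rfl nnm dck
  have bc8 : Ct bcP bcN 12 512 1024 8 0 1024 8 0 :=
    bc7.step bcok 8 8 0 rfl rfl nnm dck
  have bc9 : Ct bcP bcN 12 1024 1024 9 0 1024 9 0 :=
    bc8.step bcok 9 9 0 rfl rfl nnm dck
  have bc10 : Ct bcP bcN 12 2048 1024 10 0 1024 10 0 :=
    bc9.step bcok 10 10 0 rfl rfl nnm dck
  have bc11 : Ct bcP bcN 12 4096 1008 34584643316 38503384434 1042 37694965700 33096806584 :=
    bc10.step bcok 11 2 9 rfl rfl nnm dck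
  have bc12 : Ct bcP bcN 12 8192 1030 103997878427 102720409201 1020 102624109209 103143066002 :=
    bc11.step bcok 12 3 9 rfl rfl nnm dck
  have bc13 : Ct bcP bcN 12 16384 1028 144371740197 143451829322 1022 143694913329 143749270016 :=
    bc12.step bcok 13 4 9 rfl rfl nnm dck
  have bc14 : Ct bcP bcN 12 32768 1027 175131596684 174231621313 1025 174474427227 174332678340 :=
    bc13.step bcok 14 5 9 rfl rfl nnm dck
  have bc15 : Ct bcP bcN 12 65536 1025 196019297953 195131949181 1028 194794825131 194565180794 :=
    bc14.step bcok 15 6 9 rfl rfl nnm dck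
  have bc16 : Ct bcP bcN 12 131072 1018 210282637035 209413184683 1040 208485026248 208144895530 :=
    bc15.step bcok 16 7 9 rfl rfl nnm dck
  have bc17 : Ct bcP bcN 12 196608 1025 216266344652 215318247851 1036 214631820141 214338003197 :=
    bc16.step bcok 16 8 8 rfl rfl nnm dck
  have bc18 : Ct bcP bcN 12 262144 1033 220174023160 219182223845 1028 218608117955 218354444459 :=
    bc17.step bcok 16 8 8 rfl rfl nnm dck
  have bc19 : Ct bcP bcN 12 327680 1048 221362747084 220315136026 1029 219849043424 219583160140 :=
    bc18.step bcok 16 10 6 rfl rfl nnm dck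
  have bc20 : Ct bcP bcN 12 393216 1038 222167899759 221153287327 1038 220671053130 220374030606 :=
    bc19.step bcok 16 10 6 rfl rfl nnm dck
  have bc21 : Ct bcP bcN 12 458752 1043 222757714372 221730908971 1035 221239806268 220949801298 :=
    bc20.step bcok 16 10 6 rfl rfl nnm dck
  have bc22 : Ct bcP bcN 12 524288 1040 223310921682 222291348481 1041 221733219971 221429724570 :=
    bc21.step bcok 16 10 6 rfl rfl nnm dck
  have bc23 : Ct bcP bcN 12 589824 1037 223521340377 222506199342 1038 221930902026 221631822717 :=
    bc22.step bcok 16 11 5 rfl rfl nnm dck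
  have bc24 : Ct bcP bcN 12 655360 1053 223715950296 222672563052 1042 222068192204 221761612425 :=
    bc23.step bcok 16 11 5 rfl rfl nnm dck
  have bc25 : Ct bcP bcN 12 720896 1037 223848380595 222830683328 1039 222183340858 221881243666 :=
    bc24.step bcok 16 11 5 rfl rfl nnm dck
  have bc26 : Ct bcP bcN 12 786432 1051 223991731168 222953709734 1047 222320349040 222006729373 :=
    bc25.step bcok 16 11 5 rfl rfl nnm dck
  have bc27 : Ct bcP bcN 12 851968 1042 224081603827 223055966832 1044 222449839928 222140508833 :=
    bc26.step bcok 16 11 5 rfl rfl nnm dck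
  have bc28 : Ct bcP bcN 12 917504 1049 224174226949 223140076462 1041 222569310636 222263748126 :=
    bc27.step bcok 16 11 5 rfl rfl nnm dck
  have bc29 : Ct bcP bcN 12 983040 1040 224268248221 223244708048 1042 222663473832 222356689206 :=
    bc28.step bcok 16 11 5 rfl rfl nnm dck
  have bc30 : Ct bcP bcN 12 1048576 1058 224348795716 223306146875 1053 222769244035 222450878367 :=
    bc29.step bcok 16 11 5 rfl rfl nnm dck
  have bc31 : Ct bcP bcN 12 1114112 1045 224407480499 223378255417 1047 222811931270 222499895718 :=
    bc30.step bcok 16 12 4 rfl rfl nnm dck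
  have bc32 : Ct bcP bcN 12 1179648 1048 224446383957 223414122399 1045 222852556140 222542406987 :=
    bc31.step bcok 16 12 4 rfl rfl nnm dck
  have bc33 : Ct bcP bcN 12 1245184 1041 224482813035 223456832511 1047 222887132511 222575191492 :=
    bc32.step bcok 16 12 4 rfl rfl nnm dck
  have bc34 : Ct bcP bcN 12 1310720 1041 224525237799 223499083626 1039 222915646109 222610458203 :=
    bc33.step bcok 16 12 4 rfl rfl nnm dck
  have bc35 : Ct bcP bcN 12 1376256 1037 224545116144 223522048640 1040 222953620319 222647359769 :=
    bc34.step bcok 16 12 4 rfl rfl nnm dck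
  have bc36 : Ct bcP bcN 12 1441792 1044 224585787213 223557029320 1045 222997262653 222686973186 :=
    bc35.step bcok 16 12 4 rfl rfl nnm dck
  have bc37 : Ct bcP bcN 12 1507328 1040 224619462730 223593578271 1042 223016650364 222708535951 :=
    bc36.step bcok 16 12 4 rfl rfl nnm dck
  have bc38 : Ct bcP bcN 12 1572864 1046 224651629881 223621403873 1054 223045137799 222728533175 :=
    bc37.step bcok 16 12 4 rfl rfl nnm dck
  have bc39 : Ct bcP bcN 12 1638400 1042 224677060669 223649521247 1041 223084766813 222777101743 :=
    bc38.step bcok 16 12 4 rfl rfl nnm dck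
  have bc40 : Ct bcP bcN 12 1703936 1044 224700931909 223671982206 1042 223110479339 222802064134 :=
    bc39.step bcok 16 12 4 rfl rfl nnm dck
  have bc41 : Ct bcP bcN 12 1769472 1045 224724962461 223695360960 1045 223139800425 222829402621 :=
    bc40.step bcok 16 12 4 rfl rfl nnm dck
  have bc42 : Ct bcP bcN 12 1835008 1045 224754297675 223724613705 1042 223169809532 222861194058 :=
    bc41.step bcok 16 12 4 rfl rfl nnm dck
  have bc43 : Ct bcP bcN 12 1900544 1053 224780190791 223745848747 1045 223198753445 222888294975 :=
    bc42.step bcok 16 12 4 rfl rfl nnm dck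
  have bc44 : Ct bcP bcN 12 1966080 1040 224803510700 223776587739 1039 223218683139 222911585927 :=
    bc43.step bcok 16 12 4 rfl rfl nnm dck
  have bc45 : Ct bcP bcN 12 2031616 1045 224826650459 223796929453 1039 223247939252 222940750773 :=
    bc44.step bcok 16 12 4 rfl rfl nnm dck
  have bc46 : Ct bcP bcN 12 2097152 1044 224845871247 223816661016 1040 223271955480 222964127709 :=
    bc45.step bcok 16 12 4 rfl rfl nnm dck
  have bc47 : Ct bcP bcN 12 2162688 1049 224861957243 223830097535 1047 223289038459 222977512583 :=
    bc46.step bcok 16 13 3 rfl rfl nnm dck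
  have bc48 : Ct bcP bcN 12 2228224 1049 224868995206 223837152600 1050 223302529433 222989502625 :=
    bc47.step bcok 16 13 3 rfl rfl nnm dck
  have bc49 : Ct bcP bcN 12 2293760 1049 224878293983 223846451019 1045 223308413089 222997811039 :=
    bc48.step bcok 16 13 3 rfl rfl nnm dck
  have bc50 : Ct bcP bcN 12 2359296 1049 224887761467 223855884939 1045 223316497805 223005850335 :=
    bc49.step bcok 16 13 3 rfl rfl nnm dck
  have bc51 : Ct bcP bcN 12 2424832 1047 224897458455 223866435187 1042 223326225122 223016911271 :=
    bc50.step bcok 16 13 3 rfl rfl nnm dck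
  have bc52 : Ct bcP bcN 12 2490368 1040 224902406882 223874485753 1042 223332521853 223023158620 :=
    bc51.step bcok 16 13 3 rfl rfl nnm dck
  have bc53 : Ct bcP bcN 12 2555904 1048 224916002997 223884533003 1054 223341271787 223026659043 :=
    bc52.step bcok 16 13 3 rfl rfl nnm dck
  have bc54 : Ct bcP bcN 12 2621440 1048 224919835535 223888362469 1046 223343388852 223032221410 :=
    bc53.step bcok 16 13 3 rfl rfl nnm dck
  have bc55 : Ct bcP bcN 12 2686976 1045 224926520521 223896261975 1046 223349218264 223038004755 :=
    bc54.step bcok 16 13 3 rfl rfl nnm dck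
  have bc56 : Ct bcP bcN 12 2752512 1039 224934605071 223906727260 1048 223361373920 223049344303 :=
    bc55.step bcok 16 13 3 rfl rfl nnm dck
  have bc57 : Ct bcP bcN 12 2818048 1062 224949217932 223912243520 1049 223372444926 223060018222 :=
    bc56.step bcok 16 13 3 rfl rfl nnm dck
  have bc58 : Ct bcP bcN 12 2883584 1043 224953469422 223923871154 1056 223378976483 223063887401 :=
    bc57.step bcok 16 13 3 rfl rfl nnm dck
  have bc59 : Ct bcP bcN 12 2949120 1052 224962891250 223929889842 1048 223383116334 223071086015 :=
    bc58.step bcok 16 13 3 rfl rfl nnm dck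
  have bc60 : Ct bcP bcN 12 3014656 1041 224975095197 223946144124 1044 223391640154 223081073415 :=
    bc59.step bcok 16 13 3 rfl rfl nnm dck
  have bc61 : Ct bcP bcN 12 3080192 1044 224985230095 223955146111 1049 223396346438 223083967618 :=
    bc60.step bcok 16 13 3 rfl rfl nnm dck
  have bc62 : Ct bcP bcN 12 3145728 1061 224994760467 223958678156 1052 223403766796 223090317292 :=
    bc61.step bcok 16 13 3 rfl rfl nnm dck
  have bc63 : Ct bcP bcN 12 3211264 1059 225003728014 223968408181 1054 223411031551 223096912348 :=
    bc62.step bcok 16 13 3 rfl rfl nnm dck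
  have bc64 : Ct bcP bcN 12 3276800 1048 225007465812 223975900308 1040 223412389879 223103012648 :=
    bc63.step bcok 16 13 3 rfl rfl nnm dck
  have bc65 : Ct bcP bcN 12 3342336 1052 225014449337 223981564778 1053 223417710541 223104011787 :=
    bc64.step bcok 16 13 3 rfl rfl nnm dck
  have bc66 : Ct bcP bcN 12 3407872 1054 225017695290 223984176530 1054 223423552515 223109565945 :=
    bc65.step bcok 16 13 3 rfl rfl nnm dck
  have bc67 : Ct bcP bcN 12 3473408 1051 225021529438 223988997619 1052 223428016676 223114705118 :=
    bc66.step bcok 16 13 3 rfl rfl nnm dck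
  have bc68 : Ct bcP bcN 12 3538944 1040 225024033825 223994962813 1045 223434593497 223123482510 :=
    bc67.step bcok 16 13 3 rfl rfl nnm dck
  have bc69 : Ct bcP bcN 12 3604480 1055 225030517208 223996816956 1050 223440439123 223127795084 :=
    bc68.step bcok 16 13 3 rfl rfl nnm dck
  have bc70 : Ct bcP bcN 12 3670016 1059 225037453787 224002583837 1056 223446780654 223132332951 :=
    bc69.step bcok 16 13 3 rfl rfl nnm dck
  have bc71 : Ct bcP bcN 12 3735552 1049 225039525872 224007647145 1049 223450044490 223137693839 :=
    bc70.step bcok 16 13 3 rfl rfl nnm dck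
  have bc72 : Ct bcP bcN 12 3801088 1045 225043027212 224012315707 1047 223457642340 223145886046 :=
    bc71.step bcok 16 13 3 rfl rfl nnm dck
  have bc73 : Ct bcP bcN 12 3866624 1053 225048498503 224015472277 1041 223466856766 223156783085 :=
    bc72.step bcok 16 13 3 rfl rfl nnm dck
  have bc74 : Ct bcP bcN 12 3932160 1044 225056129638 224025627733 1048 223475047684 223162988267 :=
    bc73.step bcok 16 13 3 rfl rfl nnm dck
  have bc75 : Ct bcP bcN 12 3997696 1050 225062238132 224030065320 1049 223478662532 223166326334 :=
    bc74.step bcok 16 13 3 rfl rfl nnm dck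
  have bc76 : Ct bcP bcN 12 4063232 1043 225064152201 224033887361 1046 223482490130 223170972871 :=
    bc75.step bcok 16 13 3 rfl rfl nnm dck
  have bc77 : Ct bcP bcN 12 4128768 1050 225074374011 224042218138 1056 223488129079 223173938628 :=
    bc76.step bcok 16 13 3 rfl rfl nnm dck
  have bc78 : Ct bcP bcN 12 4194304 1047 225080719305 224049354407 1049 223493411796 223181092682 :=
    bc77.step bcok 16 13 3 rfl rfl nnm dck
  exact bc78
end

def laU (mask k : ℕ) : ℕ := sm (fun d => tb mask d (Nat.add (Nat.div (lgU d) d) 1)) k 0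
def laL (mask k : ℕ) : ℕ := sm (fun d => tb mask d (Nat.div (lgL d) d)) k 0

lemma laU_ge {mask k : ℕ} (h0 : bt mask 0 = 0) : ∑ d ∈ Frg (2^k), (bt mask d : ℝ) * (Lo d / d) ≤ (laU mask k : ℝ) / 2^48 := by
  rw [laU, sm_eq, le_div_iff₀ nnm, Finset.sum_mul]; push_cast
  refine sum_le_sum fun d _ => ?_
  rw [zero_add, tb_eq]; push_cast
  rw [mul_assoc]
  rcases Nat.eq_zero_or_pos d with h | h
  · subst h; simp [h0]
  · refine mulL ?_ (Nat.cast_nonneg _)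
    have h1 := le_lgU d h
    have h2 := le_fdiv (lgU d) d
    have hd : (0:ℝ) < d := by exact_mod_cast h
    show _ ≤ ((lgU d / d : ℕ) : ℝ) + 1
    refine le_trans ?_ h2
    rw [div_mul_eq_mul_div]
    gcongr
    linarith

lemma laL_le {mask k : ℕ} (h0 : bt mask 0 = 0) : (laL mask k : ℝ) / 2^48 ≤ ∑ d ∈ Frg (2^k), (bt mask d : ℝ) * (Lo d / d) := by
  rw [laL, sm_eq, div_le_iff₀ nnm, Finset.sum_mul]; push_cast
  refine sum_le_sum fun d _ => ?_
  rw [zero_add, tb_eq]; push_cast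
  rw [mul_assoc]
  rcases Nat.eq_zero_or_pos d with h | h
  · subst h; simp [h0]
  · refine mulL ?_ (Nat.cast_nonneg _)
    have h1 := lgL_le d h
    have h2 := fdiv_le (lgL d) d
    have hd : (0:ℝ) < d := by exact_mod_cast h
    refine h2.trans ?_
    rw [div_mul_eq_mul_div]
    gcongr
    linarith

def Ls (PM NM k J : ℕ) : List (ℕ × ℝ) :=
  (J, -sg PM NM k * J) :: (List.range (2^k - 1)).map (fun i => (i+1, ((bt PM (i+1) : ℝ) - bt NM (i+1))))

lemma list_range_sum (f : ℕ → ℝ) (n : ℕ) : ((List.range n).map f).sum = ∑ i ∈ Frg n, f i := by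
  induction n with
  | zero => simp
  | succ n ih => rw [List.range_succ, sum_range_succ, List.map_append, List.sum_append, ih]; simp

lemma range_shift (f : ℕ → ℝ) (k : ℕ) (h : f 0 = 0) : ∑ i ∈ Frg (2^k-1), f (i+1) = ∑ d ∈ Frg (2^k), f d := by
  have : 2^k = (2^k-1)+1 := by have : 0 < 2^k := by positivity
                               omega
  conv_rhs => rw [this, Finset.sum_range_succ', h, add_zero]

lemma Ls_LS {PM NM : ℕ} (k J : ℕ) (f : ℕ → ℝ) (hP : bt PM 0 = 0) (hN : bt NM 0 = 0) :
    LS (Ls PM NM k J) f = -sg PM NM k * J * f J + ∑ d ∈ Frg (2^k), ((bt PM d : ℝ) - bt NM d) * f d := by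
  rw [Ls, LS_cons]
  congr 1
  rw [LS, List.map_map, list_range_sum, ← range_shift (fun d => ((bt PM d : ℝ) - bt NM d) * f d) k (by simp [hP, hN])]
  rfl

lemma Ls_LA {PM NM : ℕ} (k J : ℕ) (hP : bt PM 0 = 0) (hN : bt NM 0 = 0) :
    LA (Ls PM NM k J) ≤ |sg PM NM k * J| + (pcn PM k + pcn NM k) := by
  rw [LA, Ls, List.map_cons, List.sum_cons]
  simp only [neg_mul, abs_neg]
  refine add_le_add le_rfl ?_
  rw [List.map_map, list_range_sum, pcn_eq, pcn_eq]
  push_cast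
  rw [← sum_add_distrib, ← range_shift (fun d => ((bt PM d : ℝ) + bt NM d)) k (by simp [hP, hN])]
  refine sum_le_sum fun i _ => ?_
  simp only [Function.comp]
  refine (abs_sub _ _).trans ?_
  simp

lemma Cert.sum_bound {f : ℕ → ℕ} {K J m P Q : ℕ} (h : Cert f K J m P Q) {x ε : ℝ} (hx : 0 ≤ x) (hε : 0 ≤ ε) (hε1 : ε ≤ 1)
    (hψ : ∀ t, x/J ≤ t → t ≤ x/2 → |psi t - t| ≤ ε * t) :
    ∃ M : ℕ → ℝ, M 1 = 0 ∧ M (J-1) = m - K ∧ (∀ v, 1 ≤ v → v < J → (f v : ℝ) - K ≤ M v) ∧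
      ∑ v ∈ Finset.Ico 2 J, (M v - M (v-1)) * psi (x / v) ≤ x * ((1+ε)*(P/2^40) - (1-ε)*(Q/2^40)) := by
  obtain ⟨hJ, M, h1, h2, h3, h4, h5⟩ := h
  refine ⟨fun v => (M v : ℝ) - K, by simp [h2], by simp [h3], fun v a b => sub_le_sub_right (by exact_mod_cast h1 v a b) _, ?_⟩
  have key : ∀ v ∈ Finset.Ico 2 J, ((M v : ℝ) - K - ((M (v-1) : ℝ) - K)) * psi (x/v) ≤
      x * (1+ε) * (((M v - M (v-1) : ℕ) : ℝ)/v) - x * (1-ε) * (((M (v-1) - M v : ℕ) : ℝ)/v) := by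
    intro v hv
    have hv' := Finset.mem_Ico.1 hv
    have hv0 : (2:ℝ) ≤ v := by exact_mod_cast hv'.1
    have hvJ : (v:ℝ) ≤ J := by exact_mod_cast hv'.2.le
    have hp := hψ (x/v) (by gcongr) (by gcongr)
    rw [abs_le] at hp
    have e1 : x * (1+ε) * (((M v - M (v-1) : ℕ) : ℝ)/v) = ((M v - M (v-1) : ℕ) : ℝ) * (x/v + ε*(x/v)) := by ring
    have e2 : x * (1-ε) * (((M (v-1) - M v : ℕ) : ℝ)/v) = ((M (v-1) - M v : ℕ) : ℝ) * (x/v - ε*(x/v)) := by ring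
    rw [e1, e2]
    rcases le_total (M v) (M (v-1)) with h | h
    · rw [Nat.sub_eq_zero_of_le h, Nat.cast_sub h]
      have : (M v : ℝ) ≤ M (v-1) := by exact_mod_cast h
      push_cast
      nlinarith
    · rw [Nat.sub_eq_zero_of_le h, Nat.cast_sub h]
      have : (M (v-1) : ℝ) ≤ M v := by exact_mod_cast h
      push_cast
      nlinarith
  refine (sum_le_sum key).trans ?_
  rw [sum_sub_distrib, ← mul_sum, ← mul_sum]
  have a1 : x * (1+ε) * (∑ v ∈ Finset.Ico 2 J, ((M v - M (v-1) : ℕ) : ℝ)/v) ≤ x * (1+ε) * (P/2^40) := by gcongr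
  have a2 : x * (1-ε) * (Q/2^40) ≤ x * (1-ε) * (∑ v ∈ Finset.Ico 2 J, ((M (v-1) - M v : ℕ) : ℝ)/v) :=
    mulL h5 (mul_nonneg hx lna)
  linarith

theorem DEmap {PM NM k J m P Q n p q : ℕ} (ok : Ok PM NM k) (ct : Ct PM NM k J m P Q n p q) (hkJ : 2^k ≤ J) (hJ22 : J ≤ 2^22)
    {U V : ℝ}
    (hm : (m:ℝ) ≤ pcn PM k + 1024) (hn : (n:ℝ) ≤ pcn NM k + 1023)
    (u1 : (laU NM k - laL PM k : ℝ)/2^48 + 1/2^20 - 1 + ((P:ℝ)-Q)/2^40 + (pcn PM k + 1.01 - (m - 1024))/J ≤ U)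
    (u2 : (laU PM k - laL NM k : ℝ)/2^48 + 1/2^20 + 1 + ((p:ℝ)-q)/2^40 + (pcn NM k - 0.99 - (n - 1024))/J ≤ U)
    (v1 : ((P:ℝ)+Q)/2^40 + (pcn PM k + 1.01 - (m - 1024))/J ≤ V)
    (v2 : ((p:ℝ)+q)/2^40 + (pcn NM k - 0.99 - (n - 1024))/J ≤ V)
    {x ε : ℝ} (hx : (J:ℝ) ≤ x) (hε : 0 ≤ ε) (hε1 : ε ≤ 1)
    (hψ : ∀ t, x/J ≤ t → t ≤ x/2 → |psi t - t| ≤ ε * t) :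
    |psi x - x| ≤ (U + V * ε) * x + (pcn PM k + pcn NM k + 1) * (1 + Lo x) := by
  have hJ2 : 2 ≤ J := ct.plus.1
  have hJ0 : (0:ℝ) < J := by exact_mod_cast (show 0 < J by omega)
  have hJr : (2:ℝ) ≤ J := by exact_mod_cast hJ2
  have hx1 : 1 ≤ x := by linarith
  have hs := sgc_bd ok.hP ok.hN ok.hs ok.p1 ok.p2
  have hJr22 : (J:ℝ) ≤ 2^22 := by exact_mod_cast hJ22
  have hsJ : |sg PM NM k * J| ≤ 0.01 := by
    rw [abs_mul, Nat.abs_cast]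
    calc _ ≤ (1/2^31 : ℝ) * 2^22 := by gcongr
      _ ≤ _ := by norm_num
  set L := Ls PM NM k J with hLdef
  have hL : ∀ p ∈ L, 0 < p.1 ∧ (p.1:ℝ) ≤ x := by
    intro p hp
    rw [hLdef, Ls, List.mem_cons] at hp
    rcases hp with h | h
    · subst h; exact ⟨by omega, hx⟩
    · rw [List.mem_map] at h
      obtain ⟨i, hi, rfl⟩ := h
      rw [List.mem_range] at hi
      refine ⟨by simp, le_trans ?_ hx⟩
      exact_mod_cast (show i + 1 ≤ J by omega)
  have h0 : LS L (fun d => 1/(d:ℝ)) = 0 := by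
    rw [hLdef, Ls_LS k J _ ok.hP ok.hN]
    have : ∑ d ∈ Frg (2^k), ((bt PM d : ℝ) - bt NM d) * (1/(d:ℝ)) = sg PM NM k := by
      rw [sg]; exact sumC fun d _ => by ring
    rw [this]; field_simp; ring
  have hee : ∀ v < J, ee L v = ep PM NM k v := by
    intro v hv
    rw [ee, hLdef, Ls_LS k J _ ok.hP ok.hN, ep_cast, Nat.div_eq_of_lt hv]; simp
  have hee2 : ∀ v, J ≤ v → -(pcn NM k : ℝ) - 0.01 ≤ ee L v - 1 ∧ ee L v - 1 ≤ pcn PM k + 0.01 := by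
    intro v hv
    have h1 := fr_bd (k := k) ok.hP ok.hN v
    have h2 := div_fract v J oma
    have e : ee L v - 1 = (v * sg PM NM k - ∑ d ∈ Frg (2^k), ((bt PM d : ℝ) - bt NM d) * ((v/d:ℕ):ℝ))
        - (sg PM NM k * J) * ((v:ℝ)/J - ((v/J:ℕ):ℝ)) := by
      rw [ee, hLdef, Ls_LS k J _ ok.hP ok.hN]
      field_simp; ring
    have h3 : |(sg PM NM k * J) * ((v:ℝ)/J - ((v/J:ℕ):ℝ))| ≤ 0.01 * 1 := by
      rw [abs_mul]
      exact mul_le_mul hsJ (abs_le.2 ⟨by linarith, by linarith⟩) (abs_nonneg _) nnm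
    rw [abs_le] at h3
    rw [e]
    constructor <;> linarith [h1.1, h1.2, h3.1, h3.2]
  have hlogJ : |sg PM NM k * Lo J| ≤ 1/2^20 := by
    have l0 : 0 ≤ Lo J := Real.log_nonneg lna
    have l1 : Lo J ≤ 22 := by
      have : Lo J ≤ Lo (2^22) := Real.log_le_log hJ0 hJr22
      rw [Real.log_pow] at this
      have := Real.log_two_lt_d9
      push_cast at *
      linarith
    rw [abs_mul, abs_of_nonneg l0]
    calc _ ≤ (1/2^31 : ℝ) * 22 := by gcongr
      _ ≤ _ := by norm_num
  have hA : LS L (fun d => Lo d / d) = -(sg PM NM k * Lo J) +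
      (∑ d ∈ Frg (2^k), (bt PM d : ℝ) * (Lo d / d) - ∑ d ∈ Frg (2^k), (bt NM d : ℝ) * (Lo d / d)) := by
    rw [hLdef, Ls_LS k J _ ok.hP ok.hN]
    simp only [sub_mul, sum_sub_distrib]
    field_simp
  have a1 := laU_ge (k := k) ok.hP
  have a2 := laL_le (k := k) ok.hP
  have a3 := laU_ge (k := k) ok.hN
  have a4 := laL_le (k := k) ok.hN
  have hLA : LA L * (1 + Lo x) ≤ (pcn PM k + pcn NM k + 1) * (1 + Lo x) := by
    have : 0 ≤ Lo x := Real.log_nonneg hx1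
    refine mul_le_mul_of_nonneg_right ?_ lna
    have := Ls_LA k J ok.hP ok.hN
    linarith
  have hpJ := hψ (x/J) le_rfl (by gcongr)
  rw [abs_le] at hpJ hlogJ
  have hxJ : 0 ≤ x / J := by positivity
  rw [abs_le]
  constructor
  · obtain ⟨M, m1, m2, m3, m4⟩ := ct.minus.sum_bound lna hε hε1 hψ
    have h := DE_side L (τ := -1) nnm hL hx1 h0 M m1 hJ2 (B := pcn NM k - 0.99 - (n-1024)) (by
      intro v hv1 hv2
      have := m3 v hv1 hv2
      rw [hee v hv2]
      refine le_trans ?_ this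
      have h2 : ((1024:ℕ):ℤ) - ep PM NM k v ≤ ((((1024:ℕ):ℤ) - ep PM NM k v).toNat : ℤ) := Int.self_le_toNat _
      have h3 : (1024:ℝ) - ep PM NM k v ≤ ((((1024:ℕ):ℤ) - ep PM NM k v).toNat : ℝ) := by exact_mod_cast h2
      push_cast at h3 ⊢
      linarith) (by
      intro v hv
      rw [m2]
      have := (hee2 v hv).1
      push_cast
      linarith)
    have hB : (pcn NM k - 0.99 - ((n:ℝ)-1024)) * psi (x/J) ≤ (pcn NM k - 0.99 - ((n:ℝ)-1024)) * (x/J + ε*(x/J)) :=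
      mulL (by linarith [hpJ.2]) (by norm_num; linarith)
    rw [hA] at h
    set S1 := ∑ d ∈ Frg (2^k), (bt PM d : ℝ) * (Lo d / d)
    set S2 := ∑ d ∈ Frg (2^k), (bt NM d : ℝ) * (Lo d / d)
    set b := pcn NM k - 0.99 - ((n:ℝ)-1024)
    have x1 : x * (-(sg PM NM k * Lo J) + (S1 - S2)) ≤ x * (1/2^20 + ((laU PM k - laL NM k : ℝ)/2^48)) :=
      mulL (by rw [sub_div]; linarith [hlogJ.1]) lna
    have x2 := mul_le_mul_of_nonneg_right u2 (show 0 ≤ x by linarith)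
    have x3 := mul_le_mul_of_nonneg_right v2 (show 0 ≤ x * ε by positivity)
    have e : x / J + ε * (x/J) = x * (1/J) + x*ε*(1/J) := by ring
    rw [e] at hB
    have e2 : b / J = b * (1/J) := by ring
    rw [e2] at x2 x3
    ring_nf at x1 x2 x3 m4 hB h hLA ⊢
    linarith
  · obtain ⟨M, m1, m2, m3, m4⟩ := ct.plus.sum_bound lna hε hε1 hψ
    have h := DE_side L (τ := 1) nnm hL hx1 h0 M m1 hJ2 (B := pcn PM k + 1.01 - (m-1024)) (by
      intro v hv1 hv2
      have := m3 v hv1 hv2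
      rw [hee v hv2]
      refine le_trans ?_ this
      have h2 : ((1024:ℕ):ℤ) + ep PM NM k v ≤ ((((1024:ℕ):ℤ) + ep PM NM k v).toNat : ℤ) := Int.self_le_toNat _
      have h3 : (1024:ℝ) + ep PM NM k v ≤ ((((1024:ℕ):ℤ) + ep PM NM k v).toNat : ℝ) := by exact_mod_cast h2
      push_cast at h3 ⊢
      linarith) (by
      intro v hv
      rw [m2]
      have := (hee2 v hv).2
      push_cast
      linarith)
    have hB : (pcn PM k + 1.01 - ((m:ℝ)-1024)) * psi (x/J) ≤ (pcn PM k + 1.01 - ((m:ℝ)-1024)) * (x/J + ε*(x/J)) :=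
      mulL (by linarith [hpJ.2]) (by norm_num; linarith)
    rw [hA] at h
    set S1 := ∑ d ∈ Frg (2^k), (bt PM d : ℝ) * (Lo d / d)
    set S2 := ∑ d ∈ Frg (2^k), (bt NM d : ℝ) * (Lo d / d)
    set b := pcn PM k + 1.01 - ((m:ℝ)-1024)
    have x1 : x * (-(1/2^20) - ((laU NM k - laL PM k : ℝ)/2^48)) ≤ x * (-(sg PM NM k * Lo J) + (S1 - S2)) :=
      mulL (by rw [sub_div]; linarith [hlogJ.2]) lna
    have x2 := mul_le_mul_of_nonneg_right u1 (show 0 ≤ x by linarith)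
    have x3 := mul_le_mul_of_nonneg_right v1 (show 0 ≤ x * ε by positivity)
    have e : x / J + ε * (x/J) = x * (1/J) + x*ε*(1/J) := by ring
    rw [e] at hB
    have e2 : b / J = b * (1/J) := by ring
    rw [e2] at x2 x3
    ring_nf at x1 x2 x3 m4 hB h hLA ⊢
    linarith

lemma sc_c1 : laU scP 9 = 1178566057185460 := by decide +kernel
lemma sc_c2 : laL scP 9 = 1178566056420856 := by decide +kernel
lemma sc_c3 : laU scN 9 = 1460100921853281 := by decide +kernel
lemma sc_c4 : laL scN 9 = 1460100920923841 := by decide +kernel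
lemma sc_c5 : pcn scP 9 = 73 := by decide +kernel
lemma sc_c6 : pcn scN 9 = 75 := by decide +kernel
lemma bc_c1 : laU bcP 12 = 2667850412770661 := by decide +kernel
lemma bc_c2 : laL bcP 12 = 2667850410984197 := by decide +kernel
lemma bc_c3 : laU bcN 12 = 2949233296514861 := by decide +kernel
lemma bc_c4 : laL bcN 12 = 2949233294563243 := by decide +kernel
lemma bc_c5 : pcn bcP 12 = 957 := by decide +kernel
lemma bc_c6 : pcn bcN 12 = 958 := by decide +kernel

/-- small Diamond-Erdos map -/
theorem smap {x ε : ℝ} (hx : 16384 ≤ x) (hε : 0 ≤ ε) (hε1 : ε ≤ 1)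
    (hψ : ∀ t, x/16384 ≤ t → t ≤ x/2 → |psi t - t| ≤ ε * t) :
    |psi x - x| ≤ (0.01101 + 0.3734 * ε) * x + 149 * (1 + Lo x) := by
  have h := DEmap scok scJ (U := 0.01101) (V := 0.3734) nnm nnm (by rw [sc_c5]; norm_num) (by rw [sc_c6]; norm_num)
    (by rw [sc_c3, sc_c2, sc_c5]; norm_num) (by rw [sc_c1, sc_c4, sc_c6]; norm_num)
    (by rw [sc_c5]; norm_num) (by rw [sc_c6]; norm_num) (x := x) (by exact_mod_cast hx) hε hε1 (by exact_mod_cast hψ)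
  rw [sc_c5, sc_c6] at h
  norm_num at h ⊢
  exact h

/-- big Diamond-Erdos map -/
theorem bmap {x ε : ℝ} (hx : 4194304 ≤ x) (hε : 0 ≤ ε) (hε1 : ε ≤ 1)
    (hψ : ∀ t, x/4194304 ≤ t → t ≤ x/2 → |psi t - t| ≤ ε * t) :
    |psi x - x| ≤ (0.000836 + 0.4088 * ε) * x + 1916 * (1 + Lo x) := by
  have h := DEmap bcok bcJ (U := 0.000836) (V := 0.4088) nnm nnm (by rw [bc_c5]; norm_num) (by rw [bc_c6]; norm_num)
    (by rw [bc_c3, bc_c2, bc_c5]; norm_num) (by rw [bc_c1, bc_c4, bc_c6]; norm_num)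
    (by rw [bc_c5]; norm_num) (by rw [bc_c6]; norm_num) (x := x) (by exact_mod_cast hx) hε hε1 (by exact_mod_cast hψ)
  rw [bc_c5, bc_c6] at h
  norm_num at h ⊢
  exact h

/-- conjunction tree -/
def al (f : ℕ → Bool) (k : ℕ) : ℕ → Bool :=
  Nat.rec (motive := fun _ => ℕ → Bool) f (fun k ih a => and (ih a) (ih (Nat.add a (Nat.pow 2 k)))) k

lemma al_spec {f : ℕ → Bool} {k a : ℕ} (h : al f k a = true) {i : ℕ} (h1 : a ≤ i) (h2 : i < a + 2^k) : f i = true := by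
  induction k generalizing a with
  | zero => rw [show i = a by simp at h2; omega]; exact h
  | succ k ih =>
    have h' : (al f k a && al f k (a + 2^k)) = true := h
    rw [Bool.and_eq_true] at h'
    rcases lt_or_ge i (a + 2^k) with h3 | h3
    · exact ih h'.1 h1 h3
    · exact ih h'.2 h3 (by rw [pow_succ] at h2; omega)

def lcmU (n : ℕ) : ℕ :=
  Nat.rec (motive := fun _ => ℕ) 1 (fun m L => Nat.mul L (Nat.div (Nat.succ m) (Nat.gcd L (Nat.succ m)))) n

lemma lcmU_eq (n : ℕ) : lcmU n = Nat.lcmUpto n := by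
  induction n with
  | zero => simp [lcmU, Nat.lcmUpto]
  | succ n ih =>
    have : lcmU (n+1) = lcmU n * ((n+1) / Nat.gcd (lcmU n) (n+1)) := rfl
    rw [this, ih, Nat.lcmUpto, Nat.lcmUpto, ← Finset.insert_Icc_right_eq_Icc_add_one oma,
      Finset.lcm_insert, id]
    rw [lcm_comm]
    exact (Nat.mul_div_assoc _ (Nat.gcd_dvd_right _ _)).symm

/-- `n+1`-st factor of the running lcm -/
def rr (m : ℕ) : ℕ := Nat.div (Nat.succ m) (Nat.gcd (lcmU m) (Nat.succ m))

/-- `0` at arguments `≤ 1` -/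
def sk (f : ℕ → ℕ) (r : ℕ) : ℕ := Nat.rec (motive := fun _ => ℕ) 0 (fun _ _ => f r) (Nat.pred r)

def psU (n : ℕ) : ℕ := Nat.rec (motive := fun _ => ℕ) 0 (fun m u => Nat.add u (sk lgU (rr m))) n
def psL (n : ℕ) : ℕ := Nat.rec (motive := fun _ => ℕ) 0 (fun m u => Nat.add u (sk lgL (rr m))) n

def sck (n : ℕ) : Bool :=
  and (Nat.ble (Nat.mul 100 (psU n)) (Nat.mul (Nat.mul 104 T48) n))
    (or (Nat.blt n 570) (and (Nat.ble (Nat.mul 10000 (psU n)) (Nat.mul (Nat.mul 10235 T48) n))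
      (Nat.ble (Nat.mul (Nat.mul 9765 T48) (Nat.succ n)) (Nat.mul 10000 (psL n)))))

lemma psi_lcmU (n : ℕ) : psi n = Lo (lcmU n) := by
  rw [lcmU_eq, Chebyshev.psi_eq_log_lcmUpto]

lemma lcmU_pos (n : ℕ) : 0 < lcmU n := by rw [lcmU_eq]; exact Nat.lcmUpto_pos n

lemma rr_pos (m : ℕ) : 0 < rr m :=
  Nat.div_pos (Nat.le_of_dvd oma (Nat.gcd_dvd_right _ _)) (Nat.gcd_pos_of_pos_right _ oma)

lemma psi_succ_rr (m : ℕ) : psi ((m+1:ℕ):ℝ) = psi m + Lo (rr m) := by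
  rw [psi_lcmU, psi_lcmU, ← Real.log_mul (by have := lcmU_pos m; positivity) (by have := rr_pos m; positivity)]
  have : lcmU (m+1) = lcmU m * rr m := rfl
  rw [this]; push_cast; rfl

lemma psU_ge (n : ℕ) : 2^48 * psi n ≤ (psU n : ℝ) := by
  induction n with
  | zero => simp [psU]
  | succ m ih =>
    have : psU (m+1) = psU m + sk lgU (rr m) := rfl
    rw [this, psi_succ_rr]; push_cast
    have h : 2^48 * Lo (rr m) ≤ (sk lgU (rr m) : ℝ) := by
      have h0 := rr_pos m
      rcases h1 : rr m with _ | _ | r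
      · omega
      · simp [sk]
      · exact le_lgU (r+1+1) oma
    linarith

lemma psL_le (n : ℕ) : (psL n : ℝ) ≤ 2^48 * psi n := by
  induction n with
  | zero => simp [psL]
  | succ m ih =>
    have : psL (m+1) = psL m + sk lgL (rr m) := rfl
    rw [this, psi_succ_rr]; push_cast
    have h : (sk lgL (rr m) : ℝ) ≤ 2^48 * Lo (rr m) := by
      have h0 := rr_pos m
      rcases h1 : rr m with _ | _ | r
      · omega
      · simp [sk]
      · exact lgL_le (r+1+1) oma
    linarith

lemma sck1 {n : ℕ} (h : sck n = true) : psi n ≤ 1.04 * n := by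
  have h' : (Nat.ble (100 * psU n) (104 * T48 * n) && _) = true := h
  rw [Bool.and_eq_true] at h'
  have h1 : 100 * psU n ≤ 104 * T48 * n := Nat.le_of_ble_eq_true h'.1
  have h2 := psU_ge n
  have h3 : (100:ℝ) * psU n ≤ 104 * T48 * n := by exact_mod_cast h1
  norm_num at h2 ⊢
  linarith

lemma sck2 {n : ℕ} (h : sck n = true) (hn : 570 ≤ n) : psi n ≤ 1.0235 * n ∧ 0.9765 * (n+1) ≤ psi n := by
  have h' : (_ && (Nat.blt n 570 || (Nat.ble (10000 * psU n) (10235 * T48 * n) &&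
    Nat.ble (9765 * T48 * (n+1)) (10000 * psL n)))) = true := h
  rw [Bool.and_eq_true] at h'
  have h0 : Nat.blt n 570 = false := by
    rw [Bool.eq_false_iff]; intro h5
    rw [Nat.blt_eq] at h5
    omega
  have h3 := h'.2
  rw [h0, Bool.false_or, Bool.and_eq_true] at h3
  have a1 : 10000 * psU n ≤ 10235 * T48 * n := Nat.le_of_ble_eq_true h3.1
  have a2 : 9765 * T48 * (n+1) ≤ 10000 * psL n := Nat.le_of_ble_eq_true h3.2
  have h2 := psU_ge n
  have h4 := psL_le n
  have a3 : (10000:ℝ) * psU n ≤ 10235 * T48 * n := by exact_mod_cast a1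
  have a4 : (9765:ℝ) * T48 * (n+1) ≤ 10000 * psL n := by exact_mod_cast a2
  norm_num at h2 h4 ⊢
  constructor <;> linarith

set_option maxHeartbeats 10000000 in
theorem sck_all : al sck 12 0 = true := by decide +kernel

theorem psi_le_104 {t : ℝ} (h1 : 0 ≤ t) (h2 : t < 4096) : psi t ≤ 1.04 * t := by
  rw [Chebyshev.psi_eq_psi_coe_floor]
  have hf : ⌊t⌋₊ < 4096 := by rw [Nat.floor_lt h1]; exact_mod_cast h2
  have := sck1 (al_spec sck_all (i := ⌊t⌋₊) oma (by norm_num; omega))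
  have := Nat.floor_le h1
  linarith

theorem psi_low {t : ℝ} (h1 : 570 ≤ t) (h2 : t < 4096) : |psi t - t| ≤ 0.0235 * t := by
  rw [Chebyshev.psi_eq_psi_coe_floor]
  have h0 : 0 ≤ t := by linarith
  have hf : ⌊t⌋₊ < 4096 := by rw [Nat.floor_lt h0]; exact_mod_cast h2
  have := sck2 (al_spec sck_all (i := ⌊t⌋₊) oma (by norm_num; omega)) (Nat.le_floor (by exact_mod_cast h1))
  have h3 := Nat.floor_le h0
  have h4 := Nat.lt_floor_add_one t
  rw [abs_le]
  constructor <;> linarith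

/-! Sieve bitmaps and block prime counts. -/
def P61 : ℕ := 117288381359406970983270

def pfl (d : ℕ) : Bool := and (Nat.ble 2 d) (or (Nat.blt d 64) (Nat.beq (Nat.gcd d P61) 1))

lemma P61_dvd : P61 ∣ Nat.factorial 63 := by decide +kernel

lemma gcd_P61 {p : ℕ} (hp : p.Prime) (h : 64 ≤ p) : Nat.gcd p P61 = 1 := by
  rw [← Nat.Coprime, Nat.Prime.coprime_iff_not_dvd hp]
  intro hd
  have := (Nat.Prime.dvd_factorial hp).1 (hd.trans P61_dvd)
  omega

lemma pfl_prime {p : ℕ} (hp : p.Prime) : pfl p = true := by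
  have h2 := hp.two_le
  unfold pfl
  rw [Bool.and_eq_true, Bool.or_eq_true]
  refine ⟨Nat.ble_eq_true_of_le h2, ?_⟩
  rcases lt_or_ge p 64 with h | h
  · left; rw [Nat.blt_eq]; exact h
  · right; rw [gcd_P61 hp h]; rfl

lemma pfl_ge {d : ℕ} (h : pfl d = true) : 2 ≤ d := by
  unfold pfl at h
  rw [Bool.and_eq_true] at h
  exact Nat.le_of_ble_eq_true h.1

def tf (b : Bool) (x : ℕ) : ℕ := Bool.rec (motive := fun _ => ℕ) 0 x b

/-- disjunction tree -/
def lo (f : ℕ → ℕ) (k : ℕ) : ℕ → ℕ :=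
  Nat.rec (motive := fun _ => ℕ → ℕ) f (fun k ih a => Nat.lor (ih a) (ih (Nat.add a (Nat.pow 2 k)))) k

lemma lo_bit (f : ℕ → ℕ) (k a i : ℕ) : (lo f k a).testBit i = true ↔ ∃ d, a ≤ d ∧ d < a + 2^k ∧ (f d).testBit i = true := by
  induction k generalizing a with
  | zero =>
    refine ⟨fun h => ⟨a, le_refl _, by simp, h⟩, ?_⟩
    rintro ⟨d, h1, h2, h3⟩
    rw [show d = a by simp at h2; omega] at h3
    exact h3
  | succ k ih =>
    have : lo f (k+1) a = lo f k a ||| lo f k (a+2^k) := rfl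
    rw [this, Nat.testBit_or, Bool.or_eq_true, ih, ih, pow_succ]
    constructor
    · rintro (⟨d, h1, h2, h3⟩ | ⟨d, h1, h2, h3⟩)
      · exact ⟨d, h1, by omega, h3⟩
      · exact ⟨d, by omega, by omega, h3⟩
    · rintro ⟨d, h1, h2, h3⟩
      rcases lt_or_ge d (a + 2^k) with h | h
      · exact Or.inl ⟨d, h1, h, h3⟩
      · exact Or.inr ⟨d, h, by omega, h3⟩

lemma bit_pack {n : ℕ} {f : ℕ → ℕ} (hf : ∀ i < n, f i < 2) {i : ℕ} (hi : i < n) :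
    (pack 1 n f).testBit i = true ↔ f i = 1 := by
  have h := gt_pack (w := 1) (n := n) (f := f) (by simpa using hf) hi
  have h2 : gt 1 (pack 1 n f) i = (pack 1 n f >>> i) % 2 := by
    show (pack 1 n f >>> (1*i)) % 2^1 = _
    rw [one_mul, pow_one]
  rw [Nat.testBit, Nat.and_comm, Nat.and_one_is_mod, ← h2, h]
  have := hf i hi
  simp; omega

lemma pack_ones (n : ℕ) : pack 1 n (fun _ => 1) = 2^n - 1 := by
  induction n with
  | zero => simp [pack]
  | succ n ih =>
    rw [pack_succ, ih, one_mul, one_mul, pow_succ]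
    have : 0 < 2^n := by positivity
    omega

lemma pack_of_bits {n Y : ℕ} (h : Y < 2^n) {f : ℕ → ℕ} (hf : ∀ i < n, f i < 2) (hb : ∀ i < n, Y.testBit i = true ↔ f i = 1) :
    Y = pack 1 n f := by
  apply Nat.eq_of_testBit_eq
  intro i
  rcases lt_or_ge i n with hi | hi
  · rw [Bool.eq_iff_iff, hb i hi, bit_pack hf hi]
  · have h1 := pack_lt (w := 1) (n := n) (f := f) (by simpa using hf)
    rw [one_mul] at h1
    rw [Nat.testBit_lt_two_pow (lt_of_lt_of_le h (Nat.pow_le_pow_right nnm hi)),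
      Nat.testBit_lt_two_pow (lt_of_lt_of_le h1 (Nat.pow_le_pow_right nnm hi))]

lemma hit_bit {N y0 d i : ℕ} (hd : 0 < d) (hi : i < 2^N) : (hit 1 N y0 d).testBit i = true ↔ 1 ≤ i ∧ d ∣ y0 + i := by
  have h := CR_hit 1 N y0 d hd
  have h1 : CR 1 (2^N) (fun i => (((fun i => if 1 ≤ i ∧ d ∣ y0 + i then 1 else 0 : ℕ → ℕ) i : ℕ) : ℤ)) (hit 1 N y0 d) := by
    refine h.congr fun i _ => ?_
    dsimp only
    split_ifs <;> rfl
  have hf : ∀ i < 2^N, (fun i => if 1 ≤ i ∧ d ∣ y0 + i then 1 else 0 : ℕ → ℕ) i < 2 := fun i _ => by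
    dsimp only; split_ifs <;> norm_num
  have h2 := h1.final (by simpa using hf)
  have h3 := bit_pack hf hi
  rw [← h2, one_mul, Nat.testBit_mod_two_pow] at h3
  simp only [hi, decide_true, Bool.true_and] at h3
  rw [h3]
  split_ifs with hh <;> simp [hh]

def nonp (N y0 : ℕ) : ℕ := Nat.lor (lo (fun d => tf (pfl d) (hit 1 N y0 d)) 12 0) 1
def prm (N y0 : ℕ) : ℕ := (fun M => Nat.sub (Nat.sub M 1) (Nat.mod (nonp N y0) M)) (Nat.pow 2 (Nat.pow 2 N))

lemma tf_bit (b : Bool) (x i : ℕ) : (tf b x).testBit i = true ↔ b = true ∧ x.testBit i = true := by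
  cases b <;> simp [tf]

theorem prm_eq {N y0 : ℕ} (h2 : 2 ∣ y0) (h0 : 4096 ≤ y0) (h1 : y0 + 2^N ≤ 2^24) :
    prm N y0 = pack 1 (2^N) (fun i => if (y0+i).Prime then 1 else 0) := by
  have key : nonp N y0 % 2^(2^N) = pack 1 (2^N) (fun i => if (y0+i).Prime then 0 else 1) := by
    refine pack_of_bits (Nat.mod_lt _ psv) (fun i _ => by split_ifs <;> norm_num) fun i hi => ?_
    rw [Nat.testBit_mod_two_pow]
    simp only [hi, decide_true, Bool.true_and]
    have e : nonp N y0 = lo (fun d => tf (pfl d) (hit 1 N y0 d)) 12 0 ||| 1 := rfl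
    rw [e, Nat.testBit_or, Bool.or_eq_true, lo_bit]
    have : ((if (y0+i).Prime then 0 else 1) = 1) ↔ ¬ (y0+i).Prime := by split_ifs with h <;> simp [h]
    rw [this]
    constructor
    · rintro (⟨d, _, hd2, hd3⟩ | h)
      · rw [tf_bit] at hd3
        have hd := pfl_ge hd3.1
        rw [hit_bit oma hi] at hd3
        intro hp
        rcases (Nat.dvd_prime hp).1 hd3.2.2 with h | h
        · omega
        · norm_num at hd2; omega
      · have : i = 0 := by
          by_contra hne
          rw [Nat.testBit_lt_two_pow (Nat.one_lt_two_pow hne)] at h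
          exact absurd h (by simp)
        subst this
        intro hp
        have := (Nat.dvd_prime hp).1 (show 2 ∣ y0 + 0 by simpa using h2)
        omega
    · intro hp
      rcases Nat.eq_zero_or_pos i with h | h
      · right; subst h; rfl
      left
      have hm := Nat.minFac_prime (show y0 + i ≠ 1 by omega)
      have hm2 := Nat.minFac_sq_le_self (show 0 < y0 + i by omega) hp
      refine ⟨(y0+i).minFac, Nat.zero_le _, ?_, ?_⟩
      · have : (y0+i).minFac^2 < 4096^2 := by
          refine lt_of_le_of_lt hm2 ?_
          norm_num at h1 ⊢; omega
        have := lt_of_pow_lt_pow_left₀ 2 nnm this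
        simpa using this
      · rw [tf_bit, hit_bit hm.pos hi]
        exact ⟨pfl_prime hm, h, Nat.minFac_dvd _⟩
  show 2^(2^N) - 1 - nonp N y0 % 2^(2^N) = _
  rw [key, ← pack_ones, pack_sub _ _ _ _ (fun i _ => by split_ifs <;> norm_num)]
  exact pack_congr fun i _ => by split_ifs <;> rfl

/-! block counts -/
def lv (n w x : ℕ) : ℕ :=
  (fun e => Nat.add e (Nat.shiftRight (Nat.sub x e) w)) (Nat.land x (Nat.div (Nat.sub (Nat.pow 2 n) 1) (Nat.add (Nat.pow 2 w) 1)))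

lemma pack_pair (w m : ℕ) (f : ℕ → ℕ) : pack w (2*m) f = pack (2*w) m (fun i => f (2*i)) + 2^w * pack (2*w) m (fun i => f (2*i+1)) := by
  induction m with
  | zero => simp [pack]
  | succ m ih =>
    rw [show 2*(m+1) = 2*m+1+1 by ring, pack_succ, pack_succ, ih, pack_succ, pack_succ,
      show w * (2*m) = 2*w*m by ring, show w * (2*m+1) = w + 2*w*m by ring, pow_add]
    ring

lemma pack_full (w m : ℕ) : pack w m (fun _ => 2^w - 1) + 1 = 2^(w*m) := by
  induction m with
  | zero => simp [pack]
  | succ m ih =>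
    rw [pack_succ, mul_add, mul_one, pow_add, ← ih]
    have : 1 ≤ 2^w := Nat.one_le_two_pow
    obtain ⟨c, hc⟩ := Nat.exists_eq_add_of_le this
    rw [hc, Nat.add_sub_cancel_left]; ring

lemma lv_pack {w m : ℕ} {f : ℕ → ℕ} (hf : ∀ i < 2*m, f i < 2^w) :
    lv (2*w*m) w (pack w (2*m) f) = pack (2*w) m (fun i => f (2*i) + f (2*i+1)) := by
  have hw : 1 ≤ 2^w := Nat.one_le_two_pow
  have hM : (2^(2*w*m) - 1) / (2^w+1) = pack (2*w) m (fun _ => 2^w - 1) := by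
    rw [← pack_full (2*w) m, Nat.add_sub_cancel]
    apply Nat.div_eq_of_eq_mul_right psv
    rw [pack_smul]
    refine pack_congr fun i _ => ?_
    rw [mul_comm 2 w, pow_mul]
    obtain ⟨c, hc⟩ := Nat.exists_eq_add_of_le hw
    rw [hc, Nat.add_sub_cancel_left]
    rw [Nat.sub_eq_iff_eq_add (by nlinarith)]; ring
  have hX : pack w (2*m) f = pack (2*w) m (fun i => f (2*i) + 2^w * f (2*i+1)) := by
    rw [pack_pair, pack_smul, pack_add]
  have hE : pack w (2*m) f &&& (2^(2*w*m) - 1) / (2^w+1) = pack (2*w) m (fun i => f (2*i)) := by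
    rw [hM, hX, pack_land]
    · refine pack_congr fun i hi => ?_
      rw [Nat.and_two_pow_sub_one_eq_mod, Nat.add_mul_mod_self_left, Nat.mod_eq_of_lt (hf _ oma)]
    · intro i hi
      have h1 := hf (2*i) oma
      have h2 : f (2*i+1) + 1 ≤ 2^w := hf (2*i+1) oma
      rw [show 2*w = w + w by ring, pow_add]
      nlinarith
    · intro i hi
      rw [show 2*w = w + w by ring, pow_add]
      have : 2^w ≤ 2^w * 2^w := Nat.le_mul_of_pos_right _ oma
      omega
  show (pack w (2*m) f &&& (2^(2*w*m) - 1) / (2^w+1)) + (pack w (2*m) f - (pack w (2*m) f &&& (2^(2*w*m) - 1) / (2^w+1))) >>> w = _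
  rw [hE, pack_pair w m f, Nat.add_sub_cancel_left, Nat.shiftRight_eq_div_pow, Nat.mul_div_cancel_left _ psv, pack_add]

def pc (n j x : ℕ) : ℕ := Nat.rec (motive := fun _ => ℕ) x (fun j x => lv n (Nat.pow 2 j) x) j

lemma cnt_le {f : ℕ → ℕ} (hf : ∀ i, f i ≤ 1) (j a : ℕ) : ∑ t ∈ Frg (2^j), f (a + t) < 2^(2^j) := by
  have : ∑ t ∈ Frg (2^j), f (a + t) ≤ 2^j := by
    refine (Finset.sum_le_card_nsmul _ _ 1 fun i _ => hf _).trans (by simp)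
  exact this.trans_lt Nat.lt_two_pow_self

lemma pc_pack {f : ℕ → ℕ} (hf : ∀ i, f i ≤ 1) (j m : ℕ) :
    pc (2^j*m) j (pack 1 (2^j*m) f) = pack (2^j) m (fun i => ∑ t ∈ Frg (2^j), f (2^j*i + t)) := by
  induction j generalizing m with
  | zero => simp [pc]
  | succ j ih =>
    have e : pc (2^(j+1)*m) (j+1) (pack 1 (2^(j+1)*m) f) = lv (2^(j+1)*m) (2^j) (pc (2^(j+1)*m) j (pack 1 (2^(j+1)*m) f)) := rfl
    have h := ih (2*m)
    rw [show 2^j*(2*m) = 2^(j+1)*m by rw [pow_succ]; ring] at h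
    rw [e, h]
    have h3 := lv_pack (w := 2^j) (m := m) (f := fun i => ∑ t ∈ Frg (2^j), f (2^j*i + t)) (fun i _ => cnt_le hf _ _)
    rw [show 2*2^j*m = 2^(j+1)*m by rw [pow_succ]; ring] at h3
    rw [h3, show 2 * 2^j = 2^(j+1) by rw [pow_succ]; ring]
    refine pack_congr fun i _ => ?_
    rw [pow_succ, mul_two, Finset.sum_range_add]
    congr 1
    · refine sumC fun t _ => ?_
      congr 1; ring
    · refine sumC fun t _ => ?_
      congr 1; ring

/-- block counts: lane `i` (width `2^j`) is the number of primes in `[y0+2^j i, y0+2^j(i+1))` -/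
def bcn (N y0 j : ℕ) : ℕ := pc (Nat.pow 2 N) j (prm N y0)

theorem bcn_get {N y0 j : ℕ} (h2 : 2 ∣ y0) (h0 : 4096 ≤ y0) (h1 : y0 + 2^N ≤ 2^24) {i : ℕ} (hi : 2^j*(i+1) ≤ 2^N) (hj : j ≤ N) :
    gt (2^j) (bcn N y0 j) i = ((Finset.Ico (y0+2^j*i) (y0+2^j*(i+1))).filter Nat.Prime).card := by
  obtain ⟨r, rfl⟩ := Nat.exists_eq_add_of_le hj
  have hf : ∀ i, (fun i => if (y0+i).Prime then 1 else 0 : ℕ → ℕ) i ≤ 1 := fun i => by dsimp only; split_ifs <;> norm_num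
  have e : bcn (j+r) y0 j = pc (2^j*2^r) j (pack 1 (2^j*2^r) (fun i => if (y0+i).Prime then 1 else 0)) := by
    rw [← pow_add, ← prm_eq h2 h0 h1]; rfl
  rw [e, pc_pack hf, gt_pack (fun i _ => cnt_le hf j (2^j*i)), Finset.card_filter, Finset.sum_Ico_eq_sum_range]
  · rw [show y0 + 2^j*(i+1) - (y0+2^j*i) = 2^j by rw [mul_add, mul_one, ← add_assoc, Nat.add_sub_cancel_left]]
    refine sumC fun t _ => ?_
    rw [add_assoc]
  · rw [pow_add] at hi
    exact Nat.le_of_mul_le_mul_left hi (by positivity)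

/-! Landau bookkeeping: `EB z e` bounds the cost of higher prime powers. -/
def EB (z e : ℕ) : Prop := ∀ a : ℕ → ℕ, (∀ p, p.Prime → 2 ≤ a p → p^(a p) < z + p^(a p - 1)) →
  ∀ s : Finset ℕ, (∀ p ∈ s, p.Prime ∧ 2 ≤ a p) → ∑ p ∈ s, (p^(a p) - p) ≤ e

/-- sum of primes up to `q` -/
def Sp (q : ℕ) : ℕ := ∑ p ∈ (Frg (q+1)).filter Nat.Prime, p

def Lq (q : ℕ) : Prop := ∃ z e F : ℕ, 11*q ≤ 10*z ∧ EB z e ∧ Sp q + z + e ≤ F ∧ (F:ℝ) * Lo F ≤ (q:ℝ)^2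

def M64 : ℕ := 2891462833508853932
def qfl (d : ℕ) : Bool := or (and (Nat.ble 64 d) (Nat.beq (Nat.gcd d P61) 1)) (Nat.beq (bt M64 d) 1)

lemma qfl_small : ∀ p < 64, p.Prime → Nat.beq (bt M64 p) 1 = true := by decide +kernel

lemma qfl_prime {p : ℕ} (hp : p.Prime) : qfl p = true := by
  unfold qfl
  rw [Bool.or_eq_true, Bool.and_eq_true]
  rcases lt_or_ge p 64 with h | h
  · exact Or.inr (qfl_small p h hp)
  · left; rw [gcd_P61 hp h]; exact ⟨Nat.ble_eq_true_of_le h, rfl⟩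

lemma sm_flag (f : ℕ → ℕ) (k : ℕ) : ∑ p ∈ (Frg (2^k)).filter Nat.Prime, f p ≤ sm (fun d => tf (qfl d) (f d)) k 0 := by
  rw [sm_eq]
  simp only [zero_add]
  calc _ = ∑ p ∈ (Frg (2^k)).filter Nat.Prime, tf (qfl p) (f p) :=
        sumC fun p hp => by rw [qfl_prime (Finset.mem_filter.1 hp).2]; rfl
    _ ≤ _ := Finset.sum_le_sum_of_subset (Finset.filter_subset _ _)

def mpf (z p k : ℕ) : ℕ → ℕ := Nat.rec (motive := fun _ => ℕ → ℕ) (fun x => x)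
  (fun _ ih x => Bool.rec (motive := fun _ => ℕ) x (ih (Nat.mul x p)) (Nat.blt (Nat.sub (Nat.mul x p) x) z)) k

lemma mpf_succ (z p k x : ℕ) : mpf z p (k+1) x = if x*p - x < z then mpf z p k (x*p) else x := by
  have : mpf z p (k+1) x = Bool.rec (motive := fun _ => ℕ) x (mpf z p k (x*p)) (Nat.blt (x*p-x) z) := rfl
  rw [this]
  by_cases h : x*p - x < z
  · rw [if_pos h]
    have : Nat.blt (x*p-x) z = true := by rw [Nat.blt_eq]; exact h
    rw [this]
  · rw [if_neg h]
    have : Nat.blt (x*p-x) z = false := by rw [Bool.eq_false_iff]; intro h2; rw [Nat.blt_eq] at h2; exact h h2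
    rw [this]

lemma mpf_ge {z p : ℕ} (hp : 2 ≤ p) (k j b : ℕ) (hb : b ≤ k) (h : ∀ c, c < b → p^(j+c) * p - p^(j+c) < z) : p^(j+b) ≤ mpf z p k (p^j) := by
  induction k generalizing j b with
  | zero => rw [show b = 0 by omega]; exact le_refl _
  | succ k ih =>
    rw [mpf_succ]
    rcases b with _ | b
    · split_ifs with h1
      · have := ih (j+1) 0 oma (fun c hc => by omega)
        rw [← pow_succ]
        exact le_trans (Nat.pow_le_pow_right oma oma) this
      · exact le_refl _
    · rw [if_pos (by simpa using h 0 oma), ← pow_succ]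
      have := ih (j+1) b oma (fun c hc => by
        have := h (c+1) oma
        rwa [show j + (c+1) = j+1+c by ring] at this)
      rwa [show j + (b+1) = j+1+b by ring]

def Eez (k z : ℕ) : ℕ := sm (fun d => tf (qfl d) (Nat.sub (mpf z d 24 d) d)) k 0

lemma EB_Eez {k z : ℕ} (hz : z ≤ 2^24) (hk : z ≤ 2^k * (2^k - 1)) : EB z (Eez k z) := by
  intro a ha s hs
  have h1 : ∀ p ∈ s, p < 2^k ∧ p^(a p) ≤ mpf z p 24 p := by
    intro p hp
    obtain ⟨h2, h3⟩ := hs p hp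
    have h4 := ha p h2 h3
    have hp2 := h2.two_le
    obtain ⟨c, hc⟩ := Nat.exists_eq_add_of_le h3
    have e1 : p^(a p) = p^(1+c) * p := by rw [hc, ← pow_succ]; congr 1; ring
    have e2 : p^(a p - 1) = p^(1+c) := by rw [hc]; congr 1; omega
    rw [e1, e2] at h4
    have mono : ∀ d, d ≤ 1+c → p^d * p - p^d < z := by
      intro d hd
      have : p^d * p - p^d = p^d * (p-1) := by rw [Nat.mul_sub, mul_one]
      rw [this]
      have h5 : p^d * (p-1) ≤ p^(1+c) * (p-1) := Nat.mul_le_mul_right _ (Nat.pow_le_pow_right oma hd)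
      have h6 : p^(1+c) * (p-1) = p^(1+c)*p - p^(1+c) := by rw [Nat.mul_sub, mul_one]
      have h7 : p^(1+c) * 1 ≤ p^(1+c) * p := Nat.mul_le_mul_left _ oma
      omega
    constructor
    · by_contra hcon
      push Not at hcon
      have := mono 1 oma
      rw [pow_one] at this
      have e3 : p * p - p = p * (p-1) := by rw [Nat.mul_sub, mul_one]
      have := Nat.mul_le_mul hcon (Nat.sub_le_sub_right hcon 1)
      omega
    · have hc24 : 1 + c ≤ 24 := by
        have h8 := mono (1+c) le_rfl
        have h9 : p^(1+c)*p - p^(1+c) = p^(1+c) * (p-1) := by rw [Nat.mul_sub, mul_one]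
        have h10 : 2^(1+c) ≤ p^(1+c) := Nat.pow_le_pow_left hp2 _
        have h11 : p^(1+c) * 1 ≤ p^(1+c) * (p-1) := Nat.mul_le_mul_left _ oma
        have : 2^(1+c) < 2^24 := by omega
        exact ((Nat.pow_lt_pow_iff_right nnm).1 this).le
      have := mpf_ge (z := z) hp2 24 1 (1+c) hc24 (fun d hd => mono _ oma)
      rw [pow_one] at this
      rw [e1, ← pow_succ]
      rwa [show 1 + c + 1 = 1 + (1+c) by ring]
  refine le_trans ?_ (sm_flag _ _)
  calc ∑ p ∈ s, (p^(a p) - p) ≤ ∑ p ∈ s, (mpf z p 24 p - p) := sum_le_sum fun p hp => Nat.sub_le_sub_right (h1 p hp).2 _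
    _ ≤ _ := Finset.sum_le_sum_of_subset fun p hp => Finset.mem_filter.2 ⟨Finset.mem_range.2 (h1 p hp).1, (hs p hp).1⟩

lemma psi_theta {t : ℝ} (h1 : 4096 ≤ t) (h2 : t < 2^24) : psi t ≤ theta t + 1.386 * Real.sqrt t := by
  have h0 : 0 ≤ t := by linarith
  have h := Chebyshev.psi_sub_theta_le_psi_add_psi_add_psi t
  have key : ∀ y : ℝ, 2 ≤ y → t^y⁻¹ ≤ t^(2:ℝ)⁻¹ := fun y hy => by
    refine Real.rpow_le_rpow_of_exponent_le lna ?_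
    exact inv_anti₀ nnm hy
  have hs : t^(2:ℝ)⁻¹ = Real.sqrt t := by rw [Real.sqrt_eq_rpow]; norm_num
  have hs4 : Real.sqrt t < 4096 := by
    rw [Real.sqrt_lt' nnm]; norm_num at h2 ⊢; exact h2
  have b : ∀ y : ℝ, 2 ≤ y → psi (t^y⁻¹) ≤ 1.04 * t^y⁻¹ := fun y hy =>
    psi_le_104 psv (by have := key y hy; rw [hs] at this; linarith)
  have b2 := b 2 nnm
  have b3 := b 3 nnm
  have b5 := b 5 nnm
  have c3 : t^(3:ℝ)⁻¹ * 4 ≤ t^(2:ℝ)⁻¹ := by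
    have e : t^(2:ℝ)⁻¹ = t^(3:ℝ)⁻¹ * t^((1:ℝ)/6) := by rw [← Real.rpow_add lna]; norm_num
    rw [e]
    refine mulL ?_ psv
    have : (4:ℝ) = 4096^((1:ℝ)/6) := by
      rw [show (4096:ℝ) = 4^(6:ℝ) by norm_num, ← Real.rpow_mul nnm]; norm_num
    rw [this]
    exact Real.rpow_le_rpow nnm h1 nnm
  have c5 : t^(5:ℝ)⁻¹ * 12.125 ≤ t^(2:ℝ)⁻¹ := by
    have e : t^(2:ℝ)⁻¹ = t^(5:ℝ)⁻¹ * t^((3:ℝ)/10) := by rw [← Real.rpow_add lna]; norm_num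
    rw [e]
    refine mulL ?_ psv
    have h3 : (12.125:ℝ) ≤ 4096^((3:ℝ)/10) := by
      have : (12.125:ℝ) = (12.125^(5:ℝ))^((1:ℝ)/5) := by rw [← Real.rpow_mul nnm]; norm_num
      rw [this, show (4096:ℝ)^((3:ℝ)/10) = (4096^((3:ℝ)/2))^((1:ℝ)/5) by rw [← Real.rpow_mul nnm]; norm_num]
      refine Real.rpow_le_rpow psv ?_ nnm
      have : (4096:ℝ)^((3:ℝ)/2) = 262144 := by
        rw [show (4096:ℝ) = 64^(2:ℝ) by norm_num, ← Real.rpow_mul nnm]; norm_num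
      rw [this]; norm_num
    exact h3.trans (Real.rpow_le_rpow nnm h1 nnm)
  rw [hs] at h b2 c3 c5
  norm_num at *
  linarith [Real.sqrt_nonneg t]

/-- log-sum over primes `< y` -/
def Tl (y : ℕ) : ℝ := ∑ p ∈ (Frg y).filter Nat.Prime, Lo p

lemma theta_le_Tl {t : ℝ} {b : ℕ} (ht : 0 ≤ t) (h : t < b) : theta t ≤ Tl b := by
  rw [theta, Tl]
  refine Finset.sum_le_sum_of_subset_of_nonneg (fun p hp => ?_) (fun p hp _ => Real.log_natCast_nonneg p)
  rw [Finset.mem_filter, Finset.mem_Ioc] at hp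
  refine Finset.mem_filter.2 ⟨Finset.mem_range.2 ?_, hp.2⟩
  have : ⌊t⌋₊ < b := by rw [Nat.floor_lt ht]; exact h
  omega

def St (y TU PL SU : ℕ) : Prop := 4096 ≤ y ∧ 2^48 * Tl y ≤ (TU:ℝ) ∧ (PL:ℝ) ≤ 2^48 * psi ((y-1:ℕ):ℝ) ∧
  ∑ p ∈ (Frg y).filter Nat.Prime, p ≤ SU ∧
  (∀ t : ℝ, 4096 ≤ t → t < y → |psi t - t| ≤ 0.0235 * t) ∧ ∀ q : ℕ, 4096 ≤ q → q < y → Lq q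

lemma filt_split (a b : ℕ) (h : a ≤ b) : (Frg b).filter Nat.Prime = (Frg a).filter Nat.Prime ∪ (Finset.Ico a b).filter Nat.Prime := by
  rw [← Finset.filter_union]; congr 1
  ext x; simp only [Finset.mem_range, Finset.mem_union, Finset.mem_Ico]; omega

lemma filt_disj (a b : ℕ) : Disjoint ((Frg a).filter Nat.Prime) ((Finset.Ico a b).filter Nat.Prime) := by
  rw [Finset.disjoint_left]; intro x h1 h2
  simp only [Finset.mem_filter, Finset.mem_range, Finset.mem_Ico] at h1 h2; omega

theorem St.step {a TU PL SU : ℕ} (h : St a TU PL SU) {L c s z e : ℕ} (hL : 0 < L)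
    (hc : c = ((Finset.Ico a (a+L)).filter Nat.Prime).card) (hb : a + L ≤ 2^24) (hs : 0 < s)
    (k1 : 10000 * s * (TU + c * lgU (a+L)) + T48 * 6930 * (a + L + s*s) ≤ T48 * 10235 * a * s)
    (k2 : 9765 * T48 * (a+L) ≤ 10000 * PL)
    (hE : EB z e) (hz : 11*(a+L) ≤ 10*z)
    (k3 : (SU + c*(a+L) + z + e) * lgU (SU + c*(a+L) + z + e) ≤ T48 * (a*a)) :
    St (a+L) (TU + c*lgU (a+L)) (PL + c * lgL a) (SU + c*(a+L)) := by
  obtain ⟨ha, hT, hP, hS, hD, hQ⟩ := h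
  have hT' : 2^48 * Tl (a+L) ≤ ((TU + c * lgU (a+L) : ℕ) : ℝ) := by
    rw [Tl, filt_split a (a+L) oma, Finset.sum_union (filt_disj _ _), mul_add]
    push_cast
    refine add_le_add hT ?_
    rw [mul_sum, hc, ← nsmul_eq_mul]
    refine Finset.sum_le_card_nsmul _ _ _ fun p hp => ?_
    rw [Finset.mem_filter, Finset.mem_Ico] at hp
    refine le_trans ?_ (le_lgU (a+L) oma)
    refine mulL (Real.log_le_log (by exact_mod_cast hp.2.pos) ?_) psv
    exact_mod_cast hp.1.2.le
  have hP' : ((PL + c * lgL a : ℕ) : ℝ) ≤ 2^48 * psi ((a+L-1:ℕ):ℝ) := by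
    have e : psi ((a-1:ℕ):ℝ) + c * Lo a ≤ psi ((a+L-1:ℕ):ℝ) := by
      rw [psi, psi, Nat.floor_natCast, Nat.floor_natCast]
      have : Finset.Ioc 0 (a+L-1) = Finset.Ioc 0 (a-1) ∪ Finset.Ico a (a+L) := by
        ext x; simp only [Finset.mem_Ioc, Finset.mem_union, Finset.mem_Ico]; omega
      rw [this, Finset.sum_union (by
        rw [Finset.disjoint_left]; intro x h1 h2
        simp only [Finset.mem_Ioc, Finset.mem_Ico] at h1 h2; omega)]
      refine add_le_add le_rfl ?_
      calc (c:ℝ) * Lo a = ((Finset.Ico a (a+L)).filter Nat.Prime).card • Lo a := by rw [hc, nsmul_eq_mul]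
        _ ≤ ∑ p ∈ (Finset.Ico a (a+L)).filter Nat.Prime, vM p := by
          refine Finset.card_nsmul_le_sum _ _ _ fun p hp => ?_
          rw [Finset.mem_filter, Finset.mem_Ico] at hp
          rw [ArithmeticFunction.vonMangoldt_apply_prime hp.2]
          exact Real.log_le_log psv (by exact_mod_cast hp.1.1)
        _ ≤ _ := Finset.sum_le_sum_of_subset_of_nonneg (Finset.filter_subset _ _) (fun p _ _ => ArithmeticFunction.vonMangoldt_nonneg)
    have h2 := lgL_le a oma
    have h3 : (c:ℝ) * lgL a ≤ c * (2^48 * Lo a) := mulL h2 psv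
    push_cast
    nlinarith
  have hS' : ∑ p ∈ (Frg (a+L)).filter Nat.Prime, p ≤ SU + c*(a+L) := by
    rw [filt_split a (a+L) oma, Finset.sum_union (filt_disj _ _)]
    refine add_le_add hS ?_
    rw [hc, ← smul_eq_mul]
    refine Finset.sum_le_card_nsmul _ _ _ fun p hp => ?_
    rw [Finset.mem_filter, Finset.mem_Ico] at hp
    exact hp.1.2.le
  refine ⟨by omega, hT', hP', hS', ?_, ?_⟩
  · intro t ht1 ht2
    rcases lt_or_ge t a with hta | hta
    · exact hD t ht1 hta
    have hb' : ((a+L:ℕ):ℝ) ≤ 2^24 := by exact_mod_cast hb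
    rw [abs_le]
    constructor
    · have h2 : psi ((a-1:ℕ):ℝ) ≤ psi t := Chebyshev.psi_mono (le_trans (by exact_mod_cast Nat.sub_le a 1) hta)
      have h3 : (9765:ℝ) * T48 * ((a+L:ℕ):ℝ) ≤ 10000 * PL := by exact_mod_cast k2
      norm_num at hP ⊢ h3 ht2
      linarith
    · have h1 := psi_theta ht1 (lt_of_lt_of_le ht2 hb')
      have h2 := theta_le_Tl lna ht2
      have hs' : (0:ℝ) < s := by exact_mod_cast hs
      have hsq := Real.sqrt_nonneg t
      have hsq2 := Real.sq_sqrt (show 0 ≤ t by linarith)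
      have h3 : 2 * s * Real.sqrt t ≤ ((a+L:ℕ):ℝ) + s*s := by nlinarith [sq_nonneg (Real.sqrt t - s)]
      have h4 : (10000:ℝ) * s * ((TU + c * lgU (a+L) : ℕ):ℝ) + T48 * 6930 * (((a+L:ℕ):ℝ) + s*s) ≤ T48 * 10235 * a * s := by
        exact_mod_cast k1
      have h5 : s * (2^48 * Tl (a+L)) ≤ s * ((TU + c * lgU (a+L) : ℕ):ℝ) := mulL hT' hs'.le
      have h6 : s * psi t ≤ s * (1.0235 * a) := by
        have : s * psi t ≤ s * (Tl (a+L) + 1.386 * Real.sqrt t) := mulL lna hs'.le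
        norm_num at this h5 ⊢
        nlinarith
      have h7 := le_of_mul_le_mul_left h6 hs'
      norm_num at h7 ⊢
      linarith
  · intro q hq1 hq2
    rcases lt_or_ge q a with hqa | hqa
    · exact hQ q hq1 hqa
    refine ⟨z, e, SU + c*(a+L) + z + e, by omega, hE, ?_, ?_⟩
    · have : Sp q ≤ SU + c*(a+L) := by
        refine le_trans (Finset.sum_le_sum_of_subset (Finset.filter_subset_filter _ (Finset.range_subset_range.2 oma))) hS'
      omega
    · set F := SU + c*(a+L) + z + e with hF
      have hFp : 0 < F := by omega
      have h1 := le_lgU F hFp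
      have h2 : (F:ℝ) * lgU F ≤ T48 * ((a:ℝ)*a) := by exact_mod_cast k3
      have h3 : (F:ℝ) * (2^48 * Lo F) ≤ F * lgU F := mulL h1 psv
      have h4 : (a:ℝ) ≤ q := by exact_mod_cast hqa
      have h5 : (0:ℝ) ≤ a := by positivity
      norm_num at h3
      nlinarith

/-- one block: `a` start, `L` length, `c` prime count -/
def stp (a L c s z e : ℕ) (K : ℕ → ℕ → ℕ → Bool) (TU PL SU : ℕ) : Bool :=
  (fun b => (fun TU' => (fun SU' => (fun F =>
    and (Nat.ble (Nat.add (Nat.mul (Nat.mul 10000 s) TU') (Nat.mul (Nat.mul T48 6930) (Nat.add b (Nat.mul s s))))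
        (Nat.mul (Nat.mul (Nat.mul T48 10235) a) s))
    (and (Nat.ble (Nat.mul (Nat.mul 9765 T48) b) (Nat.mul 10000 PL))
    (and (Nat.ble (Nat.mul F (lgU F)) (Nat.mul T48 (Nat.mul a a)))
      (K TU' (Nat.add PL (Nat.mul c (lgL a))) SU'))))
    (Nat.add (Nat.add SU' z) e)) (Nat.add SU (Nat.mul c b))) (Nat.add TU (Nat.mul c (lgU b)))) (Nat.add a L)

def go (y0 j s T z e : ℕ) (K : ℕ → ℕ → ℕ → ℕ → Bool) (n : ℕ) : ℕ → ℕ → ℕ → ℕ → Bool :=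
  Nat.rec (motive := fun _ => ℕ → ℕ → ℕ → ℕ → Bool) K
    (fun _ ih i TU PL SU => stp (Nat.add y0 (Nat.mul (Nat.pow 2 j) i)) (Nat.pow 2 j) (gt (Nat.pow 2 j) T i) s z e
      (ih (Nat.succ i)) TU PL SU) n

def chs (y0 j s T kk : ℕ) (K : ℕ → ℕ → ℕ → ℕ → Bool) (m : ℕ) : ℕ → ℕ → ℕ → ℕ → Bool :=
  Nat.rec (motive := fun _ => ℕ → ℕ → ℕ → ℕ → Bool) K
    (fun _ ih i TU PL SU => (fun z => and (Nat.ble z (Nat.mul (Nat.pow 2 kk) (Nat.sub (Nat.pow 2 kk) 1)))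
       ((fun e => go y0 j s T z e ih 16 i TU PL SU) (Eez kk z)))
      (Nat.succ (Nat.div (Nat.mul 11 (Nat.add y0 (Nat.mul (Nat.pow 2 j) (Nat.add i 16)))) 10))) m

def pce (N y0 j s kk m TU PL SU TU1 PL1 SU1 : ℕ) : Bool :=
  chs y0 j s (bcn N y0 j) kk (fun _ TU PL SU => and (Nat.ble TU TU1) (and (Nat.ble PL1 PL) (Nat.ble SU SU1))) m 0 TU PL SU

lemma go_spec {N y0 j s z e : ℕ} {K : ℕ → ℕ → ℕ → ℕ → Bool} (h2 : 2 ∣ y0) (h0 : 4096 ≤ y0) (h1 : y0 + 2^N ≤ 2^24) (hj : j ≤ N) (hs : 0 < s)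
    (hE : EB z e) (n i : ℕ) (hz : 11*(y0+2^j*(i+n)) ≤ 10*z) (hi : 2^j*(i+n) ≤ 2^N) {TU PL SU : ℕ}
    (h : go y0 j s (bcn N y0 j) z e K n i TU PL SU = true) (st : St (y0+2^j*i) TU PL SU) :
    ∃ TU' PL' SU', K (i+n) TU' PL' SU' = true ∧ St (y0+2^j*(i+n)) TU' PL' SU' := by
  induction n generalizing i TU PL SU with
  | zero => exact ⟨TU, PL, SU, h, st⟩
  | succ n ih =>
    have e1 : 2^j*(i+1) ≤ 2^j*(i+(n+1)) := Nat.mul_le_mul_left _ oma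
    have e2 : y0 + 2^j*i + 2^j = y0 + 2^j*(i+1) := by ring
    have hh : stp (y0 + 2^j*i) (2^j) (gt (2^j) (bcn N y0 j) i) s z e (go y0 j s (bcn N y0 j) z e K n (i+1)) TU PL SU = true := h
    unfold stp at hh
    simp only [Bool.and_eq_true, Nat.ble_eq, Nat.add_eq, Nat.mul_eq] at hh
    have hc := bcn_get h2 h0 h1 (i := i) (j := j) oma hj
    rw [← e2] at hc
    have st' := st.step (L := 2^j) (s := s) (z := z) (e := e) psv hc (by rw [e2]; omega) hs hh.1 hh.2.1 hE (by rw [e2]; omega) hh.2.2.1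
    rw [e2] at st'
    have := ih (i+1) (by rw [show i + 1 + n = i + (n+1) by ring]; exact hz) (by rw [show i + 1 + n = i + (n+1) by ring]; exact hi) (by have := hh.2.2.2; rw [e2] at this; exact this) st'
    rwa [show i + 1 + n = i + (n+1) by ring] at this

lemma chs_spec {N y0 j s kk : ℕ} {K : ℕ → ℕ → ℕ → ℕ → Bool} (h2 : 2 ∣ y0) (h0 : 4096 ≤ y0) (h1 : 11*(y0 + 2^N) + 10 ≤ 10*2^24) (hj : j ≤ N) (hs : 0 < s)
    (m i : ℕ) (hi : 2^j*(i+16*m) ≤ 2^N) {TU PL SU : ℕ}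
    (h : chs y0 j s (bcn N y0 j) kk K m i TU PL SU = true) (st : St (y0+2^j*i) TU PL SU) :
    ∃ TU' PL' SU', K (i+16*m) TU' PL' SU' = true ∧ St (y0+2^j*(i+16*m)) TU' PL' SU' := by
  induction m generalizing i TU PL SU with
  | zero => exact ⟨TU, PL, SU, h, st⟩
  | succ m ih =>
    have e1 : 2^j*(i+16) ≤ 2^j*(i+16*(m+1)) := Nat.mul_le_mul_left _ oma
    have hh : (Nat.ble (11 * (y0 + 2^j*(i+16)) / 10 + 1) (2^kk * (2^kk - 1)) && go y0 j s (bcn N y0 j) (11 * (y0 + 2^j*(i+16)) / 10 + 1)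
      (Eez kk (11 * (y0 + 2^j*(i+16)) / 10 + 1)) (chs y0 j s (bcn N y0 j) kk K m) 16 i TU PL SU) = true := h
    rw [Bool.and_eq_true, Nat.ble_eq] at hh
    obtain ⟨T', P', S', g1, g2⟩ := go_spec h2 h0 oma hj hs (EB_Eez oma hh.1) 16 i oma oma hh.2 st
    have := ih (i+16) (by rw [show i + 16 + 16*m = i + 16*(m+1) by ring]; exact hi) g1 g2
    rwa [show i + 16 + 16*m = i + 16*(m+1) by ring] at this

theorem St.pce {N y0 j s kk m TU PL SU TU1 PL1 SU1 : ℕ} (st : St y0 TU PL SU) (h : pce N y0 j s kk m TU PL SU TU1 PL1 SU1 = true)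
    {y1 : ℕ} (hm : 2^j*(16*m) = 2^N) (hs : 0 < s) (h1 : 11*(y0 + 2^N) + 10 ≤ 10*2^24) (h2 : 2 ∣ y0) (hj : j ≤ N) (hy : y1 = y0 + 2^N) : St y1 TU1 PL1 SU1 := by
  obtain ⟨T', P', S', g1, g2⟩ := chs_spec (kk := kk) h2 st.1 h1 hj hs m 0 (by simpa using hm.le) h (by simpa using st)
  simp only [zero_add, hm] at g2
  simp only [Bool.and_eq_true, Nat.ble_eq] at g1
  obtain ⟨a1, a2, a3, a4, a5, a6⟩ := g2
  subst hy
  exact ⟨a1, a2.trans (by exact_mod_cast g1.1), le_trans (by exact_mod_cast g1.2.1) a3, a4.trans g1.2.2, a5, a6⟩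

def TU0 : ℕ := sm (fun d => tf (qfl d) (lgU d)) 12 0
def SU0 : ℕ := sm (fun d => tf (qfl d) d) 12 0

theorem St_zero {TU PL SU : ℕ} (h1 : Nat.ble TU0 TU = true) (h2 : Nat.ble PL (psL 4095) = true) (h3 : Nat.ble SU0 SU = true) : St 4096 TU PL SU := by
  refine ⟨le_refl _, ?_, ?_, ?_, fun t a b => ?_, fun q a b => by omega⟩
  · have := sm_flag lgU 12
    have h4 : ∑ p ∈ (Frg (2^12)).filter Nat.Prime, lgU p ≤ TU := this.trans (Nat.le_of_ble_eq_true h1)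
    rw [Tl, mul_sum]
    have h5 : ((∑ p ∈ (Frg (2^12)).filter Nat.Prime, lgU p : ℕ):ℝ) ≤ TU := by exact_mod_cast h4
    refine le_trans ?_ h5
    push_cast
    exact sum_le_sum fun p hp => le_lgU p (Finset.mem_filter.1 hp).2.pos
  · exact le_trans (by exact_mod_cast Nat.le_of_ble_eq_true h2) (psL_le 4095)
  · exact (sm_flag (fun d => d) 12).trans (Nat.le_of_ble_eq_true h3)
  · norm_num at b; linarith

set_option maxHeartbeats 10000000 in
theorem St_end : St 9437184 2655869287973508012416 2654894229836878345631 2872343202891 := by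
  have s0 : St 4096 1133614265458117051 1155719419915194767 1070091 := St_zero dck dck dck
  have s1 : St 8192 2270206799724161429 2291601841223744064 3916043 := s0.pce (N := 12) (j := 5) (s := 78) (kk := 7) (m := 8) dck
    nnm nnm nnm nnm nnm nnm
  have s2 : St 16384 4576418687384550029 4596479069249072696 14619851 := s1.pce (N := 13) (j := 6) (s := 110) (kk := 8) (m := 8) dck
    nnm nnm nnm nnm nnm nnm
  have s3 : St 32768 9154374970601552576 9171969486600775321 54196043 := s2.pce (N := 14) (j := 7) (s := 156) (kk := 8) (m := 8) dck
    nnm nnm nnm nnm nnm nnm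
  have s4 : St 65536 18349492977575990554 18362446346297694856 202814027 := s3.pce (N := 15) (j := 8) (s := 221) (kk := 9) (m := 8) dck
    nnm nnm nnm nnm nnm nnm
  have s5 : St 131072 36790416883401857800 36794636286934240129 763582539 := s4.pce (N := 16) (j := 9) (s := 313) (kk := 9) (m := 8) dck
    nnm nnm nnm nnm nnm nnm
  have s6 : St 262144 73608854179194044553 73596632650966924851 2875313227 := s5.pce (N := 17) (j := 10) (s := 443) (kk := 10) (m := 8) dck
    nnm nnm nnm nnm nnm nnm
  have s7 : St 524288 147431381073868070131 147387984902724733800 10891222091 := s6.pce (N := 18) (j := 11) (s := 627) (kk := 10) (m := 8) dck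
    nnm nnm nnm nnm nnm nnm
  have s8 : St 1048576 294849532382853887301 294747077984241203363 41269709899 := s7.pce (N := 19) (j := 12) (s := 886) (kk := 11) (m := 8) dck
    nnm nnm nnm nnm nnm nnm
  have s9 : St 2097152 589987244552501220034 589772309625860286492 157001108555 := s8.pce (N := 20) (j := 13) (s := 1254) (kk := 11) (m := 8) dck
    nnm nnm nnm nnm nnm nnm
  have s10 : St 3145728 884997847117529474530 884656291083517510490 343367928907 := s9.pce (N := 20) (j := 14) (s := 1773) (kk := 12) (m := 4) dck
    nnm nnm nnm nnm nnm nnm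
  have s11 : St 4194304 1180232273000769704844 1179802866880646283180 598502640715 := s10.pce (N := 20) (j := 14) (s := 1773) (kk := 12) (m := 4) dck
    nnm nnm nnm nnm nnm nnm
  have s12 : St 5242880 1475457476709260705904 1474894085464442106677 921585650763 := s11.pce (N := 20) (j := 15) (s := 2508) (kk := 12) (m := 2) dck
    nnm nnm nnm nnm nnm nnm
  have s13 : St 6291456 1770416098863171219997 1769744750109050939420 1310804020299 := s12.pce (N := 20) (j := 15) (s := 2508) (kk := 12) (m := 2) dck
    nnm nnm nnm nnm nnm nnm
  have s14 : St 7340032 2065740106170952754956 2064978341471569318970 1766286658635 := s13.pce (N := 20) (j := 15) (s := 2508) (kk := 12) (m := 2) dck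
    nnm nnm nnm nnm nnm nnm
  have s15 : St 8388608 2360669325532466219187 2359830050437790902771 2286262029387 := s14.pce (N := 20) (j := 15) (s := 2508) (kk := 12) (m := 2) dck
    nnm nnm nnm nnm nnm nnm
  have s16 : St 9437184 2655869287973508012416 2654894229836878345631 2872343202891 := s15.pce (N := 20) (j := 16) (s := 3547) (kk := 13) (m := 1) dck
    nnm nnm nnm nnm nnm nnm
  exact s16

/-! Global bounds for `ψ`. -/
lemma log_le_lin {x : ℝ} (n : ℕ) (hx : 0 < x) : Lo x ≤ x / 2^n + n * 0.6932 - 1 := by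
  have h := Real.log_le_sub_one_of_pos (x := x / 2^n) psv
  rw [Real.log_div hx.ne' psv, Real.log_pow] at h
  have := Real.log_two_lt_d9
  have : (n:ℝ) * Lo 2 ≤ n * 0.6932 := by gcongr; linarith
  linarith

theorem psi_235_aux (k : ℕ) : ∀ t : ℝ, 570 ≤ t → t < 9437184 * 2^k → |psi t - t| ≤ 0.0235 * t := by
  induction k with
  | zero =>
    intro t h1 h2
    rcases lt_or_ge t 4096 with h | h
    · exact psi_low h1 h
    · exact St_end.2.2.2.2.1 t h (by simpa using h2)
  | succ k ih =>
    intro t h1 h2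
    rcases lt_or_ge t (9437184 * 2^k) with h | h
    · exact ih t h1 h
    have h3 : (9437184:ℝ) ≤ t := by
      have : (1:ℝ) ≤ 2^k := one_le_pow₀ nnm
      linarith
    have := smap (x := t) (ε := 0.0235) lna nnm nnm (fun s h4 h5 => ih s lna (by rw [pow_succ] at h2; linarith))
    have h6 := log_le_lin 23 (x := t) lna
    norm_num at h6 this ⊢
    linarith

theorem psi_235 {t : ℝ} (h1 : 570 ≤ t) : |psi t - t| ≤ 0.0235 * t := by
  obtain ⟨k, hk⟩ := pow_unbounded_of_one_lt t (one_lt_two)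
  exact psi_235_aux k t h1 (by nlinarith)

theorem psi_201 {t : ℝ} (h1 : 9437184 ≤ t) : |psi t - t| ≤ 0.0201 * t := by
  have := smap (x := t) (ε := 0.0235) lna nnm nnm (fun s h4 h5 => psi_235 lna)
  have h6 := log_le_lin 23 (x := t) lna
  norm_num at h6 this ⊢
  linarith

theorem psi_le_all {t : ℝ} (h : 0 ≤ t) : psi t ≤ 1.04 * t := by
  rcases lt_or_ge t 4096 with h1 | h1
  · exact psi_le_104 h h1
  · have := (abs_le.1 (psi_235 (t := t) lna)).2
    linarith

/-- `Tk k = 570 * 2^(22 k)` -/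
def Tk (k : ℕ) : ℝ := 570 * 4194304^k

lemma bstage {k : ℕ} {ε ε' : ℝ} (hε : 0 ≤ ε) (hε1 : ε ≤ 1) (h : ∀ t, Tk k ≤ t → |psi t - t| ≤ ε * t)
    (he : 0.000856 + 0.4088 * ε ≤ ε') (t : ℝ) (ht : Tk (k+1) ≤ t) : |psi t - t| ≤ ε' * t := by
  have h1 : (570:ℝ) * 4194304 ≤ t := by
    refine le_trans ?_ ht
    unfold Tk
    rw [pow_succ]
    have : (1:ℝ) ≤ 4194304^k := one_le_pow₀ nnm
    linarith
  have := bmap (x := t) lna hε hε1 (fun s h4 h5 => h s (by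
    refine le_trans ?_ h4
    unfold Tk at *
    rw [pow_succ] at ht
    rw [le_div_iff₀ nnm]
    linarith))
  have h6 := log_le_lin 31 (x := t) lna
  norm_num at h6 this
  have : (0.000856 + 0.4088 * ε) * t ≤ ε' * t := by gcongr
  nlinarith

theorem psi_s0 (t : ℝ) (ht : Tk 0 ≤ t) : |psi t - t| ≤ 0.0235 * t := psi_235 (by unfold Tk at ht; linarith)
theorem psi_s1 (t : ℝ) (ht : Tk 1 ≤ t) : |psi t - t| ≤ 0.010463 * t := bstage nnm nnm psi_s0 nnm t ht
theorem psi_s2 (t : ℝ) (ht : Tk 2 ≤ t) : |psi t - t| ≤ 0.005134 * t := bstage nnm nnm psi_s1 nnm t ht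
theorem psi_s3 (t : ℝ) (ht : Tk 3 ≤ t) : |psi t - t| ≤ 0.002955 * t := bstage nnm nnm psi_s2 nnm t ht
theorem psi_s4 (t : ℝ) (ht : Tk 4 ≤ t) : |psi t - t| ≤ 0.002065 * t := bstage nnm nnm psi_s3 nnm t ht
theorem psi_s5 (t : ℝ) (ht : Tk 5 ≤ t) : |psi t - t| ≤ 0.001701 * t := bstage nnm nnm psi_s4 nnm t ht
theorem psi_s6 (t : ℝ) (ht : Tk 6 ≤ t) : |psi t - t| ≤ 0.001552 * t := bstage nnm nnm psi_s5 nnm t ht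
theorem psi_s7 (t : ℝ) (ht : Tk 7 ≤ t) : |psi t - t| ≤ 0.001491 * t := bstage nnm nnm psi_s6 nnm t ht
theorem psi_s8 (t : ℝ) (ht : Tk 8 ≤ t) : |psi t - t| ≤ 0.001466 * t := bstage nnm nnm psi_s7 nnm t ht

theorem psi_theta_all {t : ℝ} (h1 : 1 ≤ t) : psi t - 3.12 * Real.sqrt t ≤ theta t := by
  have h := Chebyshev.psi_sub_theta_le_psi_add_psi_add_psi t
  have m : ∀ r : ℝ, r ≤ 1/2 → psi (t^r) ≤ 1.04 * Real.sqrt t := by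
    intro r hr
    refine (psi_le_all psv).trans ?_
    rw [Real.sqrt_eq_rpow]
    gcongr
  have a := m (1/2) nnm
  have b := m (1/3) nnm
  have c := m (1/5) nnm
  norm_num at h a b c ⊢
  linarith

/-- next prime -/
theorem next_prime {q : ℕ} (hq : 4096 ≤ q) : ∃ p : ℕ, p.Prime ∧ q < p ∧ 10 * p ≤ 11 * q := by
  have hq' : (4096:ℝ) ≤ q := by exact_mod_cast hq
  by_contra hc
  push Not at hc
  have e : theta (1.1 * q) ≤ theta q := by
    unfold theta
    apply Finset.sum_le_sum_of_subset_of_nonneg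
    · intro p hp
      simp only [Finset.mem_filter, Finset.mem_Ioc, Nat.floor_natCast] at hp ⊢
      refine ⟨⟨hp.1.1, ?_⟩, hp.2⟩
      by_contra h
      have h2 := hc p hp.2 oma
      have h3 := (Nat.le_floor_iff psv).1 hp.1.2
      have h4 : (11:ℝ) * q < 10 * p := by exact_mod_cast h2
      linarith
    · intro p hp _
      exact Real.log_natCast_nonneg p
  have u := (abs_le.1 (psi_235 (t := q) lna)).2
  have l := (abs_le.1 (psi_235 (t := 1.1 * q) lna)).1
  have tp := Chebyshev.theta_le_psi q
  have hs : Real.sqrt (1.1 * q) ≤ 1.05 * Real.sqrt q := by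
    rw [Real.sqrt_mul nnm]
    gcongr
    rw [Real.sqrt_le_left nnm]
    norm_num
  have sq := Real.mul_self_sqrt (show (0:ℝ) ≤ q by positivity)
  have s64 : 64 ≤ Real.sqrt q := Real.le_sqrt_of_sq_le lna
  rcases lt_or_ge (1.1 * (q:ℝ)) (2^24) with h | h
  · have := psi_theta (t := 1.1 * q) lna h
    nlinarith
  · have := psi_theta_all (t := 1.1 * q) lna
    have s64 : 128 ≤ Real.sqrt q := Real.le_sqrt_of_sq_le lna
    nlinarith

/-! From `θ` to the sum of primes. -/
def WW (t : ℝ) : ℝ := 1 / Lo t - 1 / (Lo t)^2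

def GG (t : ℝ) : ℝ := t^2 * (1 / (2 * Lo t) - 1 / (4 * (Lo t)^2) - 0.28 / (Lo t)^3)

lemma deriv_f {t : ℝ} (ht : 1 < t) : HasDerivAt (fun t : ℝ => t / Lo t) (WW t) t := by
  have h0 : t ≠ 0 := by linarith
  have hl : Lo t ≠ 0 := (Real.log_pos ht).ne'
  convert! (hasDerivAt_id t).div (Real.hasDerivAt_log h0) hl using 1
  unfold WW
  field_simp
  simp
  ring

lemma deriv_G {t : ℝ} (ht : 1 < t) : HasDerivAt GG (t * (1 / Lo t - 1 / (Lo t)^2 - 0.06 / (Lo t)^3 + 0.84 / (Lo t)^4)) t := by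
  have h0 : t ≠ 0 := by linarith
  have hl : Lo t ≠ 0 := (Real.log_pos ht).ne'
  have L := Real.hasDerivAt_log h0
  have a := ((hasDerivAt_pow 2 t).mul (((L.const_mul 2).inv (by simpa using hl)).sub (((L.pow 2).const_mul 4).inv (by simpa using hl)) |>.sub
     (((L.pow 3).inv (by simpa using hl)).const_mul 0.28)))
  refine (a.congr_deriv ?_).congr_of_eventuallyEq (Eventually.of_forall fun s => ?_)
  · simp only [Pi.pow_apply, Pi.sub_apply, Pi.inv_apply]
    field_simp
    ring
  · simp [GG, div_eq_mul_inv]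

lemma G_le_W {t : ℝ} (ht : Ex 14 ≤ t) : t * (1 / Lo t - 1 / (Lo t)^2 - 0.06 / (Lo t)^3 + 0.84 / (Lo t)^4) ≤ t * WW t := by
  have h0 : 0 < t := (Real.exp_pos _).trans_le ht
  have hl : 14 ≤ Lo t := (Real.le_log_iff_exp_le h0).2 ht
  unfold WW
  gcongr
  have : 0.84 / (Lo t)^4 ≤ 0.06 / (Lo t)^3 := by
    rw [div_le_div_iff₀ psv psv]
    have : 0 < Lo t ^3 := by positivity
    nlinarith
  linarith

lemma W_nonneg {t : ℝ} (ht : Ex 14 ≤ t) : 0 ≤ WW t := by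
  have h0 : 0 < t := (Real.exp_pos _).trans_le ht
  have hl : 14 ≤ Lo t := (Real.le_log_iff_exp_le h0).2 ht
  unfold WW
  rw [sub_nonneg, div_le_div_iff₀ psv psv]
  nlinarith

lemma W_cont {a x : ℝ} (ha : 1 < a) : ContinuousOn WW (Set.Icc a x) := by
  intro t ht
  have h0 : t ≠ 0 := by linarith [ht.1]
  have hl : Lo t ≠ 0 := (Real.log_pos (ha.trans_le ht.1)).ne'
  unfold WW
  exact ContinuousAt.continuousWithinAt (by fun_prop (disch := simp [*]))

lemma Sp_sum (n : ℕ) : (Sp n : ℝ) = ∑ k ∈ Finset.Icc 0 n, (k:ℝ) / Lo k * (Set.indicator {p | Nat.Prime p} (fun n : ℕ => Lo n) k) := by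
  unfold Sp
  push_cast
  rw [Finset.sum_filter, Nat.range_succ_eq_Icc_zero]
  refine sumC fun k _ => ?_
  by_cases h : k.Prime
  · have : Lo k ≠ 0 := Real.log_ne_zero_of_pos_of_ne_one (mod_cast h.pos) (mod_cast h.ne_one)
    simp [h]
    field_simp
  · simp [h]

lemma theta_sum (t : ℝ) : theta t = ∑ k ∈ Finset.Icc 0 ⌊t⌋₊, (Set.indicator {p | Nat.Prime p} (fun n : ℕ => Lo n) k) := by
  rw [Chebyshev.theta_eq_sum_Icc, Finset.sum_filter]
  refine sumC fun k _ => ?_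
  simp [Set.indicator_apply]

theorem Sp_abel {a x : ℝ} (ha : Ex 14 ≤ a) (hax : a ≤ x) {ε : ℝ} 
    (hθ : ∀ t, a ≤ t → t ≤ x → (1 - ε) * t ≤ theta t) (hε : ε ≤ 1) :
    (Sp ⌊x⌋₊ : ℝ) ≤ x * theta x / Lo x - (1 - ε) * (GG x - GG a) + (Sp ⌊a⌋₊ - a * theta a / Lo a) := by
  have ha1 : 1 < a := by
    have := Real.add_one_le_exp (14:ℝ)
    linarith
  have ab := sum_mul_eq_sub_sub_integral_mul (Set.indicator {p | Nat.Prime p} (fun n : ℕ => Lo n)) (f := fun t : ℝ => t / Lo t) (a := a) (b := x) lna hax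
    (fun t ht => (deriv_f (ha1.trans_le ht.1)).differentiableAt)
    (by
      refine ((W_cont ha1).integrableOn_Icc).congr_fun (fun t ht => ?_) measurableSet_Icc
      exact (deriv_f (ha1.trans_le ht.1)).deriv.symm)
  have fl : ⌊a⌋₊ ≤ ⌊x⌋₊ := Nat.floor_le_floor hax
  have e1 : (Sp ⌊x⌋₊ : ℝ) = Sp ⌊a⌋₊ + ∑ k ∈ Finset.Ioc ⌊a⌋₊ ⌊x⌋₊, (k:ℝ) / Lo k * (Set.indicator {p | Nat.Prime p} (fun n : ℕ => Lo n) k) := by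
    rw [Sp_sum, Sp_sum, ← Finset.sum_union]
    · congr 1
      ext k; simp; omega
    · rw [Finset.disjoint_left]; intro k; simp; omega
  rw [← theta_sum, ← theta_sum] at ab
  have int : (1 - ε) * (GG x - GG a) ≤ ∫ t in Set.Ioc a x, deriv (fun t : ℝ => t / Lo t) t * ∑ k ∈ Finset.Icc 0 ⌊t⌋₊, (Set.indicator {p | Nat.Prime p} (fun n : ℕ => Lo n) k) := by
    rw [← intervalIntegral.integral_of_le hax]
    have I1 : IntervalIntegrable (fun t => t * (1 / Lo t - 1 / (Lo t)^2 - 0.06 / (Lo t)^3 + 0.84 / (Lo t)^4)) MeasureTheory.volume a x := by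
      refine ContinuousOn.intervalIntegrable ?_
      rw [Set.uIcc_of_le hax]
      intro t ht
      have h0 : t ≠ 0 := by linarith [ht.1]
      have hl : Lo t ≠ 0 := (Real.log_pos (ha1.trans_le ht.1)).ne'
      exact ContinuousAt.continuousWithinAt (by fun_prop (disch := simp [*]))
    have F := intervalIntegral.integral_eq_sub_of_hasDerivAt (f := GG) (fun t ht => deriv_G (t := t) (by
      rw [Set.uIcc_of_le hax] at ht; linarith [ht.1])) I1
    rw [← F, ← intervalIntegral.integral_const_mul]
    have I2 : IntervalIntegrable (fun t => deriv (fun t : ℝ => t / Lo t) t * ∑ k ∈ Finset.Icc 0 ⌊t⌋₊, (Set.indicator {p | Nat.Prime p} (fun n : ℕ => Lo n) k)) MeasureTheory.volume a x := by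
      rw [intervalIntegrable_iff_integrableOn_Icc_of_le hax]
      refine integrableOn_mul_sum_Icc _ lna ?_
      refine ((W_cont ha1).integrableOn_Icc).congr_fun (fun t ht => ?_) measurableSet_Icc
      exact (deriv_f (ha1.trans_le ht.1)).deriv.symm
    refine intervalIntegral.integral_mono_on hax (I1.const_mul _) I2 fun t ht => ?_
    rw [(deriv_f (ha1.trans_le ht.1)).deriv, ← theta_sum]
    have g1 := G_le_W (ha.trans ht.1)
    have g2 := hθ t ht.1 ht.2
    have g3 := W_nonneg (ha.trans ht.1)
    calc _ ≤ (1 - ε) * (t * WW t) := by gcongr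
      _ = WW t * ((1 - ε) * t) := by ring
      _ ≤ _ := by gcongr
  rw [e1, ab]
  have : x / Lo x * theta x = x * theta x / Lo x := by ring
  have : a / Lo a * theta a = a * theta a / Lo a := by ring
  linarith

/-! Landau check for large `q`. -/
lemma EB_big (z : ℕ) : EB z (2 * z * (5 + 2 * ((Nat.sqrt z + 2) / 6))) := by
  intro a ha s hs
  have hb : ∀ p ∈ s, p^(a p) - p ≤ 2 * z := by
    intro p hp
    obtain ⟨h1, h2⟩ := hs p hp
    have h3 := ha p h1 h2
    have h4 : p^(a p) = p^(a p - 1) * p := by rw [← pow_succ]; congr 1; omega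
    have := h1.two_le
    have : 2 * p^(a p - 1) ≤ p^(a p) := by rw [h4, mul_comm]; gcongr
    omega
  have hsub : s ⊆ (Frg (Nat.sqrt z + 2)).filter Nat.Prime := by
    intro p hp
    obtain ⟨h1, h2⟩ := hs p hp
    have h3 := ha p h1 h2
    simp only [Finset.mem_filter, Finset.mem_range]
    refine ⟨?_, h1⟩
    have h4 : p^(a p) = p^(a p - 1) * p := by rw [← pow_succ]; congr 1; omega
    have h5 : p ≤ p^(a p - 1) := Nat.le_self_pow oma p
    have h6 : (p-1) * (p-1) ≤ z := by
      obtain ⟨m, rfl⟩ : ∃ m, p = m+1 := ⟨p-1, by have := h1.pos; omega⟩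
      simp only [Nat.add_sub_cancel] at *
      rw [h4] at h3
      nlinarith
    have := Nat.le_sqrt.2 h6
    omega
  have hc : s.card ≤ 5 + 2 * ((Nat.sqrt z + 2) / 6) := by
    refine (Finset.card_le_card hsub).trans ?_
    rw [← Nat.count_eq_card_filter_range]
    have h1 := Nat.primeCounting'_add_le (a := 6) (k := 7) nnm nnm (Nat.sqrt z + 2)
    have h2 : Nat.primeCounting' 7 = 3 := by decide
    have h3 : Nat.totient 6 = 2 := by decide
    have h4 : Nat.primeCounting' (Nat.sqrt z + 2) ≤ Nat.primeCounting' (7 + (Nat.sqrt z + 2)) := Nat.monotone_primeCounting' oma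
    rw [h2, h3] at h1
    unfold Nat.primeCounting' at *
    omega
  calc _ ≤ ∑ p ∈ s, 2 * z := sum_le_sum hb
    _ = s.card * (2 * z) := by simp
    _ ≤ (5 + 2 * ((Nat.sqrt z + 2) / 6)) * (2 * z) := by gcongr
    _ = _ := by ring

lemma Lq_of {q : ℕ} {X η : ℝ} (hq : 9000000 ≤ q) (hX : X = Lo q) (hη : 0 ≤ η)
    (hS : (Sp q : ℝ) + 0.78 * q * Real.sqrt q ≤ (q:ℝ)^2 / (2 * X) * (1 + η))
    (H : 2 * X * η ≤ (1 + η) * (Lo (2 * X) - η)) : Lq q := by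
  have hq' : (9000000:ℝ) ≤ q := by exact_mod_cast hq
  have hX0 : 0 < X := by rw [hX]; exact Real.log_pos lna
  set z := (11 * q + 9) / 10 with hz
  refine ⟨z, _, _, by omega, EB_big z, le_rfl, ?_⟩
  set e := 2 * z * (5 + 2 * ((Nat.sqrt z + 2) / 6))
  have hzr : (z:ℝ) ≤ 1.1 * q + 1 := by
    have : 10 * z ≤ 11 * q + 9 := by omega
    have : (10:ℝ) * z ≤ 11 * q + 9 := by exact_mod_cast this
    linarith
  have s0 : 3000 ≤ Real.sqrt q := Real.le_sqrt_of_sq_le lna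
  have sq := Real.mul_self_sqrt (show (0:ℝ) ≤ q by positivity)
  have hsz : (Nat.sqrt z : ℝ) ≤ 1.049 * Real.sqrt q := by
    refine Real.nat_sqrt_le_real_sqrt.trans ?_
    rw [Real.sqrt_le_left psv]
    nlinarith
  have hd : (((Nat.sqrt z + 2) / 6 : ℕ):ℝ) ≤ (Nat.sqrt z + 2) / 6 := by exact_mod_cast Nat.cast_div_le
  have he : (e:ℝ) ≤ 2 * (1.1 * q + 1) * (5 + 2 * ((1.049 * Real.sqrt q + 2)/6)) := by
    simp only [e]
    push_cast
    gcongr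
    refine hd.trans ?_
    gcongr
  have hF : ((Sp q + z + e : ℕ) : ℝ) ≤ (q:ℝ)^2 / (2 * X) * (1 + η) := by
    refine le_trans ?_ hS
    push_cast
    nlinarith
  set F : ℝ := ((Sp q + z + e : ℕ) : ℝ)
  have hz0 : (1:ℝ) ≤ F := by
    have : 1 ≤ Sp q + z + e := by omega
    show (1:ℝ) ≤ ((Sp q + z + e : ℕ) : ℝ)
    exact_mod_cast this
  have hl : Lo F ≤ 2 * X - Lo (2 * X) + η := by
    refine (Real.log_le_log lna hF).trans ?_
    rw [Real.log_mul psv psv, Real.log_div psv psv, Real.log_pow, ← hX]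
    have := Real.log_le_sub_one_of_pos (show 0 < 1 + η by linarith)
    push_cast
    linarith
  have hl0 : 0 ≤ Lo F := Real.log_nonneg hz0
  calc F * Lo F ≤ (q:ℝ)^2 / (2 * X) * (1 + η) * (2 * X - Lo (2 * X) + η) := by gcongr
    _ = (q:ℝ)^2 / (2*X) * ((1 + η) * (2 * X - Lo (2 * X) + η)) := by ring
    _ ≤ (q:ℝ)^2 / (2*X) * (2 * X) := by
      apply mulL _ psv
      linarith
    _ = _ := by field_simp

lemma GG_eq {t : ℝ} (ht : 1 < t) : GG t = t^2 / (2 * Lo t) * (1 - 0.5 / Lo t - 0.56 / (Lo t)^2) := by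
  have hl : Lo t ≠ 0 := (Real.log_pos ht).ne'
  unfold GG
  field_simp
  ring

lemma stage {q : ℕ} {a X ε δ r s : ℝ} (hX : X = Lo q) (ha : Ex 14 ≤ a) (haq : a ≤ q) (hε : 0 ≤ ε) (hδ : 0 ≤ δ) (hεδ : ε + δ ≤ 1)
    (hψ : ∀ t, a ≤ t → t ≤ q → |psi t - t| ≤ ε * t) (hd : 3.12 ≤ δ * Real.sqrt a)
    (hR : Sp ⌊a⌋₊ - a * theta a / Lo a + (1 - (ε + δ)) * GG a ≤ (q:ℝ)^2 / (2 * X) * r)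
    (hs : 1.56 * X ≤ s * Real.sqrt q) :
    (Sp q : ℝ) + 0.78 * q * Real.sqrt q ≤ (q:ℝ)^2 / (2 * X) * (1 + (3 * ε + δ + r + s + 0.5 / X + 0.56 / X^2)) := by
  have ha1 : 15 ≤ a := by
    have := Real.add_one_le_exp (14:ℝ)
    linarith
  have hX0 : 0 < X := by rw [hX]; exact Real.log_pos lna
  have hθ : ∀ t, a ≤ t → t ≤ q → (1 - (ε + δ)) * t ≤ theta t := by
    intro t h1 h2
    have h3 := (abs_le.1 (hψ t h1 h2)).1
    have h4 := psi_theta_all (t := t) lna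
    have h5 : Real.sqrt a ≤ Real.sqrt t := Real.sqrt_le_sqrt h1
    have h6 := Real.mul_self_sqrt (show 0 ≤ t by linarith)
    have h8 : δ * Real.sqrt a ≤ δ * Real.sqrt t := by gcongr
    have h9 : 3.12 * Real.sqrt t ≤ δ * Real.sqrt t * Real.sqrt t := by gcongr; linarith
    nlinarith
  have A := Sp_abel ha haq hθ hεδ
  rw [Nat.floor_natCast, ← hX] at A
  have u := (abs_le.1 (hψ q haq le_rfl)).2
  have tu := Chebyshev.theta_le_psi q
  have G := GG_eq (t := q) lna
  rw [← hX] at G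
  have B : (q:ℝ) * theta q / X ≤ (q:ℝ)^2 / (2*X) * (2 + 2 * ε) := by
    have : (q:ℝ)^2 / (2*X) * (2 + 2 * ε) = q * ((1 + ε) * q) / X := by field_simp
    rw [this]
    gcongr
    linarith
  have C : 0.78 * q * Real.sqrt q ≤ (q:ℝ)^2 / (2 * X) * s := by
    have h6 := Real.mul_self_sqrt (show 0 ≤ (q:ℝ) by linarith)
    have : (q:ℝ)^2 / (2 * X) * s = q * Real.sqrt q * (s * Real.sqrt q) / (2 * X) := by
      rw [div_mul_eq_mul_div]
      congr 1
      linear_combination (-(q:ℝ) * s) * h6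
    rw [this, le_div_iff₀ psv]
    have : 0 ≤ (q:ℝ) * Real.sqrt q := by positivity
    nlinarith
  have D : (1 - (ε + δ)) * GG q ≥ (q:ℝ)^2 / (2 * X) * (1 - (ε + δ) - 0.5 / X - 0.56 / X^2) := by
    rw [G]
    have : (1 - (ε + δ)) * ((q:ℝ)^2 / (2 * X) * (1 - 0.5 / X - 0.56 / X^2)) = (q:ℝ)^2 / (2 * X) * ((1 - (ε + δ)) * (1 - 0.5 / X - 0.56 / X^2)) := by ring
    rw [this]
    have : 0 ≤ (ε + δ) * (0.5 / X + 0.56 / X^2) := by positivity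
    apply mulL _ psv
    linarith
  nlinarith

lemma Hcheck {X X0 X1 c l η : ℝ} (h0 : 1 ≤ X0) (h1 : X0 ≤ X) (h2 : X ≤ X1) (hc : 0 ≤ c) (hl : l ≤ Lo (2 * X0))
    (hη : η = c + 0.5 / X + 0.56 / X^2)
    (h : 2 * c * X1 + 1 + 1.12 / X0 ≤ (1 + (c + 0.5 / X1)) * (l - (c + 0.5 / X1))) (hh : 1 + 2 * c + 1 / X0 + 0.56 / X0^2 ≤ l) :
    2 * X * η ≤ (1 + η) * (Lo (2 * X) - η) := by
  have hX : 0 < X := by linarith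
  have hL : l ≤ Lo (2 * X) := hl.trans (Real.log_le_log lna lna)
  have e1 : 2 * X * η = 2 * c * X + 1 + 1.12 / X := by rw [hη]; field_simp; ring
  have e2 : 1.12 / X ≤ 1.12 / X0 := by gcongr
  have e3 : 0.5 / X1 ≤ 0.5 / X := by gcongr
  have e4 : 0.5 / X ≤ 0.5 / X0 := by gcongr
  have e5 : 0.56 / X^2 ≤ 0.56 / X0^2 := by gcongr
  have e6 : 0 ≤ 0.56 / X^2 := by positivity
  have e7 : 1 / X0 = 2 * (0.5 / X0) := by ring
  have e8 : 0 ≤ 0.5 / X1 := by apply div_nonneg <;> linarith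
  have e9 : 0.5 / X0 ≤ 0.5 / X0 := le_rfl
  have e10 : 2 * c * X ≤ 2 * c * X1 := by gcongr
  rw [e1]
  generalize 0.5 / X1 = u at *
  have k1 : c + u ≤ η := by linarith
  have k2 : η + (c + u) ≤ l - 1 := by linarith
  have k3 : 0 ≤ η := by linarith
  have k4 : (1 + (c + u)) * (l - (c + u)) ≤ (1 + η) * (l - η) := by nlinarith
  have k5 : (1 + η) * (l - η) ≤ (1 + η) * (Lo (2 * X) - η) := by gcongr
  linarith

lemma lb (m c : ℕ) (hm : 0 < m) (h : Nat.ble (c * 2^48) (10000 * lgL m) = true) : (c:ℝ) / 10000 ≤ Lo m := by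
  have h1 : c * 2^48 ≤ 10000 * lgL m := Nat.le_of_ble_eq_true h
  have h2 : (c:ℝ) * 2^48 ≤ 10000 * lgL m := by exact_mod_cast h1
  have := lgL_le m hm
  linarith

lemma expl (n : ℕ) : (2.718:ℝ)^n ≤ Ex n := by
  rw [← Real.exp_one_pow]
  have := Real.exp_one_gt_d9
  gcongr
  linarith

lemma fin {q : ℕ} {a X ε δ r s X0 X1 l : ℝ} (hq : 9000000 ≤ q) (hX : X = Lo q) (ha : Ex 14 ≤ a) (haq : a ≤ q) (hε : 0 ≤ ε) (hδ : 0 ≤ δ) (hr : 0 ≤ r) (hs0 : 0 ≤ s) (hεδ : ε + δ ≤ 1)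
    (hψ : ∀ t, a ≤ t → t ≤ q → |psi t - t| ≤ ε * t) (hd : 3.12 ≤ δ * Real.sqrt a)
    (hR : Sp ⌊a⌋₊ - a * theta a / Lo a + (1 - (ε + δ)) * GG a ≤ (q:ℝ)^2 / (2 * X) * r)
    (hs : 1.56 * X ≤ s * Real.sqrt q) (h0 : 1 ≤ X0) (h1 : X0 ≤ X) (h2 : X ≤ X1) (hl : l ≤ Lo (2 * X0)) {c : ℝ} (hc : c = 3 * ε + δ + r + s)
    (h : 2 * c * X1 + 1 + 1.12 / X0 ≤ (1 + (c + 0.5 / X1)) * (l - (c + 0.5 / X1))) (hh : 1 + 2 * c + 1 / X0 + 0.56 / X0^2 ≤ l) : Lq q := by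
  have hc0 : 0 ≤ c := by rw [hc]; positivity
  have hX0 : 0 < X := by linarith
  have S := stage hX ha haq hε hδ hεδ hψ hd hR hs
  rw [← hc] at S
  exact Lq_of hq hX psv S (Hcheck h0 h1 h2 hc0 hl rfl h hh)

lemma sqrt_lb {q : ℕ} {X : ℝ} (hq : 0 < q) (hX : X = Lo q) (n : ℕ) (h : 2 * (n:ℝ) ≤ X) : (2.718:ℝ)^n ≤ Real.sqrt q := by
  refine (expl n).trans (Real.le_sqrt_of_sq_le ?_)
  rw [← Real.exp_nat_mul, ← Real.le_log_iff_exp_le psv, ← hX]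
  push_cast; exact h

lemma Sp_le_sq (n : ℕ) : Sp n ≤ n^2 := by
  unfold Sp
  have : ∑ p ∈ (Frg (n+1)).filter Nat.Prime, p ≤ ∑ p ∈ Frg (n+1), p := Finset.sum_le_sum_of_subset (Finset.filter_subset _ _)
  have h2 := Finset.sum_range_id_mul_two (n+1)
  simp only [Nat.add_sub_cancel] at h2
  nlinarith

lemma GG_le {t : ℝ} (ht : 3 ≤ t) : GG t ≤ t^2 / (2 * Lo t) := by
  have : 0 < Lo t := Real.log_pos lna
  rw [GG_eq lna]
  have : 0 ≤ 0.5 / Lo t := by positivity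
  have : 0 ≤ 0.56 / (Lo t)^2 := by positivity
  exact mul_le_of_le_one_right psv lna

lemma GG_le_sq {t : ℝ} (ht : 3 ≤ t) : GG t ≤ t^2 := by
  refine (GG_le ht).trans ?_
  have : 1 ≤ Lo t := by
    rw [Real.le_log_iff_exp_le lna]
    have := Real.exp_one_lt_d9
    linarith
  exact div_le_self psv lna

lemma hR_crude {a e : ℝ} (ha : 3 ≤ a) (he : 0 ≤ e) (he1 : e ≤ 1) : Sp ⌊a⌋₊ - a * theta a / Lo a + (1 - e) * GG a ≤ 2 * a^2 := by
  have h1 : (Sp ⌊a⌋₊ : ℝ) ≤ a^2 := by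
    have : (Sp ⌊a⌋₊ : ℝ) ≤ (⌊a⌋₊:ℝ)^2 := by exact_mod_cast Sp_le_sq _
    refine this.trans ?_
    gcongr
    exact Nat.floor_le lna
  have h2 : 0 ≤ a * theta a / Lo a := div_nonneg (mul_nonneg lna (Chebyshev.theta_nonneg a)) (Real.log_nonneg lna)
  have h3 := GG_le_sq ha
  have h4 : (1 - e) * GG a ≤ (1 - e) * a^2 := by apply mulL h3; linarith
  nlinarith [sq_nonneg a]

/-- stage with crude start -/
lemma stC {q k n : ℕ} {X ε X0 X1 l : ℝ} (hX : X = Lo q) (hk : 2 ≤ k) (hn : Tk k ≤ 2.718^n) (h46 : 46 ≤ X) (hX0 : (n:ℝ) + 9 ≤ X0) (h1 : X0 ≤ X) (h2 : X ≤ X1) (h672 : X1 ≤ 672)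
    (hε : 0 ≤ ε) (hε1 : ε ≤ 0.5)
    (hψ : ∀ t, Tk k ≤ t → |psi t - t| ≤ ε * t) (hl : l ≤ Lo (2 * X0)) 
    (h : 2 * (3 * ε + 0.0001) * X1 + 1 + 1.12 / X0 ≤ (1 + ((3 * ε + 0.0001) + 0.5 / X1)) * (l - ((3 * ε + 0.0001) + 0.5 / X1))) (hh : 1 + 2 * (3 * ε + 0.0001) + 1 / X0 + 0.56 / X0^2 ≤ l) : Lq q := by
  have q0 : 0 < q := by
    rcases Nat.eq_zero_or_pos q with h0 | h0
    · subst h0; simp at hX; linarith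
    · exact h0
  have hs23 := sqrt_lb q0 hX 23 (by norm_num; linarith)
  have hqe : (q:ℝ) = Ex X := by rw [hX, Real.exp_log (by exact_mod_cast q0)]
  have haq : Tk k * 2.718^9 ≤ q := by
    calc Tk k * 2.718^9 ≤ 2.718^n * 2.718^9 := by gcongr
      _ = 2.718^(n+9) := by rw [pow_add]
      _ ≤ Ex ((n+9:ℕ):ℝ) := expl _
      _ ≤ Ex X := by gcongr; push_cast; linarith
      _ = q := hqe.symm
  have hT : 570 * 4194304^2 ≤ Tk k := by
    unfold Tk
    gcongr
    norm_num
  have sT : (100000000:ℝ) ≤ Real.sqrt (Tk k) := Real.le_sqrt_of_sq_le lna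
  have e14 : Ex 14 ≤ 5000000 := by
    have : Ex 14 = Ex 1 ^ 14 := by rw [← Real.exp_nat_mul]; norm_num
    rw [this]
    have := Real.exp_one_lt_d9
    calc Ex 1 ^ 14 ≤ (2.72:ℝ)^14 := by gcongr; linarith
      _ ≤ _ := by norm_num
  norm_num at haq hs23 hT
  have haq' : Tk k ≤ q := by linarith
  refine fin (a := Tk k) (δ := 0.000001) (r := 0.00005) (s := 0.000049) (X0 := X0) (X1 := X1) (l := l) (c := 3 * ε + 0.0001) ?_ hX lna haq' hε nnm nnm nnm lna
    (fun t h _ => hψ t h) lna ?_ ?_ lna h1 h2 hl (by ring) h hh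
  · have : (9000000:ℝ) ≤ q := by linarith
    exact_mod_cast this
  · refine (hR_crude lna lna lna).trans ?_
    rw [div_mul_eq_mul_div, le_div_iff₀ lna]
    have : (Tk k * 8095)^2 ≤ (q:ℝ)^2 := by gcongr; linarith
    have : Tk k^2 * X ≤ Tk k^2 * 672 := by gcongr; linarith
    nlinarith
  · linarith

lemma lbX {X0 l : ℝ} (m c : ℕ) (hm : 0 < m) (h : Nat.ble (c * 2^48) (10000 * lgL m) = true) (e : 2 * X0 = m) (hl : l = c / 10000) : l ≤ Lo (2 * X0) := by
  rw [e, hl]; exact lb m c hm h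

lemma e14_le : Ex 14 ≤ 5000000 := by
  have : Ex 14 = Ex 1 ^ 14 := by rw [← Real.exp_nat_mul]; norm_num
  rw [this]
  have := Real.exp_one_lt_d9
  calc Ex 1 ^ 14 ≤ (2.72:ℝ)^14 := by gcongr; linarith
    _ ≤ _ := by norm_num

lemma sqrt_a0 : Real.sqrt 9437184 = 3072 := by
  rw [show (9437184:ℝ) = 3072^2 by norm_num, Real.sqrt_sq nnm]

lemma log_a0 : Lo 9437184 ≤ 16.061 ∧ 16.06 ≤ Lo 9437184 := by
  have e : (9437184:ℝ) = ((9437184:ℕ):ℝ) := by norm_num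
  constructor
  · have h := le_lgU 9437184 nnm
    have h2 : 1000 * lgU 9437184 ≤ 16061 * 2^48 := by decide +kernel
    have h2 : (1000:ℝ) * lgU 9437184 ≤ 16061 * 2^48 := by exact_mod_cast h2
    rw [← e] at h
    generalize (lgU 9437184 : ℝ) = u at *
    linarith
  · have := lb 9437184 160600 nnm dck
    rw [e]
    norm_num at this ⊢
    linarith

lemma hR0 {x : ℝ} (hx : 0 ≤ x) : Sp ⌊(9437184:ℝ)⌋₊ - 9437184 * theta 9437184 / Lo 9437184 + (1 - (0.0201 + 0.00102)) * GG 9437184 ≤ x * 0 := by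
  have f : ⌊(9437184:ℝ)⌋₊ = 9437184 := by norm_num
  have hS : (Sp 9437184 : ℝ) ≤ 2872343202891 := by
    have := St_end.2.2.2.1
    have h2 : Sp 9437184 ≤ 2872343202891 := by
      unfold Sp
      rw [Finset.range_add_one, Finset.filter_insert, if_neg nnm]
      exact this
    exact_mod_cast h2
  have hP := St_end.2.2.1
  have hm : psi ((9437184-1:ℕ):ℝ) ≤ psi 9437184 := Chebyshev.psi_mono nnm
  have ht := psi_theta_all (t := 9437184) nnm
  rw [sqrt_a0] at ht
  obtain ⟨l1, l2⟩ := log_a0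
  have h1 : (5530000000000:ℝ) ≤ 9437184 * theta 9437184 / Lo 9437184 := by
    rw [le_div_iff₀ lna]
    norm_num at hP hm
    nlinarith
  have h2 : GG 9437184 ≤ 2690000000000 := by
    rw [GG_eq nnm]
    have a1 : (9437184:ℝ)^2 / (2 * Lo 9437184) ≤ 9437184^2 / (2 * 16.06) := by gcongr
    have a2 : 0.5 / 16.061 ≤ 0.5 / Lo 9437184 := by gcongr
    have a3 : 0 ≤ 0.56 / (Lo 9437184)^2 := by positivity
    calc _ ≤ (9437184:ℝ)^2 / (2 * Lo 9437184) * (1 - 0.5 / 16.061) := by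
          apply mulL _ psv
          linarith
      _ ≤ 9437184^2 / (2 * 16.06) * (1 - 0.5 / 16.061) := by gcongr
      _ ≤ _ := by norm_num
  rw [f]
  linarith

lemma st0 {q : ℕ} {X s X0 X1 l : ℝ} (hq : 9437184 ≤ q) (hX : X = Lo q) (hs0 : 0 ≤ s) (hs : 1.56 * X ≤ s * Real.sqrt q) (h0 : 1 ≤ X0) (h1 : X0 ≤ X) (h2 : X ≤ X1) (hl : l ≤ Lo (2 * X0)) 
    (h : 2 * (0.06132 + s) * X1 + 1 + 1.12 / X0 ≤ (1 + ((0.06132 + s) + 0.5 / X1)) * (l - ((0.06132 + s) + 0.5 / X1))) (hh : 1 + 2 * (0.06132 + s) + 1 / X0 + 0.56 / X0^2 ≤ l) : Lq q := by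
  have hq' : (9437184:ℝ) ≤ q := by exact_mod_cast hq
  have e14 := e14_le
  refine fin (a := 9437184) (δ := 0.00102) (r := 0) (ε := 0.0201) (s := s) (X0 := X0) (X1 := X1) (l := l) (c := 0.06132 + s) oma hX lna hq' nnm nnm nnm hs0 nnm
    (fun t h _ => psi_201 h) (by rw [sqrt_a0]; norm_num) ?_ hs h0 h1 h2 hl (by ring) h hh
  exact hR0 (by have : 0 < X := by linarith
                positivity)

theorem Lq_0 {q : ℕ} (hq : 9437184 ≤ q) (h : Lo q ≤ 24.5) : Lq q := by
  have hq' : (9437184:ℝ) ≤ q := by exact_mod_cast hq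
  have h16 : 16 ≤ Lo q := by
    have := Real.log_le_log nnm hq'
    linarith [log_a0.2]
  have s0 : 3072 ≤ Real.sqrt q := Real.le_sqrt_of_sq_le lna
  have q0 : 0 < q := by omega
  rcases le_or_gt (Lo q) 18 with h1 | h1
  · exact st0 hq rfl (s := 0.00915) (X0 := 16) (X1 := 18) (l := 3.4657) nnm lna nnm h16 h1 (lbX 32 34657 nnm dck nnm nnm) nnm nnm
  rcases le_or_gt (Lo q) 20.5 with h2 | h2
  · have := sqrt_lb q0 rfl 9 (by norm_num; linarith)
    exact st0 hq rfl (s := 0.004) (X0 := 18) (X1 := 20.5) (l := 3.5835) nnm lna nnm h1.le h2 (lbX 36 35835 nnm dck nnm nnm) nnm nnm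
  rcases le_or_gt (Lo q) 22.5 with h3 | h3
  · have := sqrt_lb q0 rfl 10 (by norm_num; linarith)
    exact st0 hq rfl (s := 0.0016) (X0 := 20.5) (X1 := 22.5) (l := 3.7135) nnm lna nnm h2.le h3 (lbX 41 37135 nnm dck nnm nnm) nnm nnm
  rcases le_or_gt (Lo q) 24 with h4 | h4
  · have := sqrt_lb q0 rfl 11 (by norm_num; linarith)
    exact st0 hq rfl (s := 0.00063) (X0 := 22.5) (X1 := 24) (l := 3.8066) nnm lna nnm h3.le h4 (lbX 45 38066 nnm dck nnm nnm) nnm nnm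
  · have := sqrt_lb q0 rfl 12 (by norm_num; linarith)
    exact st0 hq rfl (s := 0.00025) (X0 := 24) (X1 := 24.5) (l := 3.8712) nnm lna nnm h4.le h (lbX 48 38712 nnm dck nnm nnm) nnm nnm

lemma hR1 : Sp ⌊(2390753280:ℝ)⌋₊ - 2390753280 * theta 2390753280 / Lo 2390753280 + (1 - (0.010463 + 0.0001)) * GG 2390753280 ≤ 300000000000000000 := by
  have f : ⌊(2390753280:ℝ)⌋₊ = 2390753280 := by norm_num
  have e : (2390753280:ℝ) = ((2390753280:ℕ):ℝ) := by norm_num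
  have l1 : 21.59 ≤ Lo 2390753280 := by
    have := lb 2390753280 215900 nnm dck
    rw [e]
    norm_num at this ⊢
    linarith
  have e14 := e14_le
  have sq : (40000:ℝ) ≤ Real.sqrt 2390753280 := Real.le_sqrt_of_sq_le nnm
  have l2 : Lo 2390753280 ≤ 22 := by
    have := log_le_lin (x := 2390753280) 31 nnm
    norm_num at this
    linarith
  have S := stage (q := 2390753280) (a := 9437184) (X := Lo 2390753280) (ε := 0.0201) (δ := 0.00102) (r := 0) (s := 0.001) nnm lna nnm nnm nnm nnm
    (fun t h _ => psi_201 h) (by rw [sqrt_a0]; norm_num) (hR0 psv) (by push_cast; linarith)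
  have h2 : 0 ≤ 2390753280 * theta 2390753280 / Lo 2390753280 := div_nonneg (mul_nonneg nnm (Chebyshev.theta_nonneg _)) lna
  have h3 := GG_le (t := 2390753280) nnm
  have a1 : (2390753280:ℝ)^2 / (2 * Lo 2390753280) ≤ 2390753280^2 / (2 * 21.59) := by gcongr
  have a2 : 0.5 / Lo 2390753280 ≤ 0.5 / 21.59 := by gcongr
  have a3 : 0.56 / Lo 2390753280^2 ≤ 0.56 / 21.59^2 := by gcongr
  have S2 : (Sp 2390753280 : ℝ) ≤ 2390753280^2 / (2 * 21.59) * 1.2 := by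
    push_cast at S
    have : (0:ℝ) ≤ 0.78 * 2390753280 * Real.sqrt 2390753280 := by positivity
    calc (Sp 2390753280 : ℝ) ≤ 2390753280^2 / (2 * Lo 2390753280) * (1 + (3 * 0.0201 + 0.00102 + 0 + 0.001 + 0.5 / Lo 2390753280 + 0.56 / Lo 2390753280^2)) := by linarith
      _ ≤ 2390753280^2 / (2 * 21.59) * 1.2 := by
        gcongr
        norm_num at a2 a3 ⊢
        linarith
  rw [f]
  have a4 : (2390753280:ℝ)^2 / (2 * 21.59) ≤ 133000000000000000 := by norm_num
  generalize (2390753280:ℝ)^2 / (2 * 21.59) = B at *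
  linarith

lemma st1 {q : ℕ} {X r s X0 X1 l : ℝ} (hX : X = Lo q) (h245 : 24.5 ≤ X) (hr : 0 ≤ r) (hR : 300000000000000000 ≤ (q:ℝ)^2 / (2 * X) * r) (hs0 : 0 ≤ s) (hs : 1.56 * X ≤ s * Real.sqrt q) (h0 : 1 ≤ X0) (h1 : X0 ≤ X) (h2 : X ≤ X1) (hl : l ≤ Lo (2 * X0)) 
    (h : 2 * (0.031489 + r + s) * X1 + 1 + 1.12 / X0 ≤ (1 + ((0.031489 + r + s) + 0.5 / X1)) * (l - ((0.031489 + r + s) + 0.5 / X1))) (hh : 1 + 2 * (0.031489 + r + s) + 1 / X0 + 0.56 / X0^2 ≤ l) : Lq q := by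
  have q0 : 0 < q := by
    rcases Nat.eq_zero_or_pos q with h0 | h0
    · subst h0; simp at hX; linarith
    · exact h0
  have sq : (40000:ℝ) ≤ Real.sqrt 2390753280 := Real.le_sqrt_of_sq_le nnm
  have hq' : (2390753280:ℝ) ≤ q := by
    have h := (expl 24).trans (Real.exp_le_exp.2 (show ((24:ℕ):ℝ) ≤ X by norm_num; linarith))
    rw [hX, Real.exp_log (by exact_mod_cast q0)] at h
    norm_num at h
    linarith
  have e14 := e14_le
  refine fin (a := 2390753280) (δ := 0.0001) (r := r) (ε := 0.010463) (s := s) (X0 := X0) (X1 := X1) (l := l) (c := 0.031489 + r + s) ?_ hX lna hq' nnm nnm hr hs0 nnm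
    (fun t h _ => psi_s1 t (by unfold Tk; linarith)) lna ?_ hs h0 h1 h2 hl (by ring) h hh
  · have : (9000000:ℝ) ≤ q := by linarith
    exact_mod_cast this
  · exact hR1.trans hR

theorem Lq_1 {q : ℕ} (h245 : 24.5 ≤ Lo q) (h : Lo q ≤ 46) : Lq q := by
  have q0 : 0 < q := by
    rcases Nat.eq_zero_or_pos q with h0 | h0
    · subst h0; simp at h245; linarith
    · exact h0
  have hq2 : (q:ℝ)^2 = Ex (2 * Lo q) := by
    rw [two_mul, Real.exp_add, Real.exp_log (by exact_mod_cast q0)]; ring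
  have := sqrt_lb q0 rfl 12 (by norm_num; linarith)
  rcases le_or_gt (Lo q) 34 with h1 | h1
  · refine st1 rfl h245 (r := 0.011) (s := 0.0004) (X0 := 24.5) (X1 := 34) (l := 3.8918) nnm ?_ nnm lna nnm h245 h1 (lbX 49 38918 nnm dck nnm nnm) nnm nnm
    have h3 := expl 49
    have h4 : Ex (2 * Lo q) = Ex ((49:ℕ):ℝ) * Ex (2 * Lo q - 49) := by
      rw [← Real.exp_add]; congr 1; push_cast; ring
    have h5 := Real.add_one_le_exp (2 * Lo q - 49)
    have h6 : Lo q * (2 / 49) ≤ Ex (2 * Lo q - 49) := by linarith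
    rw [div_mul_eq_mul_div, le_div_iff₀ lna, hq2, h4]
    have h7 : (2.718:ℝ)^49 * (Lo q * (2 / 49)) ≤ Ex ((49:ℕ):ℝ) * Ex (2 * Lo q - 49) := by
      apply mul_le_mul h3 h6 lna psv
    norm_num at h7 ⊢
    linarith
  · refine st1 rfl h245 (r := 0.00001) (s := 0.0005) (X0 := 34) (X1 := 46) (l := 4.2195) nnm ?_ nnm lna nnm h1.le h (lbX 68 42195 nnm dck nnm nnm) nnm nnm
    rw [div_mul_eq_mul_div, le_div_iff₀ lna, hq2]
    have := (expl 68).trans (Real.exp_le_exp.2 (show ((68:ℕ):ℝ) ≤ 2 * Lo q by norm_num; linarith))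
    norm_num at this ⊢
    linarith

theorem Lq_2 {q : ℕ} (h46 : 46 ≤ Lo q) (h : Lo q ≤ 672) : Lq q := by
  rcases le_or_gt (Lo q) 62 with h1 | h1
  · exact stC rfl (k := 2) (n := 37) (X0 := 46) (X1 := 62) (l := 4.5) nnm (by unfold Tk; norm_num) h46 nnm h46 h1 nnm nnm nnm psi_s2 (lbX 92 45000 nnm dck nnm nnm) nnm nnm
  rcases le_or_gt (Lo q) 77 with h2 | h2
  · exact stC rfl (k := 3) (n := 53) (X0 := 62) (X1 := 77) (l := 4.5) nnm (by unfold Tk; norm_num) h46 nnm h1.le h2 nnm nnm nnm psi_s3 (lbX 124 45000 nnm dck nnm nnm) nnm nnm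
  rcases le_or_gt (Lo q) 92 with h3 | h3
  · exact stC rfl (k := 4) (n := 68) (X0 := 77) (X1 := 92) (l := 4.5) nnm (by unfold Tk; norm_num) h46 nnm h2.le h3 nnm nnm nnm psi_s4 (lbX 154 45000 nnm dck nnm nnm) nnm nnm
  rcases le_or_gt (Lo q) 107 with h4 | h4
  · exact stC rfl (k := 5) (n := 83) (X0 := 92) (X1 := 107) (l := 4.5) nnm (by unfold Tk; norm_num) h46 nnm h3.le h4 nnm nnm nnm psi_s5 (lbX 184 45000 nnm dck nnm nnm) nnm nnm
  rcases le_or_gt (Lo q) 138 with h5 | h5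
  · exact stC rfl (k := 6) (n := 98) (X0 := 107) (X1 := 138) (l := 4.5) nnm (by unfold Tk; norm_num) h46 nnm h4.le h5 nnm nnm nnm psi_s6 (lbX 214 45000 nnm dck nnm nnm) nnm nnm
  rcases le_or_gt (Lo q) 400 with h6 | h6
  · exact stC rfl (k := 8) (n := 129) (X0 := 138) (X1 := 400) (l := 5.6) nnm (by unfold Tk; norm_num) h46 nnm h5.le h6 nnm nnm nnm psi_s8 (lbX 276 56000 nnm dck nnm nnm) nnm nnm
  rcases le_or_gt (Lo q) 580 with h7 | h7
  · exact stC rfl (k := 8) (n := 129) (X0 := 400) (X1 := 580) (l := 6.6) nnm (by unfold Tk; norm_num) h46 nnm h6.le h7 nnm nnm nnm psi_s8 (lbX 800 66000 nnm dck nnm nnm) nnm nnm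
  rcases le_or_gt (Lo q) 650 with h8 | h8
  · exact stC rfl (k := 8) (n := 129) (X0 := 580) (X1 := 650) (l := 7.05) nnm (by unfold Tk; norm_num) h46 nnm h7.le h8 nnm nnm nnm psi_s8 (lbX 1160 70500 nnm dck nnm nnm) nnm nnm
  · exact stC rfl (k := 8) (n := 129) (X0 := 650) (X1 := 672) (l := 7.17) nnm (by unfold Tk; norm_num) h46 nnm h8.le h nnm nnm nnm psi_s8 (lbX 1300 71700 nnm dck nnm nnm) nnm (by norm_num)

theorem Lq_3 {q : ℕ} (h : 672 ≤ Lo q) : Lq q := by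
  have q0 : 0 < q := by
    rcases Nat.eq_zero_or_pos q with h0 | h0
    · subst h0; simp at h; linarith
    · exact h0
  obtain ⟨X, hX⟩ : ∃ X, X = Lo q := ⟨_, rfl⟩
  rw [← hX] at h
  have hq : (q:ℝ) = Ex X := by rw [hX, Real.exp_log (by exact_mod_cast q0)]
  have hX0 : 0 < X := by linarith
  have hll := log_le_lin 10 hX0
  norm_num at hll
  have hE : 312 * X^2 ≤ Ex (X/2) := by
    have := Real.pow_div_factorial_le_exp (X/2) lna 4
    simp only [Nat.factorial] at this
    norm_num at this
    have h4 : 119808 ≤ X^2 := by nlinarith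
    have h5 : X^2 * 119808 ≤ X^2 * X^2 := by gcongr
    have h6 : (X/2)^4/24 = X^2*X^2/384 := by ring
    linarith
  have hsq : Real.sqrt q = Ex (X/2) := by
    rw [hq, Real.sqrt_eq_iff_mul_self_eq psv psv, ← Real.exp_add]
    congr 1; ring
  set a : ℝ := q / X^2 with ha
  have haX : a = Ex (X - 2 * Lo X) := by
    rw [Real.exp_sub, two_mul, Real.exp_add, Real.exp_log hX0, ha, hq]; congr 1; ring
  have hsa : Real.sqrt a = Ex (X/2) / X := by
    rw [ha, Real.sqrt_div psv, hsq, Real.sqrt_sq hX0.le]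
  have h14 : Ex 14 ≤ a := by rw [haX]; gcongr; linarith
  have e14 := Real.add_one_le_exp (14:ℝ)
  have haq : a ≤ q := by
    rw [ha]
    exact div_le_self psv (by nlinarith)
  have S := stage (q := q) (a := a) (X := X) (ε := 0.92 / X) (δ := 0.01 / X) (r := 0.01 / X) (s := 0.01 / X) hX h14 haq psv psv (by rw [← add_div, div_le_one hX0]; linarith) ?_ ?_ ?_ ?_
  · have e : 3 * (0.92 / X) + 0.01 / X + 0.01 / X + 0.01 / X + 0.5 / X + 0.56 / X^2 = 3.29 / X + 0.56 / X^2 := by ring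
    rw [e] at S
    have hl : (7:ℝ) ≤ Lo (2 * X) := by
      have h1 : Lo 1344 ≤ Lo (2 * X) := Real.log_le_log nnm lna
      have h2 := lb 1344 70000 nnm dck
      norm_num at h2
      linarith
    refine Lq_of ?_ hX psv S ?_
    · have h1 := (expl 20).trans (Real.exp_le_exp.2 (show ((20:ℕ):ℝ) ≤ X by norm_num; linarith))
      rw [← hq] at h1
      norm_num at h1
      have : (9000000:ℝ) ≤ q := by linarith
      exact_mod_cast this
    · have e2 : 2 * X * (3.29 / X + 0.56 / X^2) = 6.58 + 1.12 / X := by field_simp; norm_num; ring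
      rw [e2]
      have b1 : 1.12 / X ≤ 0.01 := by rw [div_le_iff₀ hX0]; linarith
      have b2 : 3.29 / X ≤ 0.01 := by rw [div_le_iff₀ hX0]; linarith
      have b3 : 0.56 / X^2 ≤ 0.01 := by rw [div_le_iff₀ psv]; nlinarith
      have b4 : 0 ≤ 3.29 / X := by positivity
      have b5 : 0 ≤ 0.56 / X^2 := by positivity
      nlinarith
  · intro t h1 h2
    have t0 : 0 < t := by linarith
    have hlt : X - 2 * Lo X ≤ Lo t := by
      rw [Real.le_log_iff_exp_le t0, ← haX]; exact h1
    have := psi_high (u := Lo t) lna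
    rw [Real.exp_log t0] at this
    refine this.trans ?_
    gcongr ?_ * t
    rw [div_le_div_iff₀ lna hX0]
    linarith
  · rw [hsa, div_mul_div_comm, le_div_iff₀ psv]
    nlinarith
  · have e1 : 0.92 / X + 0.01 / X ≤ 1 := by rw [← add_div, div_le_one hX0]; linarith
    refine (hR_crude lna psv e1).trans ?_
    rw [ha, div_pow, div_mul_div_comm, mul_div_assoc', div_le_div_iff₀ psv psv]
    have : 0 ≤ (q:ℝ)^2 * X^2 := by positivity
    have h400 : 400 ≤ X^2 := by nlinarith
    calc 2 * (q:ℝ)^2 * (2 * X * X) = 0.01 * ((q:ℝ)^2 * X^2) * 400 := by ring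
      _ ≤ 0.01 * ((q:ℝ)^2 * X^2) * X^2 := by gcongr
      _ = _ := by ring
  · rw [hsq, div_mul_eq_mul_div, le_div_iff₀ hX0]
    nlinarith

theorem Lq_all {q : ℕ} (h : 4096 ≤ q) : Lq q := by
  rcases lt_or_ge q 9437184 with h1 | h1
  · exact St_end.2.2.2.2.2 q h h1
  rcases le_or_gt (Lo q) 24.5 with h2 | h2
  · exact Lq_0 h1 h2
  rcases le_or_gt (Lo q) 46 with h3 | h3
  · exact Lq_1 h2.le h3
  rcases le_or_gt (Lo q) 672 with h4 | h4
  · exact Lq_2 h3.le h4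
  · exact Lq_3 h4.le

def Sq (y SU : ℕ) : Prop := ∑ p ∈ (Frg y).filter Nat.Prime, p ≤ SU ∧ ∀ q : ℕ, q.Prime → 691 ≤ q → q < y → Lq q

def sqc (z SU q : ℕ) : Bool := (fun F => Nat.ble (Nat.mul F (lgU F)) (Nat.mul T48 (Nat.mul q q))) (Nat.add (Nat.add SU z) (Eez 7 z))

def sqg (SU1 n : ℕ) : ℕ → ℕ → Bool :=
  Nat.rec (motive := fun _ => ℕ → ℕ → Bool) (fun _ SU => Nat.ble SU SU1)
    (fun _ ih q SU => Bool.rec (motive := fun _ => Bool) (ih (Nat.succ q) SU)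
      ((fun S => and (sqc (Nat.succ (Nat.div (Nat.mul 11 q) 10)) S q) (ih (Nat.succ q) S)) (Nat.add SU q)) (qfl q)) n

lemma sum_succ_prime (q : ℕ) : ∑ p ∈ (Frg (q+1)).filter Nat.Prime, p = (∑ p ∈ (Frg q).filter Nat.Prime, p) + if q.Prime then q else 0 := by
  rw [Finset.sum_filter, sum_range_succ, ← Finset.sum_filter]

lemma sqc_Lq {q SU : ℕ} (hq : q < 4096) (h0 : 0 < q) (hS : Sp q ≤ SU) (h : sqc (11*q/10+1) SU q = true) : Lq q := by
  have hE := EB_Eez (k := 7) (z := 11*q/10+1) oma (by norm_num; omega)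
  unfold sqc at h
  simp only [Nat.ble_eq, Nat.add_eq, Nat.mul_eq] at h
  have hz : 11*q ≤ 10*(11*q/10+1) := by omega
  revert h hE hz
  generalize Eez 7 (11*q/10+1) = e
  generalize 11*q/10+1 = z
  intro hE h hz
  refine ⟨z, e, SU + z + e, hz, hE, by omega, ?_⟩
  have hF0 : 0 < SU + z + e := by omega
  revert h hF0
  generalize SU + z + e = F
  intro h hF0
  have h1 := le_lgU F hF0
  have h2 : (F:ℝ) * lgU F ≤ T48 * ((q:ℝ)*q) := by exact_mod_cast h
  have h3 : (F:ℝ) * (2^48 * Lo F) ≤ F * lgU F := mulL h1 psv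
  norm_num at h3
  nlinarith

lemma sqg_spec {SU1 n : ℕ} : ∀ {q SU : ℕ}, 0 < q → q + n ≤ 4096 → Sq q SU → sqg SU1 n q SU = true → Sq (q+n) SU1 := by
  induction n with
  | zero => intro q SU _ _ h1 h2; exact ⟨h1.1.trans (Nat.le_of_ble_eq_true h2), h1.2⟩
  | succ n ih =>
    intro q SU h0 hn h1 h2
    have e : sqg SU1 (n+1) q SU = Bool.rec (motive := fun _ => Bool) (sqg SU1 n (q+1) SU)
      (and (sqc (11*q/10+1) (SU+q) q) (sqg SU1 n (q+1) (SU+q))) (qfl q) := rfl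
    rw [e] at h2
    have s0 := sum_succ_prime q
    rw [show q + (n+1) = q+1+n by ring]
    cases hf : qfl q with
    | false =>
      rw [hf] at h2
      have hnp : ¬ q.Prime := fun hp => by rw [qfl_prime hp] at hf; exact absurd hf (by decide)
      refine ih oma oma ⟨?_, fun r hr ha hb => ?_⟩ h2
      · rw [s0, if_neg hnp]; exact h1.1
      · refine h1.2 r hr ha ?_
        rcases Nat.lt_succ_iff_lt_or_eq.1 hb with hb | hb
        · exact hb
        · subst hb; exact absurd hr hnp
    | true =>
      rw [hf] at h2
      have h3 := (Bool.and_eq_true _ _).mp h2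
      have hs : Sp q ≤ SU + q := by
        have := h1.1
        rw [Sp, s0]; split_ifs <;> omega
      refine ih oma oma ⟨hs, fun r hr ha hb => ?_⟩ h3.2
      rcases Nat.lt_succ_iff_lt_or_eq.1 hb with hb | hb
      · exact h1.2 r hr ha hb
      · subst hb; exact sqc_Lq oma h0 hs h3.1

set_option maxHeartbeats 10000000 in
theorem Lq_small {q : ℕ} (hp : q.Prime) (h1 : 691 ≤ q) (h2 : q < 4096) : Lq q := by
  have b : Nat.ble (sm (fun d => tf (qfl d) (tf (Nat.blt d 691) d)) 12 0) 38921 = true := by decide +kernel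
  have s0 : Sq 691 38921 := by
    refine ⟨?_, fun r _ ha hb => by omega⟩
    refine le_trans ?_ ((sm_flag (fun d => tf (Nat.blt d 691) d) 12).trans (Nat.le_of_ble_eq_true b))
    rw [Finset.sum_congr rfl (g := fun d => tf (Nat.blt d 691) d)]
    · exact Finset.sum_le_sum_of_subset (Finset.filter_subset_filter _ (Finset.range_subset_range.2 nnm))
    · intro x hx
      have : Nat.blt x 691 = true := by
        rw [Nat.blt_eq]; exact Finset.mem_range.1 (Finset.mem_filter.1 hx).1
      rw [this]; rfl
  have s1 : Sq 1200 106733 := sqg_spec (n := 509) nnm nnm s0 dck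
  have s2 : Sq 1700 208385 := sqg_spec (n := 500) nnm nnm s1 dck
  have s3 : Sq 2200 327198 := sqg_spec (n := 500) nnm nnm s2 dck
  have s4 : Sq 2700 488774 := sqg_spec (n := 500) nnm nnm s3 dck
  have s5 : Sq 3200 661927 := sqg_spec (n := 500) nnm nnm s4 dck
  have s6 : Sq 3700 882889 := sqg_spec (n := 500) nnm nnm s5 dck
  have s7 : Sq 4096 1070091 := sqg_spec (n := 396) nnm nnm s6 dck
  exact s7.2 q hp h1 h2

lemma next_prime_small {q : ℕ} (h1 : 691 ≤ q) (h2 : q < 4096) : ∃ p, p.Prime ∧ q < p ∧ 10*p ≤ 11*q := by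
  rcases lt_or_ge q 757 with h | h
  · exact ⟨757, by norm_num, h, by omega⟩
  rcases lt_or_ge q 829 with h | h
  · exact ⟨829, by norm_num, h, by omega⟩
  rcases lt_or_ge q 911 with h | h
  · exact ⟨911, by norm_num, h, by omega⟩
  rcases lt_or_ge q 997 with h | h
  · exact ⟨997, by norm_num, h, by omega⟩
  rcases lt_or_ge q 1093 with h | h
  · exact ⟨1093, by norm_num, h, by omega⟩
  rcases lt_or_ge q 1201 with h | h
  · exact ⟨1201, by norm_num, h, by omega⟩
  rcases lt_or_ge q 1321 with h | h
  · exact ⟨1321, by norm_num, h, by omega⟩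
  rcases lt_or_ge q 1453 with h | h
  · exact ⟨1453, by norm_num, h, by omega⟩
  rcases lt_or_ge q 1597 with h | h
  · exact ⟨1597, by norm_num, h, by omega⟩
  rcases lt_or_ge q 1753 with h | h
  · exact ⟨1753, by norm_num, h, by omega⟩
  rcases lt_or_ge q 1913 with h | h
  · exact ⟨1913, by norm_num, h, by omega⟩
  rcases lt_or_ge q 2099 with h | h
  · exact ⟨2099, by norm_num, h, by omega⟩
  rcases lt_or_ge q 2297 with h | h
  · exact ⟨2297, by norm_num, h, by omega⟩
  rcases lt_or_ge q 2521 with h | h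
  · exact ⟨2521, by norm_num, h, by omega⟩
  rcases lt_or_ge q 2767 with h | h
  · exact ⟨2767, by norm_num, h, by omega⟩
  rcases lt_or_ge q 3041 with h | h
  · exact ⟨3041, by norm_num, h, by omega⟩
  rcases lt_or_ge q 3343 with h | h
  · exact ⟨3343, by norm_num, h, by omega⟩
  rcases lt_or_ge q 3677 with h | h
  · exact ⟨3677, by norm_num, h, by omega⟩
  rcases lt_or_ge q 4027 with h | h
  · exact ⟨4027, by norm_num, h, by omega⟩
  rcases lt_or_ge q 4423 with h | h
  · exact ⟨4423, by norm_num, h, by omega⟩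
  omega

lemma next_prime_all {q : ℕ} (h1 : 691 ≤ q) : ∃ p, p.Prime ∧ q < p ∧ 10*p ≤ 11*q := by
  rcases lt_or_ge q 4096 with h | h
  · exact next_prime_small h1 h
  · exact next_prime h

/-- the sum of the maximal prime powers dividing `m` -/
def ell (m : ℕ) : ℕ := ∑ p ∈ m.primeFactors, p^(m.factorization p)

lemma ell_mul {a b : ℕ} (h : a.Coprime b) : ell (a*b) = ell a + ell b := by
  unfold ell
  rw [h.primeFactors_mul, Finset.sum_union h.disjoint_primeFactors]
  congr 1
  · refine sumC fun p hp => ?_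
    rw [Nat.factorization_eq_of_coprime_left h (List.mem_toFinset.1 hp)]
  · refine sumC fun p hp => ?_
    rw [Nat.factorization_eq_of_coprime_right h (List.mem_toFinset.1 hp)]

lemma ell_prime_pow {p k : ℕ} (hp : p.Prime) (hk : k ≠ 0) : ell (p^k) = p^k := by
  unfold ell
  rw [Nat.primeFactors_prime_pow hk hp, Finset.sum_singleton, hp.factorization_pow, Finsupp.single_eq_same]

lemma ell_le {c : ℕ} (h : 0 < c) : ell c ≤ c := by
  induction c using Nat.recOnPosPrimePosCoprime with
  | prime_pow p n hp hn => rw [ell_prime_pow hp oma]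
  | zero => omega
  | one => simp [ell]
  | coprime a b ha hb hab iha ihb =>
    rw [ell_mul hab]
    have := iha oma
    have := ihb oma
    nlinarith

lemma ell_lcm {a b : ℕ} (ha : a ≠ 0) (hb : b ≠ 0) : ell (Nat.lcm a b) ≤ ell a + ell b := by
  unfold ell
  have h : ∀ m : ℕ, m ≠ 0 → m.primeFactors ⊆ (Nat.lcm a b).primeFactors → ∑ p ∈ m.primeFactors, p^(m.factorization p) = ∑ p ∈ (Nat.lcm a b).primeFactors, if p ∣ m then p^(m.factorization p) else 0 := by
    intro m hm hs
    rw [← Finset.sum_filter]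
    refine Finset.sum_congr ?_ fun _ _ => rfl
    ext p
    simp only [Finset.mem_filter]
    constructor
    · intro h; exact ⟨hs h, Nat.dvd_of_mem_primeFactors h⟩
    · rintro ⟨h1, h2⟩
      exact Nat.mem_primeFactors.2 ⟨Nat.prime_of_mem_primeFactors h1, h2, hm⟩
  have hl : Nat.lcm a b ≠ 0 := Nat.lcm_ne_zero ha hb
  rw [h a ha (Nat.primeFactors_mono (Nat.dvd_lcm_left a b) hl), h b hb (Nat.primeFactors_mono (Nat.dvd_lcm_right a b) hl), ← sum_add_distrib]
  refine sum_le_sum fun p hp => ?_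
  have hpp := Nat.prime_of_mem_primeFactors hp
  have hf : (Nat.lcm a b).factorization p = max (a.factorization p) (b.factorization p) := by
    rw [Nat.factorization_lcm ha hb]; rfl
  have hpos : 0 < (Nat.lcm a b).factorization p := hpp.factorization_pos_of_dvd hl (Nat.dvd_of_mem_primeFactors hp)
  have key : ∀ m : ℕ, 0 < m.factorization p → p ∣ m := fun m hm => Nat.dvd_of_factorization_pos hm.ne'
  rw [hf] at hpos ⊢
  rcases le_total (a.factorization p) (b.factorization p) with h1 | h1
  · rw [max_eq_right h1] at hpos ⊢
    rw [if_pos (key b hpos)]; omega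
  · rw [max_eq_left h1] at hpos ⊢
    rw [if_pos (key a hpos)]; omega

lemma ell_multiset (s : Multiset ℕ) (h : ∀ a ∈ s, 0 < a) : s.lcm ≠ 0 ∧ ell s.lcm ≤ s.sum := by
  induction s using Multiset.induction_on with
  | empty => simp [ell]
  | cons a s ih =>
    obtain ⟨h1, h2⟩ := ih fun b hb => h b (Multiset.mem_cons_of_mem hb)
    have ha := h a (Multiset.mem_cons_self a s)
    rw [Multiset.lcm_cons, Multiset.sum_cons]
    exact ⟨Nat.lcm_ne_zero ha.ne' h1, (ell_lcm ha.ne' h1).trans (Nat.add_le_add (ell_le ha) h2)⟩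

lemma le_landau {n m : ℕ} (hm : 0 < m) (h : ell m ≤ n) : m ≤ landau n := by
  obtain ⟨σ, hσ⟩ := (Equiv.Perm.exists_with_cycleType_iff (α := Fin n) (m := m.primeFactors.val.map fun p => p^(m.factorization p))).2 ⟨by
      rw [Fintype.card_fin]; exact h, fun a ha => by
      obtain ⟨p, hp, rfl⟩ := Multiset.mem_map.1 ha
      have hp' : p ∈ m.primeFactors := hp
      have h2 := Nat.prime_of_mem_primeFactors hp'
      have h3 := h2.factorization_pos_of_dvd hm.ne' (Nat.dvd_of_mem_primeFactors hp')
      exact h2.two_le.trans (Nat.le_self_pow h3.ne' p)⟩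
  have h1 : m ∣ orderOf σ := by
    rw [← Equiv.Perm.lcm_cycleType, hσ, Nat.dvd_iff_prime_pow_dvd_dvd]
    intro p k hp hk
    rcases Nat.eq_zero_or_pos k with h0 | h0
    · subst h0; simp
    have hpm : p ∈ m.primeFactors := Nat.mem_primeFactors.2 ⟨hp, (dvd_pow_self p h0.ne').trans hk, hm.ne'⟩
    refine dvd_trans (pow_dvd_pow p ((hp.pow_dvd_iff_le_factorization hm.ne').1 hk)) (Multiset.dvd_lcm ?_)
    exact Multiset.mem_map.2 ⟨p, hpm, rfl⟩
  refine (Nat.le_of_dvd (orderOf_pos σ) h1).trans ?_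
  exact Finset.le_sup (f := fun σ : Equiv.Perm (Fin n) => orderOf σ) (Finset.mem_univ σ)

lemma landau_spec (n : ℕ) : 0 < landau n ∧ ell (landau n) ≤ n := by
  obtain ⟨σ, -, hσ⟩ := Finset.exists_mem_eq_sup Finset.univ ⟨1, Finset.mem_univ _⟩ (fun σ : Equiv.Perm (Fin n) => orderOf σ)
  have hσ' : landau n = orderOf σ := hσ
  rw [hσ']
  refine ⟨orderOf_pos σ, ?_⟩
  rw [← Equiv.Perm.lcm_cycleType]
  refine (ell_multiset _ fun a ha => (Equiv.Perm.two_le_of_mem_cycleType ha).trans_lt' nnm).2.trans ?_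
  rw [Equiv.Perm.sum_cycleType]
  exact (Finset.card_le_univ _).trans (by rw [Fintype.card_fin])

lemma le_maxPF {m p : ℕ} (hm : m ≠ 0) (hp : p.Prime) (h : p ∣ m) : p ≤ maxPrimeFac m :=
  Finset.le_sup (f := id) (Nat.mem_primeFactors.2 ⟨hp, h, hm⟩)

/-- Exchange inequalities at the maximum. -/
lemma landau_exch {n p' : ℕ} (hp' : p'.Prime) (h : maxPrimeFac (landau n) < p') :
    n < ell (landau n) + p' ∧ ∀ p, p.Prime → 2 ≤ (landau n).factorization p →
      p^((landau n).factorization p) < p' + p^((landau n).factorization p - 1) := by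
  obtain ⟨h0, h1⟩ := landau_spec n
  have hmax : ∀ m, landau n < m → n < ell m := fun m hm => by
    by_contra hc
    exact absurd (le_landau (n := n) (m := m) oma oma) oma
  have hnd : ¬ p' ∣ landau n := fun hd => absurd (le_maxPF h0.ne' hp' hd) oma
  have hp2 := hp'.two_le
  have ep : ell p' = p' := by simpa using ell_prime_pow hp' (k := 1) nnm
  constructor
  · have := hmax (landau n * p') (by nlinarith)
    rwa [ell_mul (((Nat.Prime.coprime_iff_not_dvd hp').2 hnd).symm), ep] at this
  · intro p hp ha
    set M := landau n with hM
    set a := M.factorization p with haa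
    have hlt : p < p' := lt_of_le_of_lt (le_maxPF h0.ne' hp (Nat.dvd_of_factorization_pos oma)) h
    have e1 : p^a * (M / p^a) = M := Nat.ordProj_mul_ordCompl_eq_self M p
    have hc : p.Coprime (M / p^a) := Nat.coprime_ordCompl hp h0.ne'
    set R := M / p^a with hR
    have hR0 : 0 < R := by
      rcases Nat.eq_zero_or_pos R with hz | hz
      · rw [hz] at e1; omega
      · exact hz
    have e2 : p^a = p^(a-1) * p := by rw [← pow_succ]; congr 1; omega
    have hpp : 0 < p^(a-1) := pow_pos hp.pos _
    have ndR : ¬ p' ∣ R := fun hd => hnd (hd.trans ⟨p^a, by rw [mul_comm]; exact e1.symm⟩)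
    have c1 : (p^(a-1) * R).Coprime p' := by
      refine Nat.Coprime.mul_left (Nat.Coprime.pow_left _ ((Nat.coprime_primes hp hp').2 hlt.ne)) ((Nat.Prime.coprime_iff_not_dvd hp').2 ndR).symm
    have := hmax (p^(a-1) * R * p') (by
      calc M = p^(a-1) * R * p := by rw [← e1, e2]; ring
        _ < _ := Nat.mul_lt_mul_of_pos_left hlt psv)
    rw [ell_mul c1, ell_mul (Nat.Coprime.pow_left _ hc), ep, ell_prime_pow hp oma] at this
    have e3 : ell M = p^a + ell R := by
      conv_lhs => rw [← e1]
      rw [ell_mul (Nat.Coprime.pow_left _ hc), ell_prime_pow hp oma]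
    omega

lemma landau_bound {n p' z e : ℕ} (hp' : p'.Prime) (h : maxPrimeFac (landau n) < p') (hz : p' ≤ z) (hE : EB z e) :
    n < Sp (maxPrimeFac (landau n)) + z + e := by
  obtain ⟨h1, h2⟩ := landau_exch hp' h
  obtain ⟨h0, -⟩ := landau_spec n
  set M := landau n with hM
  have h3 := hE (fun p => M.factorization p) (fun p hp ha => (h2 p hp ha).trans_le oma)
    (M.primeFactors.filter fun p => 2 ≤ M.factorization p) (fun p hp => by
      rw [Finset.mem_filter] at hp
      exact ⟨Nat.prime_of_mem_primeFactors hp.1, hp.2⟩)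
  have h4 : ell M ≤ Sp (maxPrimeFac M) + ∑ p ∈ M.primeFactors.filter (fun p => 2 ≤ M.factorization p), (p^(M.factorization p) - p) := by
    have e : ell M = ∑ p ∈ M.primeFactors, p + ∑ p ∈ M.primeFactors.filter (fun p => 2 ≤ M.factorization p), (p^(M.factorization p) - p) := by
      rw [ell, Finset.sum_filter, ← sum_add_distrib]
      refine sumC fun p hp => ?_
      have hpp := Nat.prime_of_mem_primeFactors hp
      have h5 := hpp.factorization_pos_of_dvd h0.ne' (Nat.dvd_of_mem_primeFactors hp)
      split_ifs with h6
      · have := Nat.le_self_pow h5.ne' p; omega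
      · rw [show M.factorization p = 1 by omega, pow_one]; rfl
    rw [e]
    refine Nat.add_le_add_right (Finset.sum_le_sum_of_subset fun p hp => ?_) _
    have hpp := Nat.prime_of_mem_primeFactors hp
    refine Finset.mem_filter.2 ⟨Finset.mem_range.2 ?_, hpp⟩
    have := le_maxPF h0.ne' hpp (Nat.dvd_of_mem_primeFactors hp)
    omega
  omega

lemma large_case {n : ℕ} (hn : 2 ≤ n) (h : 691 ≤ maxPrimeFac (landau n)) : Real.sqrt (n * Lo n) ≤ (maxPrimeFac (landau n) : ℝ) := by
  obtain ⟨h0, -⟩ := landau_spec n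
  have hpr : (maxPrimeFac (landau n)).Prime := by
    have hne : (landau n).primeFactors.Nonempty := by
      by_contra hc
      rw [Finset.not_nonempty_iff_eq_empty] at hc
      rw [maxPrimeFac, hc] at h
      simp at h
    obtain ⟨p, hp, hp2⟩ := Finset.exists_mem_eq_sup _ hne (id : ℕ → ℕ)
    rw [maxPrimeFac, hp2]
    exact Nat.prime_of_mem_primeFactors hp
  have hL : Lq (maxPrimeFac (landau n)) := by
    rcases lt_or_ge (maxPrimeFac (landau n)) 4096 with h1 | h1
    · exact Lq_small hpr h h1
    · exact Lq_all h1
  obtain ⟨z, e, F, hz, hE, hF, hlog⟩ := hL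
  obtain ⟨p', hp', h1, h2⟩ := next_prime_all h
  have := landau_bound hp' h1 oma hE
  rw [Real.sqrt_le_left psv]
  refine le_trans ?_ hlog
  have hnF : (n:ℝ) ≤ F := by exact_mod_cast (show n ≤ F by omega)
  have hn1 : (1:ℝ) ≤ n := by exact_mod_cast (show 1 ≤ n by omega)
  exact mul_le_mul hnF (Real.log_le_log lna hnF) (Real.log_nonneg hn1) (by linarith)

/-! Small range: `1755 ≤ n ≤ 43800`. -/

lemma log_eq_sum {M : ℕ} (h : M ≠ 0) : Lo M = ∑ p ∈ M.primeFactors, (M.factorization p : ℝ) * Lo p := by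
  conv_lhs => rw [← Nat.prod_factorization_pow_eq_self h]
  rw [Finsupp.prod, Nat.support_factorization, Nat.cast_prod, Real.log_prod (fun p hp => by
    have := (Nat.prime_of_mem_primeFactors hp).pos
    positivity)]
  refine sumC fun p _ => ?_
  rw [Nat.cast_pow, Real.log_pow]

lemma log_le_sum {M : ℕ} (h : M ≠ 0) : 2^48 * Lo M ≤ ((∑ p ∈ M.primeFactors, M.factorization p * lgU p : ℕ) : ℝ) := by
  rw [log_eq_sum h, mul_sum]
  push_cast
  refine sum_le_sum fun p hp => ?_
  have := le_lgU p (Nat.prime_of_mem_primeFactors hp).pos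
  calc 2^48 * ((M.factorization p : ℝ) * Lo p) = M.factorization p * (2^48 * Lo p) := by ring
    _ ≤ _ := by gcongr

/-- candidates: lists of pairwise coprime numbers -/
def cop : List ℕ → ℕ → Bool := List.rec (motive := fun _ => ℕ → Bool) (fun _ => true)
  (fun x _ ih P => and (Nat.ble 1 x) (and (Nat.beq (Nat.gcd P x) 1) (ih (Nat.mul P x))))

def lsm (f : ℕ → ℕ) : List ℕ → ℕ := List.rec (motive := fun _ => ℕ) 0 (fun x _ ih => Nat.add (f x) ih)

lemma cop_spec (l : List ℕ) : ∀ P, cop l P = true → P.Coprime l.prod ∧ 0 < l.prod ∧ ell l.prod ≤ lsm id l ∧ ((lsm lgL l : ℕ):ℝ) ≤ 2^48 * Lo l.prod := by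
  induction l with
  | nil => intro P _; simp [ell, lsm]
  | cons x xs ih =>
    intro P h
    have h1 : (Nat.ble 1 x && (Nat.beq (Nat.gcd P x) 1 && cop xs (P*x))) = true := h
    rw [Bool.and_eq_true, Bool.and_eq_true] at h1
    have hx : 0 < x := Nat.le_of_ble_eq_true h1.1
    have hg : Nat.gcd P x = 1 := Nat.eq_of_beq_eq_true h1.2.1
    obtain ⟨a1, a2, a3, a4⟩ := ih _ h1.2.2
    have c1 : P.Coprime xs.prod := (Nat.coprime_mul_iff_left.1 a1).1
    have c2 : x.Coprime xs.prod := (Nat.coprime_mul_iff_left.1 a1).2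
    rw [List.prod_cons]
    refine ⟨Nat.Coprime.mul_right hg c1, by positivity, ?_, ?_⟩
    · rw [ell_mul c2]
      exact Nat.add_le_add (ell_le hx) a3
    · have e : lsm lgL (x::xs) = lgL x + lsm lgL xs := rfl
      have hxr : (x:ℝ) ≠ 0 := by exact_mod_cast hx.ne'
      have hpr : (xs.prod:ℝ) ≠ 0 := by exact_mod_cast a2.ne'
      rw [e, Nat.cast_mul, Real.log_mul hxr hpr, mul_add, Nat.cast_add]
      exact add_le_add (lgL_le x hx) a4

lemma cand_le {n : ℕ} {l : List ℕ} (h1 : cop l 1 = true) (h2 : lsm id l ≤ n) : ((lsm lgL l : ℕ):ℝ) ≤ 2^48 * Lo (landau n) := by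
  obtain ⟨-, a2, a3, a4⟩ := cop_spec l 1 h1
  refine a4.trans ?_
  have := le_landau a2 (a3.trans h2)
  gcongr

/-- the per-prime dual value -/
def ccr (l p k : ℕ) : ℕ := Nat.rec (motive := fun _ => ℕ) 0
  (fun k ih => Nat.add ih (Nat.sub (Nat.sub (Nat.mul (Nat.succ k) (lgU p)) (Nat.mul l (Nat.pow p (Nat.succ k)))) ih)) k

def cc (l p : ℕ) : ℕ := ccr l p 16

lemma cc_spec (l p a : ℕ) (h1 : 1 ≤ a) (h : a ≤ 16) : a * lgU p ≤ cc l p + l * p^a := by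
  have key : ∀ k a, 1 ≤ a → a ≤ k → a * lgU p ≤ ccr l p k + l * p^a := by
    intro k
    induction k with
    | zero => intro a h1 h2; omega
    | succ k ih =>
      intro a h1 h2
      have e : ccr l p (k+1) = ccr l p k + ((k+1) * lgU p - l * p^(k+1) - ccr l p k) := rfl
      rcases Nat.lt_or_ge a (k+1) with h3 | h3
      · have := ih a h1 oma
        omega
      · have : a = k+1 := by omega
        subst this
        omega
  exact key 16 a h1 h

def flt (rem : List ℕ) (x : ℕ) : Bool := List.rec (motive := fun _ => Bool) (qfl x) (fun y _ ih => Bool.rec (motive := fun _ => Bool) ih false (Nat.beq x y)) rem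

/-- consecutive primes from `lo` on, with exceptions -/
def prl (rem : List ℕ) (k : ℕ) : ℕ → List ℕ := Nat.rec (motive := fun _ => ℕ → List ℕ) (fun _ => [])
  (fun _ ih x => Bool.rec (motive := fun _ => List ℕ) (ih (Nat.succ x)) (x :: ih (Nat.succ x)) (flt rem x)) k

def prc (lo hi : ℕ) (rem pre : List ℕ) : List ℕ := List.rec (motive := fun _ => List ℕ) (prl rem (Nat.sub (Nat.succ hi) lo) lo) (fun x _ ih => x :: ih) pre

def rng (n1 n2 X l : ℕ) (c : List ℕ) : Bool :=
  and (Nat.ble (lsm id c) n1) (and (cop c 1) (and (Nat.ble (Nat.mul n2 (lgU n2)) (Nat.mul T48 (Nat.mul (Nat.succ X) (Nat.succ X))))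
    (Nat.blt (Nat.add (Nat.mul l n2) (sm (fun d => tf (qfl d) (tf (Nat.ble d X) (cc l d))) 10 0)) (lsm lgL c))))

lemma fac_le {n p : ℕ} (hn : n < 65536) (hp : p.Prime) (h : p ∣ landau n) : 1 ≤ (landau n).factorization p ∧ (landau n).factorization p ≤ 16 := by
  obtain ⟨h0, h1⟩ := landau_spec n
  refine ⟨hp.factorization_pos_of_dvd h0.ne' h, ?_⟩
  have h2 : p^((landau n).factorization p) ≤ ell (landau n) :=
    Finset.single_le_sum (f := fun p => p^((landau n).factorization p)) (fun _ _ => Nat.zero_le _) (Nat.mem_primeFactors.2 ⟨hp, h, h0.ne'⟩)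
  have h3 := Nat.pow_le_pow_left hp.two_le ((landau n).factorization p)
  have : 2^((landau n).factorization p) < 2^16 := by norm_num; omega
  exact ((Nat.pow_lt_pow_iff_right nnm).1 this).le

/-- if the claim fails, `q` is below the explicit bound -/
lemma q_le {n n2 X q : ℕ} (hn : 1 ≤ n) (h2 : n ≤ n2) (hX : n2 * lgU n2 ≤ T48 * ((X+1) * (X+1))) (h : (q:ℝ)^2 < n * Lo n) : q ≤ X := by
  by_contra hc
  push Not at hc
  have h3 : (X:ℝ) + 1 ≤ q := by exact_mod_cast hc
  have h4 := le_lgU n2 oma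
  have h5 : (n:ℝ) ≤ n2 := by exact_mod_cast h2
  have h1 : (1:ℝ) ≤ n := by exact_mod_cast hn
  have h6 : (n:ℝ) * Lo n ≤ n2 * Lo n2 := mul_le_mul h5 (Real.log_le_log lna h5) (Real.log_nonneg h1) lna
  have h7 : (n2:ℝ) * lgU n2 ≤ T48 * (((X:ℝ)+1) * (X+1)) := by exact_mod_cast hX
  have h8 : (n2:ℝ) * (2^48 * Lo n2) ≤ n2 * lgU n2 := by gcongr
  norm_num at h8
  have h9 : ((X:ℝ)+1) * (X+1) ≤ q * q := mul_le_mul h3 h3 psv psv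
  nlinarith

theorem rng_spec {n1 n2 X l : ℕ} {c : List ℕ} (h : rng n1 n2 X l c = true) (hb : n2 < 65536) (hX : X < 1024) {n : ℕ} (hn0 : 1 ≤ n) (h1 : n1 ≤ n) (h2 : n ≤ n2) :
    (n:ℝ) * Lo n ≤ (maxPrimeFac (landau n) : ℝ)^2 := by
  by_contra hc
  push Not at hc
  unfold rng at h
  simp only [Bool.and_eq_true, Nat.ble_eq, Nat.blt_eq, Nat.add_eq, Nat.mul_eq] at h
  obtain ⟨g1, g2, g3, g4⟩ := h
  have hq := q_le hn0 h2 g3 hc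
  obtain ⟨h0, hl⟩ := landau_spec n
  have k1 := cand_le g2 (g1.trans h1)
  have k2 := log_le_sum h0.ne'
  have k3 : ∑ p ∈ (landau n).primeFactors, (landau n).factorization p * lgU p ≤ l * n2 + sm (fun d => tf (qfl d) (tf (Nat.ble d X) (cc l d))) 10 0 := by
    have k4 := sm_flag (fun d => tf (Nat.ble d X) (cc l d)) 10
    calc _ ≤ ∑ p ∈ (landau n).primeFactors, (tf (Nat.ble p X) (cc l p) + l * p^((landau n).factorization p)) := by
          refine sum_le_sum fun p hp => ?_
          have hp1 := Nat.prime_of_mem_primeFactors hp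
          have hp2 := Nat.dvd_of_mem_primeFactors hp
          have hp3 := fac_le oma hp1 hp2
          have hp4 : Nat.ble p X = true := Nat.ble_eq_true_of_le ((le_maxPF h0.ne' hp1 hp2).trans hq)
          rw [hp4]
          exact cc_spec l p _ hp3.1 hp3.2
      _ = ∑ p ∈ (landau n).primeFactors, tf (Nat.ble p X) (cc l p) + l * ell (landau n) := by
          rw [sum_add_distrib, ell, mul_sum]
      _ ≤ ∑ p ∈ (Frg (2^10)).filter Nat.Prime, tf (Nat.ble p X) (cc l p) + l * n2 := by
          refine Nat.add_le_add (Finset.sum_le_sum_of_subset fun p hp => ?_) (Nat.mul_le_mul_left _ (hl.trans h2))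
          have hp1 := Nat.prime_of_mem_primeFactors hp
          have hp2 := Nat.dvd_of_mem_primeFactors hp
          have := le_maxPF h0.ne' hp1 hp2
          exact Finset.mem_filter.2 ⟨Finset.mem_range.2 (by norm_num; omega), hp1⟩
      _ ≤ _ := by omega
  have k5 : ((∑ p ∈ (landau n).primeFactors, (landau n).factorization p * lgU p : ℕ):ℝ) < (lsm lgL c : ℕ) := by exact_mod_cast k3.trans_lt g4
  linarith

/-! Branch and bound for `1755 ≤ n ≤ 1769`. -/
def opt (f : ℕ → ℕ → Bool) (p g E T k : ℕ) : ℕ → ℕ → Bool := Nat.rec (motive := fun _ => ℕ → ℕ → Bool) (fun _ _ => true)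
  (fun _ ih a w => Bool.rec (motive := fun _ => Bool) true (and (f (Nat.sub E w) (Nat.sub T (Nat.mul a g))) (ih (Nat.succ a) (Nat.mul w p))) (Nat.ble w E)) k

def bb (l : ℕ) : List (ℕ × ℕ × ℕ) → ℕ → ℕ → ℕ → Bool := List.rec (motive := fun _ => ℕ → ℕ → ℕ → Bool) (fun _ _ T => Nat.blt 0 T)
  (fun x _ ih C E T => or (Nat.blt (Nat.add (Nat.mul l E) C) T) (and (ih (Nat.sub C x.2.2) E T) (opt (ih (Nat.sub C x.2.2)) x.1 x.2.1 E T 16 1 x.1)))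

lemma opt_spec {f : ℕ → ℕ → Bool} {p g E T : ℕ} (hp : 1 ≤ p) (k : ℕ) : ∀ a w, w = p^a → opt f p g E T k a w = true → ∀ b, a ≤ b → b < a + k → p^b ≤ E → f (E - p^b) (T - b*g) = true := by
  induction k with
  | zero => intro a w _ _ b h1 h2; omega
  | succ k ih =>
    intro a w hw h b h1 h2 h3
    have e : opt f p g E T (k+1) a w = Bool.rec (motive := fun _ => Bool) true (and (f (E - w) (T - a*g)) (opt f p g E T k (a+1) (w*p))) (Nat.ble w E) := rfl
    have hwE : Nat.ble w E = true := Nat.ble_eq_true_of_le (by rw [hw]; exact (Nat.pow_le_pow_right hp h1).trans h3)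
    rw [e, hwE] at h
    have h' := (Bool.and_eq_true _ _).mp h
    rcases Nat.eq_or_lt_of_le h1 with h4 | h4
    · subst h4; rw [← hw]; exact h'.1
    · exact ih (a+1) (w*p) (by rw [hw, pow_succ]) h'.2 b h4 oma h3

def cost (p a : ℕ) : ℕ := if a = 0 then 0 else p^a

lemma bb_spec {l : ℕ} (α : ℕ → ℕ) (xs : List (ℕ × ℕ × ℕ)) : ∀ C E T, bb l xs C E T = true → (xs.map fun x => x.2.2).sum ≤ C →
    (∀ x ∈ xs, 1 ≤ x.1 ∧ α x.1 ≤ 16 ∧ ∀ a, 1 ≤ a → a ≤ 16 → a * x.2.1 ≤ x.2.2 + l * x.1^a) →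
    (xs.map fun x => cost x.1 (α x.1)).sum ≤ E → (xs.map fun x => α x.1 * x.2.1).sum < T := by
  induction xs with
  | nil => intro C E T h _ _ _; simpa [bb] using h
  | cons x xs ih =>
    intro C E T h hC hv hE
    have h' : (Nat.blt (l*E + C) T || (bb l xs (C - x.2.2) E T && opt (bb l xs (C - x.2.2)) x.1 x.2.1 E T 16 1 x.1)) = true := h
    rw [Bool.or_eq_true, Bool.and_eq_true, Nat.blt_eq] at h'
    obtain ⟨v1, v2, v3⟩ := hv x (List.mem_cons_self)
    have hv' : ∀ y ∈ xs, 1 ≤ y.1 ∧ α y.1 ≤ 16 ∧ ∀ a, 1 ≤ a → a ≤ 16 → a * y.2.1 ≤ y.2.2 + l * y.1^a := fun y hy => hv y (List.mem_cons_of_mem _ hy)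
    rcases h' with h1 | ⟨h1, h2⟩
    · have key : ∀ ys : List (ℕ × ℕ × ℕ), (∀ y ∈ ys, 1 ≤ y.1 ∧ α y.1 ≤ 16 ∧ ∀ a, 1 ≤ a → a ≤ 16 → a * y.2.1 ≤ y.2.2 + l * y.1^a) →
          (ys.map fun x => α x.1 * x.2.1).sum ≤ l * (ys.map fun x => cost x.1 (α x.1)).sum + (ys.map fun x => x.2.2).sum := by
        intro ys
        induction ys with
        | nil => intro _; simp
        | cons y ys ihy =>
          intro hy
          have a1 := ihy fun z hz => hy z (List.mem_cons_of_mem _ hz)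
          obtain ⟨w1, w2, w3⟩ := hy y (List.mem_cons_self)
          simp only [List.map_cons, List.sum_cons, mul_add]
          rcases Nat.eq_zero_or_pos (α y.1) with h0 | h0
          · have e0 : cost y.1 (α y.1) = 0 := if_pos h0
            rw [e0, h0, zero_mul, mul_zero]; omega
          · have := w3 _ h0 w2
            have e0 : cost y.1 (α y.1) = y.1^(α y.1) := if_neg h0.ne'
            rw [e0]; omega
      have := key _ hv
      have h3 : l * ((x::xs).map fun x => cost x.1 (α x.1)).sum ≤ l * E := Nat.mul_le_mul_left _ hE
      omega
    · simp only [List.map_cons, List.sum_cons] at hC hE ⊢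
      rcases Nat.eq_zero_or_pos (α x.1) with h0 | h0
      · have := ih _ _ _ h1 oma hv' oma
        rw [h0]; omega
      · have hc : cost x.1 (α x.1) = x.1^(α x.1) := if_neg h0.ne'
        rw [hc] at hE
        have h3 := opt_spec v1 16 1 x.1 (pow_one _).symm h2 (α x.1) h0 oma oma
        have := ih _ _ _ h3 oma hv' oma
        omega

/-- validity of the table -/
def bvl (l : ℕ) (xs : List (ℕ × ℕ × ℕ)) : Bool := List.rec (motive := fun _ => Bool) true
  (fun x _ ih => and (Nat.ble 1 x.1) (and (Nat.ble (lgU x.1) x.2.1) (and (Nat.rec (motive := fun _ => Bool) true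
    (fun k ih2 => and (Nat.ble (Nat.mul (Nat.succ k) x.2.1) (Nat.add x.2.2 (Nat.mul l (Nat.pow x.1 (Nat.succ k))))) ih2) 16) ih))) xs

lemma bvl_spec {l : ℕ} (xs : List (ℕ × ℕ × ℕ)) (h : bvl l xs = true) : ∀ x ∈ xs, 1 ≤ x.1 ∧ lgU x.1 ≤ x.2.1 ∧ ∀ a, 1 ≤ a → a ≤ 16 → a * x.2.1 ≤ x.2.2 + l * x.1^a := by
  induction xs with
  | nil => intro x hx; simp at hx
  | cons y ys ih =>
    have h' : (Nat.ble 1 y.1 && (Nat.ble (lgU y.1) y.2.1 && ((Nat.rec (motive := fun _ => Bool) true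
      (fun k ih2 => and (Nat.ble ((k+1) * y.2.1) (y.2.2 + l * y.1^(k+1))) ih2) 16) && bvl l ys))) = true := h
    rw [Bool.and_eq_true, Bool.and_eq_true, Bool.and_eq_true, Nat.ble_eq, Nat.ble_eq] at h'
    obtain ⟨h1, h2, h3, h4⟩ := h'
    intro x hx
    rcases List.mem_cons.1 hx with hx | hx
    · subst hx
      refine ⟨h1, h2, ?_⟩
      have key : ∀ k, (Nat.rec (motive := fun _ => Bool) true
        (fun k ih2 => and (Nat.ble ((k+1) * x.2.1) (x.2.2 + l * x.1^(k+1))) ih2) k : Bool) = true → ∀ a, 1 ≤ a → a ≤ k → a * x.2.1 ≤ x.2.2 + l * x.1^a := by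
        intro k
        induction k with
        | zero => intro _ a h1 h2; omega
        | succ k ihk =>
          intro hh a h1 h2
          have hh' := (Bool.and_eq_true _ _).mp hh
          rcases Nat.lt_or_ge a (k+1) with h3 | h3
          · exact ihk hh'.2 a h1 oma
          · have : a = k+1 := by omega
            subst this
            exact Nat.le_of_ble_eq_true hh'.1
      exact key 16 h3
    · exact ih h4 x hx

def brg (n1 n2 X l C : ℕ) (xs : List (ℕ × ℕ × ℕ)) (c : List ℕ) : Bool :=
  and (Nat.ble (lsm id c) n1) (and (cop c 1) (and (Nat.ble (Nat.mul n2 (lgU n2)) (Nat.mul T48 (Nat.mul (Nat.succ X) (Nat.succ X))))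
    (bb l xs C n2 (lsm lgL c))))

theorem brg_spec {n1 n2 X l C : ℕ} {xs : List (ℕ × ℕ × ℕ)} {c : List ℕ} (h : brg n1 n2 X l C xs c = true) (hv : bvl l xs = true) (hC : (xs.map fun x => x.2.2).sum ≤ C)
    (hnd : (xs.map fun x => x.1).Nodup) (hpr : ∀ p, p.Prime → p ≤ X → p ∈ xs.map fun x => x.1) (hpp : ∀ x ∈ xs, x.1.Prime)
    (hb : n2 < 65536) {n : ℕ} (hn0 : 1 ≤ n) (h1 : n1 ≤ n) (h2 : n ≤ n2) :
    (n:ℝ) * Lo n ≤ (maxPrimeFac (landau n) : ℝ)^2 := by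
  by_contra hc
  push Not at hc
  unfold brg at h
  simp only [Bool.and_eq_true, Nat.ble_eq, Nat.mul_eq] at h
  obtain ⟨g1, g2, g3, g4⟩ := h
  have hq := q_le hn0 h2 g3 hc
  obtain ⟨h0, hl⟩ := landau_spec n
  have k1 := cand_le g2 (g1.trans h1)
  have k2 := log_le_sum h0.ne'
  have hv' := bvl_spec xs hv
  have hsub : (landau n).primeFactors ⊆ (xs.map fun x => x.1).toFinset := fun p hp => by
    have hp1 := Nat.prime_of_mem_primeFactors hp
    have := (le_maxPF h0.ne' hp1 (Nat.dvd_of_mem_primeFactors hp)).trans hq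
    exact List.mem_toFinset.2 (hpr p hp1 this)
  have hnf : ∀ p, p ∉ (landau n).primeFactors → (landau n).factorization p = 0 := fun p hp => by
    rwa [← Nat.support_factorization, Finsupp.notMem_support_iff] at hp
  have hcv : ∀ f : ℕ → ℕ, (∀ p, p ∉ (landau n).primeFactors → f p = 0) → (xs.map fun x => f x.1).sum = ∑ p ∈ (landau n).primeFactors, f p := by
    intro f hf
    rw [Finset.sum_subset hsub (fun p _ hp => hf p hp), List.sum_toFinset f hnd, List.map_map]
    rfl
  have hcost : (xs.map fun x => cost x.1 ((landau n).factorization x.1)).sum ≤ n2 := by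
    rw [hcv (fun p => cost p ((landau n).factorization p)) (fun p hp => by simp [cost, hnf p hp])]
    refine le_trans (le_of_eq ?_) (hl.trans h2)
    rw [ell]
    refine sumC fun p hp => ?_
    have hp1 := Nat.prime_of_mem_primeFactors hp
    have := (fac_le (by omega : n < 65536) hp1 (Nat.dvd_of_mem_primeFactors hp)).1
    exact if_neg oma
  have k3 := bb_spec (fun p => (landau n).factorization p) xs C n2 _ g4 hC (fun x hx => by
    refine ⟨(hv' x hx).1, ?_, (hv' x hx).2.2⟩
    by_cases hd : x.1 ∣ landau n
    · exact (fac_le oma (hpp x hx) hd).2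
    · show (landau n).factorization x.1 ≤ 16
      rw [Nat.factorization_eq_zero_of_not_dvd hd]; omega) hcost
  have k4 : ∑ p ∈ (landau n).primeFactors, (landau n).factorization p * lgU p ≤ (xs.map fun x => (landau n).factorization x.1 * x.2.1).sum := by
    rw [← hcv (fun p => (landau n).factorization p * lgU p) (fun p hp => by rw [hnf p hp, zero_mul])]
    exact List.sum_le_sum fun x hx => Nat.mul_le_mul_left _ (hv' x hx).2.1
  have k5 : ((∑ p ∈ (landau n).primeFactors, (landau n).factorization p * lgU p : ℕ):ℝ) < (lsm lgL c : ℕ) := by exact_mod_cast k4.trans_lt k3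
  linarith

def bbl : List (ℕ × ℕ × ℕ) := [(2, 195103590699471, 779255127939339), (3, 309231872561200, 762098858619024), (11, 674947520259817, 607776231378386),
  (5, 453016503113939, 752702673760678), (7, 547725018080677, 794922584525642), (13, 721969064849802, 642237291966858),
  (17, 797478664228847, 693214038151151), (19, 828785897281125, 712254844606053), (23, 882563165599358, 741499259729534),
  (29, 947809519517635, 769946333855683), (31, 966581472601451, 776451860342123), (37, 1016383039559927, 789454147508471),
  (41, 1045277615183241, 793815869937033), (43, 1058683719163266, 794955547319682), (47, 1083720210718230, 795459185679894),
  (53, 1117537828095893, 792477523265429), (59, 1147724761254494, 785865176631902), (61, 1157108129372931, 782982118152963),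
  (67, 1183515761312843, 772590470300747), (71, 1199837723309490, 764379579102642), (73, 1207656975469561, 759932404665337),
  (79, 1229890236705884, 745366386109532), (83, 1243793061361952, 734736357570848), (89, 1263438821827261, 717582838244029),
  (97, 1287666670326526, 692744980353790), (101, 1299040944189068, 679586401021580), (103, 1304560238216442, 672839268451578),
  (107, 1315284391547350, 659030568587734), (109, 1320497040086337, 651976790529345), (113, 1330641380368598, 637588277616854)]

set_option maxHeartbeats 10000000 in
theorem small_A {n : ℕ} (h1 : 1755 ≤ n) (h2 : n ≤ 1769) : (n:ℝ) * Lo n ≤ (maxPrimeFac (landau n) : ℝ)^2 := by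
  have hv : bvl 6133213298688 bbl = true := by decide +kernel
  have hC : (bbl.map fun x => x.2.2).sum ≤ 22055722995923861 := by decide +kernel
  have hnd : (bbl.map fun x => x.1).Nodup := by decide +kernel
  have hpr' : ∀ p < 116, p.Prime → p ∈ bbl.map fun x => x.1 := by decide +kernel
  have hpr : ∀ p, p.Prime → p ≤ 115 → p ∈ bbl.map fun x => x.1 := fun p a b => hpr' p oma a
  have hpp : ∀ x ∈ bbl, x.1.Prime := by decide +kernel
  rcases lt_or_ge n 1763 with h | h
  · exact brg_spec (n1 := 1755) (n2 := 1762) (X := 115) (c := prc 8 127 [113] [64, 27, 25, 49]) dck hv hC hnd hpr hpp nnm oma h1 oma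
  rcases lt_or_ge n 1764 with h' | h'
  · exact brg_spec (n1 := 1760) (n2 := 1763) (X := 115) (c := prc 6 127 [] [16, 9, 25]) dck hv hC hnd hpr hpp nnm oma oma oma
  · exact brg_spec (n1 := 1764) (n2 := 1769) (X := 115) (c := prc 6 131 [127] [16, 9, 25]) dck hv hC hnd hpr hpp nnm oma oma oma

/-- rows: last `n`, prime bound, multiplier, first and last prime, exceptions, prime powers -/
def rws : List (ℕ × ℕ × ℕ × ℕ × ℕ × List ℕ × List ℕ) := [
  (1778, 115, 357, 6, 127, [], [8, 27, 25]),
  (1810, 116, 357, 6, 127, [], [16, 27, 25]),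
  (1850, 117, 354, 8, 131, [127], [16, 9, 25, 49]),
  (1950, 121, 270, 8, 139, [127, 131, 137], [32, 27, 25, 49]),
  (2107, 126, 264, 8, 131, [], [16, 27, 25, 49]),
  (2226, 130, 264, 8, 139, [137], [32, 27, 25, 49]),
  (2410, 136, 263, 8, 139, [], [16, 27, 25, 49]),
  (2495, 139, 270, 8, 157, [139, 151], [32, 27, 25, 49]),
  (2637, 144, 264, 6, 157, [149], [16, 27, 25]),
  (2797, 148, 171, 8, 157, [149], [64, 81, 25, 49]),
  (2905, 152, 264, 8, 163, [151], [64, 81, 25, 49]),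
  (3069, 156, 171, 8, 167, [157], [64, 27, 25, 49]),
  (3281, 162, 171, 8, 173, [167], [64, 27, 25, 49]),
  (3426, 166, 171, 8, 181, [157, 179], [32, 81, 25, 49]),
  (3648, 172, 171, 8, 191, [179, 181], [64, 27, 25, 49]),
  (3877, 178, 171, 8, 181, [], [64, 81, 25, 49]),
  (3975, 181, 264, 12, 193, [179], [32, 27, 25, 49, 121]),
  (4232, 187, 171, 8, 199, [173, 197], [32, 27, 25, 49]),
  (4435, 192, 171, 8, 199, [197], [64, 81, 25, 49]),
  (4601, 196, 171, 8, 199, [], [64, 81, 25, 49]),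
  (4685, 198, 171, 8, 227, [211, 223], [64, 27, 25, 49]),
  (4762, 200, 264, 12, 233, [211, 223, 227, 229], [32, 27, 25, 49, 121]),
  (4955, 205, 171, 8, 223, [], [16, 27, 25, 49]),
  (5202, 210, 141, 12, 233, [223, 227, 229], [32, 81, 25, 49, 121]),
  (5712, 222, 111, 12, 229, [227], [64, 81, 25, 49, 121]),
  (6025, 228, 141, 8, 241, [233], [32, 27, 25, 49]),
  (6285, 234, 141, 8, 251, [227], [32, 81, 25, 49]),
  (6598, 240, 141, 8, 251, [], [64, 81, 25, 49]),
  (6998, 248, 141, 12, 257, [], [64, 27, 25, 49, 121]),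
  (7412, 256, 111, 8, 281, [269, 271, 277], [32, 27, 25, 49]),
  (7789, 264, 141, 12, 277, [263], [64, 27, 25, 49, 121]),
  (8154, 270, 111, 12, 283, [269, 281], [64, 27, 125, 49, 121]),
  (8482, 276, 111, 8, 283, [], [32, 81, 25, 49]),
  (8745, 281, 141, 8, 293, [], [64, 81, 25, 49]),
  (8949, 285, 141, 14, 293, [], [64, 81, 25, 49, 121, 169]),
  (9385, 292, 111, 12, 317, [307, 311, 313], [64, 27, 125, 49, 121]),
  (10051, 304, 102, 8, 317, [307], [32, 81, 25, 49]),
  (10572, 312, 108, 14, 331, [317], [64, 27, 125, 49, 121, 169]),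
  (11050, 320, 109, 12, 337, [], [32, 81, 125, 49, 121]),
  (11696, 330, 101, 14, 353, [311, 347], [64, 81, 25, 49, 121, 169]),
  (12738, 346, 68, 14, 367, [347, 359], [32, 81, 25, 49, 121, 169]),
  (13546, 358, 88, 12, 379, [359], [32, 81, 125, 49, 121]),
  (14518, 372, 68, 14, 389, [379], [32, 81, 25, 49, 121, 169]),
  (15307, 384, 101, 14, 397, [], [128, 81, 125, 49, 121, 169]),
  (16254, 396, 68, 14, 421, [379, 419], [64, 81, 125, 49, 121, 169]),
  (17156, 408, 68, 12, 433, [431], [32, 81, 25, 49, 121]),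
  (18080, 420, 68, 12, 443, [439], [64, 81, 25, 49, 121]),
  (19027, 432, 68, 12, 457, [421], [64, 81, 25, 49, 121]),
  (19991, 444, 68, 12, 463, [461], [128, 81, 25, 49, 121]),
  (21129, 458, 68, 12, 467, [], [64, 81, 125, 49, 121]),
  (21828, 466, 68, 14, 503, [487, 491, 499], [64, 81, 125, 49, 121, 169]),
  (22859, 478, 61, 18, 491, [], [64, 27, 125, 49, 121, 169, 289]),
  (23911, 490, 61, 18, 509, [499], [32, 81, 125, 49, 121, 169, 289]),
  (24985, 502, 61, 18, 523, [521], [64, 81, 125, 49, 121, 169, 289]),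
  (26637, 520, 53, 18, 547, [541], [64, 81, 125, 49, 121, 169, 289]),
  (28529, 540, 50, 18, 571, [541, 569], [32, 81, 125, 49, 121, 169, 289]),
  (30785, 564, 50, 18, 587, [577], [64, 243, 125, 49, 121, 169, 289]),
  (33107, 586, 50, 18, 617, [569, 607, 613], [64, 81, 125, 49, 121, 169, 289]),
  (35195, 606, 50, 18, 631, [617], [64, 81, 25, 49, 121, 169, 289]),
  (37319, 626, 50, 18, 661, [641, 643, 653, 659], [128, 81, 125, 49, 121, 169, 289]),
  (39546, 646, 50, 18, 673, [647, 661], [128, 243, 125, 49, 121, 169, 289]),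
  (41124, 660, 50, 14, 701, [643, 691], [64, 81, 125, 49, 121, 169]),
  (42962, 676, 50, 18, 701, [], [32, 81, 125, 49, 121, 169, 289]),
  (43799, 684, 50, 20, 733, [701, 719], [64, 81, 125, 49, 121, 169, 289, 361])]

def rgs : List (ℕ × ℕ × ℕ × ℕ × ℕ × List ℕ × List ℕ) → ℕ → Bool := List.rec (motive := fun _ => ℕ → Bool) (fun a => Nat.ble 43750 a)
  (fun r _ ih a => and (Nat.ble r.1 65535) (and (Nat.ble r.2.1 1023) (and (rng a r.1 r.2.1 (Nat.mul 17179869184 r.2.2.1)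
    (prc r.2.2.2.1 r.2.2.2.2.1 r.2.2.2.2.2.1 r.2.2.2.2.2.2)) (ih (Nat.succ r.1)))))

lemma rgs_spec {n : ℕ} (hn : 1 ≤ n) (hn2 : n < 43750) (rs : List (ℕ × ℕ × ℕ × ℕ × ℕ × List ℕ × List ℕ)) : ∀ a, rgs rs a = true → a ≤ n →
    (n:ℝ) * Lo n ≤ (maxPrimeFac (landau n) : ℝ)^2 := by
  induction rs with
  | nil =>
    intro a h h1
    have := Nat.le_of_ble_eq_true h
    omega
  | cons r rs ih =>
    intro a h h1
    have h' : (Nat.ble r.1 65535 && (Nat.ble r.2.1 1023 && (rng a r.1 r.2.1 (17179869184 * r.2.2.1)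
      (prc r.2.2.2.1 r.2.2.2.2.1 r.2.2.2.2.2.1 r.2.2.2.2.2.2) && rgs rs (r.1+1)))) = true := h
    rw [Bool.and_eq_true, Bool.and_eq_true, Bool.and_eq_true, Nat.ble_eq, Nat.ble_eq] at h'
    obtain ⟨g1, g2, g3, g4⟩ := h'
    rcases Nat.lt_or_ge r.1 n with h2 | h2
    · exact ih _ g4 h2
    · exact rng_spec g3 oma oma hn h1 h2

set_option maxHeartbeats 10000000 in
theorem small_B {n : ℕ} (h1 : 1770 ≤ n) (h2 : n < 43750) : (n:ℝ) * Lo n ≤ (maxPrimeFac (landau n) : ℝ)^2 :=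
  rgs_spec oma h2 rws 1770 dck h1

lemma Sp_mono {a b : ℕ} (h : a ≤ b) : Sp a ≤ Sp b :=
  Finset.sum_le_sum_of_subset (Finset.filter_subset_filter _ (Finset.range_subset_range.2 oma))

set_option maxHeartbeats 10000000 in
theorem final {n : ℕ} (hn : 1755 ≤ n) : Real.sqrt (n * Lo n) ≤ (maxPrimeFac (landau n) : ℝ) := by
  rcases lt_or_ge (maxPrimeFac (landau n)) 691 with h | h
  · have hE : EB 691 (Eez 7 691) := EB_Eez nnm nnm
    have h1 := landau_bound (by norm_num : Nat.Prime 691) h le_rfl hE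
    have h2 : Nat.ble (Nat.add (sm (fun d => tf (qfl d) (tf (Nat.blt d 691) d)) 10 0) (Nat.add 691 (Eez 7 691))) 43750 = true := by decide +kernel
    have h3 : Sp (maxPrimeFac (landau n)) ≤ sm (fun d => tf (qfl d) (tf (Nat.blt d 691) d)) 10 0 := by
      refine (Sp_mono (show _ ≤ 690 by omega)).trans (le_trans ?_ (sm_flag (fun d => tf (Nat.blt d 691) d) 10))
      rw [Sp, Finset.sum_congr rfl (g := fun d => tf (Nat.blt d 691) d)]
      · exact Finset.sum_le_sum_of_subset (Finset.filter_subset_filter _ (Finset.range_subset_range.2 nnm))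
      · intro x hx
        have : Nat.blt x 691 = true := by
          rw [Nat.blt_eq]; exact Finset.mem_range.1 (Finset.mem_filter.1 hx).1
        rw [this]; rfl
    rw [Nat.ble_eq] at h2
    simp only [Nat.add_eq] at h2
    have h4 : n < 43750 := by omega
    rw [Real.sqrt_le_left psv]
    rcases lt_or_ge n 1770 with h5 | h5
    · exact small_A hn oma
    · exact small_B h5 h4
  · exact large_case oma h

end LP
end

/-- For every n ≥ 1755, P⁺(g(n)) ≥ √(n log n). -/
theorem stmt3 (n : ℕ) (hn : 1755 ≤ n) :
    Real.sqrt (n * Real.log n) ≤ (maxPrimeFac (landau n) : ℝ) := by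
  exact LP.final hn
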